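/- Blow-up of all nontrivial solutions when max(r,p) ≥ q > 1: Suppose max(r,p) ≥ q > 1 and b(x,t) ≤ ε(t) exp[λ₁(q−1)t] for x ∈ Ω, t > 0, where ε ∈ C([0,∞)) is nonnegative with ∫₀^∞ ε(t) dt < ∞. Define a̲(t) = inf_Ω a(x,t) and b̄(t) = sup_Ω b(x,t), and assume (i) a̲(t) = γ(t) exp[λ₁(r+p−q)t] b̄(t) with γ(t) → ∞ as t → ∞, and (ii) ∫₀^∞ a̲(t) exp[−λ₁(r+p−1)t] dt = ∞. Then every nontrivial (not identically zero) solution of problem (P) blows up in finite time. -/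

import Mathlib

open Set MeasureTheory Real Filter

noncomputable section

/-- The Laplacian of `f : ℝⁿ → ℝ`, written as the sum of second directional
derivatives along the coordinate directions. -/
def lap {n : ℕ} (f : EuclideanSpace ℝ (Fin n) → ℝ) (x : EuclideanSpace ℝ (Fin n)) : ℝ :=
  ∑ i : Fin n,
    fderiv ℝ (fun y => fderiv ℝ f y (EuclideanSpace.single i 1)) x (EuclideanSpace.single i 1)

/-- Local Hölder continuity on `closure Ω × [0,∞)` (with exponent `α ∈ (0,1)`). -/
def LocHolder {n : ℕ} (Ω : Set (EuclideanSpace ℝ (Fin n)))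
    (f : EuclideanSpace ℝ (Fin n) → ℝ → ℝ) : Prop :=
  ∃ α : ℝ, 0 < α ∧ α < 1 ∧ ∀ M : ℝ, 0 < M → ∃ C : ℝ,
    ∀ x ∈ closure Ω, ∀ y ∈ closure Ω, ∀ s ∈ Icc (0:ℝ) M, ∀ t ∈ Icc (0:ℝ) M,
      |f x s - f y t| ≤ C * (dist x y + |s - t|) ^ α

/-- Structural hypotheses on the domain `Ω` and the coefficients `a`, `b`, `k`
of problem (P): `Ω` is a nonempty bounded open set, `a, b` are nonnegative and locally
Hölder continuous on `closure Ω × [0,∞)`, and `k` is nonnegative and continuous on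
`∂Ω × closure Ω × [0,∞)`. -/
def GoodData {n : ℕ} (Ω : Set (EuclideanSpace ℝ (Fin n)))
    (a b : EuclideanSpace ℝ (Fin n) → ℝ → ℝ)
    (k : EuclideanSpace ℝ (Fin n) → EuclideanSpace ℝ (Fin n) → ℝ → ℝ) : Prop :=
  IsOpen Ω ∧ Bornology.IsBounded Ω ∧ Ω.Nonempty ∧
  LocHolder Ω a ∧ LocHolder Ω b ∧
  (∀ x ∈ closure Ω, ∀ t : ℝ, 0 ≤ t → 0 ≤ a x t ∧ 0 ≤ b x t) ∧
  ContinuousOn (fun z : (EuclideanSpace ℝ (Fin n) × EuclideanSpace ℝ (Fin n)) × ℝ =>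
      k z.1.1 z.1.2 z.2) ((frontier Ω ×ˢ closure Ω) ×ˢ Ici 0) ∧
  (∀ x ∈ frontier Ω, ∀ y ∈ closure Ω, ∀ t : ℝ, 0 ≤ t → 0 ≤ k x y t)

/-- Admissible initial datum for problem (P): nonnegative, continuous on `closure Ω`,
and compatible with the nonlocal boundary condition at `t = 0`. -/
def GoodInit {n : ℕ} (Ω : Set (EuclideanSpace ℝ (Fin n)))
    (k : EuclideanSpace ℝ (Fin n) → EuclideanSpace ℝ (Fin n) → ℝ → ℝ) (l : ℝ)
    (u0 : EuclideanSpace ℝ (Fin n) → ℝ) : Prop :=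
  ContinuousOn u0 (closure Ω) ∧ (∀ x ∈ closure Ω, 0 ≤ u0 x) ∧
  ∀ x ∈ frontier Ω, u0 x = ∫ y in Ω, k x y 0 * u0 y ^ l

/-- Regularity required of sub/supersolutions in `Q_T`: continuity on
`Q_T ∪ Γ_T = closure Ω × [0,T)`, `C²` in space and differentiability in time inside `Q_T`. -/
def RegQ {n : ℕ} (Ω : Set (EuclideanSpace ℝ (Fin n))) (T : ℝ)
    (u : EuclideanSpace ℝ (Fin n) → ℝ → ℝ) : Prop :=
  ContinuousOn (fun z : EuclideanSpace ℝ (Fin n) × ℝ => u z.1 z.2) (closure Ω ×ˢ Ico 0 T) ∧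
  (∀ t ∈ Ioo (0:ℝ) T, ContDiffOn ℝ 2 (fun x => u x t) Ω) ∧
  (∀ x ∈ Ω, ∀ t ∈ Ioo (0:ℝ) T, DifferentiableAt ℝ (u x) t)

/-- `u` is a supersolution of problem (P) in `Q_T`. -/
def IsSuperSol {n : ℕ} (r p q l : ℝ) (Ω : Set (EuclideanSpace ℝ (Fin n)))
    (a b : EuclideanSpace ℝ (Fin n) → ℝ → ℝ)
    (k : EuclideanSpace ℝ (Fin n) → EuclideanSpace ℝ (Fin n) → ℝ → ℝ)
    (u0 : EuclideanSpace ℝ (Fin n) → ℝ) (T : ℝ)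
    (u : EuclideanSpace ℝ (Fin n) → ℝ → ℝ) : Prop :=
  RegQ Ω T u ∧ (∀ x ∈ closure Ω, ∀ t ∈ Ico (0:ℝ) T, 0 ≤ u x t) ∧
  (∀ x ∈ Ω, ∀ t ∈ Ioo (0:ℝ) T,
    deriv (u x) t ≥ lap (fun y => u y t) x
      + a x t * u x t ^ r * (∫ y in Ω, u y t ^ p) - b x t * u x t ^ q) ∧
  (∀ x ∈ frontier Ω, ∀ t ∈ Ioo (0:ℝ) T, u x t ≥ ∫ y in Ω, k x y t * u y t ^ l) ∧
  (∀ x ∈ Ω, u x 0 ≥ u0 x)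

/-- `u` is a subsolution of problem (P) in `Q_T`. -/
def IsSubSol {n : ℕ} (r p q l : ℝ) (Ω : Set (EuclideanSpace ℝ (Fin n)))
    (a b : EuclideanSpace ℝ (Fin n) → ℝ → ℝ)
    (k : EuclideanSpace ℝ (Fin n) → EuclideanSpace ℝ (Fin n) → ℝ → ℝ)
    (u0 : EuclideanSpace ℝ (Fin n) → ℝ) (T : ℝ)
    (u : EuclideanSpace ℝ (Fin n) → ℝ → ℝ) : Prop :=
  RegQ Ω T u ∧ (∀ x ∈ closure Ω, ∀ t ∈ Ico (0:ℝ) T, 0 ≤ u x t) ∧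
  (∀ x ∈ Ω, ∀ t ∈ Ioo (0:ℝ) T,
    deriv (u x) t ≤ lap (fun y => u y t) x
      + a x t * u x t ^ r * (∫ y in Ω, u y t ^ p) - b x t * u x t ^ q) ∧
  (∀ x ∈ frontier Ω, ∀ t ∈ Ioo (0:ℝ) T, u x t ≤ ∫ y in Ω, k x y t * u y t ^ l) ∧
  (∀ x ∈ Ω, u x 0 ≤ u0 x)

/-- `u` is a solution of problem (P) in `Q_T`: both a subsolution and a supersolution. -/
def IsSol {n : ℕ} (r p q l : ℝ) (Ω : Set (EuclideanSpace ℝ (Fin n)))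
    (a b : EuclideanSpace ℝ (Fin n) → ℝ → ℝ)
    (k : EuclideanSpace ℝ (Fin n) → EuclideanSpace ℝ (Fin n) → ℝ → ℝ)
    (u0 : EuclideanSpace ℝ (Fin n) → ℝ) (T : ℝ)
    (u : EuclideanSpace ℝ (Fin n) → ℝ → ℝ) : Prop :=
  IsSubSol r p q l Ω a b k u0 T u ∧ IsSuperSol r p q l Ω a b k u0 T u

/-- `u` solves problem (P) in `Q_T` for every `T < Tstar`. -/
def IsSolOn {n : ℕ} (r p q l : ℝ) (Ω : Set (EuclideanSpace ℝ (Fin n)))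
    (a b : EuclideanSpace ℝ (Fin n) → ℝ → ℝ)
    (k : EuclideanSpace ℝ (Fin n) → EuclideanSpace ℝ (Fin n) → ℝ → ℝ)
    (u0 : EuclideanSpace ℝ (Fin n) → ℝ) (Tstar : ℝ)
    (u : EuclideanSpace ℝ (Fin n) → ℝ → ℝ) : Prop :=
  ∀ T : ℝ, 0 < T → T < Tstar → IsSol r p q l Ω a b k u0 T u

/-- `sup_Ω u(·,t) → ∞` as `t → Tstar⁻`. -/
def BlowsUpAt {n : ℕ} (Ω : Set (EuclideanSpace ℝ (Fin n)))
    (u : EuclideanSpace ℝ (Fin n) → ℝ → ℝ) (Tstar : ℝ) : Prop :=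
  ∀ M : ℝ, ∀ᶠ t in nhdsWithin Tstar (Iio Tstar), ∃ x ∈ Ω, M < u x t

/-- Every nontrivial solution with initial datum `u0` blows up in finite time: there is no
global solution, and every noncontinuable solution on a maximal time interval `[0, Tstar)`
satisfies `sup_Ω u(·,t) → ∞` as `t → Tstar⁻`. -/
def AllSolutionsBlowUp {n : ℕ} (r p q l : ℝ) (Ω : Set (EuclideanSpace ℝ (Fin n)))
    (a b : EuclideanSpace ℝ (Fin n) → ℝ → ℝ)
    (k : EuclideanSpace ℝ (Fin n) → EuclideanSpace ℝ (Fin n) → ℝ → ℝ)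
    (u0 : EuclideanSpace ℝ (Fin n) → ℝ) : Prop :=
  (∀ u : EuclideanSpace ℝ (Fin n) → ℝ → ℝ, ¬ (∀ T : ℝ, 0 < T → IsSol r p q l Ω a b k u0 T u)) ∧
  (∀ (u : EuclideanSpace ℝ (Fin n) → ℝ → ℝ) (Tstar : ℝ), 0 < Tstar →
    IsSolOn r p q l Ω a b k u0 Tstar u →
    (¬ ∃ (v : EuclideanSpace ℝ (Fin n) → ℝ → ℝ) (T' : ℝ), Tstar < T' ∧
        IsSolOn r p q l Ω a b k u0 T' v ∧
        ∀ x ∈ closure Ω, ∀ t ∈ Ico (0:ℝ) Tstar, v x t = u x t) →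
    BlowsUpAt Ω u Tstar)

/-- `φ` is a (positive, hence principal) Dirichlet eigenfunction of `-Δ` on `Ω` with
eigenvalue `lam`:  `Δφ + lam φ = 0` in `Ω`, `φ = 0` on `∂Ω`, `φ > 0` in `Ω`. -/
def IsDirichletEigen {n : ℕ} (Ω : Set (EuclideanSpace ℝ (Fin n))) (lam : ℝ)
    (φ : EuclideanSpace ℝ (Fin n) → ℝ) : Prop :=
  ContinuousOn φ (closure Ω) ∧ ContDiffOn ℝ 2 φ Ω ∧
  (∀ x ∈ Ω, lap φ x + lam * φ x = 0) ∧ (∀ x ∈ frontier Ω, φ x = 0) ∧ (∀ x ∈ Ω, 0 < φ x)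

/-- `lam` is the first Dirichlet eigenvalue of `-Δ` on `Ω`, with (some) positive
eigenfunction `φ`. -/
def IsFirstEigen {n : ℕ} (Ω : Set (EuclideanSpace ℝ (Fin n))) (lam : ℝ)
    (φ : EuclideanSpace ℝ (Fin n) → ℝ) : Prop :=
  IsDirichletEigen Ω lam φ ∧
  ∀ lam' : ℝ, (∃ ψ : EuclideanSpace ℝ (Fin n) → ℝ, ContinuousOn ψ (closure Ω) ∧
      ContDiffOn ℝ 2 ψ Ω ∧ (∀ x ∈ Ω, lap ψ x + lam' * ψ x = 0) ∧
      (∀ x ∈ frontier Ω, ψ x = 0) ∧ ∃ x ∈ Ω, ψ x ≠ 0) → lam ≤ lam'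

/-- `sup_Ω f(·,t)`. -/
def supOmega {n : ℕ} (Ω : Set (EuclideanSpace ℝ (Fin n)))
    (f : EuclideanSpace ℝ (Fin n) → ℝ → ℝ) (t : ℝ) : ℝ :=
  sSup ((fun x => f x t) '' Ω)

/-- `inf_Ω f(·,t)`. -/
def infOmega {n : ℕ} (Ω : Set (EuclideanSpace ℝ (Fin n)))
    (f : EuclideanSpace ℝ (Fin n) → ℝ → ℝ) (t : ℝ) : ℝ :=
  sInf ((fun x => f x t) '' Ω)

/-- `inf_{∂Ω × Ω} k(·,·,t)`. -/
def infBdry {n : ℕ} (Ω : Set (EuclideanSpace ℝ (Fin n)))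
    (k : EuclideanSpace ℝ (Fin n) → EuclideanSpace ℝ (Fin n) → ℝ → ℝ) (t : ℝ) : ℝ :=
  sInf ((fun z : EuclideanSpace ℝ (Fin n) × EuclideanSpace ℝ (Fin n) => k z.1 z.2 t) ''
    (frontier Ω ×ˢ Ω))

open scoped Topology
open Filter.Eventually (of_forall)
open Bornology renaming IsBounded → Bdd
open Metric (ball ball_mem_nhds ball_subset_ball ball_subset_closedBall closedBall closedBall_mem_nhds closedBall_subset_closedBall closedBall_subset_closedBall' closedBall_subset_cthickening isOpen_ball mem_ball mem_ball_self mem_closedBall mem_closedBall_self)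

variable {n : ℕ}

local notation "E" => EuclideanSpace ℝ (Fin n)
local notation "Q" => E × ℝ
local notation:max "♯" w:max => fun z : Q => w (Prod.fst z) (Prod.snd z)

variable {s t δ M c β α C h ρ ε s' lam r p q l τ A₀ T : ℝ}
  {x x₀ y : EuclideanSpace ℝ (Fin n)}
  {F χ φ f g u0 : EuclideanSpace ℝ (Fin n) → ℝ}
  {Ω U V : Set (EuclideanSpace ℝ (Fin n))}
  {w a b u : EuclideanSpace ℝ (Fin n) → ℝ → ℝ} {k : EuclideanSpace ℝ (Fin n) → EuclideanSpace ℝ (Fin n) → ℝ → ℝ}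
  {H : Type*} [NormedAddCommGroup H] [NormedSpace ℝ H]

/-- The `i`-th coordinate vector. -/
def cvec (i : Fin n) : E := EuclideanSpace.single i (1 : ℝ)

lemma lap_eq_sum {f' : E → E →L[ℝ] ℝ}
    {f'' : E →L[ℝ] E →L[ℝ] ℝ} (h1 : ∀ᶠ y in 𝓝 x, HasFDerivAt f (f' y) y)
    (h2 : HasFDerivAt f' f'' x) : lap f x = ∑ i, f'' (cvec i) (cvec i) := by
  unfold lap
  refine Finset.sum_congr rfl fun i _ => ?_
  have : (fun y => fderiv ℝ f y (EuclideanSpace.single i 1)) =ᶠ[𝓝 x]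
      fun y => f' y (cvec i) := by
    filter_upwards [h1] with y hy
    rw [hy.fderiv]; rfl
  rw [this.fderiv_eq]
  have h3 := h2.clm_apply (hasFDerivAt_const (cvec i) x)
  rw [h3.fderiv]
  simp [cvec]

lemma ContDiffAt.eventually_hasFDerivAt (h : ContDiffAt ℝ 2 f x) : ∀ᶠ y in 𝓝 x, HasFDerivAt f (fderiv ℝ f y) y := by
  filter_upwards [h.eventually (by simp)] with y hy
  exact (hy.differentiableAt (by simp)).hasFDerivAt

lemma ContDiffAt.hasFDerivAt_fderiv (h : ContDiffAt ℝ 2 f x) :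
    HasFDerivAt (fderiv ℝ f) (fderiv ℝ (fderiv ℝ f) x) x :=
  ((h.fderiv_right (m := 1) (by norm_num)).differentiableAt (by simp)).hasFDerivAt

lemma lap_eq_fderiv (h : ContDiffAt ℝ 2 f x) :
    lap f x = ∑ i, fderiv ℝ (fderiv ℝ f) x (cvec i) (cvec i) :=
  lap_eq_sum h.eventually_hasFDerivAt h.hasFDerivAt_fderiv

lemma lap_congr (h : f =ᶠ[𝓝 x] g) : lap f x = lap g x := by
  unfold lap
  refine Finset.sum_congr rfl fun i _ => ?_
  have : (fun y => fderiv ℝ f y (EuclideanSpace.single i 1)) =ᶠ[𝓝 x]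
      fun y => fderiv ℝ g y (EuclideanSpace.single i 1) := by
    filter_upwards [h.fderiv (𝕜 := ℝ)] with y hy
    rw [hy]
  rw [this.fderiv_eq]

lemma lap_add (hf : ContDiffAt ℝ 2 f x)
    (hg : ContDiffAt ℝ 2 g x) : lap (fun y => f y + g y) x = lap f x + lap g x := by
  rw [lap_eq_fderiv hf, lap_eq_fderiv hg, ← Finset.sum_add_distrib,
    lap_eq_sum (f' := fun y => fderiv ℝ f y + fderiv ℝ g y)
      (f'' := fderiv ℝ (fderiv ℝ f) x + fderiv ℝ (fderiv ℝ g) x)]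
  · rfl
  · filter_upwards [hf.eventually_hasFDerivAt, hg.eventually_hasFDerivAt] with y h1 h2
    exact h1.add h2
  · exact hf.hasFDerivAt_fderiv.add hg.hasFDerivAt_fderiv

lemma lap_const_mul (c : ℝ) (hf : ContDiffAt ℝ 2 f x) : lap (fun y => c * f y) x = c * lap f x := by
  rw [lap_eq_fderiv hf, Finset.mul_sum,
    lap_eq_sum (f' := fun y => c • fderiv ℝ f y) (f'' := c • fderiv ℝ (fderiv ℝ f) x)]
  · rfl
  · filter_upwards [hf.eventually_hasFDerivAt] with y h1
    exact h1.const_mul c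
  · exact hf.hasFDerivAt_fderiv.const_smul c

lemma lap_sub (hf : ContDiffAt ℝ 2 f x)
    (hg : ContDiffAt ℝ 2 g x) : lap (fun y => f y - g y) x = lap f x - lap g x := by
  have h := lap_add hf (g := fun y => (-1) * g y) (contDiffAt_const.mul hg)
  rw [lap_const_mul (-1) hg] at h
  simp only [neg_mul, one_mul, ← sub_eq_add_neg] at h
  exact h

lemma lap_neg (hf : ContDiffAt ℝ 2 f x) : lap (fun y => - f y) x = - lap f x := by
  have := lap_const_mul (-1) hf
  simpa using this

lemma lap_const (c : ℝ) (x : E) : lap (fun _ => c) x = 0 := by simp [lap]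

/-- The squared gradient norm. -/
def gradSq (f : E → ℝ) (x : E) : ℝ := ∑ i, (fderiv ℝ f x (cvec i)) ^ 2

lemma gradSq_nonneg (f : E → ℝ) (x : E) : 0 ≤ gradSq f x := Finset.sum_nonneg fun _ _ => sq_nonneg _

/-- Chain rule for the Laplacian. -/
lemma lap_comp {H H' : ℝ → ℝ} (hf : ContDiffAt ℝ 2 f x)
    (h1 : ∀ᶠ s in 𝓝 (f x), HasDerivAt H (H' s) s) (h2 : HasDerivAt H' c (f x)) :
    lap (fun y => H (f y)) x = H' (f x) * lap f x + c * gradSq f x := by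
  rw [lap_eq_fderiv hf, gradSq, Finset.mul_sum, Finset.mul_sum, ← Finset.sum_add_distrib,
    lap_eq_sum (f' := fun y => H' (f y) • fderiv ℝ f y)
      (f'' := H' (f x) • fderiv ℝ (fderiv ℝ f) x + (c • fderiv ℝ f x).smulRight (fderiv ℝ f x))]
  · refine Finset.sum_congr rfl fun i _ => ?_
    simp; ring
  · filter_upwards [hf.eventually_hasFDerivAt, hf.continuousAt.eventually h1] with y hy1 hy2
    exact hy2.comp_hasFDerivAt y hy1
  · have := (h2.comp_hasFDerivAt x hf.eventually_hasFDerivAt.self_of_nhds)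
    exact this.smul hf.hasFDerivAt_fderiv

lemma fderiv_sqDist (a x : E) :
    HasFDerivAt (fun y : E => ‖y - a‖ ^ 2) (2 • innerSL ℝ (x - a)) x := by
  have := ((hasFDerivAt_id x).sub_const a).norm_sq
  simpa using this

lemma contDiff_sqDist (a : E) : ContDiff ℝ 2 (fun y : E => ‖y - a‖ ^ 2) :=
  (contDiff_id.sub contDiff_const).norm_sq ℝ

lemma inner_cvec (x : E) (i : Fin n) : inner ℝ x (cvec i) = x i := by
  simp [cvec, EuclideanSpace.inner_single_right]

lemma lap_sqDist (a x : E) : lap (fun y : E => ‖y - a‖ ^ 2) x = 2 * n := by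
  rw [lap_eq_sum (f' := fun y => 2 • innerSL ℝ (y - a)) (f'' := 2 • innerSL ℝ)]
  · have : ∀ i : Fin n, ((2 • innerSL ℝ : E →L[ℝ] E →L[ℝ] ℝ) (cvec i)) (cvec i) = 2 := by
      intro i
      change (2 : ℕ) • inner ℝ (cvec i : E) (cvec i) = 2
      rw [inner_cvec]; simp [cvec]
    rw [Finset.sum_congr rfl fun i _ => this i]
    simp [mul_comm]
  · exact of_forall fun y => fderiv_sqDist a y
  · have := (((innerSL ℝ : E →L⋆[ℝ] E →L[ℝ] ℝ).hasFDerivAt (x := x - a)).comp x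
      ((hasFDerivAt_id x).sub_const a)).const_smul (2 : ℕ)
    exact this

lemma gradSq_sqDist (a x : E) : gradSq (fun y : E => ‖y - a‖ ^ 2) x = 4 * ‖x - a‖ ^ 2 := by
  unfold gradSq
  simp only [(fderiv_sqDist a x).fderiv]
  rw [EuclideanSpace.norm_sq_eq, Finset.mul_sum]
  refine Finset.sum_congr rfl fun i _ => ?_
  have : (2 • innerSL ℝ (x - a)) (cvec i) = 2 * (x - a) i := by simp [inner_cvec, -PiLp.sub_apply]
  rw [this, Real.norm_eq_abs, sq_abs]; ring

lemma lap_nonpos_of_isLocalMax (hf : ContDiffAt ℝ 2 f x) (hm : IsLocalMax f x) : lap f x ≤ 0 := by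
  rw [lap_eq_fderiv hf]
  refine Finset.sum_nonpos fun i _ => ?_
  by_contra! hpos
  set g : ℝ → ℝ := fun s => f (x + s • cvec i)
  have hline : ∀ s : ℝ, HasDerivAt (fun s : ℝ => x + s • cvec i) (cvec i) s := by
    intro s
    have := ((hasDerivAt_id s).smul_const (cvec i)).const_add x
    simpa using this
  have hc : ContinuousAt (fun s : ℝ => x + s • cvec i) 0 := (hline 0).continuousAt
  have hx0 : x + (0 : ℝ) • cvec i = x := by simp
  have hc' : Tendsto (fun s : ℝ => x + s • cvec i) (𝓝 0) (𝓝 x) := by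
    have := hc.tendsto; rwa [hx0] at this
  have hg1 : ∀ᶠ s in 𝓝 (0:ℝ), HasDerivAt g (fderiv ℝ f (x + s • cvec i) (cvec i)) s := by
    filter_upwards [hc'.eventually hf.eventually_hasFDerivAt] with s hs
    exact hs.comp_hasDerivAt s (hline s)
  have hg2 : HasDerivAt (fun s : ℝ => fderiv ℝ f (x + s • cvec i) (cvec i))
      (fderiv ℝ (fderiv ℝ f) x (cvec i) (cvec i)) 0 := by
    have h1 : HasFDerivAt (fderiv ℝ f) (fderiv ℝ (fderiv ℝ f) x) (x + (0:ℝ) • cvec i) := by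
      rw [hx0]; exact hf.hasFDerivAt_fderiv
    have h2 := h1.comp_hasDerivAt (0:ℝ) (hline 0)
    exact ((ContinuousLinearMap.apply ℝ ℝ (cvec i)).hasFDerivAt).comp_hasDerivAt (0:ℝ) h2
  have hd : deriv g =ᶠ[𝓝 0] fun s : ℝ => fderiv ℝ f (x + s • cvec i) (cvec i) := by
    filter_upwards [hg1] with s hs using hs.deriv
  have hdd : deriv (deriv g) 0 = fderiv ℝ (fderiv ℝ f) x (cvec i) (cvec i) := by
    rw [hd.deriv_eq, hg2.deriv]
  have hgmax : IsLocalMax g 0 := by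
    have := hc'.eventually hm
    filter_upwards [this] with s hs
    simpa [g] using hs
  have hmin : IsLocalMin g 0 :=
    isLocalMin_of_deriv_deriv_pos (by rw [hdd]; exact hpos) hgmax.deriv_eq_zero
      hg1.self_of_nhds.continuousAt
  have hconst : g =ᶠ[𝓝 0] fun _ => g 0 := by
    filter_upwards [hgmax, hmin] with s h1 h2 using le_antisymm h1 h2
  have : deriv g =ᶠ[𝓝 0] fun _ => 0 := by
    have := hconst.deriv
    simpa using this
  have h0 : deriv (deriv g) 0 = 0 := by rw [this.deriv_eq]; simp
  rw [hdd] at h0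
  exact hpos.ne' h0

/-- Weak maximum principle on a bounded cylinder. -/
lemma heat_comparison {D : Set E} (hD : IsOpen D) (hb : Bdd D) {e : E → ℝ → ℝ}
    (hc : ContinuousOn ♯e (closure D ×ˢ Icc s s'))
    (h2 : ∀ x ∈ D, ∀ t ∈ Ioo s s', ContDiffAt ℝ 2 (fun y => e y t) x)
    (ht : ∀ x ∈ D, ∀ t ∈ Ioo s s', DifferentiableAt ℝ (e x) t)
    (hle : ∀ x ∈ D, ∀ t ∈ Ioo s s', deriv (e x) t ≤ lap (fun y => e y t) x)
    (h0 : ∀ x ∈ closure D, e x s ≤ 0) (hbd : ∀ x ∈ frontier D, ∀ t ∈ Icc s s', e x t ≤ 0) :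
    ∀ x ∈ closure D, ∀ t ∈ Icc s s', e x t ≤ 0 := by
  -- it suffices to treat times below `s'`
  have key : ∀ x ∈ closure D, ∀ t ∈ Ico s s', e x t ≤ 0 := by
    intro x hx t ht'
    refine le_of_forall_pos_le_add fun κ hκ => ?_
    set κ' := κ / (1 + t - s) with hκ'
    have h1ts : 0 < 1 + t - s := by linarith [ht'.1]
    have hκ'pos : 0 < κ' := by positivity
    have hcomp : IsCompact (closure D ×ˢ Icc s t) := (hb.isCompact_closure).prod isCompact_Icc
    have hcont : ContinuousOn (fun z : Q => e z.1 z.2 - κ' * (1 + z.2 - s))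
        (closure D ×ˢ Icc s t) := by
      refine ContinuousOn.sub (hc.mono (prod_mono_right (Icc_subset_Icc_right ht'.2.le))) ?_
      exact Continuous.continuousOn (by fun_prop)
    obtain ⟨⟨y, τ⟩, hyτ, hmax⟩ := hcomp.exists_isMaxOn ⟨(x, t), hx, right_mem_Icc.2 ht'.1⟩ hcont
    have hyτ1 : y ∈ closure D := hyτ.1
    have hyτ2 : τ ∈ Icc s t := hyτ.2
    have hmax' : ∀ x' ∈ closure D, ∀ t' ∈ Icc s t,
        e x' t' - κ' * (1 + t' - s) ≤ e y τ - κ' * (1 + τ - s) := fun x' hx' t' ht' =>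
      hmax (show (x', t') ∈ closure D ×ˢ Icc s t from ⟨hx', ht'⟩)
    have hneg : e y τ - κ' * (1 + τ - s) ≤ 0 := by
      by_contra! hpos
      have hepos : 0 < e y τ := by
        have : 0 < κ' * (1 + τ - s) := mul_pos hκ'pos (by linarith [hyτ2.1])
        linarith
      have hτs : s < τ := by
        rcases hyτ2.1.lt_or_eq with h | h
        · exact h
        · subst h; exact absurd (h0 y hyτ1) (not_le.2 hepos)
      have hτI : τ ∈ Ioo s s' := ⟨hτs, hyτ2.2.trans_lt ht'.2⟩
      have hyD : y ∈ D := by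
        by_contra hyD
        have : y ∈ frontier D := by rw [hD.frontier_eq]; exact ⟨hyτ1, hyD⟩
        exact absurd (hbd y this τ (Ioo_subset_Icc_self hτI)) (not_le.2 hepos)
      have hlap : lap (fun y => e y τ) y ≤ 0 := by
        refine lap_nonpos_of_isLocalMax (h2 y hyD τ hτI) ?_
        filter_upwards [hD.mem_nhds hyD] with x' hx'
        have := hmax' x' (subset_closure hx') τ hyτ2
        linarith
      have hder := hle y hyD τ hτI
      have hd := (ht y hyD τ hτI).hasDerivAt
      -- left difference quotient
      have hslope := (hasDerivAt_iff_tendsto_slope.1 hd).mono_left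
        (nhdsWithin_mono τ (show Iio τ ⊆ {τ}ᶜ from fun z hz => by simpa using hz.ne))
      have hge : κ' ≤ deriv (e y) τ := by
        refine ge_of_tendsto hslope ?_
        have : Ioo s τ ∈ 𝓝[<] τ := Ioo_mem_nhdsLT hτs
        filter_upwards [this] with t' ht1
        have := hmax' y hyτ1 t' ⟨ht1.1.le, ht1.2.le.trans hyτ2.2⟩
        rw [slope_def_field, le_div_iff_of_neg (by linarith [ht1.2])]
        nlinarith
      linarith
    have := hmax' x hx t (right_mem_Icc.2 ht'.1)
    have h3 : κ' * (1 + t - s) = κ := by rw [hκ']; field_simp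
    linarith
  intro x hx t ht'
  rcases ht'.2.lt_or_eq with h | h
  · exact key x hx t ⟨ht'.1, h⟩
  · subst h
    rcases ht'.1.lt_or_eq with h | h
    · have hcx : ContinuousWithinAt (fun τ => e x τ) (Ico s t) t := by
        have h1 : ContinuousOn (fun τ => e x τ) (Icc s t) :=
          hc.comp (f := fun τ => (x, τ)) (by fun_prop) (fun τ hτ => ⟨hx, hτ⟩)
        exact (h1 t ht').mono Ico_subset_Icc_self
      have hne : (𝓝[Ico s t] t).NeBot := by
        rw [← mem_closure_iff_nhdsWithin_neBot, closure_Ico h.ne]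
        exact ht'
      exact le_of_tendsto hcx (by filter_upwards [self_mem_nhdsWithin] with τ hτ using key x hx τ hτ)
    · subst h; exact h0 x hx

/-- The heat kernel. -/
def gauss (s : ℝ) (z : E) : ℝ := (4 * π * s) ^ (-(n : ℝ) / 2) * exp (-‖z‖ ^ 2 / (4 * s))

lemma gauss_pos (hs : 0 < s) (z : E) : 0 < gauss s z := by unfold gauss; positivity

lemma gauss_neg_arg (s : ℝ) (z : E) : gauss s (-z) = gauss s z := by unfold gauss; rw [norm_neg]

lemma integral_gauss (hs : 0 < s) : ∫ z : E, gauss s z = 1 := by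
  unfold gauss
  rw [integral_const_mul]
  have h := GaussianFourier.integral_rexp_neg_mul_sq_norm (V := E) (b := 1 / (4 * s))
    (by positivity)
  have h' : (fun z : E => exp (-‖z‖ ^ 2 / (4 * s))) = fun v => exp (-(1 / (4 * s)) * ‖v‖ ^ 2) := by
    funext z; congr 1; ring
  rw [h', h, finrank_euclideanSpace, Fintype.card_fin]
  have : π / (1 / (4 * s)) = 4 * π * s := by field_simp
  rw [this, ← rpow_add (by positivity)]
  have : -(n : ℝ) / 2 + n / 2 = 0 := by ring
  rw [this, rpow_zero]

lemma integrable_gauss (hs : 0 < s) : Integrable (fun z : E => gauss s z) := by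
  by_contra h
  have := integral_undef h
  rw [integral_gauss hs] at this
  exact one_ne_zero this

lemma contDiff_gauss (s : ℝ) {m : ℕ∞} : ContDiff ℝ m (fun z : E => gauss s z) := by
  unfold gauss
  exact contDiff_const.mul (((contDiff_id.norm_sq ℝ).neg.div_const _).exp)

lemma continuousOn_gauss : ContinuousOn (fun z : Q => gauss z.2 z.1) (univ ×ˢ Ioi 0) := by
  unfold gauss
  refine ContinuousOn.mul ?_ ?_
  · refine ContinuousOn.rpow_const (Continuous.continuousOn (by fun_prop)) ?_
    rintro ⟨z, s⟩ ⟨-, hs⟩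
    left
    have : (0:ℝ) < s := hs
    dsimp; positivity
  · refine Real.continuous_exp.comp_continuousOn ?_
    refine ContinuousOn.div (Continuous.continuousOn (by fun_prop))
      (Continuous.continuousOn (by fun_prop)) ?_
    rintro ⟨z, s⟩ ⟨-, hs⟩
    have : (0:ℝ) < s := hs
    dsimp; positivity

/-- The logarithmic time derivative of the heat kernel. -/
def gaussRate (s : ℝ) (z : E) : ℝ := ‖z‖ ^ 2 / (4 * s ^ 2) - n / (2 * s)

lemma hasDerivAt_gauss (hs : 0 < s) (z : E) :
    HasDerivAt (fun τ => gauss τ z) (gauss s z * gaussRate s z) s := by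
  unfold gauss gaussRate
  have h1 : HasDerivAt (fun τ : ℝ => (4 * π * τ) ^ (-(n : ℝ) / 2))
      (4 * π * (-(n : ℝ) / 2) * (4 * π * s) ^ (-(n : ℝ) / 2 - 1)) s := by
    have h0 : HasDerivAt (fun τ : ℝ => 4 * π * τ) (4 * π) s := by
      simpa using (hasDerivAt_id s).const_mul (4 * π)
    exact h0.rpow_const (Or.inl (by positivity))
  have h2 : HasDerivAt (fun τ : ℝ => -‖z‖ ^ 2 / (4 * τ)) (‖z‖ ^ 2 / (4 * s ^ 2)) s := by
    have h0 : HasDerivAt (fun τ : ℝ => 4 * τ) 4 s := by simpa using (hasDerivAt_id s).const_mul 4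
    have := (hasDerivAt_const s (-‖z‖ ^ 2)).div h0 (by positivity)
    refine this.congr_deriv ?_
    field_simp; ring
  have := h1.mul h2.exp
  refine this.congr_deriv ?_
  rw [rpow_sub_one (by positivity)]
  field_simp
  ring

lemma hasFDerivAt_gauss (s : ℝ) (z : E) :
    HasFDerivAt (fun y => gauss s y) ((-(gauss s z) / (2 * s)) • innerSL ℝ z) z := by
  unfold gauss
  have h1 := fderiv_sqDist (0 : E) z
  simp only [sub_zero] at h1
  have h2 : HasFDerivAt (fun y : E => -‖y‖ ^ 2 / (4 * s)) ((-1 / (4 * s)) • (2 • innerSL ℝ z)) z := by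
    have := h1.const_mul (-1 / (4 * s))
    refine this.congr_of_eventuallyEq (of_forall fun y => ?_)
    ring
  have := h2.exp.const_mul ((4 * π * s) ^ (-(n : ℝ) / 2))
  refine this.congr_fderiv ?_
  ext v
  simp
  ring

variable (n) in
/-- The inner product as a bilinear map. -/
def innerB : E →L[ℝ] E →L[ℝ] ℝ := innerSL ℝ

lemma hasFDerivAt_fderiv_gauss (s : ℝ) (z : E) :
    HasFDerivAt (fun y : E => (-(gauss s y) / (2 * s)) • innerSL ℝ y)
    ((-(gauss s z) / (2 * s)) • innerB n +
    ((gauss s z / (4 * s ^ 2)) • innerSL ℝ z).smulRight (innerSL ℝ z)) z := by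
  have h1 : HasFDerivAt (fun y : E => -(gauss s y) / (2 * s))
      ((gauss s z / (4 * s ^ 2)) • innerSL ℝ z) z := by
    have := (hasFDerivAt_gauss s z).const_mul (-1 / (2 * s))
    refine (this.congr_of_eventuallyEq (of_forall fun y => ?_)).congr_fderiv ?_
    · ring
    · ext v; simp; ring
  exact h1.smul (innerB n).hasFDerivAt

lemma sum_sq_coord (z : E) : ∑ i, z i ^ 2 = ‖z‖ ^ 2 := by
  rw [EuclideanSpace.norm_sq_eq]
  simp

lemma lap_gauss (hs : 0 < s) (z : E) : lap (fun y => gauss s y) z = gauss s z * gaussRate s z := by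
  rw [lap_eq_sum (of_forall fun y => hasFDerivAt_gauss s y)
    (hasFDerivAt_fderiv_gauss s z)]
  have : ∀ i, ((-(gauss s z) / (2 * s)) • innerB n +
        ((gauss s z / (4 * s ^ 2)) • innerSL ℝ z).smulRight (innerSL ℝ z)) (cvec i) (cvec i)
      = -(gauss s z) / (2 * s) + gauss s z / (4 * s ^ 2) * z i ^ 2 := by
    intro i
    have h1 : inner ℝ (cvec i : E) (cvec i) = (1:ℝ) := by rw [inner_cvec]; simp [cvec]
    change (-(gauss s z) / (2 * s)) • inner ℝ (cvec i : E) (cvec i) +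
      ((gauss s z / (4 * s ^ 2)) • inner ℝ z (cvec i)) • inner ℝ z (cvec i) = _
    rw [h1, inner_cvec]
    simp; ring
  rw [Finset.sum_congr rfl fun i _ => this i, Finset.sum_add_distrib, ← Finset.mul_sum,
    sum_sq_coord]
  unfold gaussRate
  simp
  field_simp
  ring

lemma integrable_conv
    (hF : Continuous F) (hFc : HasCompactSupport F) {k : E → H}
    (hk : Continuous k) (x : E) : Integrable (fun y => F y • k (x - y)) :=
  Continuous.integrable_of_hasCompactSupport (by fun_prop) hFc.smul_right

lemma conv_apply
    [CompleteSpace H]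
    (hF : Continuous F) (hFc : HasCompactSupport F) {k : E → E →L[ℝ] H}
    (hk : Continuous k) (x v : E) :
    (∫ y, F y • k (x - y)) v = ∫ y, F y • k (x - y) v :=
  ContinuousLinearMap.integral_apply (integrable_conv hF hFc hk x) v

/-- Differentiation of a convolution, the derivative falling on the smooth factor. -/
lemma hasFDerivAt_conv (hF : Continuous F) (hFc : HasCompactSupport F) {k : E → H}
    {k' : E → E →L[ℝ] H} (hk : ∀ z, HasFDerivAt k (k' z) z) (hk' : Continuous k') (x : E) :
    HasFDerivAt (fun x => ∫ y, F y • k (x - y)) (∫ y, F y • k' (x - y)) x := by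
  have hkc : Continuous k := continuous_iff_continuousAt.2 fun z => (hk z).continuousAt
  obtain ⟨C, hC⟩ := ((isCompact_closedBall x 1).prod hFc.isCompact).exists_bound_of_continuousOn
    (f := fun z : E × E => k' (z.1 - z.2)) (Continuous.continuousOn (by fun_prop))
  refine hasFDerivAt_integral_of_dominated_of_fderiv_le (𝕜 := ℝ) (F := fun x y => F y • k (x - y))
    (F' := fun x y => F y • k' (x - y)) (bound := fun y => ‖F y‖ * C)
    (ball_mem_nhds x one_pos) ?_ ?_ ?_ ?_ ?_ ?_
  · exact of_forall fun x' => (integrable_conv hF hFc hkc x').1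
  · exact integrable_conv hF hFc hkc x
  · exact (integrable_conv hF hFc hk' x).1
  · refine of_forall fun y x' hx' => ?_
    rw [norm_smul]
    by_cases hy : y ∈ tsupport F
    · exact mul_le_mul_of_nonneg_left (hC (x', y) ⟨ball_subset_closedBall hx', hy⟩)
        (norm_nonneg _)
    · rw [image_eq_zero_of_notMem_tsupport hy]; simp
  · exact (hF.norm.integrable_of_hasCompactSupport hFc.norm).mul_const C
  · refine of_forall fun y x' _ => ?_
    have h1 : HasFDerivAt (fun x' => k (x' - y)) (k' (x' - y)) x' := by
      have := (hk (x' - y)).comp x' ((hasFDerivAt_id x').sub_const y)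
      exact this.congr_fderiv (ContinuousLinearMap.comp_id _)
    exact h1.const_smul (F y)

lemma continuous_conv (hF : Continuous F) (hFc : HasCompactSupport F) {k : E → H}
    (hk : Continuous k) : Continuous (fun x => ∫ y, F y • k (x - y)) := by
  rw [← continuousOn_univ]
  refine continuousOn_integral_of_compact_support hFc.isCompact
    (Continuous.continuousOn (by fun_prop)) ?_
  intro p y _ hy
  rw [image_eq_zero_of_notMem_tsupport hy, zero_smul]

lemma contDiff_two_of_hasFDerivAt {f' : E → E →L[ℝ] ℝ}
    {f'' : E → E →L[ℝ] E →L[ℝ] ℝ} (h1 : ∀ x ∈ U, HasFDerivAt f (f' x) x)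
    (h2 : ∀ x ∈ U, HasFDerivAt f' (f'' x) x) (h3 : ContinuousOn f'' U) : ContDiffOn ℝ 2 f U := by
  have e1 : ContDiffOn ℝ 1 f' U := by
    have : (1 : WithTop ℕ∞) = 0 + 1 := by norm_num
    rw [this, contDiffOn_succ_iff_hasFDerivWithinAt (by simp)]
    intro x hx
    refine ⟨U, ?_, by simp, f'', fun y hy => (h2 y hy).hasFDerivWithinAt, ?_⟩
    · rw [insert_eq_of_mem hx]; exact self_mem_nhdsWithin
    · exact contDiffOn_zero.2 h3
  have : (2 : WithTop ℕ∞) = 1 + 1 := by norm_num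
  rw [this, contDiffOn_succ_iff_hasFDerivWithinAt (by simp)]
  intro x hx
  refine ⟨U, ?_, by simp, f', fun y hy => (h1 y hy).hasFDerivWithinAt, e1⟩
  rw [insert_eq_of_mem hx]; exact self_mem_nhdsWithin

lemma conv_two (hF : Continuous F) (hFc : HasCompactSupport F) {k : E → ℝ} (hk : ContDiff ℝ 2 k) :
    ContDiff ℝ 2 (fun x => ∫ y, F y * k (x - y)) ∧
    ∀ x, lap (fun x => ∫ y, F y * k (x - y)) x = ∫ y, F y * lap k (x - y) := by
  have hk1 : ∀ z, HasFDerivAt k (fderiv ℝ k z) z := fun z =>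
    (hk.differentiable (by simp) z).hasFDerivAt
  have hkd : ContDiff ℝ 1 (fderiv ℝ k) := hk.fderiv_right (by norm_num)
  have hk2 : ∀ z, HasFDerivAt (fderiv ℝ k) (fderiv ℝ (fderiv ℝ k) z) z := fun z =>
    (hkd.differentiable (by simp) z).hasFDerivAt
  have hkc : Continuous (fderiv ℝ (fderiv ℝ k)) := hkd.continuous_fderiv (by simp)
  have d1 := fun x => hasFDerivAt_conv hF hFc hk1 hkd.continuous x
  have d2 := fun x => hasFDerivAt_conv hF hFc hk2 hkc x
  have d3 := continuous_conv (H := E →L[ℝ] E →L[ℝ] ℝ) hF hFc hkc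
  constructor
  · rw [← contDiffOn_univ]
    exact contDiff_two_of_hasFDerivAt (fun x _ => d1 x) (fun x _ => d2 x) d3.continuousOn
  · intro x
    have := lap_eq_sum (of_forall fun y => d1 y) (d2 x)
    simp only [smul_eq_mul] at this
    rw [this]
    have hkv : ∀ v, Continuous (fun z => fderiv ℝ (fderiv ℝ k) z v) := fun v =>
      hkc.clm_apply continuous_const
    have e : ∀ i : Fin n, (∫ y, F y • fderiv ℝ (fderiv ℝ k) (x - y)) (cvec i) (cvec i) =
        ∫ y, F y * fderiv ℝ (fderiv ℝ k) (x - y) (cvec i) (cvec i) := by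
      intro i
      rw [conv_apply hF hFc hkc x, conv_apply hF hFc (hkv _) x]
      rfl
    rw [Finset.sum_congr rfl fun i _ => e i, ← integral_finsetSum]
    · refine integral_congr_ae (of_forall fun y => ?_)
      dsimp only
      rw [lap_eq_fderiv hk.contDiffAt, Finset.mul_sum]
    · intro i _
      exact integrable_conv hF hFc ((hkv (cvec i)).clm_apply continuous_const) x

/-- The heat flow. -/
def heat (F : E → ℝ) (s : ℝ) (x : E) : ℝ := ∫ ξ : E, gauss 1 ξ * F (x - √s • ξ)

lemma heat_zero (F : E → ℝ) (x : E) : heat F 0 x = F x := by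
  unfold heat
  simp only [sqrt_zero, zero_smul, sub_zero]
  rw [integral_mul_const, integral_gauss one_pos, one_mul]

lemma heat_integrable (hF : Continuous F) (hM : ∀ x, |F x| ≤ M)
    (s : ℝ) (x : E) : Integrable (fun ξ : E => gauss 1 ξ * F (x - √s • ξ)) := by
  refine (integrable_gauss one_pos).mul_bdd (c := M) ?_ (of_forall fun _ => hM _)
  exact Continuous.aestronglyMeasurable (by fun_prop)

lemma heat_continuous (hF : Continuous F) (hM : ∀ x, |F x| ≤ M) :
    Continuous (fun z : Q => heat F z.2 z.1) := by
  unfold heat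
  refine continuous_of_dominated (bound := fun ξ => gauss 1 ξ * M) ?_ ?_ ?_ ?_
  · exact fun z => (heat_integrable hF hM z.2 z.1).1
  · refine fun z => of_forall fun ξ => ?_
    rw [norm_mul, Real.norm_eq_abs, Real.norm_eq_abs, abs_of_pos (gauss_pos one_pos _)]
    exact mul_le_mul_of_nonneg_left (hM _) (gauss_pos one_pos _).le
  · exact (integrable_gauss one_pos).mul_const M
  · refine of_forall fun ξ => ?_
    fun_prop

lemma heat_le (hF : Continuous F) (hM : ∀ x, |F x| ≤ M)
    (h : ∀ x, F x ≤ c) (s : ℝ) (x : E) : heat F s x ≤ c := by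
  have h1 : heat F s x ≤ ∫ ξ : E, gauss 1 ξ * c :=
    integral_mono (heat_integrable hF hM s x) ((integrable_gauss one_pos).mul_const c) fun ξ =>
      mul_le_mul_of_nonneg_left (h _) (gauss_pos one_pos _).le
  rwa [integral_mul_const, integral_gauss one_pos, one_mul] at h1

lemma le_heat (hF : Continuous F) (hM : ∀ x, |F x| ≤ M)
    (h : ∀ x, c ≤ F x) (s : ℝ) (x : E) : c ≤ heat F s x := by
  have h1 : ∫ ξ : E, gauss 1 ξ * c ≤ heat F s x :=
    integral_mono ((integrable_gauss one_pos).mul_const c) (heat_integrable hF hM s x) fun ξ =>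
      mul_le_mul_of_nonneg_left (h _) (gauss_pos one_pos _).le
  rwa [integral_mul_const, integral_gauss one_pos, one_mul] at h1

lemma abs_heat_le (hF : Continuous F) (hM : ∀ x, |F x| ≤ M)
    (s : ℝ) (x : E) : |heat F s x| ≤ M :=
  abs_le.2 ⟨le_heat hF hM (fun x => (abs_le.1 (hM x)).1) s x,
    heat_le hF hM (fun x => (abs_le.1 (hM x)).2) s x⟩

lemma heat_add {F' : E → ℝ} (hF : Continuous F) (hF' : Continuous F')
    {M' : ℝ} (hM : ∀ x, |F x| ≤ M) (hM' : ∀ x, |F' x| ≤ M') (s : ℝ) (x : E) :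
    heat (fun y => F y + F' y) s x = heat F s x + heat F' s x := by
  unfold heat
  rw [← integral_add (heat_integrable hF hM s x) (heat_integrable hF' hM' s x)]
  refine integral_congr_ae (of_forall fun ξ => ?_)
  dsimp only; ring

lemma heat_const_mul (F : E → ℝ) (c s : ℝ) (x : E) :
    heat (fun y => c * F y) s x = c * heat F s x := by
  unfold heat
  rw [← integral_const_mul]
  refine integral_congr_ae (of_forall fun ξ => ?_)
  dsimp only; ring

lemma heat_neg (F : E → ℝ) (s : ℝ) (x : E) : heat (fun y => - F y) s x = - heat F s x := by
  have := heat_const_mul F (-1) s x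
  simpa using this

lemma gauss_scale (hs : 0 < s) (ξ : E) : gauss s (√s • ξ) = (√s ^ n)⁻¹ * gauss 1 ξ := by
  unfold gauss
  rw [norm_smul, mul_pow, Real.norm_eq_abs, sq_abs, sq_sqrt hs.le]
  have h1 : -(s * ‖ξ‖ ^ 2) / (4 * s) = -‖ξ‖ ^ 2 / (4 * 1) := by field_simp
  have h2 : (4 * π * s) ^ (-(n : ℝ) / 2) = (4 * π * 1) ^ (-(n : ℝ) / 2) * (√s ^ n)⁻¹ := by
    rw [mul_rpow (by positivity) hs.le, mul_one]
    congr 1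
    rw [sqrt_eq_rpow, ← rpow_natCast, ← rpow_mul hs.le, ← rpow_neg hs.le]
    congr 1; ring
  rw [h1, h2]; ring

lemma heat_eq_conv' (F : E → ℝ) (hs : 0 < s) (x : E) : heat F s x = ∫ w, gauss s w * F (x - w) := by
  have h := Measure.integral_comp_smul (μ := (volume : Measure E))
    (fun w => gauss s w * F (x - w)) (√s)
  simp only [finrank_euclideanSpace, Fintype.card_fin, gauss_scale hs] at h
  have hp : 0 < √s ^ n := by positivity
  rw [abs_of_pos (by positivity)] at h
  unfold heat
  have : ∫ w, gauss s w * F (x - w) = √s ^ n * ((√s ^ n)⁻¹ • ∫ w, gauss s w * F (x - w)) := by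
    rw [smul_eq_mul]; field_simp
  rw [this, ← h, ← integral_const_mul]
  refine integral_congr_ae (of_forall fun ξ => ?_)
  dsimp only; field_simp

lemma heat_eq_conv (F : E → ℝ) (hs : 0 < s) (x : E) : heat F s x = ∫ y, F y * gauss s (x - y) := by
  rw [heat_eq_conv' F hs x, ← integral_sub_left_eq_self _ volume x]
  refine integral_congr_ae (of_forall fun ξ => ?_)
  dsimp only; rw [sub_sub_cancel, mul_comm]

lemma heat_contDiff (hF : Continuous F) (hFc : HasCompactSupport F)
    (hs : 0 < s) : ContDiff ℝ 2 (fun x => heat F s x) := by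
  have := (conv_two hF hFc (contDiff_gauss s (m := 2))).1
  simpa only [heat_eq_conv F hs] using this

lemma lap_heat (hF : Continuous F) (hFc : HasCompactSupport F) (hs : 0 < s) (x : E) :
    lap (fun x => heat F s x) x = ∫ y, F y * (gauss s (x - y) * gaussRate s (x - y)) := by
  have := (conv_two hF hFc (contDiff_gauss s (m := 2))).2 x
  simpa only [heat_eq_conv F hs, lap_gauss hs] using this

lemma heat_hasDerivAt (hF : Continuous F) (hFc : HasCompactSupport F) (hs : 0 < s) (x : E) :
    HasDerivAt (fun τ => heat F τ x) (lap (fun x => heat F s x) x) s := by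
  rw [lap_heat hF hFc hs]
  have hev : (fun τ => heat F τ x) =ᶠ[𝓝 s] fun τ => ∫ y, F y * gauss τ (x - y) := by
    filter_upwards [lt_mem_nhds hs] with τ hτ using heat_eq_conv F hτ x
  refine HasDerivAt.congr_of_eventuallyEq ?_ hev
  have hcg : ContinuousOn (fun z : Q => gauss z.2 (x - z.1) * gaussRate z.2 (x - z.1))
      (univ ×ˢ Ioi 0) := by
    refine ContinuousOn.mul ?_ ?_
    · exact continuousOn_gauss.comp (f := fun z : Q => (x - z.1, z.2))
        (Continuous.continuousOn (by fun_prop)) (fun z hz => ⟨mem_univ _, hz.2⟩)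
    · unfold gaussRate
      refine ContinuousOn.sub ?_ ?_ <;>
      refine ContinuousOn.div (Continuous.continuousOn (by fun_prop))
        (Continuous.continuousOn (by fun_prop)) ?_ <;>
      · rintro ⟨z, τ⟩ ⟨-, hτ⟩
        have : (0:ℝ) < τ := hτ
        dsimp; positivity
  have hball : ∀ τ ∈ closedBall s (s / 2), 0 < τ := by
    intro τ hτ
    rw [mem_closedBall, Real.dist_eq, abs_le] at hτ
    linarith
  obtain ⟨C, hC⟩ := (hFc.isCompact.prod (isCompact_closedBall s (s/2))).exists_bound_of_continuousOn
    (hcg.mono (fun z hz => ⟨mem_univ _, hball _ hz.2⟩))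
  have hcont : ∀ τ : ℝ, Continuous (fun y => F y * gauss τ (x - y)) := fun τ => by
    have : Continuous (fun z : E => gauss τ z) := (contDiff_gauss τ (m := 0)).continuous
    fun_prop
  have hrate : Continuous (fun y => F y * (gauss s (x - y) * gaussRate s (x - y))) := by
    have : Continuous (fun z : E => gauss s z) := (contDiff_gauss s (m := 0)).continuous
    unfold gaussRate
    fun_prop
  refine (hasDerivAt_integral_of_dominated_loc_of_deriv_le
    (F' := fun τ y => F y * (gauss τ (x - y) * gaussRate τ (x - y))) (bound := fun y => ‖F y‖ * C)
    (ball_mem_nhds s (half_pos hs)) ?_ ?_ ?_ ?_ ?_ ?_).2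
  · exact of_forall fun τ => (hcont τ).aestronglyMeasurable
  · exact (hcont s).integrable_of_hasCompactSupport hFc.mul_right
  · exact hrate.aestronglyMeasurable
  · refine of_forall fun y τ hτ => ?_
    rw [norm_mul]
    by_cases hy : y ∈ tsupport F
    · exact mul_le_mul_of_nonneg_left (hC (y, τ) ⟨hy, ball_subset_closedBall hτ⟩)
        (norm_nonneg _)
    · rw [image_eq_zero_of_notMem_tsupport hy]; simp
  · exact (hF.norm.integrable_of_hasCompactSupport hFc.norm).mul_const C
  · refine of_forall fun y τ hτ => ?_
    exact (hasDerivAt_gauss (hball τ (ball_subset_closedBall hτ)) _).const_mul (F y)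

lemma exists_abs_le_of_hasCompactSupport (hF : Continuous F)
    (hFc : HasCompactSupport F) : ∃ M, ∀ x, |F x| ≤ M :=
  hFc.exists_bound_of_continuous hF

lemma gauss_le (hs : 0 < s) (z : E) : gauss s z ≤ (4 * π * s) ^ (-(n : ℝ) / 2) := by
  unfold gauss
  refine mul_le_of_le_one_right (by positivity) ?_
  rw [exp_le_one_iff]
  have := sq_nonneg ‖z‖
  rw [neg_div]
  exact neg_nonpos.2 (by positivity)

/-- Smoothing estimate for the heat flow of nonnegative data. -/
lemma heat_le_integral (hF : Continuous F) (hFc : HasCompactSupport F)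
    (h0 : ∀ x, 0 ≤ F x) (hs : 0 < s) (x : E) :
    heat F s x ≤ (4 * π * s) ^ (-(n : ℝ) / 2) * ∫ y, F y := by
  rw [heat_eq_conv F hs, ← integral_const_mul]
  have hc : Continuous (fun z : E => gauss s z) := (contDiff_gauss s (m := 0)).continuous
  refine integral_mono (Continuous.integrable_of_hasCompactSupport (by fun_prop) hFc.mul_right)
    ((hF.integrable_of_hasCompactSupport hFc).const_mul _) fun y => ?_
  dsimp only
  rw [mul_comm]
  exact mul_le_mul_of_nonneg_right (gauss_le hs _) (h0 y)

/-- `heat_comparison` for functions satisfying the differential inequality on successive slabs. -/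
lemma heat_comparison_slabs {D : Set E} (hD : IsOpen D) (hb : Bdd D) {e : E → ℝ → ℝ}
    (hc : ContinuousOn ♯e (closure D ×ˢ Icc s s'))
    (hpde : ∀ t ∈ Ico s s', ∃ t' > t, ∀ x ∈ D, ∀ τ ∈ Ioo t t',
    ContDiffAt ℝ 2 (fun y => e y τ) x ∧ DifferentiableAt ℝ (e x) τ ∧
    deriv (e x) τ ≤ lap (fun y => e y τ) x) (h0 : ∀ x ∈ closure D, e x s ≤ 0)
    (hbd : ∀ x ∈ frontier D, ∀ t ∈ Icc s s', e x t ≤ 0) :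
    ∀ x ∈ closure D, ∀ t ∈ Icc s s', e x t ≤ 0 := by
  set A : Set ℝ := {t | ∀ x ∈ closure D, e x t ≤ 0} with hA
  suffices h : Icc s s' ⊆ A by intro x hx t ht; exact h ht x hx
  have hclosed : IsClosed (A ∩ Icc s s') := by
    rcases (closure D).eq_empty_or_nonempty with h | ⟨x0, hx0⟩
    · have : A = univ := eq_univ_of_forall fun t x hx => absurd hx (h ▸ notMem_empty x)
      rw [this, univ_inter]; exact isClosed_Icc
    · have : A ∩ Icc s s' = ⋂ x ∈ closure D, (Icc s s' ∩ (fun t => e x t) ⁻¹' Iic 0) := by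
        ext t
        simp only [hA, mem_inter_iff, mem_iInter, mem_preimage, mem_Iic, Set.mem_ofPred_eq]
        exact ⟨fun h x hx => ⟨h.2, h.1 x hx⟩, fun h => ⟨fun x hx => (h x hx).2, (h x0 hx0).1⟩⟩
      rw [this]
      refine isClosed_biInter fun x hx => ?_
      have h1 : ContinuousOn (fun τ => e x τ) (Icc s s') :=
        hc.comp (f := fun τ => ((x : E), τ)) (by fun_prop) (fun τ hτ => ⟨hx, hτ⟩)
      exact h1.preimage_isClosed_of_isClosed isClosed_Icc isClosed_Iic
  refine hclosed.Icc_subset_of_forall_exists_gt h0 ?_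
  rintro t ⟨htA, ht⟩ y hy
  obtain ⟨t', ht', hp⟩ := hpde t ht
  set t2 := min (min t' s') y with ht2
  have hlt : t < t2 := lt_min (lt_min ht' ht.2) hy
  have h2t' : t2 ≤ t' := (min_le_left _ _).trans (min_le_left _ _)
  have h2s' : t2 ≤ s' := (min_le_left _ _).trans (min_le_right _ _)
  refine ⟨t2, ?_, hlt, min_le_right _ _⟩
  intro x hx
  refine heat_comparison hD hb (s := t) (s' := t2) (e := e) ?_ ?_ ?_ ?_ htA ?_ x hx t2
    (right_mem_Icc.2 hlt.le)
  · exact hc.mono (prod_mono_right (Icc_subset_Icc ht.1 h2s'))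
  · exact fun x hx τ hτ => (hp x hx τ ⟨hτ.1, hτ.2.trans_le h2t'⟩).1
  · exact fun x hx τ hτ => (hp x hx τ ⟨hτ.1, hτ.2.trans_le h2t'⟩).2.1
  · exact fun x hx τ hτ => (hp x hx τ ⟨hτ.1, hτ.2.trans_le h2t'⟩).2.2
  · exact fun x hx τ hτ => hbd x hx τ ⟨ht.1.trans hτ.1, hτ.2.trans h2s'⟩

/-- Supersolutions of `z_t = Δz + f`, expressed by comparison with the heat flow on balls. -/
def HeatSuper (U : Set E) (α β : ℝ) (z f : E → ℝ → ℝ) : Prop :=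
  ∀ (x : E) (d s h A₀ M : ℝ) (A : ℝ → ℝ) (F : E → ℝ), 0 < d → closedBall x d ⊆ U → α < s →
    0 ≤ h → s + h < β → Continuous A → (∀ t, |A t| ≤ A₀) →
    (∀ y ∈ closedBall x d, ∀ t ∈ Icc s (s + h), A t ≤ f y t) →
    (∀ y ∈ closedBall x d, ∀ t ∈ Icc s (s + h), |z y t| ≤ M) →
    Continuous F → HasCompactSupport F → (∀ y, |F y| ≤ M) →
    (∀ y ∈ closedBall x d, F y ≤ z y s) →
    heat F h x + (∫ τ in s..(s + h), A τ)
      - (2 * M + A₀ * h) * (2 * n + 4) ^ 2 * h ^ 2 / d ^ 4 ≤ z x (s + h)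

/-- `z_t ≥ Δz + f` in the classical sense, on successive time slabs. -/
def SlabSuper (U : Set E) (α β : ℝ) (z f : E → ℝ → ℝ) : Prop :=
  ∀ t ∈ Ioo α β, ∃ t' > t, ∀ x ∈ U, ∀ τ ∈ Ioo t t',
      ContDiffAt ℝ 2 (fun y => z y τ) x ∧ DifferentiableAt ℝ (z x) τ ∧
      lap (fun y => z y τ) x + f x τ ≤ deriv (z x) τ

lemma lap_quartic (x y : E) (c : ℝ) :
    lap (fun y => (‖y - x‖ ^ 2 + c) ^ 2) y = 4 * n * (‖y - x‖ ^ 2 + c) + 8 * ‖y - x‖ ^ 2 := by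
  have h := lap_comp (f := fun y : E => ‖y - x‖ ^ 2) (x := y) (H := fun s => (s + c) ^ 2)
    (H' := fun s => 2 * (s + c)) (c := 2) (contDiff_sqDist x).contDiffAt
    (of_forall fun s => by
      have := ((hasDerivAt_id s).add_const c).pow 2
      exact this.congr_deriv (by simp))
    (by
      have := ((hasDerivAt_id (‖y - x‖ ^ 2)).add_const c).const_mul 2
      exact this.congr_deriv (by simp))
  rw [h, lap_sqDist, gradSq_sqDist]; ring

lemma SlabSuper.heatSuper {z f : E → ℝ → ℝ}
    (hc : ContinuousOn ♯z (U ×ˢ Ioo α β))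
    (hs : SlabSuper U α β z f) : HeatSuper U α β z f := by
  intro x d s h A₀ M A F hd hU hαs hh hβ hAc hA₀ hA hM hF hFc hFM hFz
  have hM0 : 0 ≤ M := (abs_nonneg _).trans (hFM 0)
  have hA₀0 : 0 ≤ A₀ := (abs_nonneg _).trans (hA₀ 0)
  set M' := 2 * M + A₀ * h with hM'
  have hM'0 : 0 ≤ M' := by positivity
  set c : ℝ := 2 * n + 4 with hcdef
  have hc0 : 0 < c := by positivity
  set κ := M' / d ^ 4 with hκ
  have hκ0 : 0 ≤ κ := by positivity
  have hI : Icc s (s + h) ⊆ Ioo α β := fun t ht => ⟨hαs.trans_le ht.1, ht.2.trans_lt hβ⟩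
  set e : E → ℝ → ℝ := fun y t => heat F (t - s) y + (∫ τ in s..t, A τ)
    - κ * (‖y - x‖ ^ 2 + c * (t - s)) ^ 2 - z y t with he
  have hheat := heat_continuous hF hFM
  have hcl : closure (ball x d) = closedBall x d := closure_ball x hd.ne'
  have key := heat_comparison_slabs (D := ball x d) isOpen_ball Metric.isBounded_ball
    (s := s) (s' := s + h) (e := e) ?_ ?_ ?_ ?_ x
      (subset_closure (mem_ball_self hd)) (s + h) (right_mem_Icc.2 (by linarith))
  · simp only [he, add_sub_cancel_left, sub_self, norm_zero] at key
    have : κ * (0 ^ 2 + c * h) ^ 2 = M' * c ^ 2 * h ^ 2 / d ^ 4 := by rw [hκ]; ring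
    rw [this] at key
    linarith
  · rw [hcl]
    refine ContinuousOn.sub (Continuous.continuousOn ?_) (hc.mono (prod_mono hU hI))
    have h1 : Continuous (fun p : Q => heat F (p.2 - s) p.1) :=
      hheat.comp (by fun_prop : Continuous fun p : Q => (p.1, p.2 - s))
    have h2 : Continuous (fun p : Q => ∫ τ in s..p.2, A τ) :=
      (intervalIntegral.continuous_primitive (fun _ _ => hAc.intervalIntegrable _ _) s).comp
        continuous_snd
    fun_prop
  · intro t ht
    obtain ⟨t', ht', hp⟩ := hs t (hI ⟨ht.1, ht.2.le⟩)
    refine ⟨min t' (s + h), lt_min ht' ht.2, fun y hy τ hτ => ?_⟩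
    have hyc : y ∈ closedBall x d := ball_subset_closedBall hy
    obtain ⟨p1, p2, p3⟩ := hp y (hU hyc) τ ⟨hτ.1, hτ.2.trans_le (min_le_left _ _)⟩
    have hτs : 0 < τ - s := by linarith [hτ.1, ht.1]
    have hτI : τ ∈ Icc s (s + h) := ⟨by linarith, hτ.2.le.trans (min_le_right _ _)⟩
    have q1 : ContDiffAt ℝ 2 (fun y => heat F (τ - s) y) y := (heat_contDiff hF hFc hτs).contDiffAt
    have q2 : ContDiffAt ℝ 2 (fun y : E => (‖y - x‖ ^ 2 + c * (τ - s)) ^ 2) y :=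
      (((contDiff_sqDist x).add contDiff_const).pow 2).contDiffAt
    have q3 : ContDiffAt ℝ 2 (fun y : E => heat F (τ - s) y + ∫ τ' in s..τ, A τ') y :=
      q1.add contDiffAt_const
    have q4 : ContDiffAt ℝ 2 (fun y : E => κ * (‖y - x‖ ^ 2 + c * (τ - s)) ^ 2) y :=
      contDiffAt_const.mul q2
    have dt : HasDerivAt (e y) (lap (fun y => heat F (τ - s) y) y + A τ
        - κ * (2 * (‖y - x‖ ^ 2 + c * (τ - s)) * c) - deriv (z y) τ) τ := by
      have hsub : HasDerivAt (fun t : ℝ => t - s) 1 τ := (hasDerivAt_id τ).sub_const s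
      have e1 : HasDerivAt (fun t => heat F (t - s) y) (lap (fun y => heat F (τ - s) y) y) τ := by
        have := (heat_hasDerivAt hF hFc hτs y).comp τ hsub
        exact this.congr_deriv (mul_one _)
      have e2 : HasDerivAt (fun t : ℝ => ∫ τ' in s..t, A τ') (A τ) τ :=
        intervalIntegral.integral_hasDerivAt_right (hAc.intervalIntegrable _ _)
          (hAc.stronglyMeasurableAtFilter _ _) hAc.continuousAt
      have e3 : HasDerivAt (fun t : ℝ => κ * (‖y - x‖ ^ 2 + c * (t - s)) ^ 2)
          (κ * (2 * (‖y - x‖ ^ 2 + c * (τ - s)) * c)) τ := by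
        have := (((hsub.const_mul c).const_add (‖y - x‖ ^ 2)).pow 2).const_mul κ
        refine this.congr_deriv ?_
        simp
      exact ((e1.add e2).sub e3).sub p2.hasDerivAt
    refine ⟨(q3.sub q4).sub p1, dt.differentiableAt, ?_⟩
    rw [dt.deriv]
    have hl : lap (fun y => e y τ) y = lap (fun y => heat F (τ - s) y) y
        - κ * (4 * n * (‖y - x‖ ^ 2 + c * (τ - s)) + 8 * ‖y - x‖ ^ 2) - lap (fun y => z y τ) y := by
      simp only [he]
      rw [lap_sub (q3.sub q4) p1, lap_sub q3 q4, lap_add q1 contDiffAt_const, lap_const,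
        lap_const_mul κ q2, lap_quartic]
      ring
    rw [hl]
    have hAf := hA y hyc τ hτI
    have : κ * (4 * n * (‖y - x‖ ^ 2 + c * (τ - s)) + 8 * ‖y - x‖ ^ 2) ≤
        κ * (2 * (‖y - x‖ ^ 2 + c * (τ - s)) * c) := by
      refine mul_le_mul_of_nonneg_left ?_ hκ0
      have : 0 ≤ c * (τ - s) := by positivity
      rw [hcdef] at this ⊢
      nlinarith
    linarith
  · intro y hy
    rw [hcl] at hy
    simp only [he, sub_self, mul_zero, add_zero, heat_zero, intervalIntegral.integral_same]
    have := hFz y hy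
    have : 0 ≤ κ * (‖y - x‖ ^ 2) ^ 2 := by positivity
    linarith
  · intro y hy t ht
    rw [frontier_ball x hd.ne'] at hy
    have hyd : ‖y - x‖ = d := by simpa [dist_eq_norm] using hy
    have hyc : y ∈ closedBall x d := Metric.sphere_subset_closedBall hy
    have h1 := abs_le.1 (abs_heat_le hF hFM (t - s) y)
    have h2 := abs_le.1 (hM y hyc t ht)
    have hts : 0 ≤ t - s := by linarith [ht.1]
    have h3 : (∫ τ in s..t, A τ) ≤ A₀ * h := by
      have := intervalIntegral.norm_integral_le_of_norm_le_const (a := s) (b := t) (f := A)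
        (C := A₀) (fun τ _ => hA₀ τ)
      rw [abs_of_nonneg hts] at this
      exact (le_abs_self _).trans (this.trans (by gcongr; linarith [ht.2]))
    have h4 : M' ≤ κ * (‖y - x‖ ^ 2 + c * (t - s)) ^ 2 := by
      have : M' = κ * (d ^ 2) ^ 2 := by rw [hκ]; field_simp
      rw [this, hyd]
      refine mul_le_mul_of_nonneg_left ?_ hκ0
      have : 0 ≤ c * (t - s) := by positivity
      gcongr
      linarith
    simp only [he]
    linarith

lemma continuous_gauss (s : ℝ) : Continuous (fun z : E => gauss s z) :=
  (contDiff_gauss s (m := 0)).continuous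

lemma gauss_eq_double (hs : 0 < s) (z : E) :
    gauss s z = 2 ^ ((n : ℝ) / 2) * exp (-(‖z‖ ^ 2 / s) / 8) * gauss (2 * s) z := by
  unfold gauss
  have h1 : (4 * π * (2 * s)) ^ (-(n : ℝ) / 2) = 2 ^ (-(n : ℝ) / 2) * (4 * π * s) ^ (-(n : ℝ) / 2) := by
    rw [← mul_rpow (by positivity) (by positivity)]; congr 1; ring
  have h2 : exp (-‖z‖ ^ 2 / (4 * s)) = exp (-(‖z‖ ^ 2 / s) / 8) * exp (-‖z‖ ^ 2 / (4 * (2 * s))) := by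
    rw [← exp_add]; congr 1; field_simp; ring
  have h3 : (2 : ℝ) ^ ((n : ℝ) / 2) * 2 ^ (-(n : ℝ) / 2) = 1 := by
    rw [← rpow_add (by norm_num)]; simp [neg_div]
  rw [h1, h2]
  linear_combination (-(exp (-(‖z‖ ^ 2 / s) / 8) * exp (-‖z‖ ^ 2 / (4 * (2 * s))) *
    (4 * π * s) ^ (-(n : ℝ) / 2))) * h3

/-- The constant in the weighted estimates for the heat kernel. -/
def gaussC (n : ℕ) : ℝ := 24 * 8 ^ 4 * exp (1 / 8) * 2 ^ ((n : ℝ) / 2)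

lemma gaussC_pos (n : ℕ) : 0 < gaussC n := by unfold gaussC; positivity

lemma gauss_weight (hs : 0 < s) (z : E) :
    (1 + ‖z‖ ^ 2 / s) ^ 4 * gauss s z ≤ gaussC n * gauss (2 * s) z := by
  set t := ‖z‖ ^ 2 / s with ht
  have ht0 : 0 ≤ t := by positivity
  rw [gauss_eq_double hs z, ← ht]
  have h := Real.pow_div_factorial_le_exp ((1 + t) / 8) (by positivity) 4
  have h4 : ((Nat.factorial 4 : ℕ) : ℝ) = 24 := by norm_num [Nat.factorial]
  rw [h4] at h
  have h2 : (1 + t) ^ 4 * exp (-t / 8) ≤ 24 * 8 ^ 4 * exp (1 / 8) := by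
    have e : exp ((1 + t) / 8) * exp (-t / 8) = exp (1 / 8) := by rw [← exp_add]; congr 1; ring
    have h' : (1 + t) ^ 4 ≤ 24 * 8 ^ 4 * exp ((1 + t) / 8) := by
      have : (1 + t) ^ 4 = 24 * 8 ^ 4 * (((1 + t) / 8) ^ 4 / 24) := by ring
      rw [this]; gcongr
    calc _ ≤ 24 * 8 ^ 4 * exp ((1 + t) / 8) * exp (-t / 8) := by gcongr
      _ = _ := by rw [mul_assoc, e]
  unfold gaussC
  have h3 := (gauss_pos (n := n) (by positivity : 0 < 2 * s) z).le
  calc _ = (1 + t) ^ 4 * exp (-t / 8) * (2 ^ ((n : ℝ) / 2) * gauss (2 * s) z) := by ring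
    _ ≤ 24 * 8 ^ 4 * exp (1 / 8) * (2 ^ ((n : ℝ) / 2) * gauss (2 * s) z) := by gcongr
    _ = _ := by ring

lemma gauss_shift (hs : 0 < s) {x' : E} (h : ‖x' - x‖ ≤ √s) (y : E) :
    gauss (2 * s) (x' - y) ≤ 2 ^ ((n : ℝ) / 2) * exp (1 / 8) * gauss (4 * s) (x - y) := by
  unfold gauss
  have h1 : (4 * π * (4 * s)) ^ (-(n : ℝ) / 2) =
      2 ^ (-(n : ℝ) / 2) * (4 * π * (2 * s)) ^ (-(n : ℝ) / 2) := by
    rw [← mul_rpow (by positivity) (by positivity)]; congr 1; ring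
  have h3 : (2 : ℝ) ^ ((n : ℝ) / 2) * 2 ^ (-(n : ℝ) / 2) = 1 := by
    rw [← rpow_add (by norm_num)]; simp [neg_div]
  have h4 : exp (-‖x' - y‖ ^ 2 / (4 * (2 * s))) ≤
      exp (1 / 8) * exp (-‖x - y‖ ^ 2 / (4 * (4 * s))) := by
    rw [← exp_add, exp_le_exp]
    have h5 : ‖x' - x‖ ^ 2 ≤ s := by
      have := pow_le_pow_left₀ (norm_nonneg _) h 2
      rwa [sq_sqrt hs.le] at this
    have h6 : ‖x - y‖ ^ 2 ≤ 2 * ‖x' - y‖ ^ 2 + 2 * ‖x' - x‖ ^ 2 := by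
      have : ‖x - y‖ ≤ ‖x' - y‖ + ‖x' - x‖ := by
        have := norm_sub_le (x' - y) (x' - x)
        rwa [show x' - y - (x' - x) = x - y by abel] at this
      nlinarith [norm_nonneg (x - y), sq_nonneg (‖x' - y‖ - ‖x' - x‖)]
    rw [div_add_div _ _ (by norm_num) (by positivity), div_le_div_iff₀ (by positivity) (by positivity)]
    nlinarith
  rw [h1]
  calc _ ≤ (4 * π * (2 * s)) ^ (-(n : ℝ) / 2) *
        (exp (1 / 8) * exp (-‖x - y‖ ^ 2 / (4 * (4 * s)))) := by gcongr
    _ = _ := by linear_combination (-((4 * π * (2 * s)) ^ (-(n : ℝ) / 2) *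
        (exp (1 / 8) * exp (-‖x - y‖ ^ 2 / (4 * (4 * s)))))) * h3

lemma integrable_conv_bdd (hF : Continuous F) (hM : ∀ y, |F y| ≤ M) {k : E → H}
    (hk : Continuous k) (hs : 0 < s) (hkC : ∀ z, ‖k z‖ ≤ C * gauss s z) (x : E) :
    Integrable (fun y => F y • k (x - y)) := by
  have h1 : Integrable (fun y => M * (C * gauss s (x - y))) :=
    (((integrable_gauss hs).comp_sub_left x).const_mul C).const_mul M
  refine h1.mono' (by fun_prop : Continuous fun y => F y • k (x - y)).aestronglyMeasurable
    (of_forall fun y => ?_)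
  rw [norm_smul]
  exact mul_le_mul (hM y) (hkC _) (norm_nonneg _) ((abs_nonneg _).trans (hM y))

/-- Differentiation of the convolution of a bounded function with a Gaussian-type kernel. -/
lemma hasFDerivAt_conv_bdd (hF : Continuous F) (hM : ∀ y, |F y| ≤ M) {k : E → H}
    {k' : E → E →L[ℝ] H} (hk : ∀ z, HasFDerivAt k (k' z) z) (hk' : Continuous k')
    {C' : ℝ} (hs : 0 < s) (hkC : ∀ z, ‖k z‖ ≤ C * gauss (2 * s) z)
    (hkC' : ∀ z, ‖k' z‖ ≤ C' * gauss (2 * s) z) (x : E) :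
    HasFDerivAt (fun x => ∫ y, F y • k (x - y)) (∫ y, F y • k' (x - y)) x := by
  have hkc : Continuous k := continuous_iff_continuousAt.2 fun z => (hk z).continuousAt
  have hC'0 : 0 ≤ C' := by
    have := (norm_nonneg _).trans (hkC' 0)
    exact nonneg_of_mul_nonneg_left this (gauss_pos (by positivity) _)
  have hM0 : 0 ≤ M := (abs_nonneg _).trans (hM 0)
  set D := 2 ^ ((n : ℝ) / 2) * exp (1 / 8) with hD
  have hs2 : 0 < 2 * s := by positivity
  refine hasFDerivAt_integral_of_dominated_of_fderiv_le (𝕜 := ℝ) (F := fun x y => F y • k (x - y))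
    (F' := fun x y => F y • k' (x - y)) (bound := fun y => M * (C' * (D * gauss (4 * s) (x - y))))
    (ball_mem_nhds x (sqrt_pos.2 hs)) ?_ ?_ ?_ ?_ ?_ ?_
  · exact of_forall fun x' => (integrable_conv_bdd hF hM hkc hs2 hkC x').1
  · exact integrable_conv_bdd hF hM hkc hs2 hkC x
  · exact (integrable_conv_bdd hF hM hk' hs2 hkC' x).1
  · refine of_forall fun y x' hx' => ?_
    rw [norm_smul]
    have hd : ‖x' - x‖ ≤ √s := by rw [mem_ball, dist_eq_norm] at hx'; exact hx'.le
    exact mul_le_mul (hM y) ((hkC' _).trans (mul_le_mul_of_nonneg_left (gauss_shift hs hd y) hC'0))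
      (norm_nonneg _) hM0
  · exact ((((integrable_gauss (by positivity)).comp_sub_left x).const_mul D).const_mul C').const_mul M
  · refine of_forall fun y x' _ => ?_
    have h1 : HasFDerivAt (fun x' => k (x' - y)) (k' (x' - y)) x' := by
      have := (hk (x' - y)).comp x' ((hasFDerivAt_id x').sub_const y)
      exact this.congr_fderiv (ContinuousLinearMap.comp_id _)
    exact h1.const_smul (F y)

/-- The first derivative of the heat kernel. -/
def gaussD (s : ℝ) (z : E) : E →L[ℝ] ℝ := (-(gauss s z) / (2 * s)) • innerSL ℝ z

/-- The second derivative of the heat kernel. -/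
def gaussDD (s : ℝ) (z : E) : E →L[ℝ] E →L[ℝ] ℝ :=
  (-(gauss s z) / (2 * s)) • innerB n +
        ((gauss s z / (4 * s ^ 2)) • innerSL ℝ z).smulRight (innerSL ℝ z)

lemma continuous_gaussD (s : ℝ) : Continuous (fun z : E => gaussD s z) :=
  continuous_iff_continuousAt.2 fun z => (hasFDerivAt_fderiv_gauss s z).continuousAt

lemma gaussDD_eq (s : ℝ) (z : E) :
    gaussDD s z = fderiv ℝ (fderiv ℝ (fun y : E => gauss s y)) z := by
  have h1 : fderiv ℝ (fun y : E => gauss s y) = fun y => gaussD s y :=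
    funext fun y => (hasFDerivAt_gauss s y).fderiv
  rw [h1]
  exact (hasFDerivAt_fderiv_gauss s z).fderiv.symm

lemma continuous_gaussDD (s : ℝ) : Continuous (fun z : E => gaussDD s z) := by
  have h : ContDiff ℝ 1 (fderiv ℝ (fun y : E => gauss s y)) :=
    (contDiff_gauss s (m := 2)).fderiv_right (by norm_num)
  simp only [gaussDD_eq]
  exact h.continuous_fderiv (by simp)

lemma norm_gaussD_le (hs : 0 < s) (z : E) :
    ‖gaussD s z‖ ≤ (√s)⁻¹ * ((1 + ‖z‖ ^ 2 / s) * gauss s z) := by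
  unfold gaussD
  rw [norm_smul, innerSL_apply_norm, norm_div, norm_neg, Real.norm_of_nonneg (gauss_pos hs z).le,
    Real.norm_of_nonneg (by positivity)]
  have h := gauss_pos hs z
  have h1 : ‖z‖ / (2 * s) ≤ (√s)⁻¹ * (1 + ‖z‖ ^ 2 / s) := by
    set a := √s with ha
    have ha0 : 0 < a := sqrt_pos.2 hs
    have hsa : s = a ^ 2 := (sq_sqrt hs.le).symm
    rw [hsa]
    have : a⁻¹ * (1 + ‖z‖ ^ 2 / a ^ 2) - ‖z‖ / (2 * a ^ 2) =
      a⁻¹ * ((‖z‖ / a - 1 / 4) ^ 2 + 15 / 16) := by field_simp; ring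
    have : 0 ≤ a⁻¹ * ((‖z‖ / a - 1 / 4) ^ 2 + 15 / 16) := by positivity
    linarith
  calc gauss s z / (2 * s) * ‖z‖ = gauss s z * (‖z‖ / (2 * s)) := by ring
    _ ≤ gauss s z * ((√s)⁻¹ * (1 + ‖z‖ ^ 2 / s)) := by gcongr
    _ = _ := by ring

lemma norm_gaussDD_le (hs : 0 < s) (z : E) :
    ‖gaussDD s z‖ ≤ s⁻¹ * ((1 + ‖z‖ ^ 2 / s) * gauss s z) := by
  have h := gauss_pos hs z
  refine ContinuousLinearMap.opNorm_le_bound _ (by positivity) fun v => ?_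
  have e : gaussDD s z v = (-(gauss s z) / (2 * s)) • innerSL ℝ v +
      (gauss s z / (4 * s ^ 2) * inner ℝ z v) • innerSL ℝ z := rfl
  rw [e]
  refine (norm_add_le _ _).trans ?_
  rw [norm_smul, norm_smul, innerSL_apply_norm, innerSL_apply_norm, norm_mul, norm_div,
    norm_neg, norm_div, Real.norm_of_nonneg h.le, Real.norm_of_nonneg (by positivity),
    Real.norm_of_nonneg (by positivity)]
  have h1 : ‖inner ℝ z v‖ ≤ ‖z‖ * ‖v‖ := norm_inner_le_norm z v
  calc _ ≤ gauss s z / (2 * s) * ‖v‖ + gauss s z / (4 * s ^ 2) * (‖z‖ * ‖v‖) * ‖z‖ := by gcongr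
    _ = s⁻¹ * ((1 / 2 + ‖z‖ ^ 2 / s / 4) * gauss s z) * ‖v‖ := by field_simp
    _ ≤ _ := by
      have : 0 ≤ ‖z‖ ^ 2 / s := by positivity
      have : 1 / 2 + ‖z‖ ^ 2 / s / 4 ≤ 1 + ‖z‖ ^ 2 / s := by linarith
      gcongr

lemma gauss_weight_le (hs : 0 < s) (z : E) {j : ℕ} (hj : j ≤ 4) :
    (1 + ‖z‖ ^ 2 / s) ^ j * gauss s z ≤ gaussC n * gauss (2 * s) z := by
  refine le_trans ?_ (gauss_weight hs z)
  have := gauss_pos hs z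
  have : 0 ≤ ‖z‖ ^ 2 / s := by positivity
  gcongr
  linarith

lemma norm_gauss_le' (hs : 0 < s) (z : E) : ‖gauss s z‖ ≤ gaussC n * gauss (2 * s) z := by
  rw [Real.norm_of_nonneg (gauss_pos hs z).le]
  simpa using gauss_weight_le hs z (j := 0) (by norm_num)

lemma norm_gaussD_le' (hs : 0 < s) (z : E) :
    ‖gaussD s z‖ ≤ (√s)⁻¹ * gaussC n * gauss (2 * s) z := by
  refine (norm_gaussD_le hs z).trans ?_
  rw [mul_assoc]
  have := gauss_weight_le hs z (j := 1) (by norm_num)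
  rw [pow_one] at this
  gcongr

lemma norm_gaussDD_le' (hs : 0 < s) (z : E) : ‖gaussDD s z‖ ≤ s⁻¹ * gaussC n * gauss (2 * s) z := by
  refine (norm_gaussDD_le hs z).trans ?_
  rw [mul_assoc]
  have := gauss_weight_le hs z (j := 1) (by norm_num)
  rw [pow_one] at this
  gcongr

/-- The space derivative of the heat flow. -/
def heatD (F : E → ℝ) (s : ℝ) (x : E) : E →L[ℝ] ℝ := ∫ y, F y • gaussD s (x - y)

/-- The second space derivative of the heat flow. -/
def heatDD (F : E → ℝ) (s : ℝ) (x : E) : E →L[ℝ] E →L[ℝ] ℝ := ∫ y, F y • gaussDD s (x - y)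

lemma hasFDerivAt_heat (hF : Continuous F) (hM : ∀ y, |F y| ≤ M)
    (hs : 0 < s) (x : E) : HasFDerivAt (fun x => heat F s x) (heatD F s x) x := by
  have := hasFDerivAt_conv_bdd hF hM (k := fun z => gauss s z) (fun z => hasFDerivAt_gauss s z)
    (continuous_gaussD s) hs (norm_gauss_le' hs) (norm_gaussD_le' hs) x
  simp only [heat_eq_conv F hs]
  exact this

lemma hasFDerivAt_heatD (hF : Continuous F) (hM : ∀ y, |F y| ≤ M)
    (hs : 0 < s) (x : E) : HasFDerivAt (fun x => heatD F s x) (heatDD F s x) x :=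
  hasFDerivAt_conv_bdd (H := E →L[ℝ] ℝ) hF hM (k := fun z => gaussD s z)
    (k' := fun z => gaussDD s z)
    (fun z => hasFDerivAt_fderiv_gauss s z)
    (continuous_gaussDD s) hs (norm_gaussD_le' hs) (norm_gaussDD_le' hs) x

lemma heat_const (c s : ℝ) (x : E) : heat (fun _ => c) s x = c := by
  unfold heat
  rw [integral_mul_const, integral_gauss one_pos, one_mul]

lemma heatD_const (c : ℝ) (hs : 0 < s) (x : E) : heatD (fun _ : E => c) s x = 0 := by
  have h := hasFDerivAt_heat (F := fun _ : E => c) continuous_const (fun _ => le_rfl) hs x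
  simp only [heat_const] at h
  exact h.unique (hasFDerivAt_const c x)

lemma heatDD_const (c : ℝ) (hs : 0 < s) (x : E) : heatDD (fun _ : E => c) s x = 0 := by
  have h := hasFDerivAt_heatD (F := fun _ : E => c) continuous_const (fun _ => le_rfl) hs x
  simp only [heatD_const c hs] at h
  exact h.unique (hasFDerivAt_const _ x)

lemma norm_conv_le (hF : Continuous F) (hM : ∀ y, |F y| ≤ M) {k : E → H}
    (hkc : Continuous k) (hs : 0 < s) (hC : 0 ≤ C)
    (hk : ∀ z, ‖k z‖ ≤ C * ((1 + ‖z‖ ^ 2 / s) * gauss s z))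
    (x : E) (c : ℝ) (h0 : ∫ y, c • k (x - y) = 0) (hδ : ∀ y, |F y - c| ≤ δ * (1 + ‖x - y‖ ^ 2 / s) ^ 2) :
    ‖∫ y, F y • k (x - y)‖ ≤ C * gaussC n * δ := by
  have hk2 : ∀ z, ‖k z‖ ≤ C * gaussC n * gauss (2 * s) z := fun z => (hk z).trans (by
    rw [mul_assoc]
    have := gauss_weight_le hs z (j := 1) (by norm_num)
    rw [pow_one] at this
    gcongr)
  have hs2 : 0 < 2 * s := by positivity
  have hδ0 : 0 ≤ δ := by
    have := (abs_nonneg _).trans (hδ x)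
    exact nonneg_of_mul_nonneg_left this (by positivity)
  have i1 := integrable_conv_bdd hF hM hkc hs2 hk2 x
  have i2 := integrable_conv_bdd (F := fun _ => c) continuous_const (fun _ => le_rfl) hkc hs2 hk2 x
  have e : ∫ y, F y • k (x - y) = ∫ y, (F y - c) • k (x - y) := by
    have := integral_sub i1 i2
    rw [h0, sub_zero] at this
    rw [← this]
    refine integral_congr_ae (of_forall fun y => ?_)
    dsimp only; rw [sub_smul]
  rw [e]
  have hb : ∀ y, ‖(F y - c) • k (x - y)‖ ≤ C * gaussC n * δ * gauss (2 * s) (x - y) := by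
    intro y
    rw [norm_smul]
    have hw := gauss_weight_le hs (x - y) (j := 3) (by norm_num)
    have hg := gauss_pos hs (x - y)
    calc _ ≤ (δ * (1 + ‖x - y‖ ^ 2 / s) ^ 2) * (C * ((1 + ‖x - y‖ ^ 2 / s) * gauss s (x - y))) :=
          mul_le_mul (hδ y) (hk _) (norm_nonneg _) (by positivity)
      _ = C * δ * ((1 + ‖x - y‖ ^ 2 / s) ^ 3 * gauss s (x - y)) := by ring
      _ ≤ C * δ * (gaussC n * gauss (2 * s) (x - y)) := by gcongr
      _ = _ := by ring
  refine (norm_integral_le_of_norm_le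
    (((integrable_gauss hs2).comp_sub_left x).const_mul _) (of_forall hb)).trans ?_
  rw [integral_const_mul, integral_sub_left_eq_self (fun z : E => gauss (2 * s) z) volume x,
    integral_gauss hs2, mul_one]

lemma norm_heatD_le (hF : Continuous F) (hM : ∀ y, |F y| ≤ M)
    (hs : 0 < s) (x : E) (c : ℝ) (hδ : ∀ y, |F y - c| ≤ δ * (1 + ‖x - y‖ ^ 2 / s) ^ 2) :
    ‖heatD F s x‖ ≤ (√s)⁻¹ * gaussC n * δ :=
  norm_conv_le hF hM (continuous_gaussD s) hs (by positivity) (norm_gaussD_le hs) x c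
    (heatD_const c hs x) hδ

lemma norm_heatDD_le (hF : Continuous F) (hM : ∀ y, |F y| ≤ M)
    (hs : 0 < s) (x : E) (c : ℝ) (hδ : ∀ y, |F y - c| ≤ δ * (1 + ‖x - y‖ ^ 2 / s) ^ 2) :
    ‖heatDD F s x‖ ≤ s⁻¹ * gaussC n * δ :=
  norm_conv_le (H := E →L[ℝ] E →L[ℝ] ℝ) hF hM (continuous_gaussDD s) hs (by positivity)
    (norm_gaussDD_le hs) x c
    (heatDD_const c hs x) hδ

lemma abs_heat_sub_le (hF : Continuous F) (hM : ∀ y, |F y| ≤ M)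
    (hs : 0 < s) (x : E) (c : ℝ) (hδ : ∀ y, |F y - c| ≤ δ * (1 + ‖x - y‖ ^ 2 / s) ^ 2) :
    |heat F s x - c| ≤ gaussC n * δ := by
  have hF' : Continuous (fun y => F y - c) := hF.sub continuous_const
  have hM' : ∀ y, |F y - c| ≤ M + |c| := fun y => (abs_sub _ _).trans (by gcongr; exact hM y)
  have e : heat F s x - c = heat (fun y => F y - c) s x := by
    have := heat_add hF (continuous_const (y := -c)) hM (fun _ => le_rfl) s x
    rw [heat_const] at this
    simp only [sub_eq_add_neg]; exact this.symm
  rw [e, heat_eq_conv _ hs]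
  have := norm_conv_le hF' hM' (k := fun z : E => gauss s z) (continuous_gauss s) hs zero_le_one
    (fun z => by
      rw [Real.norm_of_nonneg (gauss_pos hs z).le, one_mul]
      refine le_mul_of_one_le_left (gauss_pos hs z).le ?_
      have : 0 ≤ ‖z‖ ^ 2 / s := by positivity
      linarith) x 0 (by simp) (δ := δ) (by simpa using hδ)
  simpa using this

lemma heat_lipschitz (hF : Continuous F) (hM : ∀ y, |F y| ≤ M) (hs : 0 < s) (x y : E) :
    |heat F s x - heat F s y| ≤ (√s)⁻¹ * gaussC n * M * ‖x - y‖ := by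
  refine Convex.norm_image_sub_le_of_norm_hasFDerivWithin_le (𝕜 := ℝ) (f := fun x => heat F s x)
    (f' := fun x => heatD F s x) (s := univ)
    (fun z _ => (hasFDerivAt_heat hF hM hs z).hasFDerivWithinAt) (fun z _ => ?_) convex_univ
    (mem_univ y) (mem_univ x)
  refine norm_heatD_le hF hM hs z 0 fun w => ?_
  rw [sub_zero]
  have hM0 : 0 ≤ M := (abs_nonneg _).trans (hM 0)
  refine (hM w).trans (le_mul_of_one_le_right hM0 (one_le_pow₀ ?_))
  have : 0 ≤ ‖z - w‖ ^ 2 / s := by positivity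
  linarith

lemma gauss_mul_gauss (hs : 0 < s) (ht : 0 < t) (y v : E) : gauss t v * gauss s (y - v) =
    gauss (s + t) y * gauss (s * t / (s + t)) (v - (t / (s + t)) • y) := by
  unfold gauss
  have h1 : (4 * π * t) ^ (-(n : ℝ) / 2) * (4 * π * s) ^ (-(n : ℝ) / 2) =
      (4 * π * (s + t)) ^ (-(n : ℝ) / 2) * (4 * π * (s * t / (s + t))) ^ (-(n : ℝ) / 2) := by
    rw [← mul_rpow (by positivity) (by positivity), ← mul_rpow (by positivity) (by positivity)]
    congr 1; field_simp
  have h2 : exp (-‖v‖ ^ 2 / (4 * t)) * exp (-‖y - v‖ ^ 2 / (4 * s)) = exp (-‖y‖ ^ 2 / (4 * (s + t)))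
      * exp (-‖v - (t / (s + t)) • y‖ ^ 2 / (4 * (s * t / (s + t)))) := by
    rw [← exp_add, ← exp_add]
    congr 1
    rw [norm_sub_sq_real, norm_sub_sq_real, norm_smul, inner_smul_right, mul_pow, Real.norm_eq_abs,
      sq_abs, real_inner_comm]
    field_simp
    ring
  calc _ = ((4 * π * t) ^ (-(n : ℝ) / 2) * (4 * π * s) ^ (-(n : ℝ) / 2)) *
        (exp (-‖v‖ ^ 2 / (4 * t)) * exp (-‖y - v‖ ^ 2 / (4 * s))) := by ring
    _ = _ := by rw [h1, h2]; ring

lemma gauss_conv_gauss (hs : 0 < s) (ht : 0 < t) (y : E) :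
    ∫ v, gauss t v * gauss s (y - v) = gauss (s + t) y := by
  simp only [gauss_mul_gauss hs ht]
  rw [integral_const_mul,
    integral_sub_right_eq_self (fun v : E => gauss (s * t / (s + t)) v), integral_gauss
      (by positivity), mul_one]

lemma heat_heat (hF : Continuous F) (hM : ∀ y, |F y| ≤ M) (hs : 0 < s) (ht : 0 < t) (x : E) :
    heat (fun y => heat F s y) t x = heat F (s + t) x := by
  rw [heat_eq_conv' _ ht, heat_eq_conv' _ (by positivity)]
  have e1 : ∀ v : E, gauss t v * heat F s (x - v) =
      ∫ y, gauss t v * gauss s (y - v) * F (x - y) := by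
    intro v
    rw [heat_eq_conv' _ hs, ← integral_const_mul, ← integral_sub_right_eq_self _ v]
    refine integral_congr_ae (of_forall fun y => ?_)
    dsimp only
    rw [show x - v - (y - v) = x - y by abel]; ring
  simp only [e1]
  rw [integral_integral_swap]
  · refine integral_congr_ae (of_forall fun y => ?_)
    dsimp only
    rw [integral_mul_const, gauss_conv_gauss hs ht]
  · have h := Integrable.convolution_integrand (ContinuousLinearMap.mul ℝ ℝ)
      (integrable_gauss (n := n) ht) (integrable_gauss (n := n) hs)
    have h2 := h.swap
    refine (h2.mul_bdd (c := M) (g := fun p : E × E => F (x - p.2)) ?_ ?_)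
    · exact (by fun_prop : Continuous fun p : E × E => F (x - p.2)).aestronglyMeasurable
    · exact of_forall fun p => hM _

lemma exists_cutoff (x₀ : E) {R R' : ℝ} (hR : 0 < R) (hRR : R < R') :
    ∃ χ : E → ℝ, ContDiff ℝ 2 χ ∧ HasCompactSupport χ ∧
    tsupport χ ⊆ closedBall x₀ R' ∧ (∀ y, 0 ≤ χ y) ∧ (∀ y, χ y ≤ 1) ∧
    ∀ y ∈ closedBall x₀ R, χ y = 1 := by
  let f : ContDiffBump x₀ := ⟨R, R', hR, hRR⟩
  exact ⟨f, f.contDiff, f.hasCompactSupport, f.tsupport_eq.subset, fun y => f.nonneg,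
    fun y => f.le_one, fun y hy => f.one_of_mem_closedBall hy⟩

/-- Multiplication by a cutoff function extends a continuous function by zero. -/
lemma continuousOn_cutoff_mul (hU : IsOpen U) {I : Set ℝ}
    (hw : ContinuousOn ♯w (U ×ˢ I))
    (hχ : Continuous χ) (hs : tsupport χ ⊆ U) :
    ContinuousOn (fun p : Q => χ p.1 * w p.1 p.2) (univ ×ˢ I) := by
  rintro ⟨y, s⟩ ⟨-, hsI⟩
  by_cases hy : y ∈ U
  · have h1 : ContinuousWithinAt ♯w (univ ×ˢ I) (y, s) := by
      refine (hw (y, s) ⟨hy, hsI⟩).mono_of_mem_nhdsWithin ?_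
      have : (fun p : Q => p.1) ⁻¹' U ∈ 𝓝 (y, s) := (hU.preimage continuous_fst).mem_nhds hy
      filter_upwards [self_mem_nhdsWithin, mem_nhdsWithin_of_mem_nhds this] with p hp hp'
      exact ⟨hp', hp.2⟩
    exact (hχ.comp continuous_fst).continuousWithinAt.mul h1
  · have hy' : y ∈ (tsupport χ)ᶜ := fun h => hy (hs h)
    have : (fun p : Q => p.1) ⁻¹' (tsupport χ)ᶜ ∈ 𝓝 (y, s) :=
      ((isClosed_tsupport χ).isOpen_compl.preimage continuous_fst).mem_nhds hy'
    have h0 : (fun p : Q => χ p.1 * w p.1 p.2) =ᶠ[𝓝[univ ×ˢ I] (y, s)] fun _ => 0 := by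
      filter_upwards [mem_nhdsWithin_of_mem_nhds this] with p hp
      rw [image_eq_zero_of_notMem_tsupport hp, zero_mul]
    refine ContinuousWithinAt.congr_of_eventuallyEq continuousWithinAt_const h0 ?_
    dsimp only
    rw [image_eq_zero_of_notMem_tsupport hy', zero_mul]

/-- Solutions of `z_t = Δz + f`, expressed by comparison with the heat flow on balls. -/
def HeatSol (U : Set E) (α β : ℝ) (z f : E → ℝ → ℝ) : Prop :=
  HeatSuper U α β z f ∧ HeatSuper U α β (fun x t => - z x t) (fun x t => - f x t)

lemma HeatSuper.mono {α' β' : ℝ} {z f : E → ℝ → ℝ}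
    (h : HeatSuper U α β z f) (hV : V ⊆ U) (hα : α ≤ α') (hβ : β' ≤ β) : HeatSuper V α' β' z f :=
  fun x d s h' A₀ M A F hd hb hs h0 h1 => h x d s h' A₀ M A F hd (hb.trans hV) (hα.trans_lt hs) h0
    (h1.trans_le hβ)

lemma HeatSol.mono {α' β' : ℝ} {z f : E → ℝ → ℝ}
    (h : HeatSol U α β z f) (hV : V ⊆ U) (hα : α ≤ α') (hβ : β' ≤ β) : HeatSol V α' β' z f :=
  ⟨h.1.mono hV hα hβ, h.2.mono hV hα hβ⟩

lemma HeatSol.step {f : E → ℝ → ℝ}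
    (hw : HeatSol U α β w f) {d ω : ℝ} {A : ℝ → ℝ} (hd : 0 < d) (hU : closedBall x d ⊆ U) (hs : α < s) (hh : 0 ≤ h) (hβ : s + h < β)
    (hAc : Continuous A) (hA₀ : ∀ t, |A t| ≤ A₀) (hω : 0 ≤ ω)
    (hA : ∀ y ∈ closedBall x d, ∀ t ∈ Icc s (s + h), |f y t - A t| ≤ ω)
    (hM : ∀ y ∈ closedBall x d, ∀ t ∈ Icc s (s + h), |w y t| ≤ M)
    (hF : Continuous F) (hFc : HasCompactSupport F) (hFM : ∀ y, |F y| ≤ M)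
    (hFw : ∀ y ∈ closedBall x d, F y = w y s) :
    |w x (s + h) - heat F h x - ∫ τ in s..(s + h), A τ| ≤
    ω * h + (2 * M + (A₀ + ω) * h) * (2 * n + 4) ^ 2 * h ^ 2 / d ^ 4 := by
  have i1 : (∫ τ in s..(s + h), (A τ - ω)) = (∫ τ in s..(s + h), A τ) - ω * h := by
    rw [intervalIntegral.integral_sub (hAc.intervalIntegrable _ _) (by simp)]
    simp [mul_comm]
  have i2 : (∫ τ in s..(s + h), (-A τ - ω)) = -(∫ τ in s..(s + h), A τ) - ω * h := by
    rw [intervalIntegral.integral_sub ((by fun_prop : Continuous fun τ => -A τ).intervalIntegrable _ _) (by simp),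
      intervalIntegral.integral_neg]
    simp [mul_comm]
  have h1 := hw.1 x d s h (A₀ + ω) M (fun τ => A τ - ω) F hd hU hs hh hβ (by fun_prop)
    (fun t => (abs_sub _ _).trans (add_le_add (hA₀ t) (abs_of_nonneg hω).le))
    (fun y hy t ht => by have := (abs_le.1 (hA y hy t ht)).1; linarith) hM hF hFc hFM
    (fun y hy => (hFw y hy).le)
  have h2 := hw.2 x d s h (A₀ + ω) M (fun τ => -A τ - ω) (fun y => - F y) hd hU hs hh hβ
    (by fun_prop)
    (fun t => (abs_sub _ _).trans (add_le_add (by rw [abs_neg]; exact hA₀ t) (abs_of_nonneg hω).le))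
    (fun y hy t ht => by have := (abs_le.1 (hA y hy t ht)).2; linarith)
    (fun y hy t ht => by rw [abs_neg]; exact hM y hy t ht) hF.neg hFc.neg
    (fun y => by rw [abs_neg]; exact hFM y)
    (fun y hy => by rw [hFw y hy])
  rw [i1] at h1
  rw [i2, heat_neg] at h2
  rw [abs_le]
  constructor <;> linarith

/-- The constant in the interior modulus of continuity. -/
def modC (n : ℕ) (ρ M A₀ : ℝ) : ℝ := A₀ + (2 * M + A₀) * (2 * n + 4) ^ 2 / ρ ^ 4

lemma HeatSol.sub_heat_le {f : E → ℝ → ℝ}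
    (hw : HeatSol U α β w f) (hρ : 0 < ρ) (hU : closedBall x ρ ⊆ U) (hs : α < s) (hh : 0 ≤ h) (hh1 : h ≤ 1)
    (hβ : s + h < β) (hA : ∀ y ∈ closedBall x ρ, ∀ t ∈ Ioo α β, |f y t| ≤ A₀)
    (hM : ∀ y ∈ closedBall x ρ, ∀ t ∈ Ioo α β, |w y t| ≤ M)
    (hF : Continuous F) (hFc : HasCompactSupport F) (hFM : ∀ y, |F y| ≤ M)
    (hFw : ∀ y ∈ closedBall x ρ, F y = w y s) : |w x (s + h) - heat F h x| ≤ modC n ρ M A₀ * h := by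
  have hI : Icc s (s + h) ⊆ Ioo α β := fun t ht => ⟨hs.trans_le ht.1, ht.2.trans_lt hβ⟩
  have hx : x ∈ closedBall x ρ := mem_closedBall_self hρ.le
  have hA0 : 0 ≤ A₀ := (abs_nonneg _).trans (hA x hx s (hI ⟨le_rfl, by linarith⟩))
  have hM0 : 0 ≤ M := (abs_nonneg _).trans (hFM x)
  have := hw.step hρ hU hs hh hβ (A := fun _ => 0) (A₀ := 0) (ω := A₀) continuous_const (by simp) hA0
    (fun y hy t ht => by simpa using hA y hy t (hI ht)) (fun y hy t ht => hM y hy t (hI ht))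
    hF hFc hFM hFw
  rw [intervalIntegral.integral_zero, sub_zero] at this
  refine this.trans ?_
  unfold modC
  have e : (2 * M + (0 + A₀) * h) * (2 * n + 4) ^ 2 * h ^ 2 / ρ ^ 4 ≤
      (2 * M + A₀) * (2 * n + 4) ^ 2 / ρ ^ 4 * h := by
    rw [zero_add]
    calc _ = ((2 * M + A₀ * h) * h) * ((2 * n + 4) ^ 2 / ρ ^ 4) * h := by ring
      _ ≤ ((2 * M + A₀ * 1) * 1) * ((2 * n + 4) ^ 2 / ρ ^ 4) * h := by gcongr
      _ = _ := by ring
  linarith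

section interior

variable {f : EuclideanSpace ℝ (Fin n) → ℝ → ℝ}

/-- Interior modulus of continuity in space. -/
lemma HeatSol.space_modulus (hUo : IsOpen U)
    (hc : ContinuousOn ♯w (U ×ˢ Ioo α β))
    (hw : HeatSol U α β w f) (hρ : 0 < ρ) (hU : closedBall x₀ (4 * ρ) ⊆ U)
    (hA : ∀ y ∈ closedBall x₀ (4 * ρ), ∀ t ∈ Ioo α β, |f y t| ≤ A₀)
    (hM : ∀ y ∈ closedBall x₀ (4 * ρ), ∀ t ∈ Ioo α β, |w y t| ≤ M)
    (hx : x ∈ closedBall x₀ (2 * ρ)) (hy : y ∈ closedBall x₀ (2 * ρ))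
    (hh : 0 < h) (hh1 : h ≤ 1) (ht : α < t - h) (htβ : t < β) :
    |w x t - w y t| ≤ (2 * modC n ρ M A₀ + gaussC n * M) * (h + (√h)⁻¹ * ‖x - y‖) := by
  obtain ⟨χ, hχ2, hχc, hχs, hχ0, hχ1, hχe⟩ := exists_cutoff x₀ (R := 3 * ρ) (R' := 4 * ρ)
    (by positivity) (by linarith)
  have hs : t - h ∈ Ioo α β := ⟨ht, by linarith⟩
  have hFc := continuousOn_cutoff_mul hUo hc hχ2.continuous (hχs.trans hU)
  have hF : Continuous (fun y => χ y * w y (t - h)) := by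
    rw [← continuousOn_univ]
    exact hFc.comp (f := fun y : E => (y, t - h)) (by fun_prop) (fun y _ => ⟨mem_univ _, hs⟩)
  have hMx : x₀ ∈ closedBall x₀ (4 * ρ) := mem_closedBall_self (by positivity)
  have hM0 : 0 ≤ M := (abs_nonneg _).trans (hM x₀ hMx _ hs)
  have hA0 : 0 ≤ A₀ := (abs_nonneg _).trans (hA x₀ hMx _ hs)
  have hFM : ∀ y, |χ y * w y (t - h)| ≤ M := by
    intro y
    rw [abs_mul, abs_of_nonneg (hχ0 y)]
    by_cases hy : y ∈ tsupport χ
    · calc _ ≤ 1 * M := mul_le_mul (hχ1 y) (hM y (hχs hy) _ hs) (abs_nonneg _) zero_le_one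
        _ = M := one_mul _
    · rw [image_eq_zero_of_notMem_tsupport hy, zero_mul]; exact hM0
  have hsub : ∀ {x : E}, x ∈ closedBall x₀ (2 * ρ) →
      closedBall x ρ ⊆ closedBall x₀ (3 * ρ) := fun hx =>
    closedBall_subset_closedBall' (by have := mem_closedBall.1 hx; linarith)
  have h34 : closedBall x₀ (3 * ρ) ⊆ closedBall x₀ (4 * ρ) :=
    closedBall_subset_closedBall (by linarith)
  have key : ∀ x ∈ closedBall x₀ (2 * ρ),
      |w x t - heat (fun y => χ y * w y (t - h)) h x| ≤ modC n ρ M A₀ * h := by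
    intro x hx
    have := hw.sub_heat_le (x := x) (ρ := ρ) (s := t - h) (h := h) (A₀ := A₀) (M := M) hρ
      ((hsub hx).trans (h34.trans hU)) ht hh.le hh1 (by simpa using htβ)
      (fun y hy => hA y (h34 (hsub hx hy))) (fun y hy => hM y (h34 (hsub hx hy)))
      hF hχc.mul_right hFM (fun y hy => by rw [hχe y (hsub hx hy), one_mul])
    rwa [sub_add_cancel] at this
  have k1 := abs_le.1 (key x hx)
  have k2 := abs_le.1 (key y hy)
  have k3 := abs_le.1 (heat_lipschitz hF hFM hh x y)
  have hm : 0 ≤ modC n ρ M A₀ := by unfold modC; positivity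
  have hg := gaussC_pos n
  have hfin : 2 * modC n ρ M A₀ * h + (√h)⁻¹ * gaussC n * M * ‖x - y‖ ≤
      (2 * modC n ρ M A₀ + gaussC n * M) * (h + (√h)⁻¹ * ‖x - y‖) := by
    have h1 : 0 ≤ modC n ρ M A₀ * ((√h)⁻¹ * ‖x - y‖) := by positivity
    have h2 : 0 ≤ gaussC n * M * h := by positivity
    nlinarith
  rw [abs_le]
  constructor <;> linarith [k1.1, k1.2, k2.1, k2.2, k3.1, k3.2]

/-- Interior modulus of continuity in time. -/
lemma HeatSol.time_modulus (hUo : IsOpen U)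
    (hc : ContinuousOn ♯w (U ×ˢ Ioo α β))
    (hw : HeatSol U α β w f) (hρ : 0 < ρ) (hU : closedBall x₀ (4 * ρ) ⊆ U)
    (hA : ∀ y ∈ closedBall x₀ (4 * ρ), ∀ t ∈ Ioo α β, |f y t| ≤ A₀)
    (hM : ∀ y ∈ closedBall x₀ (4 * ρ), ∀ t ∈ Ioo α β, |w y t| ≤ M) (hx : x ∈ closedBall x₀ ρ)
    {η : ℝ} (hh : 0 < h) (hh1 : h ≤ 1) (hη : 0 < η) (hη1 : η ≤ 1) (hs : α < s - η)
    (hsβ : s + h < β) : |w x (s + h) - w x s| ≤ modC n ρ M A₀ * h + gaussC n *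
    ((2 * modC n ρ M A₀ + gaussC n * M) * (η + (√η)⁻¹ * √h) + 2 * M / ρ ^ 4 * h ^ 2) := by
  obtain ⟨χ, hχ2, hχc, hχs, hχ0, hχ1, hχe⟩ := exists_cutoff x₀ (R := 3 * ρ) (R' := 4 * ρ)
    (by positivity) (by linarith)
  have hsI : s ∈ Ioo α β := ⟨by linarith, by linarith⟩
  have hFc := continuousOn_cutoff_mul hUo hc hχ2.continuous (hχs.trans hU)
  have hF : Continuous (fun y => χ y * w y s) := by
    rw [← continuousOn_univ]
    exact hFc.comp (f := fun y : E => (y, s)) (by fun_prop) (fun y _ => ⟨mem_univ _, hsI⟩)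
  have hMx : x₀ ∈ closedBall x₀ (4 * ρ) := mem_closedBall_self (by positivity)
  have hM0 : 0 ≤ M := (abs_nonneg _).trans (hM x₀ hMx _ hsI)
  have hA0 : 0 ≤ A₀ := (abs_nonneg _).trans (hA x₀ hMx _ hsI)
  have hFM : ∀ y, |χ y * w y s| ≤ M := by
    intro y
    rw [abs_mul, abs_of_nonneg (hχ0 y)]
    by_cases hy : y ∈ tsupport χ
    · calc _ ≤ 1 * M := mul_le_mul (hχ1 y) (hM y (hχs hy) _ hsI) (abs_nonneg _) zero_le_one
        _ = M := one_mul _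
    · rw [image_eq_zero_of_notMem_tsupport hy, zero_mul]; exact hM0
  have hsub : ∀ {x : E}, x ∈ closedBall x₀ (2 * ρ) →
      closedBall x ρ ⊆ closedBall x₀ (3 * ρ) := fun hx =>
    closedBall_subset_closedBall' (by have := mem_closedBall.1 hx; linarith)
  have h34 : closedBall x₀ (3 * ρ) ⊆ closedBall x₀ (4 * ρ) :=
    closedBall_subset_closedBall (by linarith)
  have h23 : closedBall x₀ (2 * ρ) ⊆ closedBall x₀ (3 * ρ) :=
    closedBall_subset_closedBall (by linarith)
  have hx2 : x ∈ closedBall x₀ (2 * ρ) := closedBall_subset_closedBall (by linarith) hx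
  have k1 := hw.sub_heat_le (x := x) (ρ := ρ) (s := s) (h := h) (A₀ := A₀) (M := M) hρ
      ((hsub hx2).trans (h34.trans hU)) hsI.1 hh.le hh1 hsβ
      (fun y hy => hA y (h34 (hsub hx2 hy))) (fun y hy => hM y (h34 (hsub hx2 hy)))
      hF hχc.mul_right hFM (fun y hy => by rw [hχe y (hsub hx2 hy), one_mul])
  set C := 2 * modC n ρ M A₀ + gaussC n * M with hC
  have hm : 0 ≤ modC n ρ M A₀ := by unfold modC; positivity
  have hg := gaussC_pos n
  have hC0 : 0 ≤ C := by positivity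
  have hFx : χ x * w x s = w x s := by rw [hχe x (h23 hx2), one_mul]
  have k2 : |heat (fun y => χ y * w y s) h x - w x s| ≤ gaussC n *
      (C * (η + (√η)⁻¹ * √h) + 2 * M / ρ ^ 4 * h ^ 2) := by
    refine abs_heat_sub_le hF hFM hh x _ fun y => ?_
    have ht0 : 0 ≤ ‖x - y‖ ^ 2 / h := by positivity
    by_cases hy : y ∈ closedBall x₀ (2 * ρ)
    · rw [hχe y (h23 hy), one_mul, abs_sub_comm]
      refine (hw.space_modulus hUo hc hρ hU hA hM hx2 hy hη hη1 hs hsI.2).trans ?_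
      have e1 : ‖x - y‖ ≤ √h * (1 + ‖x - y‖ ^ 2 / h) := by
        set a := √h with ha
        have ha0 : 0 < a := sqrt_pos.2 hh
        rw [(sq_sqrt hh.le).symm, ← ha]
        have : a * (1 + ‖x - y‖ ^ 2 / a ^ 2) - ‖x - y‖ =
          a * ((‖x - y‖ / a - 1 / 2) ^ 2 + 3 / 4) := by field_simp; ring
        have : 0 ≤ a * ((‖x - y‖ / a - 1 / 2) ^ 2 + 3 / 4) := by positivity
        linarith
      have e2 : 1 + ‖x - y‖ ^ 2 / h ≤ (1 + ‖x - y‖ ^ 2 / h) ^ 2 := by nlinarith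
      calc C * (η + (√η)⁻¹ * ‖x - y‖)
          ≤ C * (η * (1 + ‖x - y‖ ^ 2 / h) + (√η)⁻¹ * (√h * (1 + ‖x - y‖ ^ 2 / h))) := by
            gcongr
            exact le_mul_of_one_le_right hη.le (by linarith)
        _ = C * (η + (√η)⁻¹ * √h) * (1 + ‖x - y‖ ^ 2 / h) := by ring
        _ ≤ (C * (η + (√η)⁻¹ * √h) + 2 * M / ρ ^ 4 * h ^ 2) * (1 + ‖x - y‖ ^ 2 / h) ^ 2 := by
            gcongr
            have : 0 ≤ 2 * M / ρ ^ 4 * h ^ 2 := by positivity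
            linarith
    · have hxy : ρ ≤ ‖x - y‖ := by
        rw [mem_closedBall, not_le] at hy
        have h1 := mem_closedBall.1 hx
        have h2 := dist_triangle y x x₀
        rw [dist_comm y x, dist_eq_norm x y] at h2
        linarith
      have e1 : |χ y * w y s - w x s| ≤ 2 * M := by
        have := hFM x
        rw [hFx] at this
        exact (abs_sub _ _).trans (by linarith [hFM y])
      refine e1.trans ?_
      have e2 : 2 * M ≤ 2 * M / ρ ^ 4 * h ^ 2 * (‖x - y‖ ^ 2 / h) ^ 2 := by
        have : 2 * M / ρ ^ 4 * h ^ 2 * (‖x - y‖ ^ 2 / h) ^ 2 = 2 * M * (‖x - y‖ / ρ) ^ 4 := by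
          field_simp
        rw [this]
        exact le_mul_of_one_le_right (by positivity) (one_le_pow₀ ((one_le_div hρ).2 hxy))
      refine e2.trans ?_
      have : 0 ≤ C * (η + (√η)⁻¹ * √h) := by positivity
      gcongr
      · linarith
      · linarith
  have := abs_sub_le (w x (s + h)) (heat (fun y => χ y * w y s) h x) (w x s)
  linarith

end interior

section regularity

variable {f : EuclideanSpace ℝ (Fin n) → ℝ → ℝ} {L θ : ℝ}

/-- Interior bounds for a solution of the inhomogeneous heat equation. -/
structure InteriorData (U : Set E) (α β : ℝ) (w f : E → ℝ → ℝ) (x₀ : E)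
    (ρ A₀ M L θ : ℝ) : Prop where
  isOpen : IsOpen U
  cont : ContinuousOn ♯w (U ×ˢ Ioo α β)
  contf : ContinuousOn ♯f (U ×ˢ Ioo α β)
  sol : HeatSol U α β w f
  rho_pos : 0 < ρ
  sub : closedBall x₀ (4 * ρ) ⊆ U
  boundf : ∀ y ∈ closedBall x₀ (4 * ρ), ∀ t ∈ Ioo α β, |f y t| ≤ A₀
  bound : ∀ y ∈ closedBall x₀ (4 * ρ), ∀ t ∈ Ioo α β, |w y t| ≤ M
  theta_pos : 0 < θ
  theta_le : θ ≤ 1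
  holder_nonneg : 0 ≤ L
  M_nonneg : 0 ≤ M
  A_nonneg : 0 ≤ A₀
  holder : ∀ y ∈ closedBall x₀ (4 * ρ), ∀ z ∈ closedBall x₀ (4 * ρ),
    ∀ t ∈ Ioo α β, |f y t - f z t| ≤ L * ‖y - z‖ ^ θ

/-- The constant in the step estimate. -/
def stepC (n : ℕ) (ρ A₀ M L θ : ℝ) : ℝ :=
  L * (ρ ^ θ + 1) + (2 * M + A₀ + L * ρ ^ θ) * (2 * n + 4) ^ 2 / ρ ^ 4

lemma stepC_nonneg (D : InteriorData U α β w f x₀ ρ A₀ M L θ) : 0 ≤ stepC n ρ A₀ M L θ := by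
  have := D.rho_pos
  have := D.M_nonneg
  have := D.A_nonneg
  have := D.holder_nonneg
  unfold stepC; positivity

lemma rpow_norm_le {g z : ℝ} (hθ : 0 < θ) (hθ1 : θ ≤ 1) (hg : 0 < g) (hg1 : g ≤ 1) (hz : 0 ≤ z) :
    z ^ θ ≤ g ^ θ * (1 + z ^ 2 / g ^ 8) := by
  have e : z = g ^ 4 * (z / g ^ 4) := by field_simp
  set v := z / g ^ 4 with hv
  have hv0 : 0 ≤ v := by positivity
  have e2 : z ^ 2 / g ^ 8 = v ^ 2 := by rw [hv]; field_simp
  rw [e2, e, mul_rpow (by positivity) hv0]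
  have h1 : (g ^ 4) ^ θ ≤ g ^ θ :=
    rpow_le_rpow (by positivity) (by simpa using pow_le_pow_of_le_one hg.le hg1 (by norm_num : 1 ≤ 4)) hθ.le
  have h2 : v ^ θ ≤ 1 + v ^ 2 := by
    rcases le_total v 1 with h | h
    · have := rpow_le_one hv0 h hθ.le
      nlinarith
    · have := rpow_le_rpow_of_exponent_le h hθ1
      rw [rpow_one] at this
      nlinarith
  exact mul_le_mul h1 h2 (by positivity) (by positivity)

lemma cutoff_continuous (D : InteriorData U α β w f x₀ ρ A₀ M L θ) (hχ : Continuous χ) (hχs : tsupport χ ⊆ closedBall x₀ (4 * ρ)) (hs : s ∈ Ioo α β) : Continuous (fun y => χ y * w y s) := by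
  have hFc := continuousOn_cutoff_mul D.isOpen D.cont hχ (hχs.trans D.sub)
  rw [← continuousOn_univ]
  exact hFc.comp (f := fun y : E => (y, s)) (by fun_prop) (fun y _ => ⟨mem_univ _, hs⟩)

lemma cutoff_bound (D : InteriorData U α β w f x₀ ρ A₀ M L θ) (hχs : tsupport χ ⊆ closedBall x₀ (4 * ρ)) (hχ0 : ∀ y, 0 ≤ χ y) (hχ1 : ∀ y, χ y ≤ 1)
    (hs : s ∈ Ioo α β) (y : E) : |χ y * w y s| ≤ M := by
  rw [abs_mul, abs_of_nonneg (hχ0 y)]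
  by_cases hy : y ∈ tsupport χ
  · calc _ ≤ 1 * M := mul_le_mul (hχ1 y) (D.bound y (hχs hy) _ hs) (abs_nonneg _) zero_le_one
      _ = M := one_mul _
  · rw [image_eq_zero_of_notMem_tsupport hy, zero_mul]; exact D.M_nonneg

lemma step_bound (D : InteriorData U α β w f x₀ ρ A₀ M L θ) (hχ : Continuous χ) (hχc : HasCompactSupport χ)
    (hχs : tsupport χ ⊆ closedBall x₀ (4 * ρ)) (hχ0 : ∀ y, 0 ≤ χ y) (hχ1 : ∀ y, χ y ≤ 1)
    (hχe : ∀ y ∈ closedBall x₀ (3 * ρ), χ y = 1)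
    (hx : x ∈ closedBall x₀ ρ) {g : ℝ} (hg : 0 < g) (hg1 : g ≤ 1)
    (hs : α < s) (hsβ : s + g ^ 8 < β) (y : E) :
    |heat (fun y => χ y * w y s) (g ^ 8) y - χ y * w y (s + g ^ 8) -
    (-∫ τ in s..(s + g ^ 8), f x τ)| ≤
    stepC n ρ A₀ M L θ * g ^ θ * g ^ 8 * (1 + ‖x - y‖ ^ 2 / g ^ 8) ^ 2 := by
  have hρ := D.rho_pos
  have hM0 := D.M_nonneg
  have hA0 := D.A_nonneg
  have hL0 := D.holder_nonneg
  have hθ := D.theta_pos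
  have hθ1 := D.theta_le
  set h := g ^ 8 with hh
  have hh0 : 0 < h := by positivity
  have hh1 : h ≤ 1 := pow_le_one₀ hg.le hg1
  have hI : Icc s (s + h) ⊆ Ioo α β := fun t ht => ⟨hs.trans_le ht.1, ht.2.trans_lt hsβ⟩
  have hsI : s ∈ Ioo α β := hI ⟨le_rfl, by linarith⟩
  have hsI' : s + h ∈ Ioo α β := hI ⟨by linarith, le_rfl⟩
  have hgκ : g ≤ g ^ θ := by simpa using rpow_le_rpow_of_exponent_ge hg hg1 hθ1
  have hκ0 : 0 < g ^ θ := by positivity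
  have hκ1 : g ^ θ ≤ 1 := rpow_le_one hg.le hg1 hθ.le
  have hz0 : 0 ≤ ‖x - y‖ ^ 2 / h := by positivity
  have e2 : 1 + ‖x - y‖ ^ 2 / h ≤ (1 + ‖x - y‖ ^ 2 / h) ^ 2 := by nlinarith
  have h34 : closedBall x₀ (3 * ρ) ⊆ closedBall x₀ (4 * ρ) :=
    closedBall_subset_closedBall (by linarith)
  have h24 : closedBall x₀ (2 * ρ) ⊆ closedBall x₀ (4 * ρ) :=
    closedBall_subset_closedBall (by linarith)
  have h14 : closedBall x₀ (ρ) ⊆ closedBall x₀ (4 * ρ) := closedBall_subset_closedBall (by linarith)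
  have hF := cutoff_continuous D hχ hχs hsI
  have hFM := cutoff_bound D hχs hχ0 hχ1 hsI
  have hfc : ∀ y ∈ closedBall x₀ (4 * ρ), ContinuousOn (f y) (Ioo α β) := fun y hy =>
    D.contf.comp (f := fun t : ℝ => (y, t)) (by fun_prop) (fun t ht => ⟨D.sub hy, ht⟩)
  have hint : ∀ y ∈ closedBall x₀ (4 * ρ), IntervalIntegrable (f y) volume s (s + h) := by
    intro y hy
    refine ContinuousOn.intervalIntegrable ?_
    rw [uIcc_of_le (by linarith)]
    exact (hfc y hy).mono hI
  set K := (2 * M + A₀ + L * ρ ^ θ) * (2 * n + 4) ^ 2 / ρ ^ 4 with hK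
  have hK0 : 0 ≤ K := by positivity
  by_cases hy : y ∈ closedBall x₀ (2 * ρ)
  · have hsub : closedBall y (ρ * g) ⊆ closedBall x₀ (3 * ρ) :=
      closedBall_subset_closedBall' (by
        have := mem_closedBall.1 hy
        nlinarith)
    have hsle : s ≤ s + h := by linarith
    have hyy : y ∈ closedBall y (ρ * g) := mem_closedBall_self (by positivity)
    have h1 := D.sol.step (x := y) (d := ρ * g) (s := s) (h := h) (A₀ := A₀) (M := M)
      (ω := L * ρ ^ θ * g ^ θ) (A := IccExtend hsle (fun t => f y t))
      (F := fun y => χ y * w y s) (by positivity) (hsub.trans (h34.trans D.sub)) hs hh0.le hsβ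
      (by
        refine Continuous.Icc_extend' ?_
        exact ((hfc y (h24 hy)).mono hI).domRestrict)
      (fun t => D.boundf y (h24 hy) _ (hI (projIcc s (s + h) hsle t).2)) (by positivity)
      (fun z hz t ht => by
        rw [IccExtend_of_mem hsle _ ht]
        refine (D.holder z (h34 (hsub hz)) y (h24 hy) t (hI ht)).trans ?_
        rw [mul_assoc, ← mul_rpow hρ.le hg.le]
        gcongr
        rw [← dist_eq_norm]
        exact hz)
      (fun z hz t ht => D.bound z (h34 (hsub hz)) t (hI ht)) hF hχc.mul_right hFM
      (fun z hz => by rw [hχe z (hsub hz), one_mul])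
    have h2 : (∫ τ in s..(s + h), IccExtend hsle (fun t => f y t) τ) = ∫ τ in s..(s + h), f y τ := by
      refine intervalIntegral.integral_congr fun t ht => ?_
      rw [uIcc_of_le hsle] at ht
      exact IccExtend_of_mem hsle _ ht
    rw [h2] at h1
    have h3 : |(∫ τ in s..(s + h), f y τ) - ∫ τ in s..(s + h), f x τ| ≤ L * ‖x - y‖ ^ θ * h := by
      rw [← intervalIntegral.integral_sub (hint y (h24 hy)) (hint x (h14 hx))]
      have := intervalIntegral.norm_integral_le_of_norm_le_const (a := s) (b := s + h)
        (f := fun τ => f y τ - f x τ) (C := L * ‖x - y‖ ^ θ) (fun t ht => by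
          rw [uIoc_of_le hsle] at ht
          rw [norm_sub_rev x y]
          exact D.holder y (h24 hy) x (h14 hx) t (hI ⟨ht.1.le, ht.2⟩))
      simpa [abs_of_nonneg hh0.le] using this
    have h4 : (2 * M + (A₀ + L * ρ ^ θ * g ^ θ) * h) * (2 * n + 4) ^ 2 * h ^ 2 / (ρ * g) ^ 4 ≤
        K * g ^ θ * h := by
      have : h ^ 2 / (ρ * g) ^ 4 = g ^ 4 * h / ρ ^ 4 := by rw [hh]; field_simp
      rw [mul_div_assoc, this]
      calc _ ≤ (2 * M + (A₀ + L * ρ ^ θ * 1) * 1) * (2 * n + 4) ^ 2 * (g ^ θ * h / ρ ^ 4) := by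
            gcongr
            exact le_trans (by simpa using pow_le_pow_of_le_one hg.le hg1 (by norm_num : 1 ≤ 4)) hgκ
        _ = _ := by rw [hK]; ring
    have h5 : L * ‖x - y‖ ^ θ * h ≤ L * g ^ θ * h * (1 + ‖x - y‖ ^ 2 / h) := by
      have := rpow_norm_le hθ hθ1 hg hg1 (norm_nonneg (x - y))
      calc _ ≤ L * (g ^ θ * (1 + ‖x - y‖ ^ 2 / g ^ 8)) * h := by gcongr
        _ = _ := by rw [hh]; ring
    have hχy : χ y = 1 := hχe y (closedBall_subset_closedBall (by linarith) hy)
    rw [hχy, one_mul]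
    have h6 : |heat (fun y => χ y * w y s) h y - w y (s + h) - (-∫ τ in s..(s + h), f x τ)| ≤
        (L * ρ ^ θ + K) * g ^ θ * h + L * g ^ θ * h * (1 + ‖x - y‖ ^ 2 / h) := by
      rw [abs_le] at h1 h3 ⊢
      constructor <;> nlinarith [h1.1, h1.2, h3.1, h3.2]
    refine h6.trans ?_
    calc _ ≤ (L * ρ ^ θ + K) * g ^ θ * h * (1 + ‖x - y‖ ^ 2 / h) ^ 2 +
          L * g ^ θ * h * (1 + ‖x - y‖ ^ 2 / h) ^ 2 := by
          refine add_le_add (le_mul_of_one_le_right (by positivity) (by linarith)) ?_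
          exact mul_le_mul_of_nonneg_left e2 (by positivity)
      _ = _ := by unfold stepC; rw [← hK]; ring
  · have hxy : ρ ≤ ‖x - y‖ := by
      rw [mem_closedBall, not_le] at hy
      have h1 := mem_closedBall.1 hx
      have h2 := dist_triangle y x x₀
      rw [dist_comm y x, dist_eq_norm x y] at h2
      linarith
    have h1 := abs_le.1 (abs_heat_le hF hFM h y)
    have h2 := abs_le.1 (cutoff_bound D hχs hχ0 hχ1 hsI' y)
    have h3 : |∫ τ in s..(s + h), f x τ| ≤ A₀ := by
      have := intervalIntegral.norm_integral_le_of_norm_le_const (a := s) (b := s + h)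
        (f := fun τ => f x τ) (C := A₀) (fun t ht => by
          rw [uIoc_of_le (by linarith)] at ht
          exact D.boundf x (h14 hx) t (hI ⟨ht.1.le, ht.2⟩))
      rw [add_sub_cancel_left, abs_of_nonneg hh0.le] at this
      exact this.trans (mul_le_of_le_one_right hA0 hh1)
    have h4 : |heat (fun y => χ y * w y s) h y - χ y * w y (s + h) - (-∫ τ in s..(s + h), f x τ)| ≤
        2 * M + A₀ := by
      rw [abs_le] at h3 ⊢
      constructor <;> linarith [h1.1, h1.2, h2.1, h2.2, h3.1, h3.2]
    refine h4.trans ?_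
    have h5 : 2 * M + A₀ ≤ (2 * M + A₀) / ρ ^ 4 * h * h * (‖x - y‖ ^ 2 / h) ^ 2 := by
      have : (2 * M + A₀) / ρ ^ 4 * h * h * (‖x - y‖ ^ 2 / h) ^ 2 =
        (2 * M + A₀) * (‖x - y‖ / ρ) ^ 4 := by field_simp
      rw [this]
      exact le_mul_of_one_le_right (by positivity) (one_le_pow₀ ((one_le_div hρ).2 hxy))
    refine h5.trans ?_
    have h6 : (2 * M + A₀) / ρ ^ 4 ≤ stepC n ρ A₀ M L θ := by
      unfold stepC
      rw [← hK]
      have : (2 * M + A₀) / ρ ^ 4 ≤ K := by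
        rw [hK]
        have h0 : 0 ≤ L * ρ ^ θ := by positivity
        have h2n : (1:ℝ) ≤ (2 * n + 4) ^ 2 := one_le_pow₀ (by linarith [(Nat.cast_nonneg n : (0:ℝ) ≤ n)])
        refine div_le_div_of_nonneg_right ?_ (by positivity)
        exact le_trans (by linarith) (le_mul_of_one_le_right (by positivity) h2n)
      have : 0 ≤ L * (ρ ^ θ + 1) := by positivity
      linarith
    have h7 : h ≤ g ^ θ :=
      le_trans (by simpa using pow_le_pow_of_le_one hg.le hg1 (by norm_num : 1 ≤ 8)) hgκ
    have := stepC_nonneg D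
    have e3 : (‖x - y‖ ^ 2 / h) ^ 2 ≤ (1 + ‖x - y‖ ^ 2 / h) ^ 2 :=
      pow_le_pow_left₀ hz0 (by linarith) 2
    exact mul_le_mul (mul_le_mul_of_nonneg_right (mul_le_mul h6 h7 hh0.le this) hh0.le) e3
      (by positivity) (by positivity)

lemma step_diff (D : InteriorData U α β w f x₀ ρ A₀ M L θ) (hχ : Continuous χ) (hχc : HasCompactSupport χ)
    (hχs : tsupport χ ⊆ closedBall x₀ (4 * ρ)) (hχ0 : ∀ y, 0 ≤ χ y) (hχ1 : ∀ y, χ y ≤ 1)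
    (hχe : ∀ y ∈ closedBall x₀ (3 * ρ), χ y = 1)
    (hx : x ∈ closedBall x₀ ρ) {g : ℝ} (hg : 0 < g) (hg1 : g ≤ 1)
    (hs : α < s) (hsβ : s + g ^ 8 < β) :
    ‖heatD (fun y => χ y * w y s) (2 * g ^ 8) x - heatD (fun y => χ y * w y (s + g ^ 8)) (g ^ 8) x‖
    ≤ gaussC n * stepC n ρ A₀ M L θ * g ^ θ ∧ ‖heatDD (fun y => χ y * w y s) (2 * g ^ 8) x -
    heatDD (fun y => χ y * w y (s + g ^ 8)) (g ^ 8) x‖ ≤ gaussC n * stepC n ρ A₀ M L θ * g ^ θ := by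
  have hh0 : 0 < g ^ 8 := by positivity
  have hh1 : g ^ 8 ≤ 1 := pow_le_one₀ hg.le hg1
  set h := g ^ 8 with hh
  have hsI : s ∈ Ioo α β := ⟨hs, by linarith⟩
  have hsI' : s + h ∈ Ioo α β := ⟨by linarith, hsβ⟩
  have hF := cutoff_continuous D hχ hχs hsI
  have hFM := cutoff_bound D hχs hχ0 hχ1 hsI
  have hF' := cutoff_continuous D hχ hχs hsI'
  have hFM' := cutoff_bound D hχs hχ0 hχ1 hsI'
  set F := fun y => χ y * w y s with hFd
  set F' := fun y => χ y * w y (s + h) with hFd'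
  have hH : Continuous (fun y => heat F h y) :=
    continuous_iff_continuousAt.2 fun z => (hasFDerivAt_heat hF hFM hh0 z).continuousAt
  have hHM : ∀ y, |heat F h y| ≤ M := abs_heat_le hF hFM h
  have hB : Continuous (fun y => heat F h y - F' y) := hH.sub hF'
  have hBM : ∀ y, |heat F h y - F' y| ≤ 2 * M := fun y =>
    (abs_sub _ _).trans (by linarith [hHM y, hFM' y])
  have e : ∀ x, heat (fun y => heat F h y - F' y) h x = heat F (2 * h) x - heat F' h x := by
    intro x
    have h1 := heat_add (F' := fun y => -F' y) hH hF'.neg hHM (fun y => by rw [abs_neg]; exact hFM' y) h x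
    have h2 := heat_heat hF hFM hh0 hh0 x
    rw [heat_neg] at h1
    rw [two_mul, ← h2]
    simp only [sub_eq_add_neg]
    exact h1
  have d1 : ∀ x, heatD (fun y => heat F h y - F' y) h x = heatD F (2 * h) x - heatD F' h x := by
    intro x
    have h1 := hasFDerivAt_heat hB hBM hh0 x
    simp only [e] at h1
    exact h1.unique ((hasFDerivAt_heat hF hFM (by positivity) x).sub (hasFDerivAt_heat hF' hFM' hh0 x))
  have d2 : ∀ x, heatDD (fun y => heat F h y - F' y) h x = heatDD F (2 * h) x - heatDD F' h x := by
    intro x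
    have h1 := hasFDerivAt_heatD hB hBM hh0 x
    simp only [d1] at h1
    exact h1.unique ((hasFDerivAt_heatD hF hFM (by positivity) x).sub (hasFDerivAt_heatD hF' hFM' hh0 x))
  have hsb := step_bound D hχ hχc hχs hχ0 hχ1 hχe hx hg hg1 hs hsβ
  have hC := stepC_nonneg D
  have hG := gaussC_pos n
  rw [← d1, ← d2]
  constructor
  · refine (norm_heatD_le hB hBM hh0 x _ hsb).trans ?_
    rw [← hh]
    have : (√h)⁻¹ * h ≤ 1 := by
      have e : (√h)⁻¹ * h = √h := by
        have h0 : √h ≠ 0 := (sqrt_pos.2 hh0).ne'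
        nth_rewrite 2 [← Real.mul_self_sqrt hh0.le]
        field_simp
      rw [e]; exact sqrt_le_one.2 hh1
    calc _ = gaussC n * stepC n ρ A₀ M L θ * g ^ θ * ((√h)⁻¹ * h) := by ring
      _ ≤ _ := mul_le_of_le_one_right (by positivity) this
  · refine (norm_heatDD_le hB hBM hh0 x _ hsb).trans ?_
    rw [← hh]
    have : h⁻¹ * h = 1 := inv_mul_cancel₀ hh0.ne'
    calc _ = gaussC n * stepC n ρ A₀ M L θ * g ^ θ * (h⁻¹ * h) := by ring
      _ ≤ _ := by rw [this, mul_one]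

end regularity

lemma exists_tendstoUniformlyOn_of_geometric {X H : Type*} [NormedAddCommGroup H] [CompleteSpace H]
    {W : ℕ → X → H} {S : Set X} (hq : q < 1) (hq0 : 0 ≤ q)
    (h : ∀ z ∈ S, ∀ j, ‖W j z - W (j + 1) z‖ ≤ C * q ^ j) :
    ∃ G : X → H, TendstoUniformlyOn W G atTop S := by
  classical
  have h' : ∀ z ∈ S, ∀ j, dist (W j z) (W (j + 1) z) ≤ C * q ^ j := fun z hz j => by
    rw [dist_eq_norm]; exact h z hz j
  have hl : ∀ z, ∃ a, z ∈ S → Tendsto (fun j => W j z) atTop (𝓝 a) := fun z => by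
    by_cases hz : z ∈ S
    · obtain ⟨a, ha⟩ := cauchySeq_tendsto_of_complete (cauchySeq_of_le_geometric q C hq (h' z hz))
      exact ⟨a, fun _ => ha⟩
    · exact ⟨0, fun hz' => absurd hz' hz⟩
  choose G hG using hl
  refine ⟨G, Metric.tendstoUniformlyOn_iff.2 fun ε hε => ?_⟩
  have ht : Tendsto (fun j => C * q ^ j / (1 - q)) atTop (𝓝 0) := by
    simpa using ((tendsto_pow_atTop_nhds_zero_of_lt_one hq0 hq).const_mul C).div_const (1 - q)
  filter_upwards [ht.eventually (gt_mem_nhds hε)] with j hj z hz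
  rw [dist_comm]
  exact (dist_le_of_le_geometric_of_tendsto q C hq (h' z hz) (hG z hz) j).trans_lt hj

lemma continuousOn_heatDD (hχc : HasCompactSupport χ) {I : Set ℝ}
    (hw : ContinuousOn (fun p : Q => χ p.1 * w p.1 p.2) (univ ×ˢ I)) (h : ℝ) :
    ContinuousOn (fun p : Q => heatDD (fun y => χ y * w y (p.2 - h)) h p.1) {p | p.2 - h ∈ I} := by
  unfold heatDD
  refine continuousOn_integral_of_compact_support hχc ?_ ?_
  · have h1 : ContinuousOn (fun z : Q × E => χ z.2 * w z.2 (z.1.2 - h))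
        ({p | p.2 - h ∈ I} ×ˢ univ) :=
      hw.comp (f := fun z : Q × E => (z.2, z.1.2 - h)) (by fun_prop)
        (fun z hz => ⟨mem_univ _, hz.1⟩)
    have h2 : Continuous (fun z : Q × E => gaussDD h (z.1.1 - z.2)) :=
      (continuous_gaussDD h).comp (by fun_prop)
    exact h1.smul h2.continuousOn
  · intro p y hp hy
    simp only
    rw [image_eq_zero_of_notMem_tsupport hy, zero_mul]
    ext u v
    exact zero_mul (gaussDD h (p.1 - y) u v)

section regularity

variable {f : EuclideanSpace ℝ (Fin n) → ℝ → ℝ} {L θ : ℝ}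

lemma InteriorData.exists_hasFDerivAt (D : InteriorData U α β w f x₀ ρ A₀ M L θ) {g : ℝ}
    (hg : 0 < g) (hg1 : g ≤ 1) : ∃ (G' : E → ℝ → E →L[ℝ] ℝ) (G'' : E → ℝ → E →L[ℝ] E →L[ℝ] ℝ),
    (∀ x ∈ ball x₀ ρ, ∀ t ∈ Ioo (α + g ^ 8) β,
    HasFDerivAt (fun y => w y t) (G' x t) x ∧ HasFDerivAt (fun y => G' y t) (G'' x t) x) ∧
    ContinuousOn ♯G'' (ball x₀ ρ ×ˢ Ioo (α + g ^ 8) β) := by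
  have hρ := D.rho_pos
  obtain ⟨χ, hχ2, hχc, hχs, hχ0, hχ1, hχe⟩ := exists_cutoff x₀ (R := 3 * ρ) (R' := 4 * ρ)
    (by positivity) (by linarith)
  have hχ := hχ2.continuous
  have hFc := continuousOn_cutoff_mul D.isOpen D.cont hχ (hχs.trans D.sub)
  set b : ℝ := (1 / 2 : ℝ) ^ ((1:ℝ) / 8) with hb
  have hb0 : 0 < b := by positivity
  have hb1 : b < 1 := rpow_lt_one (by norm_num) (by norm_num) (by norm_num)
  have hb8 : b ^ 8 = 1 / 2 := by rw [hb, ← rpow_natCast, ← rpow_mul (by norm_num)]; norm_num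
  set gs : ℕ → ℝ := fun j => g * b ^ j with hgs
  have gs0 : ∀ j, 0 < gs j := fun j => by positivity
  have gs1 : ∀ j, gs j ≤ 1 := fun j => mul_le_one₀ hg1 (by positivity) (pow_le_one₀ hb0.le hb1.le)
  have gsle : ∀ j, gs j ≤ g := fun j => mul_le_of_le_one_right hg.le (pow_le_one₀ hb0.le hb1.le)
  have gs8le : ∀ j, gs j ^ 8 ≤ g ^ 8 := fun j => pow_le_pow_left₀ (gs0 j).le (gsle j) 8
  have gs8 : ∀ j, gs j ^ 8 = 2 * gs (j + 1) ^ 8 := fun j => by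
    simp only [hgs]
    rw [pow_succ b j, mul_pow, mul_pow, mul_pow, hb8]; ring
  set S : Set Q := ball x₀ ρ ×ˢ Ioo (α + g ^ 8) β with hS
  have hθ := D.theta_pos
  set q := b ^ θ with hq
  have hq0 : 0 ≤ q := by positivity
  have hq1 : q < 1 := rpow_lt_one hb0.le hb1 hθ
  set C := gaussC n * stepC n ρ A₀ M L θ * (g ^ θ * q) with hC
  have key : ∀ z ∈ S, ∀ j,
      ‖heatD (fun y => χ y * w y (z.2 - gs j ^ 8)) (gs j ^ 8) z.1 -
        heatD (fun y => χ y * w y (z.2 - gs (j + 1) ^ 8)) (gs (j + 1) ^ 8) z.1‖ ≤ C * q ^ j ∧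
      ‖heatDD (fun y => χ y * w y (z.2 - gs j ^ 8)) (gs j ^ 8) z.1 -
        heatDD (fun y => χ y * w y (z.2 - gs (j + 1) ^ 8)) (gs (j + 1) ^ 8) z.1‖ ≤ C * q ^ j := by
    rintro ⟨x, t⟩ ⟨hx, ht⟩ j
    simp only at hx ht ⊢
    have hp : 0 < gs (j + 1) ^ 8 := pow_pos (gs0 _) _
    have h1 := step_diff D hχ hχc hχs hχ0 hχ1 hχe (ball_subset_closedBall hx)
      (s := t - gs j ^ 8) (g := gs (j + 1)) (gs0 _) (gs1 _)
      (by have := gs8le j; have := ht.1; linarith) (by rw [gs8]; have := ht.2; linarith)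
    have e1 : t - gs j ^ 8 + gs (j + 1) ^ 8 = t - gs (j + 1) ^ 8 := by rw [gs8]; ring
    have e2 : gs (j + 1) ^ θ = g ^ θ * q * q ^ j := by
      simp only [hgs]
      have e3 : (b ^ (j + 1)) ^ θ = q ^ (j + 1) := by
        rw [hq, ← rpow_natCast, ← rpow_natCast, ← rpow_mul hb0.le, ← rpow_mul hb0.le, mul_comm]
      rw [mul_rpow hg.le (by positivity), e3, pow_succ]
      ring
    rw [e1, ← gs8, e2] at h1
    rw [hC, mul_assoc (gaussC n * stepC n ρ A₀ M L θ)]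
    exact h1
  obtain ⟨G1, hG1⟩ := exists_tendstoUniformlyOn_of_geometric hq1 hq0 fun z hz j => (key z hz j).1
  obtain ⟨G2, hG2⟩ := exists_tendstoUniformlyOn_of_geometric
    (H := E →L[ℝ] E →L[ℝ] ℝ) hq1 hq0 fun z hz j => (key z hz j).2
  have hlim8 : Tendsto (fun j => gs j ^ 8) atTop (𝓝 0) := by
    have h1 : Tendsto (fun j => g * b ^ j) atTop (𝓝 0) := by
      simpa using (tendsto_pow_atTop_nhds_zero_of_lt_one hb0.le hb1).const_mul g
    simpa using h1.pow 8
  have hI : ∀ {t}, t ∈ Ioo (α + g ^ 8) β → ∀ j, t - gs j ^ 8 ∈ Ioo α β := fun {t} ht j =>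
    ⟨by have := gs8le j; have := ht.1; linarith, by have := pow_pos (gs0 j) 8; have := ht.2; linarith⟩
  refine ⟨fun x t => G1 (x, t), fun x t => G2 (x, t), ?_, ?_⟩
  · intro x hx t ht
    have hF := fun j => cutoff_continuous D hχ hχs (hI ht j)
    have hFM := fun j => cutoff_bound D hχs hχ0 hχ1 (hI ht j)
    have u1 : TendstoUniformlyOn (fun j y => heatD (fun y => χ y * w y (t - gs j ^ 8)) (gs j ^ 8) y)
        (fun y => G1 (y, t)) atTop (ball x₀ ρ) :=
      (hG1.comp (fun y => (y, t))).mono fun y hy => ⟨hy, ht⟩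
    have u2 : TendstoUniformlyOn (fun j y => heatDD (fun y => χ y * w y (t - gs j ^ 8)) (gs j ^ 8) y)
        (fun y => G2 (y, t)) atTop (ball x₀ ρ) :=
      (hG2.comp (fun y => (y, t))).mono fun y hy => ⟨hy, ht⟩
    constructor
    · refine hasFDerivAt_of_tendstoUniformlyOn isOpen_ball u1
        (f := fun j y => heat (fun y => χ y * w y (t - gs j ^ 8)) (gs j ^ 8) y)
        (fun j y hy => hasFDerivAt_heat (hF j) (hFM j) (pow_pos (gs0 j) 8) y) (fun y hy => ?_) hx
      have hb : ∀ j, ‖heat (fun y => χ y * w y (t - gs j ^ 8)) (gs j ^ 8) y - w y t‖ ≤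
          modC n ρ M A₀ * gs j ^ 8 := by
        intro j
        have hsub : closedBall y ρ ⊆ closedBall x₀ (3 * ρ) :=
          closedBall_subset_closedBall' (by have := mem_ball.1 hy; linarith)
        have h34 : closedBall x₀ (3 * ρ) ⊆ closedBall x₀ (4 * ρ) :=
          closedBall_subset_closedBall (by linarith)
        have := D.sol.sub_heat_le (x := y) (ρ := ρ) (s := t - gs j ^ 8) (h := gs j ^ 8)
          (A₀ := A₀) (M := M) hρ ((hsub).trans (h34.trans D.sub)) (hI ht j).1 (pow_pos (gs0 j) 8).le
          (pow_le_one₀ (gs0 j).le (gs1 j)) (by simpa using ht.2)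
          (fun z hz => D.boundf z (h34 (hsub hz))) (fun z hz => D.bound z (h34 (hsub hz)))
          (hF j) hχc.mul_right (hFM j) (fun z hz => by rw [hχe z (hsub hz), one_mul])
        rw [sub_add_cancel] at this
        rw [Real.norm_eq_abs, abs_sub_comm]
        exact this
      have hz : Tendsto (fun j => modC n ρ M A₀ * gs j ^ 8) atTop (𝓝 0) := by
        simpa using hlim8.const_mul (modC n ρ M A₀)
      exact tendsto_sub_nhds_zero_iff.1 (squeeze_zero_norm hb hz)
    · exact hasFDerivAt_of_tendstoUniformlyOn (G := E →L[ℝ] ℝ) isOpen_ball u2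
        (fun j y hy => hasFDerivAt_heatD (hF j) (hFM j) (pow_pos (gs0 j) 8) y)
        (fun y hy => u1.tendsto_at hy) hx
  · refine hG2.continuousOn (Frequently.of_forall fun j => ?_)
    refine (continuousOn_heatDD hχc hFc (gs j ^ 8)).mono ?_
    rintro ⟨x, t⟩ ⟨hx, ht⟩
    exact hI ht j

end regularity

/-- Multiplication by a function supported in `V` extends a continuous function on `V`. -/
lemma continuous_mul_of_tsupport (hV : IsOpen V) {ψ z : E → ℝ}
    (hψ : Continuous ψ) (hs : tsupport ψ ⊆ V) (hz : ContinuousOn z V) :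
    Continuous (fun y => ψ y * z y) := by
  have h := continuousOn_cutoff_mul hV (I := univ) (w := fun y _ => z y)
    (hz.comp (f := fun p : Q => p.1) (by fun_prop) (fun p hp => hp.1)) hψ hs
  rw [← continuousOn_univ]
  exact h.comp (f := fun y : E => (y, (0:ℝ))) (by fun_prop) (fun y _ => ⟨mem_univ _, mem_univ _⟩)

lemma contDiff_mul_of_tsupport (hV : IsOpen V) {ψ z : E → ℝ}
    (hψ : ContDiff ℝ 2 ψ) (hs : tsupport ψ ⊆ V) (hz : ContDiffOn ℝ 2 z V) :
    ContDiff ℝ 2 (fun y => ψ y * z y) := by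
  refine contDiff_iff_contDiffAt.2 fun y => ?_
  by_cases hy : y ∈ V
  · exact hψ.contDiffAt.mul (hz.contDiffAt (hV.mem_nhds hy))
  · have : (fun y => ψ y * z y) =ᶠ[𝓝 y] fun _ => 0 := by
      filter_upwards [(isClosed_tsupport ψ).isOpen_compl.mem_nhds (fun h => hy (hs h))] with p hp
      rw [image_eq_zero_of_notMem_tsupport hp, zero_mul]
    exact contDiffAt_const.congr_of_eventuallyEq this

lemma integral_mul_fderiv_of_tsupport (hV : IsOpen V) {ψ z : E → ℝ}
    (hψ : ContDiff ℝ 1 ψ) (hψc : HasCompactSupport ψ) (hs : tsupport ψ ⊆ V)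
    (hz : ContDiffOn ℝ 1 z V) (v : E) :
    ∫ x, ψ x * fderiv ℝ z x v = - ∫ x, fderiv ℝ ψ x v * z x := by
  have hs' : tsupport (fun x => fderiv ℝ ψ x v) ⊆ tsupport ψ := tsupport_fderiv_apply_subset ℝ v
  have hdc : HasCompactSupport (fun x => fderiv ℝ ψ x v) := hψc.fderiv_apply ℝ v
  have hzd : ContinuousOn (fun x => fderiv ℝ z x v) V :=
    (hz.continuousOn_fderiv_of_isOpen hV le_rfl).clm_apply continuousOn_const
  have hψd : Continuous (fun x => fderiv ℝ ψ x v) :=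
    (hψ.continuous_fderiv (by simp)).clm_apply continuous_const
  have i1 := (continuous_mul_of_tsupport hV hψd (hs'.trans hs) hz.continuousOn).integrable_of_hasCompactSupport
    (μ := volume) hdc.mul_right
  have i2 := (continuous_mul_of_tsupport hV hψ.continuous hs hzd).integrable_of_hasCompactSupport
    (μ := volume) hψc.mul_right
  have i3 := (continuous_mul_of_tsupport hV hψ.continuous hs hz.continuousOn).integrable_of_hasCompactSupport
    (μ := volume) hψc.mul_right
  exact integral_mul_fderiv_eq_neg_fderiv_mul_of_integrable i1 i2 i3
    (fun x _ => hψ.differentiable (by simp) x)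
    (fun x hx => (hz.contDiffAt (hV.mem_nhds (hs hx))).differentiableAt (by simp))

/-- Green's identity against a compactly supported test function. -/
lemma green_identity (hV : IsOpen V) {ψ z : E → ℝ}
    (hψ : ContDiff ℝ 2 ψ) (hψc : HasCompactSupport ψ) (hs : tsupport ψ ⊆ V)
    (hz : ContDiffOn ℝ 2 z V) : ∫ x, ψ x * lap z x = ∫ x, lap ψ x * z x := by
  have hψ1 : ContDiff ℝ 1 ψ := hψ.of_le (by norm_num)
  have hz1 : ContDiffOn ℝ 1 z V := hz.of_le (by norm_num)
  have dψ : ∀ v, ContDiff ℝ 1 (fun x => fderiv ℝ ψ x v) := fun v =>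
    (hψ.fderiv_right (m := 1) (by norm_num)).clm_apply contDiff_const
  have dz : ∀ v, ContDiffOn ℝ 1 (fun x => fderiv ℝ z x v) V := fun v =>
    (hz.fderiv_of_isOpen hV (m := 1) (by norm_num)).clm_apply contDiffOn_const
  have hs' : ∀ v, tsupport (fun x => fderiv ℝ ψ x v) ⊆ tsupport ψ :=
    fun v => tsupport_fderiv_apply_subset ℝ v
  have hdc : ∀ v, HasCompactSupport (fun x => fderiv ℝ ψ x v) := fun v => hψc.fderiv_apply ℝ v
  have key : ∀ v, ∫ x, ψ x * fderiv ℝ (fun y => fderiv ℝ z y v) x v =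
      ∫ x, fderiv ℝ (fun y => fderiv ℝ ψ y v) x v * z x := by
    intro v
    rw [integral_mul_fderiv_of_tsupport hV hψ1 hψc hs (dz v) v,
      integral_mul_fderiv_of_tsupport hV (dψ v) (hdc v) ((hs' v).trans hs) hz1 v, neg_neg]
  unfold lap
  simp only [Finset.mul_sum, Finset.sum_mul]
  rw [integral_finsetSum, integral_finsetSum]
  · exact Finset.sum_congr rfl fun i _ => key _
  · intro i _
    have hc : Continuous (fun x => fderiv ℝ (fun y => fderiv ℝ ψ y (EuclideanSpace.single i 1)) x
        (EuclideanSpace.single i 1)) :=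
      ((dψ _).continuous_fderiv (by simp)).clm_apply continuous_const
    have hts := (tsupport_fderiv_apply_subset ℝ (f := fun y => fderiv ℝ ψ y (EuclideanSpace.single i 1))
      (EuclideanSpace.single i 1)).trans ((hs' _).trans hs)
    exact (continuous_mul_of_tsupport hV hc hts hz.continuousOn).integrable_of_hasCompactSupport
      ((hdc _).fderiv_apply ℝ _).mul_right
  · intro i _
    have hc : ContinuousOn (fun x => fderiv ℝ (fun y => fderiv ℝ z y (EuclideanSpace.single i 1)) x
        (EuclideanSpace.single i 1)) V :=
      ((dz _).continuousOn_fderiv_of_isOpen hV le_rfl).clm_apply continuousOn_const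
    exact (continuous_mul_of_tsupport hV hψ.continuous hs hc).integrable_of_hasCompactSupport
      hψc.mul_right

lemma lap_comp_sub (g : E → ℝ) (a x : E) : lap (fun y => g (y - a)) x = lap g (x - a) := by
  unfold lap
  simp only [fderiv_comp_sub]
  refine Finset.sum_congr rfl fun i _ => ?_
  rw [fderiv_comp_sub (f := fun z => fderiv ℝ g z (EuclideanSpace.single i 1)) a]

lemma continuous_lap {P : E → ℝ} (hP : ContDiff ℝ 2 P) : Continuous (fun x => lap P x) := by
  unfold lap
  refine continuous_finsetSum _ fun i _ => ?_
  have h : ContDiff ℝ 1 (fun x => fderiv ℝ P x (EuclideanSpace.single i 1)) :=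
    (hP.fderiv_right (m := 1) (by norm_num)).clm_apply contDiff_const
  exact (h.continuous_fderiv (by simp)).clm_apply continuous_const

lemma lap_hasCompactSupport {P : E → ℝ} (hP : HasCompactSupport P) :
    HasCompactSupport (fun x => lap P x) := by
  refine hP.mono' fun x hx => ?_
  by_contra hx'
  refine hx ?_
  have h0 : P =ᶠ[𝓝 x] fun _ => 0 := by
    filter_upwards [(isClosed_tsupport P).isOpen_compl.mem_nhds hx'] with p hp
    exact image_eq_zero_of_notMem_tsupport hp
  show lap P x = 0
  rw [lap_congr h0, lap_const]

lemma lap_heat_eq_heat_lap {P : E → ℝ} (hP : ContDiff ℝ 2 P) (hPc : HasCompactSupport P)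
    (hs : 0 < s) (x : E) : lap (fun y => heat P s y) x = heat (fun y => lap P y) s x := by
  rw [lap_heat hP.continuous hPc hs, heat_eq_conv _ hs]
  have hz : ContDiff ℝ 2 (fun y : E => gauss s (y - x)) :=
    (contDiff_gauss s (m := 2)).comp (contDiff_id.sub contDiff_const)
  have h := green_identity isOpen_univ hP hPc (subset_univ _) hz.contDiffOn
  have e : ∀ y : E, gauss s (y - x) = gauss s (x - y) := fun y => by rw [← gauss_neg_arg, neg_sub]
  have e2 : ∀ y : E, lap (fun y => gauss s (y - x)) y = gauss s (x - y) * gaussRate s (x - y) := by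
    intro y
    rw [lap_comp_sub (fun z => gauss s z), lap_gauss hs, e]
    unfold gaussRate
    rw [norm_sub_rev]
  simp only [e2] at h
  simp only [e] at h
  exact h

lemma heat_hasDerivWithinAt_zero {P : E → ℝ} (hP : ContDiff ℝ 2 P)
    (hPc : HasCompactSupport P) (x : E) :
    HasDerivWithinAt (fun h => heat P h x) (lap P x) (Ici 0) 0 := by
  obtain ⟨M, hM⟩ := exists_abs_le_of_hasCompactSupport hP.continuous hPc
  obtain ⟨M', hM'⟩ := exists_abs_le_of_hasCompactSupport (continuous_lap hP) (lap_hasCompactSupport hPc)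
  have hc : Continuous (fun h => heat P h x) :=
    (heat_continuous hP.continuous hM).comp (f := fun h : ℝ => (x, h)) (by fun_prop)
  have hc' : Continuous (fun h => heat (fun y => lap P y) h x) :=
    (heat_continuous (continuous_lap hP) hM').comp (f := fun h : ℝ => (x, h)) (by fun_prop)
  have hd : ∀ h > 0, HasDerivAt (fun h => heat P h x) (heat (fun y => lap P y) h x) h := by
    intro h hh
    rw [← lap_heat_eq_heat_lap hP hPc hh]
    exact heat_hasDerivAt hP.continuous hPc hh x
  refine hasDerivWithinAt_Ici_of_tendsto_deriv (s := Ioi 0)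
    (fun h hh => (hd h hh).differentiableAt.differentiableWithinAt) hc.continuousWithinAt
    self_mem_nhdsWithin ?_
  have h1 : Tendsto (fun h => heat (fun y => lap P y) h x) (𝓝[>] 0) (𝓝 (lap P x)) := by
    have := hc'.tendsto 0
    rw [heat_zero] at this
    exact this.mono_left nhdsWithin_le_nhds
  refine h1.congr' ?_
  filter_upwards [self_mem_nhdsWithin] with h hh
  exact (hd h hh).deriv.symm

lemma hasDerivAt_of_hasDerivWithinAt_right {g v : ℝ → ℝ} (hg : ContinuousOn g (Ioo α β))
    (hv : ContinuousOn v (Ioo α β)) (h : ∀ t ∈ Ioo α β, HasDerivWithinAt g (v t) (Ici t) t)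
    (ht : t ∈ Ioo α β) : HasDerivAt g (v t) t := by
  obtain ⟨a, ha, hat⟩ := exists_between ht.1
  obtain ⟨b, htb, hb⟩ := exists_between ht.2
  have hI : Icc a b ⊆ Ioo α β := fun s hs => ⟨ha.trans_le hs.1, hs.2.trans_lt hb⟩
  have hint : ∀ s ∈ Icc a b, IntervalIntegrable v volume a s := fun s hs =>
    (hv.mono (by rw [uIcc_of_le hs.1]; exact (Icc_subset_Icc_right hs.2).trans hI)).intervalIntegrable
  have hd : ∀ s ∈ Icc a b, HasDerivAt (fun u => ∫ τ in a..u, v τ) (v s) s := fun s hs =>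
    intervalIntegral.integral_hasDerivAt_right (hint s hs)
      (hv.stronglyMeasurableAtFilter isOpen_Ioo s (hI hs))
      (hv.continuousAt (isOpen_Ioo.mem_nhds (hI hs)))
  have hconst := constant_of_has_deriv_right_zero (f := fun s => g s - ∫ τ in a..s, v τ) (a := a) (b := b)
    ((hg.mono hI).sub fun s hs => (hd s hs).continuousAt.continuousWithinAt)
    (fun s hs => ((h s (hI ⟨hs.1, hs.2.le⟩)).sub
      (hd s ⟨hs.1, hs.2.le⟩).hasDerivWithinAt).congr_deriv (by simp))
  have he : g =ᶠ[𝓝 t] fun s => (∫ τ in a..s, v τ) + g a := by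
    filter_upwards [Ioo_mem_nhds hat htb] with s hs
    have := hconst s ⟨hs.1.le, hs.2.le⟩
    simp only [intervalIntegral.integral_same, sub_zero] at this
    linarith
  exact ((hd t ⟨hat.le, htb.le⟩).add_const (g a)).congr_of_eventuallyEq he

/-- Local data for interior regularity at every point of a space-time cylinder. -/
def LocInterior (U : Set E) (α β : ℝ) (w f : E → ℝ → ℝ) : Prop :=
  ∀ x ∈ U, ∀ t ∈ Ioo α β, ∃ α' β' ρ A₀ M L θ, t ∈ Ioo α' β' ∧ Ioo α' β' ⊆ Ioo α β ∧
    InteriorData U α' β' w f x ρ A₀ M L θ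

section regularity

variable {f : EuclideanSpace ℝ (Fin n) → ℝ → ℝ}

lemma LocInterior.exists_hasFDerivAt (h : LocInterior U α β w f) (hx : x ∈ U) (ht : t ∈ Ioo α β) :
    ∃ (ρ α' : ℝ) (β' : ℝ) (G' : E → ℝ → E →L[ℝ] ℝ)
    (G'' : E → ℝ → E →L[ℝ] E →L[ℝ] ℝ), 0 < ρ ∧ t ∈ Ioo α' β' ∧ ball x ρ ⊆ U ∧
    (∀ y ∈ ball x ρ, ∀ s ∈ Ioo α' β',
    HasFDerivAt (fun y => w y s) (G' y s) y ∧ HasFDerivAt (fun y => G' y s) (G'' y s) y) ∧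
    ContinuousOn ♯G'' (ball x ρ ×ˢ Ioo α' β') := by
  obtain ⟨α', β', ρ, A₀, M, L, θ, ht', -, D⟩ := h x hx t ht
  obtain ⟨g, hg0, hg1, hg⟩ : ∃ g : ℝ, 0 < g ∧ g ≤ 1 ∧ g ^ 8 < t - α' := by
    refine ⟨min 1 ((t - α') / 2), lt_min one_pos (by linarith [ht'.1]), min_le_left _ _, ?_⟩
    have h0 : 0 < min 1 ((t - α') / 2) := lt_min one_pos (by linarith [ht'.1])
    have h1 := pow_le_pow_of_le_one h0.le (min_le_left _ _) (by norm_num : 1 ≤ 8)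
    rw [pow_one] at h1
    have h2 := min_le_right 1 ((t - α') / 2)
    linarith [ht'.1]
  obtain ⟨G', G'', h1, h2⟩ := D.exists_hasFDerivAt hg0 hg1
  have hρ := D.rho_pos
  exact ⟨ρ, α' + g ^ 8, β', G', G'', hρ, ⟨by linarith, ht'.2⟩,
    (ball_subset_closedBall.trans
      (closedBall_subset_closedBall (by linarith))).trans D.sub, h1, h2⟩

lemma LocInterior.contDiffOn (h : LocInterior U α β w f) (ht : t ∈ Ioo α β) :
    ContDiffOn ℝ 2 (fun y => w y t) U := by
  intro x hx
  obtain ⟨ρ, α', β', G', G'', hρ, ht', -, h1, h2⟩ := h.exists_hasFDerivAt hx ht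
  have := contDiff_two_of_hasFDerivAt (f := fun y => w y t) (f' := fun y => G' y t)
    (f'' := fun y => G'' y t) (fun y hy => (h1 y hy t ht').1) (fun y hy => (h1 y hy t ht').2)
    (h2.comp (f := fun y : E => (y, t)) (by fun_prop) (fun y hy => ⟨hy, ht'⟩))
  exact (this.contDiffAt (ball_mem_nhds x hρ)).contDiffWithinAt

lemma LocInterior.continuousOn_lap (h : LocInterior U α β w f) :
    ContinuousOn (fun p : Q => lap (fun y => w y p.2) p.1) (U ×ˢ Ioo α β) := by
  rintro ⟨x, t⟩ ⟨hx, ht⟩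
  obtain ⟨ρ, α', β', G', G'', hρ, ht', -, h1, h2⟩ := h.exists_hasFDerivAt hx ht
  have hn : ball x ρ ×ˢ Ioo α' β' ∈ 𝓝 (x, t) :=
    prod_mem_nhds (ball_mem_nhds x hρ) (isOpen_Ioo.mem_nhds ht')
  refine ContinuousAt.continuousWithinAt ?_
  have h3 : ContinuousAt (fun p : Q => ∑ i, G'' p.1 p.2 (cvec i) (cvec i)) (x, t) := by
    have hG := h2.continuousAt hn
    exact tendsto_finsetSum _ fun i _ =>
      ((hG.clm_apply continuousAt_const).clm_apply continuousAt_const)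
  refine h3.congr ?_
  filter_upwards [hn] with p hp
  rw [lap_eq_sum (f' := fun y => G' y p.2) _ (h1 p.1 hp.1 p.2 hp.2).2]
  filter_upwards [isOpen_ball.mem_nhds hp.1] with y hy
  exact (h1 y hy p.2 hp.2).1

lemma LocInterior.hasDerivWithinAt_right (h : LocInterior U α β w f) (hx : x ∈ U) (ht : t ∈ Ioo α β) : HasDerivWithinAt (w x) (lap (fun y => w y t) x + f x t) (Ici t) t := by
  obtain ⟨α', β', ρ, A₀, M, L, θ, ht', -, D⟩ := h x hx t ht
  have hρ := D.rho_pos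
  have hθ := D.theta_pos
  obtain ⟨χ, hχ2, hχc, hχs, hχ0, hχ1, hχe⟩ := exists_cutoff x (R := 3 * ρ) (R' := 4 * ρ)
    (by positivity) (by linarith)
  have hFs : ContDiff ℝ 2 (fun y => χ y * w y t) :=
    contDiff_mul_of_tsupport D.isOpen hχ2 (hχs.trans D.sub) (h.contDiffOn ht)
  have hxx : ∀ r, 0 ≤ r → x ∈ closedBall x r := fun r hr => mem_closedBall_self hr
  have hlap : lap (fun y => χ y * w y t) x = lap (fun y => w y t) x := by
    refine lap_congr ?_
    filter_upwards [closedBall_mem_nhds x (by positivity : 0 < 3 * ρ)] with y hy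
    rw [hχe y hy, one_mul]
  have hd1 : HasDerivWithinAt (fun τ => heat (fun y => χ y * w y t) (τ - t) x)
      (lap (fun y => w y t) x) (Ici t) t := by
    have h0 := heat_hasDerivWithinAt_zero hFs hχc.mul_right x
    rw [hlap] at h0
    have h1 : HasDerivWithinAt (fun τ : ℝ => τ - t) 1 (Ici t) t :=
      ((hasDerivAt_id t).sub_const t).hasDerivWithinAt
    have h2 := HasDerivWithinAt.scomp_of_eq (h := fun τ : ℝ => τ - t) (t' := Ici 0) t h0 h1
      (fun τ hτ => by simpa using hτ) (by simp)
    exact h2.congr_deriv (by simp)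
  have hfc : ContinuousOn (f x) (Ioo α' β') :=
    D.contf.comp (f := fun t : ℝ => (x, t)) (by fun_prop) (fun s hs => ⟨hx, hs⟩)
  have hd2 : HasDerivWithinAt (fun τ => ∫ s in t..τ, f x s) (f x t) (Ici t) t :=
    (intervalIntegral.integral_hasDerivAt_right (by simp)
      (hfc.stronglyMeasurableAtFilter isOpen_Ioo t ht')
      (hfc.continuousAt (isOpen_Ioo.mem_nhds ht'))).hasDerivWithinAt
  have hR : HasDerivWithinAt (fun τ => w x τ - (heat (fun y => χ y * w y t) (τ - t) x +
      ∫ s in t..τ, f x s)) 0 (Ici t) t := by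
    rw [hasDerivWithinAt_iff_isLittleO]
    refine Asymptotics.IsLittleO.of_bound fun c hc => ?_
    have hlim : Tendsto (fun τ : ℝ => stepC n ρ A₀ M L θ * ((τ - t) ^ ((1:ℝ) / 8)) ^ θ) (𝓝 t) (𝓝 0) := by
      have : ContinuousAt (fun τ : ℝ => stepC n ρ A₀ M L θ * ((τ - t) ^ ((1:ℝ) / 8)) ^ θ) t := by
        refine continuousAt_const.mul (ContinuousAt.rpow_const ?_ (Or.inr hθ.le))
        exact ContinuousAt.rpow_const (by fun_prop) (Or.inr (by norm_num))
      simpa [ContinuousAt, zero_rpow hθ.ne'] using this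
    filter_upwards [self_mem_nhdsWithin, mem_nhdsWithin_of_mem_nhds (hlim.eventually (gt_mem_nhds hc)),
      mem_nhdsWithin_of_mem_nhds (gt_mem_nhds ht'.2),
      mem_nhdsWithin_of_mem_nhds (gt_mem_nhds (lt_add_one t))] with τ h1 h2 h3 h4
    have hχx : χ x = 1 := hχe x (hxx _ (by positivity))
    have hz : w x t - (heat (fun y => χ y * w y t) (t - t) x + ∫ s in t..t, f x s) = 0 := by
      rw [sub_self, heat_zero, intervalIntegral.integral_same, hχx]; ring
    rw [hz, smul_zero, sub_zero, sub_zero]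
    rcases eq_or_lt_of_le (show t ≤ τ from h1) with rfl | hlt
    · rw [hz]; simp
    set g := (τ - t) ^ ((1:ℝ) / 8) with hg
    have hpos : 0 < τ - t := by linarith
    have hg0 : 0 < g := rpow_pos_of_pos hpos _
    have hg1 : g ≤ 1 := rpow_le_one hpos.le (by linarith) (by norm_num)
    have hg8 : g ^ 8 = τ - t := by rw [hg, ← rpow_natCast, ← rpow_mul hpos.le]; norm_num
    have hsb := step_bound D hχ2.continuous hχc hχs hχ0 hχ1 hχe (hxx ρ hρ.le) hg0 hg1 ht'.1
      (by rw [hg8]; linarith) x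
    rw [hg8, add_sub_cancel, hχx, one_mul, sub_self, norm_zero] at hsb
    norm_num at hsb
    rw [Real.norm_eq_abs, Real.norm_eq_abs, abs_of_pos hpos, abs_sub_comm]
    calc _ = |heat (fun y => χ y * w y t) (τ - t) x - w x τ + ∫ s in t..τ, f x s| := by congr 1; ring
      _ ≤ _ := hsb
      _ ≤ c * (τ - t) := by gcongr
  have := hR.add (hd1.add hd2)
  refine (this.congr_deriv (by ring)).congr (fun τ _ => ?_) ?_
  · simp
  · simp

lemma LocInterior.hasDerivAt (hc : ContinuousOn ♯w (U ×ˢ Ioo α β))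
    (hf : ContinuousOn ♯f (U ×ˢ Ioo α β))
    (h : LocInterior U α β w f) (hx : x ∈ U) (ht : t ∈ Ioo α β) : HasDerivAt (w x) (lap (fun y => w y t) x + f x t) t := by
  have hcx : ContinuousOn (fun s : ℝ => (x, s)) (Ioo α β) := by fun_prop
  have hm : MapsTo (fun s : ℝ => (x, s)) (Ioo α β) (U ×ˢ Ioo α β) := fun s hs => ⟨hx, hs⟩
  exact hasDerivAt_of_hasDerivWithinAt_right (v := fun t => lap (fun y => w y t) x + f x t)
    (hc.comp hcx hm) ((h.continuousOn_lap.comp hcx hm).add (hf.comp hcx hm))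
    (fun s hs => h.hasDerivWithinAt_right hx hs) ht

lemma InteriorData.of_holder (hU : IsOpen U)
    (hc : ContinuousOn ♯w (U ×ˢ Ioo α β))
    (hf : ContinuousOn ♯f (U ×ˢ Ioo α β)) (hw : HeatSol U α β w f)
    (hH : ∀ x ∈ U, ∀ t ∈ Ioo α β, ∃ θ L δ : ℝ, 0 < θ ∧ θ ≤ 1 ∧ 0 < δ ∧
    ∀ y ∈ ball x δ, ∀ z ∈ ball x δ, ∀ s ∈ ball t δ,
    |f y s - f z s| ≤ L * ‖y - z‖ ^ θ) : LocInterior U α β w f := by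
  intro x hx t ht
  obtain ⟨θ, L, δ, hθ, hθ1, hδ, hL⟩ := hH x hx t ht
  obtain ⟨ε, hε, hεU⟩ := Metric.isOpen_iff.1 hU x hx
  obtain ⟨ε', hε', hεt⟩ := Metric.isOpen_iff.1 isOpen_Ioo t ht
  set ρ := min δ ε / 8 with hρ
  have hρ0 : 0 < ρ := by have := lt_min hδ hε; positivity
  set σ := min δ ε' / 2 with hσ
  have hσ0 : 0 < σ := by have := lt_min hδ hε'; positivity
  have h4 : closedBall x (4 * ρ) ⊆ ball x δ ∩ ball x ε := fun y hy => by
    have h1 := mem_closedBall.1 hy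
    have h2 := min_le_left δ ε
    have h3 := min_le_right δ ε
    have h4 := lt_min hδ hε
    exact ⟨mem_ball.2 (by linarith), mem_ball.2 (by linarith)⟩
  have hs : Icc (t - σ) (t + σ) ⊆ ball t δ ∩ ball t ε' := fun s hs => by
    have h2 := min_le_left δ ε'
    have h3 := min_le_right δ ε'
    have h4 := lt_min hδ hε'
    have h5 : |s - t| ≤ σ := abs_le.2 ⟨by linarith [hs.1], by linarith [hs.2]⟩
    exact ⟨by rw [mem_ball, Real.dist_eq]; linarith, by rw [mem_ball, Real.dist_eq]; linarith⟩
  have hsI : Ioo (t - σ) (t + σ) ⊆ Ioo α β := fun s hs' => hεt (hs (Ioo_subset_Icc_self hs')).2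
  have hK : IsCompact (closedBall x (4 * ρ) ×ˢ Icc (t - σ) (t + σ)) :=
    (isCompact_closedBall x _).prod isCompact_Icc
  have hKs : closedBall x (4 * ρ) ×ˢ Icc (t - σ) (t + σ) ⊆ U ×ˢ Ioo α β :=
    prod_mono (fun y hy => hεU (h4 hy).2) (fun s hs' => hεt (hs hs').2)
  obtain ⟨M, hM⟩ := hK.exists_bound_of_continuousOn (hc.mono hKs)
  obtain ⟨A₀, hA⟩ := hK.exists_bound_of_continuousOn (hf.mono hKs)
  have hxt : (x, t) ∈ closedBall x (4 * ρ) ×ˢ Icc (t - σ) (t + σ) :=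
    ⟨mem_closedBall_self (by positivity), by constructor <;> linarith⟩
  refine ⟨t - σ, t + σ, ρ, A₀, M, max L 0, θ, ⟨by linarith, by linarith⟩, hsI, ?_⟩
  have hUs : U ×ˢ Ioo (t - σ) (t + σ) ⊆ U ×ˢ Ioo α β := prod_mono le_rfl hsI
  have hne : (Ioo (t - σ) (t + σ)).Nonempty := ⟨t, by linarith, by linarith⟩
  have hαβ := (Ioo_subset_Ioo_iff (by linarith : t - σ < t + σ)).1 hsI
  exact
  { isOpen := hU
    cont := hc.mono hUs
    contf := hf.mono hUs
    sol := hw.mono le_rfl hαβ.1 hαβ.2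
    rho_pos := hρ0
    sub := fun y hy => hεU (h4 hy).2
    boundf := fun y hy s hs' => hA (y, s) ⟨hy, Ioo_subset_Icc_self hs'⟩
    bound := fun y hy s hs' => hM (y, s) ⟨hy, Ioo_subset_Icc_self hs'⟩
    theta_pos := hθ
    theta_le := hθ1
    holder_nonneg := le_max_right _ _
    M_nonneg := (norm_nonneg _).trans (hM _ hxt)
    A_nonneg := (norm_nonneg _).trans (hA _ hxt)
    holder := fun y hy z hz s hs' => (hL y (h4 hy).1 z (h4 hz).1 s (hs (Ioo_subset_Icc_self hs')).1).trans
      (mul_le_mul_of_nonneg_right (le_max_left _ _) (by positivity)) }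

end regularity

lemma abs_rpow_sub_rpow_le_of_le_one {x y : ℝ} (hx : 0 ≤ x) (hy : 0 ≤ y) (hr : 0 ≤ r)
    (hr1 : r ≤ 1) : |x ^ r - y ^ r| ≤ |x - y| ^ r := by
  wlog h : y ≤ x generalizing x y
  · rw [abs_sub_comm, abs_sub_comm x]; exact this hy hx (not_le.1 h).le
  have h1 := Real.rpow_add_le_add_rpow (sub_nonneg.2 h) hy hr hr1
  have h2 := Real.rpow_le_rpow hy h hr
  rw [sub_add_cancel] at h1
  rw [abs_of_nonneg (by linarith), abs_of_nonneg (by linarith)]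
  linarith

lemma abs_rpow_sub_rpow_le_of_one_le {x y L : ℝ} (hx : x ∈ Icc 0 L) (hy : y ∈ Icc 0 L)
    (hr : 1 ≤ r) : |x ^ r - y ^ r| ≤ r * L ^ (r - 1) * |x - y| := by
  have := Convex.norm_image_sub_le_of_norm_hasDerivWithin_le (f := fun x : ℝ => x ^ r)
    (f' := fun x => r * x ^ (r - 1)) (C := r * L ^ (r - 1)) (s := Icc 0 L)
    (fun z _ => (Real.hasDerivAt_rpow_const (Or.inr hr)).hasDerivWithinAt)
    (fun z hz => by
      rw [Real.norm_of_nonneg (mul_nonneg (by linarith) (Real.rpow_nonneg hz.1 _))]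
      exact mul_le_mul_of_nonneg_left (Real.rpow_le_rpow hz.1 hz.2 (by linarith)) (by linarith))
    (convex_Icc _ _) hy hx
  simpa [Real.norm_eq_abs] using this

/-- Local boundedness and Hölder continuity in space, uniformly in time. -/
def SpaceHolderAt (f : E → ℝ → ℝ) (x : E) (t : ℝ) : Prop :=
  ∃ θ L δ : ℝ, 0 < θ ∧ θ ≤ 1 ∧ 0 < δ ∧ δ ≤ 1 / 2 ∧ 0 ≤ L ∧
    (∀ y ∈ ball x δ, ∀ z ∈ ball x δ, ∀ s ∈ ball t δ,
      |f y s - f z s| ≤ L * ‖y - z‖ ^ θ) ∧ ∀ y ∈ ball x δ, ∀ s ∈ ball t δ, |f y s| ≤ L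

section

variable {f g : EuclideanSpace ℝ (Fin n) → ℝ → ℝ}

lemma norm_sub_le_one_of_mem_ball {z : E} (hδ : δ ≤ 1 / 2) (hy : y ∈ ball x δ)
    (hz : z ∈ ball x δ) : ‖y - z‖ ≤ 1 := by
  rw [← dist_eq_norm]
  have := dist_triangle_right y z x
  rw [mem_ball] at hy hz
  linarith

lemma SpaceHolderAt.pair (hf : SpaceHolderAt f x t) (hg : SpaceHolderAt g x t) :
    ∃ θ L δ : ℝ, 0 < θ ∧ θ ≤ 1 ∧ 0 < δ ∧ δ ≤ 1 / 2 ∧ 0 ≤ L ∧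
    (∀ y ∈ ball x δ, ∀ z ∈ ball x δ, ∀ s ∈ ball t δ,
    |f y s - f z s| ≤ L * ‖y - z‖ ^ θ ∧ |g y s - g z s| ≤ L * ‖y - z‖ ^ θ) ∧
    ∀ y ∈ ball x δ, ∀ s ∈ ball t δ, |f y s| ≤ L ∧ |g y s| ≤ L := by
  obtain ⟨θ, L, δ, h1, h2, h3, h4, h5, h6, h7⟩ := hf
  obtain ⟨θ', L', δ', h1', h2', h3', h4', h5', h6', h7'⟩ := hg
  have b1 : ball x (min δ δ') ⊆ ball x δ := ball_subset_ball (min_le_left _ _)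
  have b2 : ball x (min δ δ') ⊆ ball x δ' := ball_subset_ball (min_le_right _ _)
  have c1 : ball t (min δ δ') ⊆ ball t δ := ball_subset_ball (min_le_left _ _)
  have c2 : ball t (min δ δ') ⊆ ball t δ' := ball_subset_ball (min_le_right _ _)
  refine ⟨min θ θ', max L L', min δ δ', lt_min h1 h1', (min_le_left _ _).trans h2, lt_min h3 h3',
    (min_le_left _ _).trans h4, h5.trans (le_max_left _ _), ?_, ?_⟩
  · intro y hy z hz s hs
    have hn := norm_sub_le_one_of_mem_ball h4 (b1 hy) (b1 hz)
    constructor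
    · refine (h6 y (b1 hy) z (b1 hz) s (c1 hs)).trans ?_
      exact mul_le_mul (le_max_left _ _) (Real.rpow_le_rpow_of_exponent_ge' (norm_nonneg _) hn
        (lt_min h1 h1').le (min_le_left _ _)) (by positivity) (h5.trans (le_max_left _ _))
    · refine (h6' y (b2 hy) z (b2 hz) s (c2 hs)).trans ?_
      exact mul_le_mul (le_max_right _ _) (Real.rpow_le_rpow_of_exponent_ge' (norm_nonneg _) hn
        (lt_min h1 h1').le (min_le_right _ _)) (by positivity) (h5.trans (le_max_left _ _))
  · intro y hy s hs
    exact ⟨(h7 y (b1 hy) s (c1 hs)).trans (le_max_left _ _),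
      (h7' y (b2 hy) s (c2 hs)).trans (le_max_right _ _)⟩

lemma SpaceHolderAt.sub (hf : SpaceHolderAt f x t) (hg : SpaceHolderAt g x t) :
    SpaceHolderAt (fun y s => f y s - g y s) x t := by
  obtain ⟨θ, L, δ, h1, h2, h3, h4, h5, h6, h7⟩ := hf.pair hg
  refine ⟨θ, 2 * L, δ, h1, h2, h3, h4, by linarith, ?_, ?_⟩
  · intro y hy z hz s hs
    obtain ⟨e1, e2⟩ := h6 y hy z hz s hs
    have : f y s - g y s - (f z s - g z s) = (f y s - f z s) - (g y s - g z s) := by ring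
    rw [this]
    refine (abs_sub _ _).trans ?_
    linarith
  · intro y hy s hs
    obtain ⟨e1, e2⟩ := h7 y hy s hs
    refine (abs_sub _ _).trans ?_
    linarith

lemma SpaceHolderAt.mul (hf : SpaceHolderAt f x t) (hg : SpaceHolderAt g x t) :
    SpaceHolderAt (fun y s => f y s * g y s) x t := by
  obtain ⟨θ, L, δ, h1, h2, h3, h4, h5, h6, h7⟩ := hf.pair hg
  refine ⟨θ, 2 * L * L + L * L, δ, h1, h2, h3, h4, by positivity, ?_, ?_⟩
  · intro y hy z hz s hs
    obtain ⟨e1, e2⟩ := h6 y hy z hz s hs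
    have e3 := (h7 y hy s hs).1
    have e4 := (h7 z hz s hs).2
    have : f y s * g y s - f z s * g z s = f y s * (g y s - g z s) + (f y s - f z s) * g z s := by
      ring
    rw [this]
    refine (abs_add_le _ _).trans ?_
    rw [abs_mul, abs_mul]
    have m1 := mul_le_mul e3 e2 (abs_nonneg _) h5
    have m2 := mul_le_mul e1 e4 (abs_nonneg _) (by positivity)
    have : 0 ≤ L * L * ‖y - z‖ ^ θ := by positivity
    linarith
  · intro y hy s hs
    obtain ⟨e1, e2⟩ := h7 y hy s hs
    rw [abs_mul]
    have m1 := mul_le_mul e1 e2 (abs_nonneg _) h5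
    nlinarith

lemma SpaceHolderAt.rpow (hf : SpaceHolderAt f x t)
    (h0 : ∀ᶠ z : E × ℝ in 𝓝 (x, t), 0 ≤ f z.1 z.2) (hr : 0 < r) :
    SpaceHolderAt (fun y s => f y s ^ r) x t := by
  obtain ⟨θ, L, δ, h1, h2, h3, h4, h5, h6, h7⟩ := hf
  obtain ⟨ε, hε, hb⟩ := Metric.eventually_nhds_iff_ball.1 h0
  have hb' : ∀ y ∈ ball x ε, ∀ s ∈ ball t ε, 0 ≤ f y s := fun y hy s hs =>
    hb (y, s) (by rw [← ball_prod_same]; exact ⟨hy, hs⟩)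
  have b1 : ball x (min δ ε) ⊆ ball x δ := ball_subset_ball (min_le_left _ _)
  have b2 : ball x (min δ ε) ⊆ ball x ε := ball_subset_ball (min_le_right _ _)
  have c1 : ball t (min δ ε) ⊆ ball t δ := ball_subset_ball (min_le_left _ _)
  have c2 : ball t (min δ ε) ⊆ ball t ε := ball_subset_ball (min_le_right _ _)
  have hbd : ∀ y ∈ ball x (min δ ε), ∀ s ∈ ball t (min δ ε), |f y s ^ r| ≤ L ^ r := by
    intro y hy s hs
    have e0 := hb' y (b2 hy) s (c2 hs)
    rw [abs_of_nonneg (Real.rpow_nonneg e0 _)]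
    exact Real.rpow_le_rpow e0 ((le_abs_self _).trans (h7 y (b1 hy) s (c1 hs))) hr.le
  rcases le_total r 1 with hr1 | hr1
  · refine ⟨θ * r, L ^ r, min δ ε, by positivity, by nlinarith, lt_min h3 hε,
      (min_le_left _ _).trans h4, by positivity, ?_, hbd⟩
    intro y hy z hz s hs
    refine (abs_rpow_sub_rpow_le_of_le_one (hb' y (b2 hy) s (c2 hs)) (hb' z (b2 hz) s (c2 hs))
      hr.le hr1).trans ?_
    rw [Real.rpow_mul (norm_nonneg _), ← Real.mul_rpow h5 (by positivity)]
    exact Real.rpow_le_rpow (abs_nonneg _) (h6 y (b1 hy) z (b1 hz) s (c1 hs)) hr.le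
  · refine ⟨θ, r * L ^ (r - 1) * L + L ^ r, min δ ε, h1, h2, lt_min h3 hε,
      (min_le_left _ _).trans h4, by positivity, ?_, fun y hy s hs => (hbd y hy s hs).trans ?_⟩
    · intro y hy z hz s hs
      refine (abs_rpow_sub_rpow_le_of_one_le (L := L)
        ⟨hb' y (b2 hy) s (c2 hs), (le_abs_self _).trans (h7 y (b1 hy) s (c1 hs))⟩
        ⟨hb' z (b2 hz) s (c2 hs), (le_abs_self _).trans (h7 z (b1 hz) s (c1 hs))⟩ hr1).trans ?_
      have m := mul_le_mul_of_nonneg_left (h6 y (b1 hy) z (b1 hz) s (c1 hs))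
        (by positivity : 0 ≤ r * L ^ (r - 1))
      have : 0 ≤ L ^ r * ‖y - z‖ ^ θ := by positivity
      linarith
    · have : 0 ≤ r * L ^ (r - 1) * L := by positivity
      linarith

lemma SpaceHolderAt.of_time {I : ℝ → ℝ} (hI : ContinuousAt I t) :
    SpaceHolderAt (fun _ s => I s) x t := by
  obtain ⟨δ, hδ, h⟩ := Metric.continuousAt_iff.1 hI 1 one_pos
  refine ⟨1, |I t| + 1, min δ (1 / 2), one_pos, le_rfl, lt_min hδ (by norm_num), min_le_right _ _,
    by positivity, fun y _ z _ s _ => by rw [sub_self, abs_zero]; positivity, fun y _ s hs => ?_⟩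
  have := h (ball_subset_ball (min_le_left _ _) hs)
  rw [Real.dist_eq] at this
  have h2 := abs_sub_abs_le_abs_sub (I s) (I t)
  linarith

lemma LocHolder.nonneg_const {c : E → ℝ → ℝ} (hc : LocHolder Ω c) :
    ∃ θ : ℝ, 0 < θ ∧ θ < 1 ∧ ∀ M : ℝ, 0 < M → ∃ C : ℝ, 0 ≤ C ∧
    ∀ x ∈ closure Ω, ∀ y ∈ closure Ω, ∀ s ∈ Icc (0:ℝ) M, ∀ t ∈ Icc (0:ℝ) M,
    |c x s - c y t| ≤ C * (dist x y + |s - t|) ^ θ := by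
  obtain ⟨θ, h1, h2, h⟩ := hc
  refine ⟨θ, h1, h2, fun M hM => ?_⟩
  obtain ⟨C, hC⟩ := h M hM
  refine ⟨|C|, abs_nonneg _, fun x hx y hy s hs t ht => (hC x hx y hy s hs t ht).trans ?_⟩
  exact mul_le_mul_of_nonneg_right (le_abs_self _) (by positivity)

lemma LocHolder.continuousOn {c : E → ℝ → ℝ} (hc : LocHolder Ω c) :
    ContinuousOn ♯c (closure Ω ×ˢ Ici 0) := by
  obtain ⟨θ, h1, -, h⟩ := hc.nonneg_const
  rintro ⟨x, t⟩ ⟨hx, ht⟩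
  simp only [mem_Ici] at ht hx
  obtain ⟨C, hC0, hC⟩ := h (t + 1) (by linarith)
  rw [ContinuousWithinAt, tendsto_iff_dist_tendsto_zero]
  have hlim : Tendsto (fun z : Q => C * (dist z.1 x + |z.2 - t|) ^ θ)
      (𝓝[closure Ω ×ˢ Ici 0] (x, t)) (𝓝 0) := by
    have : Continuous (fun z : Q => C * (dist z.1 x + |z.2 - t|) ^ θ) := by
      refine continuous_const.mul (Continuous.rpow_const (by fun_prop) fun _ => Or.inr h1.le)
    have h2 := this.tendsto (x, t)
    simp only [dist_self, sub_self, abs_zero, add_zero, Real.zero_rpow h1.ne', mul_zero] at h2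
    exact h2.mono_left nhdsWithin_le_nhds
  refine squeeze_zero' (of_forall fun _ => dist_nonneg) ?_ hlim
  have hev : ∀ᶠ z : E × ℝ in 𝓝 (x, t), z.2 < t + 1 :=
    continuous_snd.continuousAt.eventually_lt continuousAt_const (by simp)
  filter_upwards [self_mem_nhdsWithin, nhdsWithin_le_nhds hev] with z hz hz2
  rw [Real.dist_eq]
  exact hC z.1 hz.1 x hx z.2 ⟨hz.2, hz2.le⟩ t ⟨ht, by linarith⟩

lemma SpaceHolderAt.of_locHolder (hΩ : IsOpen Ω) {c : E → ℝ → ℝ}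
    (hc : LocHolder Ω c) (hx : x ∈ Ω) (ht : 0 < t) : SpaceHolderAt c x t := by
  have hcc := hc.continuousOn
  obtain ⟨θ, h1, h2, h⟩ := hc.nonneg_const
  obtain ⟨C, hC0, hC⟩ := h (t + 1) (by linarith)
  obtain ⟨δ, hδ, hU⟩ := Metric.isOpen_iff.1 hΩ x hx
  set d := min (min δ t) (1 / 2) with hd
  have hd1 : d ≤ δ := (min_le_left _ _).trans (min_le_left _ _)
  have hd2 : d ≤ t := (min_le_left _ _).trans (min_le_right _ _)
  have hd3 : d ≤ 1 / 2 := min_le_right _ _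
  have hb : ∀ y ∈ ball x d, y ∈ closure Ω := fun y hy =>
    subset_closure (hU (ball_subset_ball hd1 hy))
  have hT : ∀ s ∈ ball t d, s ∈ Icc 0 (t + 1) ∧ |s - t| ≤ 1 / 2 := fun s hs => by
    rw [mem_ball, Real.dist_eq] at hs
    have := abs_lt.1 hs
    exact ⟨⟨by linarith, by linarith⟩, by linarith⟩
  refine ⟨θ, C + |c x t|, d, h1, h2.le, lt_min (lt_min hδ ht) (by norm_num), hd3, by positivity,
    fun y hy z hz s hs => ?_, fun y hy s hs => ?_⟩
  · have := hC y (hb y hy) z (hb z hz) s (hT s hs).1 s (hT s hs).1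
    rw [sub_self, abs_zero, add_zero, dist_eq_norm] at this
    refine this.trans (mul_le_mul_of_nonneg_right ?_ (by positivity))
    linarith [abs_nonneg (c x t)]
  · have := hC y (hb y hy) x (subset_closure hx) s (hT s hs).1 t ⟨ht.le, by linarith⟩
    have h3 : (dist y x + |s - t|) ^ θ ≤ 1 :=
      Real.rpow_le_one (by positivity) (by linarith [mem_ball.1 hy, (hT s hs).2]) h1.le
    have h4 := abs_sub_abs_le_abs_sub (c y s) (c x t)
    nlinarith

end

lemma HeatSol.spaceHolderAt {f : E → ℝ → ℝ} (hU : IsOpen U)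
    (hc : ContinuousOn ♯w (U ×ˢ Ioo α β))
    (hf : ContinuousOn ♯f (U ×ˢ Ioo α β))
    (hw : HeatSol U α β w f) (hx : x ∈ U) (ht : t ∈ Ioo α β) : SpaceHolderAt w x t := by
  obtain ⟨ε, hε, hεU⟩ := Metric.isOpen_iff.1 hU x hx
  obtain ⟨ε', hε', hεt⟩ := Metric.isOpen_iff.1 isOpen_Ioo t ht
  set σ := ε' / 2 with hσ
  have hσ0 : 0 < σ := by positivity
  set ρ := ε / 8 with hρ
  have hρ0 : 0 < ρ := by positivity
  have h4 : closedBall x (4 * ρ) ⊆ U := fun y hy =>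
    hεU (mem_ball.2 (by linarith [mem_closedBall.1 hy]))
  have hs : Icc (t - σ) (t + σ) ⊆ Ioo α β := fun s hs => hεt (by
    rw [mem_ball, Real.dist_eq, abs_lt]; constructor <;> linarith [hs.1, hs.2])
  have hK : IsCompact (closedBall x (4 * ρ) ×ˢ Icc (t - σ) (t + σ)) :=
    (isCompact_closedBall _ _).prod isCompact_Icc
  obtain ⟨A₀, hA⟩ := hK.exists_bound_of_continuousOn (hf.mono (prod_mono h4 hs))
  obtain ⟨M, hM⟩ := hK.exists_bound_of_continuousOn (hc.mono (prod_mono h4 hs))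
  have hI : Ioo (t - σ) (t + σ) ⊆ Icc (t - σ) (t + σ) := Ioo_subset_Icc_self
  have hM0 : 0 ≤ M := (norm_nonneg _).trans
    (hM (x, t) ⟨mem_closedBall_self (by positivity), by constructor <;> linarith⟩)
  have hA0 : 0 ≤ A₀ := (norm_nonneg _).trans
    (hA (x, t) ⟨mem_closedBall_self (by positivity), by constructor <;> linarith⟩)
  have hC0 : 0 ≤ 2 * modC n ρ M A₀ + gaussC n * M := by
    have := gaussC_pos n
    unfold modC; positivity
  set d := min (min (2 * ρ) (σ / 4)) (1 / 2) with hd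
  have hd1 : d ≤ 2 * ρ := (min_le_left _ _).trans (min_le_left _ _)
  have hd2 : d ≤ σ / 4 := (min_le_left _ _).trans (min_le_right _ _)
  have hd3 : d ≤ 1 / 2 := min_le_right _ _
  have hd0 : 0 < d := lt_min (lt_min (by positivity) (by positivity)) (by norm_num)
  refine ⟨1 / 2, 2 * (2 * modC n ρ M A₀ + gaussC n * M) + M, d, by norm_num, by norm_num, hd0, hd3,
    by positivity, fun y hy z hz s hs' => ?_, fun y hy s hs' => ?_⟩
  · rcases eq_or_ne y z with rfl | hne
    · rw [sub_self, abs_zero]; positivity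
    have hn : 0 < ‖y - z‖ := norm_pos_iff.2 (sub_ne_zero.2 hne)
    have hn1 := norm_sub_le_one_of_mem_ball hd3 hy hz
    have hnd : ‖y - z‖ ≤ 2 * d := by
      rw [← dist_eq_norm]
      have := dist_triangle_right y z x
      linarith [mem_ball.1 hy, mem_ball.1 hz]
    rw [mem_ball, Real.dist_eq, abs_lt] at hs'
    have key := HeatSol.space_modulus (x₀ := x) (ρ := ρ) (A₀ := A₀) (M := M) (α := t - σ)
      (β := t + σ) hU (hc.mono (prod_mono_right (hI.trans hs)))
      (hw.mono subset_rfl (hs (left_mem_Icc.2 (by linarith))).1.le (hs (right_mem_Icc.2 (by linarith))).2.le)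
      hρ0 h4 (fun y hy s hs => hA (y, s) ⟨hy, hI hs⟩) (fun y hy s hs => hM (y, s) ⟨hy, hI hs⟩)
      (x := y) (y := z) (ball_subset_closedBall (ball_subset_ball hd1 hy))
      (ball_subset_closedBall (ball_subset_ball hd1 hz)) (t := s) (h := ‖y - z‖) hn hn1
      (by linarith) (by linarith)
    refine key.trans ?_
    rw [← Real.sqrt_eq_rpow]
    have hsq := Real.mul_self_sqrt hn.le
    have hsp := Real.sqrt_pos.2 hn
    have e1 : (√‖y - z‖)⁻¹ * ‖y - z‖ = √‖y - z‖ := by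
      nth_rewrite 2 [← hsq]
      field_simp
    have e2 : ‖y - z‖ ≤ √‖y - z‖ := by
      have : √‖y - z‖ ≤ 1 := Real.sqrt_le_one.2 hn1
      nlinarith
    rw [e1]
    nlinarith [mul_nonneg hM0 hsp.le, mul_le_mul_of_nonneg_left e2 hC0]
  · have := hM (y, s) ⟨ball_subset_closedBall
      (ball_subset_ball (by linarith) hy), by
        rw [mem_ball, Real.dist_eq, abs_lt] at hs'; constructor <;> linarith⟩
    rw [Real.norm_eq_abs] at this
    simp only at this
    linarith

/-- The reaction term, with the nonlocal factor replaced by a given function of time. -/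
def reac (a b : E → ℝ → ℝ) (r q : ℝ) (I : ℝ → ℝ) (w : E → ℝ → ℝ) (x : E) (t : ℝ) : ℝ :=
  a x t * w x t ^ r * I t - b x t * w x t ^ q

section

variable {I : ℝ → ℝ}

lemma reac_continuousOn {S : Set E} {J : Set ℝ} (ha : LocHolder Ω a) (hb : LocHolder Ω b)
    (hr : 0 < r) (hq : 0 < q) (hS : S ⊆ closure Ω) (hJ : J ⊆ Ici 0) (hI : ContinuousOn I J)
    (hc : ContinuousOn ♯w (S ×ˢ J)) :
    ContinuousOn (fun p : Q => reac a b r q I w p.1 p.2) (S ×ˢ J) := by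
  have h1 := ha.continuousOn.mono (prod_mono hS hJ)
  have h2 := hb.continuousOn.mono (prod_mono hS hJ)
  have h3 : ContinuousOn (fun p : Q => I p.2) (S ×ˢ J) := hI.comp continuousOn_snd fun p hp => hp.2
  exact ((h1.mul (hc.rpow_const fun _ _ => Or.inr hr.le)).mul h3).sub
    (h2.mul (hc.rpow_const fun _ _ => Or.inr hq.le))

lemma HeatSol.locInterior_reac (hΩ : IsOpen Ω) (ha : LocHolder Ω a) (hb : LocHolder Ω b)
    (hr : 0 < r) (hq : 0 < q) (hUo : IsOpen U) (hU : U ⊆ Ω) (hα : 0 ≤ α)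
    (hI : ContinuousOn I (Ioo α β)) (hc : ContinuousOn ♯w (U ×ˢ Ioo α β))
    (h0 : ∀ x ∈ U, ∀ t ∈ Ioo α β, 0 ≤ w x t)
    (hw : HeatSol U α β w (reac a b r q I w)) : LocInterior U α β w (reac a b r q I w) := by
  have hf := reac_continuousOn ha hb hr hq (hU.trans subset_closure)
    (fun t ht => hα.trans ht.1.le) hI hc
  refine InteriorData.of_holder hUo hc hf hw fun x hx t ht => ?_
  have hwH := HeatSol.spaceHolderAt hUo hc hf hw hx ht
  have hev : ∀ᶠ z : E × ℝ in 𝓝 (x, t), 0 ≤ w z.1 z.2 := by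
    filter_upwards [(hUo.prod isOpen_Ioo).mem_nhds (⟨hx, ht⟩ : (x, t) ∈ U ×ˢ Ioo α β)] with z hz
    exact h0 z.1 hz.1 z.2 hz.2
  have ht0 : 0 < t := hα.trans_lt ht.1
  obtain ⟨θ, L, δ, h1, h2, h3, h4, h5, h6, -⟩ :=
    (((SpaceHolderAt.of_locHolder hΩ ha (hU hx) ht0).mul (hwH.rpow hev hr)).mul
    (SpaceHolderAt.of_time (hI.continuousAt (isOpen_Ioo.mem_nhds ht)))).sub
    ((SpaceHolderAt.of_locHolder hΩ hb (hU hx) ht0).mul (hwH.rpow hev hq))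
  exact ⟨θ, L, δ, h1, h2, h3, h6⟩

end

lemma integrableOn_of_closure (hb : Bdd Ω)
    (hf : ContinuousOn f (closure Ω)) : IntegrableOn f Ω :=
  (hf.integrableOn_compact hb.isCompact_closure).mono_set subset_closure

lemma continuousOn_setIntegral {X : Type*} [TopologicalSpace X] {S : Set X}
    (hb : Bdd Ω) (hm : MeasurableSet Ω) {f : X → E → ℝ}
    (hf : ContinuousOn (fun z : X × E => f z.1 z.2) (S ×ˢ closure Ω)) :
    ContinuousOn (fun s => ∫ y in Ω, f s y) S := by
  intro s hs
  have hK := hb.isCompact_closure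
  have hint : ∀ s' ∈ S, IntegrableOn (f s') Ω := fun s' hs' =>
    integrableOn_of_closure hb
      (hf.comp (f := fun y => (s', y)) (by fun_prop) fun y hy => ⟨hs', hy⟩)
  have hfin : volume Ω < ⊤ := (measure_mono subset_closure).trans_lt hK.measure_lt_top
  rw [ContinuousWithinAt, Metric.tendsto_nhds]
  intro ε hε
  set δ := ε / (volume.real Ω + 1) with hδ
  have hvol : 0 ≤ volume.real Ω := measureReal_nonneg
  have hδ0 : 0 < δ := by positivity
  obtain ⟨v, hv, h⟩ := hK.mem_uniformity_of_prod hf hs (Metric.dist_mem_uniformity hδ0)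
  filter_upwards [hv, self_mem_nhdsWithin] with s' hs' hs'S
  rw [Real.dist_eq, ← integral_sub (hint s' hs'S) (hint s hs)]
  have := norm_setIntegral_le_of_norm_le_const (f := fun y => f s' y - f s y) (C := δ) hfin
    (fun y hy => le_of_lt (by
      have := h s' hs' y (subset_closure hy)
      rwa [mem_ofPred_eq, dist_eq_norm] at this))
  rw [Real.norm_eq_abs] at this
  refine this.trans_lt ?_
  rw [hδ, div_mul_eq_mul_div, div_lt_iff₀ (by positivity)]
  nlinarith

/-- A `C²` convex approximation of the positive part. -/
def psi (s : ℝ) : ℝ := max s 0 - arctan (max s 0)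

/-- The derivative of `psi`. -/
def psi1 (s : ℝ) : ℝ := 1 - 1 / (1 + max s 0 ^ 2)

/-- The second derivative of `psi`. -/
def psi2 (s : ℝ) : ℝ := 2 * max s 0 / (1 + max s 0 ^ 2) ^ 2

lemma continuous_psi : Continuous psi := by unfold psi; fun_prop

lemma continuous_psi1 : Continuous psi1 := by
  unfold psi1
  exact continuous_const.sub (continuous_const.div (by fun_prop) fun s => by positivity)

lemma continuous_psi2 : Continuous psi2 := by
  unfold psi2
  exact Continuous.div (by fun_prop) (by fun_prop) fun s => by positivity

lemma hasDerivAt_psi (s : ℝ) : HasDerivAt psi (psi1 s) s := by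
  refine hasDerivAt_of_hasDerivAt_of_ne' (x := 0) (fun y hy => ?_) continuous_psi.continuousAt
    continuous_psi1.continuousAt s
  rcases lt_or_gt_of_ne hy with h | h
  · have e : psi =ᶠ[𝓝 y] fun _ => 0 := by
      filter_upwards [Iio_mem_nhds h] with z hz
      simp [psi, max_eq_right (le_of_lt (by simpa using hz))]
    have : psi1 y = 0 := by simp [psi1, max_eq_right h.le]
    rw [this]
    exact (hasDerivAt_const y 0).congr_of_eventuallyEq e
  · have e : psi =ᶠ[𝓝 y] fun z => z - arctan z := by
      filter_upwards [Ioi_mem_nhds h] with z hz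
      simp [psi, max_eq_left (le_of_lt (by simpa using hz))]
    refine HasDerivAt.congr_of_eventuallyEq ?_ e
    refine ((hasDerivAt_id y).sub (hasDerivAt_arctan y)).congr_deriv ?_
    simp [psi1, max_eq_left h.le]

lemma hasDerivAt_psi1 (s : ℝ) : HasDerivAt psi1 (psi2 s) s := by
  refine hasDerivAt_of_hasDerivAt_of_ne' (x := 0) (fun y hy => ?_) continuous_psi1.continuousAt
    continuous_psi2.continuousAt s
  rcases lt_or_gt_of_ne hy with h | h
  · have e : psi1 =ᶠ[𝓝 y] fun _ => 0 := by
      filter_upwards [Iio_mem_nhds h] with z hz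
      simp [psi1, max_eq_right (le_of_lt (by simpa using hz))]
    have : psi2 y = 0 := by simp [psi2, max_eq_right h.le]
    rw [this]
    exact (hasDerivAt_const y 0).congr_of_eventuallyEq e
  · have e : psi1 =ᶠ[𝓝 y] fun z => 1 - (1 + z ^ 2)⁻¹ := by
      filter_upwards [Ioi_mem_nhds h] with z hz
      simp [psi1, max_eq_left (le_of_lt (by simpa using hz))]
    refine HasDerivAt.congr_of_eventuallyEq ?_ e
    have h1 : HasDerivAt (fun z : ℝ => 1 + z ^ 2) (2 * y) y :=
      (((hasDerivAt_id y).pow 2).const_add 1).congr_deriv (by simp)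
    refine ((h1.inv (by positivity)).const_sub 1).congr_deriv ?_
    simp [psi2, max_eq_left h.le]
    ring

lemma contDiff_psi : ContDiff ℝ 2 psi := by
  have h1 : deriv psi = psi1 := funext fun s => (hasDerivAt_psi s).deriv
  have h2 : deriv psi1 = psi2 := funext fun s => (hasDerivAt_psi1 s).deriv
  have hp1 : ContDiff ℝ 1 psi1 := contDiff_one_iff_deriv.2
    ⟨fun s => (hasDerivAt_psi1 s).differentiableAt, h2 ▸ continuous_psi2⟩
  rw [show (2 : WithTop ℕ∞) = 1 + 1 by norm_num, contDiff_succ_iff_deriv]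
  exact ⟨fun s => (hasDerivAt_psi s).differentiableAt, by simp, h1 ▸ hp1⟩

lemma psi_of_nonpos (hs : s ≤ 0) : psi s = 0 := by simp [psi, max_eq_right hs]

lemma psi1_of_nonpos (hs : s ≤ 0) : psi1 s = 0 := by simp [psi1, max_eq_right hs]

lemma psi_le (s : ℝ) : psi s ≤ max s 0 := by
  have := arctan_nonneg.2 (le_max_right s 0)
  unfold psi; linarith

lemma psi1_nonneg (s : ℝ) : 0 ≤ psi1 s := by
  unfold psi1
  rw [sub_nonneg, div_le_one (by positivity)]
  nlinarith [sq_nonneg (max s 0)]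

lemma psi1_le_one (s : ℝ) : psi1 s ≤ 1 := by
  unfold psi1
  have : 0 ≤ 1 / (1 + max s 0 ^ 2) := by positivity
  linarith

lemma psi2_nonneg (s : ℝ) : 0 ≤ psi2 s := by unfold psi2; positivity

lemma psi_nonneg (s : ℝ) : 0 ≤ psi s := by
  rcases le_total s 0 with h | h
  · rw [psi_of_nonpos h]
  · have hm : MonotoneOn psi univ := monotoneOn_of_deriv_nonneg convex_univ
      continuous_psi.continuousOn (fun x _ => (hasDerivAt_psi x).differentiableAt.differentiableWithinAt)
      (fun x _ => by rw [(hasDerivAt_psi x).deriv]; exact psi1_nonneg x)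
    have := hm (mem_univ 0) (mem_univ s) h
    rwa [psi_of_nonpos le_rfl] at this

lemma le_psi (s : ℝ) : max s 0 - 2 ≤ psi s := by
  have := arctan_lt_pi_div_two (max s 0)
  have := pi_lt_four
  unfold psi; linarith

lemma tendsto_psi1_atTop : Tendsto psi1 atTop (𝓝 1) := by
  have h1 : Tendsto (fun s : ℝ => 1 + max s 0 ^ 2) atTop atTop := by
    refine tendsto_atTop_mono' atTop ?_ tendsto_id
    filter_upwards [eventually_ge_atTop 0] with s hs
    rw [max_eq_left hs]; simp only [id]; nlinarith [sq_nonneg (s - 1)]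
  have h2 := (tendsto_const_nhds (x := (1:ℝ))).sub (tendsto_inv_atTop_zero.comp h1)
  rw [sub_zero] at h2
  refine h2.congr fun s => ?_
  simp [psi1]

lemma IsDirichletEigen.continuous_indicator (heig : IsDirichletEigen Ω lam φ) :
    Continuous (Ω.indicator φ) :=
  _root_.continuous_indicator heig.2.2.2.1 heig.1

lemma IsDirichletEigen.indicator_nonneg (heig : IsDirichletEigen Ω lam φ) (x : E) :
    0 ≤ Ω.indicator φ x := Set.indicator_nonneg (fun x hx => (heig.2.2.2.2 x hx).le) x

lemma IsDirichletEigen.eventually_eq (heig : IsDirichletEigen Ω lam φ) (hΩ : IsOpen Ω) (hx : x ∈ Ω) : Ω.indicator φ =ᶠ[𝓝 x] φ := by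
  filter_upwards [hΩ.mem_nhds hx] with y hy
  exact indicator_of_mem hy φ

lemma IsDirichletEigen.mem_of_pos (x : E) (hx : 0 < Ω.indicator φ x) : x ∈ Ω := by
  by_contra h
  rw [indicator_of_notMem h] at hx
  exact lt_irrefl _ hx

lemma IsDirichletEigen.isCompact_superlevel (heig : IsDirichletEigen Ω lam φ)
    (hb : Bdd Ω) (hδ : 0 < δ) : IsCompact {x | δ ≤ Ω.indicator φ x} :=
  Metric.isCompact_of_isClosed_isBounded (isClosed_le continuous_const heig.continuous_indicator)
    (hb.subset fun x hx => IsDirichletEigen.mem_of_pos x (hδ.trans_le hx))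

/-- Smooth compactly supported approximation of the eigenfunction. -/
def etest (Ω : Set E) (φ : E → ℝ) (δ : ℝ) (x : E) : ℝ := δ * psi ((Ω.indicator φ x - δ) / δ)

lemma etest_eq_zero (hδ : 0 < δ) (hx : Ω.indicator φ x ≤ δ) : etest Ω φ δ x = 0 := by
  rw [etest, psi_of_nonpos (div_nonpos_of_nonpos_of_nonneg (by linarith) hδ.le), mul_zero]

lemma etest_nonneg (hδ : 0 < δ) (x : E) : 0 ≤ etest Ω φ δ x := mul_nonneg hδ.le (psi_nonneg _)

lemma etest_le (heig : IsDirichletEigen Ω lam φ) (hδ : 0 < δ) (x : E) :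
    etest Ω φ δ x ≤ Ω.indicator φ x := by
  have h0 := heig.indicator_nonneg x
  refine (mul_le_mul_of_nonneg_left (psi_le _) hδ.le).trans ?_
  rw [mul_max_of_nonneg _ _ hδ.le, mul_div_cancel₀ _ hδ.ne', mul_zero]
  exact max_le (by linarith) h0

lemma le_etest (hδ : 0 < δ) (x : E) : Ω.indicator φ x - 3 * δ ≤ etest Ω φ δ x := by
  have h := mul_le_mul_of_nonneg_left (le_psi ((Ω.indicator φ x - δ) / δ)) hδ.le
  rw [mul_sub, mul_max_of_nonneg _ _ hδ.le, mul_div_cancel₀ _ hδ.ne', mul_zero] at h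
  have := le_max_left (Ω.indicator φ x - δ) 0
  unfold etest
  linarith

lemma etest_tsupport_subset (heig : IsDirichletEigen Ω lam φ) (hδ : 0 < δ) :
    tsupport (etest Ω φ δ) ⊆ {x | δ ≤ Ω.indicator φ x} := by
  refine closure_minimal (fun x hx => ?_) (isClosed_le continuous_const heig.continuous_indicator)
  by_contra h
  exact hx (etest_eq_zero hδ (not_le.1 h).le)

lemma etest_hasCompactSupport (heig : IsDirichletEigen Ω lam φ) (hb : Bdd Ω)
    (hδ : 0 < δ) : HasCompactSupport (etest Ω φ δ) :=
  (heig.isCompact_superlevel hb hδ).of_isClosed_subset (isClosed_tsupport _)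
    (etest_tsupport_subset heig hδ)

lemma etest_eventually_zero (heig : IsDirichletEigen Ω lam φ) (hδ : 0 < δ) (hx : x ∉ Ω) : etest Ω φ δ =ᶠ[𝓝 x] fun _ => 0 := by
  have : ∀ᶠ y in 𝓝 x, Ω.indicator φ y < δ :=
    heig.continuous_indicator.continuousAt.eventually_lt continuousAt_const
      (by rw [indicator_of_notMem hx]; exact hδ)
  filter_upwards [this] with y hy
  exact etest_eq_zero hδ hy.le

lemma etest_contDiff (heig : IsDirichletEigen Ω lam φ) (hΩ : IsOpen Ω) (hδ : 0 < δ) :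
    ContDiff ℝ 2 (etest Ω φ δ) := by
  refine contDiff_iff_contDiffAt.2 fun x => ?_
  by_cases hx : x ∈ Ω
  · have h1 : ContDiffAt ℝ 2 (Ω.indicator φ) x :=
      (heig.2.1.contDiffAt (hΩ.mem_nhds hx)).congr_of_eventuallyEq (heig.eventually_eq hΩ hx)
    exact contDiffAt_const.mul (contDiff_psi.contDiffAt.comp x
      ((h1.sub contDiffAt_const).div_const δ))
  · exact contDiffAt_const.congr_of_eventuallyEq (etest_eventually_zero heig hδ hx)

/-- The weight appearing in the lower bound for the Laplacian of `etest`. -/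
def ewt (Ω : Set E) (φ : E → ℝ) (δ : ℝ) (x : E) : ℝ :=
  Ω.indicator φ x * psi1 ((Ω.indicator φ x - δ) / δ)

lemma ewt_eq_zero (hδ : 0 < δ) (hx : Ω.indicator φ x ≤ δ) : ewt Ω φ δ x = 0 := by
  rw [ewt, psi1_of_nonpos (div_nonpos_of_nonpos_of_nonneg (by linarith) hδ.le), mul_zero]

lemma ewt_tsupport_subset (heig : IsDirichletEigen Ω lam φ) (hδ : 0 < δ) :
    tsupport (ewt Ω φ δ) ⊆ {x | δ ≤ Ω.indicator φ x} := by
  refine closure_minimal (fun x hx => ?_) (isClosed_le continuous_const heig.continuous_indicator)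
  by_contra h
  exact hx (ewt_eq_zero hδ (not_le.1 h).le)

lemma ewt_continuous (heig : IsDirichletEigen Ω lam φ) (δ : ℝ) : Continuous (ewt Ω φ δ) :=
  heig.continuous_indicator.mul (continuous_psi1.comp
    ((heig.continuous_indicator.sub continuous_const).div_const δ))

lemma ewt_nonneg (heig : IsDirichletEigen Ω lam φ) (δ : ℝ) (x : E) : 0 ≤ ewt Ω φ δ x :=
  mul_nonneg (heig.indicator_nonneg x) (psi1_nonneg _)

lemma ewt_le (heig : IsDirichletEigen Ω lam φ) (δ : ℝ) (x : E) :
    ewt Ω φ δ x ≤ Ω.indicator φ x :=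
  mul_le_of_le_one_right (heig.indicator_nonneg x) (psi1_le_one _)

lemma lap_etest_ge (heig : IsDirichletEigen Ω lam φ) (hΩ : IsOpen Ω) (hδ : 0 < δ)
    (x : E) : - lam * ewt Ω φ δ x ≤ lap (etest Ω φ δ) x := by
  by_cases hx : x ∈ Ω
  · have h2 := heig.2.1.contDiffAt (hΩ.mem_nhds hx)
    have e : etest Ω φ δ =ᶠ[𝓝 x] fun y => δ * psi ((φ y - δ) / δ) := by
      filter_upwards [heig.eventually_eq hΩ hx] with y hy
      rw [etest, hy]
    have hd : ∀ s : ℝ, HasDerivAt (fun s => (s - δ) / δ) (1 / δ) s := fun s =>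
      ((hasDerivAt_id s).sub_const δ).div_const δ
    rw [lap_congr e, lap_comp (H := fun s => δ * psi ((s - δ) / δ)) (H' := fun s => psi1 ((s - δ) / δ))
      (c := psi2 ((φ x - δ) / δ) * (1 / δ)) h2]
    · have := heig.2.2.1 x hx
      rw [ewt, indicator_of_mem hx, show lap φ x = - lam * φ x by linarith]
      have h3 : 0 ≤ psi2 ((φ x - δ) / δ) * (1 / δ) * gradSq φ x :=
        mul_nonneg (mul_nonneg (psi2_nonneg _) (by positivity)) (gradSq_nonneg _ _)
      linarith
    · refine of_forall fun s => ?_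
      refine (((hasDerivAt_psi _).comp s (hd s)).const_mul δ).congr_deriv ?_
      field_simp
    · exact (hasDerivAt_psi1 _).comp (φ x) (hd (φ x))
  · have e := etest_eventually_zero (φ := φ) heig hδ hx
    rw [lap_congr e, lap_const, ewt, indicator_of_notMem hx]
    simp

section kaplan

variable {z zt F : EuclideanSpace ℝ (Fin n) → ℝ → ℝ}

lemma setIntegral_eq_integral_of_tsupport {ψ : E → ℝ} (hs : tsupport ψ ⊆ Ω) :
    ∫ x in Ω, ψ x * g x = ∫ x, ψ x * g x :=
  setIntegral_eq_integral_of_forall_compl_eq_zero fun x hx => by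
    rw [image_eq_zero_of_notMem_tsupport fun h => hx (hs h), zero_mul]

lemma integrable_mul_of_tsupport (hΩ : IsOpen Ω) {ψ : E → ℝ} (hψ : Continuous ψ)
    (hψc : HasCompactSupport ψ) (hs : tsupport ψ ⊆ Ω) (hg : ContinuousOn g Ω) :
    Integrable (fun x => ψ x * g x) :=
  (continuous_mul_of_tsupport hΩ hψ hs hg).integrable_of_hasCompactSupport hψc.mul_right

lemma hasDerivAt_integral_etest (hΩ : IsOpen Ω) {ψ : E → ℝ} (hψ : Continuous ψ)
    (hψc : HasCompactSupport ψ) (hs : tsupport ψ ⊆ Ω)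
    (hz : ∀ t > 0, ContinuousOn (fun x => z x t) Ω)
    (hzt : ∀ x ∈ Ω, ∀ t > 0, HasDerivAt (z x) (zt x t) t)
    (hztc : ContinuousOn ♯zt (Ω ×ˢ Ioi 0)) (ht : 0 < t) :
    HasDerivAt (fun t => ∫ x, ψ x * z x t) (∫ x, ψ x * zt x t) t := by
  have hsub : Icc (t / 2) (2 * t) ⊆ Ioi 0 := fun s hs => by
    have := hs.1; simp only [mem_Ioi]; linarith
  obtain ⟨C, hC⟩ := (hψc.isCompact.prod (isCompact_Icc (a := t / 2) (b := 2 * t))).exists_bound_of_continuousOn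
    (hztc.mono (prod_mono hs hsub))
  have hztx : ∀ s : ℝ, 0 < s → ContinuousOn (fun x => zt x s) Ω := fun s hs0 =>
    hztc.comp (f := fun x : E => (x, s)) (by fun_prop) fun x hx => ⟨hx, hs0⟩
  refine (hasDerivAt_integral_of_dominated_loc_of_deriv_le (μ := volume)
    (F := fun t x => ψ x * z x t) (F' := fun t x => ψ x * zt x t) (x₀ := t) (s := Ioo (t / 2) (2 * t))
    (bound := fun x => ‖ψ x‖ * C) (Ioo_mem_nhds (by linarith) (by linarith)) ?_ ?_ ?_ ?_ ?_ ?_).2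
  · filter_upwards [Ioi_mem_nhds ht] with s hs0
    exact (integrable_mul_of_tsupport hΩ hψ hψc hs (hz s hs0)).aestronglyMeasurable
  · exact integrable_mul_of_tsupport hΩ hψ hψc hs (hz t ht)
  · exact (integrable_mul_of_tsupport hΩ hψ hψc hs (hztx t ht)).aestronglyMeasurable
  · refine of_forall fun x s hs' => ?_
    by_cases hx : x ∈ tsupport ψ
    · rw [norm_mul]
      exact mul_le_mul_of_nonneg_left (hC (x, s) ⟨hx, Ioo_subset_Icc_self hs'⟩) (norm_nonneg _)
    · rw [image_eq_zero_of_notMem_tsupport hx]; simp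
  · exact (hψ.integrable_of_hasCompactSupport hψc).norm.mul_const C
  · refine of_forall fun x s hs' => ?_
    by_cases hx : x ∈ tsupport ψ
    · exact (hzt x (hs hx) s (hsub (Ioo_subset_Icc_self hs'))).const_mul _
    · rw [image_eq_zero_of_notMem_tsupport hx]
      simpa using hasDerivAt_const s (0:ℝ)

lemma kaplan_etest (hΩ : IsOpen Ω) (hb : Bdd Ω) (heig : IsDirichletEigen Ω lam φ)
    (hzc : ContinuousOn ♯z (closure Ω ×ˢ Ici 0))
    (hz0 : ∀ x ∈ closure Ω, ∀ t ≥ 0, 0 ≤ z x t)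
    (hz2 : ∀ t > 0, ContDiffOn ℝ 2 (fun x => z x t) Ω)
    (hzt : ∀ x ∈ Ω, ∀ t > 0, HasDerivAt (z x) (zt x t) t)
    (hztc : ContinuousOn ♯zt (Ω ×ˢ Ioi 0))
    (hF : ContinuousOn ♯F (closure Ω ×ˢ Ici 0))
    (hpde : ∀ x ∈ Ω, ∀ t > 0, lap (fun y => z y t) x + lam * z x t + F x t ≤ zt x t)
    (hs : 0 ≤ s) (hst : s ≤ t) (hδ : 0 < δ) :
    ∫ τ in s..t, (∫ x in Ω, (lam * (etest Ω φ δ x - ewt Ω φ δ x) * z x τ + etest Ω φ δ x * F x τ)) ≤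
    (∫ x in Ω, etest Ω φ δ x * z x t) - ∫ x in Ω, etest Ω φ δ x * z x s := by
  set ψ := etest Ω φ δ with hψdef
  set χ := ewt Ω φ δ with hχdef
  have hK : {x | δ ≤ Ω.indicator φ x} ⊆ Ω := fun x hx =>
    IsDirichletEigen.mem_of_pos x (hδ.trans_le hx)
  have hψ2 : ContDiff ℝ 2 ψ := etest_contDiff heig hΩ hδ
  have hψ : Continuous ψ := hψ2.continuous
  have hψc : HasCompactSupport ψ := etest_hasCompactSupport heig hb hδ
  have hψs : tsupport ψ ⊆ Ω := (etest_tsupport_subset heig hδ).trans hK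
  have hχ : Continuous χ := ewt_continuous heig δ
  have hχs : tsupport χ ⊆ Ω := (ewt_tsupport_subset heig hδ).trans hK
  have hχc : HasCompactSupport χ := (heig.isCompact_superlevel hb hδ).of_isClosed_subset
    (isClosed_tsupport _) (ewt_tsupport_subset heig hδ)
  have hzx : ∀ t ≥ 0, ContinuousOn (fun x => z x t) (closure Ω) := fun t ht =>
    hzc.comp (f := fun x : E => (x, t)) (by fun_prop) fun x hx => ⟨hx, ht⟩
  have hFx : ∀ t ≥ 0, ContinuousOn (fun x => F x t) (closure Ω) := fun t ht =>
    hF.comp (f := fun x : E => (x, t)) (by fun_prop) fun x hx => ⟨hx, ht⟩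
  have hztx : ∀ s : ℝ, 0 < s → ContinuousOn (fun x => zt x s) Ω := fun s hs0 =>
    hztc.comp (f := fun x : E => (x, s)) (by fun_prop) fun x hx => ⟨hx, hs0⟩
  have hlap : ∀ s : ℝ, 0 < s → ContinuousOn (fun x => lap (fun y => z y s) x) Ω := by
    intro s hs0
    have h1 := hz2 s hs0
    unfold lap
    refine continuousOn_finset_sum _ fun i _ => ?_
    have h2 : ContDiffOn ℝ 1 (fun x => fderiv ℝ (fun y => z y s) x (EuclideanSpace.single i 1)) Ω :=
      (h1.fderiv_of_isOpen hΩ (m := 1) (by norm_num)).clm_apply contDiffOn_const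
    exact (h2.continuousOn_fderiv_of_isOpen hΩ (by norm_num)).clm_apply continuousOn_const
  have hflip : ∀ {f : E → ℝ → ℝ}, ContinuousOn ♯f (closure Ω ×ˢ Ici 0) →
      ContinuousOn (fun t => ∫ x in Ω, f x t) (Ici 0) := fun {f} hf =>
    continuousOn_setIntegral hb hΩ.measurableSet (f := fun t x => f x t)
      (hf.comp (f := fun p : ℝ × E => (p.2, p.1)) (by fun_prop) fun p hp => ⟨hp.2, hp.1⟩)
  have hsub : Icc s t ⊆ Ici 0 := fun τ hτ => hs.trans hτ.1
  have hψ' : Continuous (fun p : Q => ψ p.1) := hψ.comp continuous_fst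
  have hχ' : Continuous (fun p : Q => χ p.1) := hχ.comp continuous_fst
  refine intervalIntegral.integral_le_sub_of_hasDeriv_right_of_le
    (g := fun t => ∫ x in Ω, ψ x * z x t) (g' := fun t => ∫ x, ψ x * zt x t) hst
    ((hflip (hψ'.continuousOn.mul hzc)).mono hsub) ?_ ?_ ?_
  · intro τ hτ
    simp only [setIntegral_eq_integral_of_tsupport hψs]
    exact (hasDerivAt_integral_etest hΩ hψ hψc hψs (fun t ht => (hz2 t ht).continuousOn) hzt hztc
      (hs.trans_lt hτ.1)).hasDerivWithinAt
  · refine ContinuousOn.integrableOn_Icc ((hflip ?_).mono hsub)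
    exact ((continuous_const.mul (hψ'.sub hχ')).continuousOn.mul hzc).add (hψ'.continuousOn.mul hF)
  · intro τ hτ
    have hτ0 : 0 < τ := hs.trans_lt hτ.1
    have hzτ := (hzx τ hτ0.le).mono subset_closure
    have hFτ := (hFx τ hτ0.le).mono subset_closure
    have i1 := integrable_mul_of_tsupport hΩ hψ hψc hψs (hlap τ hτ0)
    have i2 : Integrable (fun x => ψ x * (lam • z x τ + F x τ)) :=
      integrable_mul_of_tsupport hΩ hψ hψc hψs (hzτ.const_smul lam |>.add hFτ)
    have i3 := integrable_mul_of_tsupport hΩ hψ hψc hψs (hztx τ hτ0)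
    have i4 := integrable_mul_of_tsupport hΩ hχ hχc hχs (hzτ)
    have i5 : Integrable (fun x => lap ψ x * z x τ) := by
      refine integrable_mul_of_tsupport hΩ (continuous_lap hψ2) (lap_hasCompactSupport hψc) ?_ hzτ
      refine (closure_minimal (fun x hx => ?_) (isClosed_tsupport ψ)).trans hψs
      by_contra h
      have e : ψ =ᶠ[𝓝 x] fun _ => 0 := by
        filter_upwards [(isClosed_tsupport ψ).isOpen_compl.mem_nhds h] with y hy
        exact image_eq_zero_of_notMem_tsupport hy
      exact hx (by rw [lap_congr e, lap_const])
    have g1 := green_identity hΩ hψ2 hψc hψs (hz2 τ hτ0)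
    have step1 : (∫ x, ψ x * lap (fun y => z y τ) x) + ∫ x, ψ x * (lam • z x τ + F x τ) ≤
        ∫ x, ψ x * zt x τ := by
      rw [← integral_add i1 i2]
      refine integral_mono (i1.add i2) i3 fun x => ?_
      by_cases hx : x ∈ Ω
      · have := mul_le_mul_of_nonneg_left (hpde x hx τ hτ0) (etest_nonneg (Ω := Ω) (φ := φ) hδ x)
        simp only [smul_eq_mul]
        refine le_trans (le_of_eq ?_) this
        rw [hψdef]
        ring
      · have h0 : ψ x = 0 := image_eq_zero_of_notMem_tsupport fun h => hx (hψs h)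
        simp [h0]
    have step2 : - lam * ∫ x, χ x * z x τ ≤ ∫ x, lap ψ x * z x τ := by
      rw [← integral_const_mul]
      refine integral_mono (i4.const_mul _) i5 fun x => ?_
      by_cases hx : x ∈ Ω
      · have := mul_le_mul_of_nonneg_right (lap_etest_ge heig hΩ hδ x)
          (hz0 x (subset_closure hx) τ hτ0.le)
        refine le_trans (le_of_eq ?_) this
        rw [hχdef]; ring
      · have e := etest_eventually_zero (φ := φ) heig hδ hx
        have h0 : χ x = 0 := image_eq_zero_of_notMem_tsupport fun h => hx (hχs h)
        have h1 : lap ψ x = 0 := by rw [lap_congr e, lap_const]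
        simp [h0, h1]
    have e1 : (∫ x in Ω, (lam * (ψ x - χ x) * z x τ + ψ x * F x τ)) =
        - lam * (∫ x, χ x * z x τ) + ∫ x, ψ x * (lam • z x τ + F x τ) := by
      rw [← integral_const_mul, ← integral_add (i4.const_mul _) i2]
      rw [setIntegral_eq_integral_of_forall_compl_eq_zero]
      · refine integral_congr_ae (of_forall fun x => ?_)
        simp only [smul_eq_mul]; ring
      · intro x hx
        have h0 : χ x = 0 := image_eq_zero_of_notMem_tsupport fun h => hx (hχs h)
        have h1 : ψ x = 0 := image_eq_zero_of_notMem_tsupport fun h => hx (hψs h)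
        simp [h0, h1]
    rw [e1]
    linarith

/-- Kaplan's inequality: testing `z_t ≥ Δz + λz + F` against the first eigenfunction. -/
lemma kaplan (hΩ : IsOpen Ω) (hb : Bdd Ω) (heig : IsDirichletEigen Ω lam φ)
    (hzc : ContinuousOn ♯z (closure Ω ×ˢ Ici 0))
    (hz0 : ∀ x ∈ closure Ω, ∀ t ≥ 0, 0 ≤ z x t)
    (hz2 : ∀ t > 0, ContDiffOn ℝ 2 (fun x => z x t) Ω)
    (hzt : ∀ x ∈ Ω, ∀ t > 0, HasDerivAt (z x) (zt x t) t)
    (hztc : ContinuousOn ♯zt (Ω ×ˢ Ioi 0))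
    (hF : ContinuousOn ♯F (closure Ω ×ˢ Ici 0))
    (hpde : ∀ x ∈ Ω, ∀ t > 0, lap (fun y => z y t) x + lam * z x t + F x t ≤ zt x t)
    (hs : 0 ≤ s) (hst : s ≤ t) :
    ∫ τ in s..t, (∫ x in Ω, φ x * F x τ) ≤ (∫ x in Ω, φ x * z x t) - ∫ x in Ω, φ x * z x s := by
  set δ : ℕ → ℝ := fun N => 1 / ((N : ℝ) + 1) with hδdef
  have hδ0 : ∀ N, 0 < δ N := fun N => by simp only [hδdef]; positivity
  have hδlim : Tendsto δ atTop (𝓝 0) := tendsto_one_div_add_atTop_nhds_zero_nat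
  have hKc := hb.isCompact_closure
  have hfin : volume Ω < ⊤ := (measure_mono subset_closure).trans_lt hKc.measure_lt_top
  haveI : IsFiniteMeasure (volume.restrict Ω) := ⟨by rwa [Measure.restrict_apply_univ]⟩
  have hsub : Icc s t ⊆ Ici 0 := fun τ hτ => hs.trans hτ.1
  obtain ⟨Z, hZ⟩ := (hKc.prod (isCompact_Icc (a := s) (b := t))).exists_bound_of_continuousOn
    (hzc.mono (prod_mono_right hsub))
  obtain ⟨B, hB⟩ := (hKc.prod (isCompact_Icc (a := s) (b := t))).exists_bound_of_continuousOn
    (hF.mono (prod_mono_right hsub))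
  obtain ⟨G, hG⟩ := hKc.exists_bound_of_continuousOn heig.1
  have hφlim : ∀ x ∈ Ω, Tendsto (fun N => etest Ω φ (δ N) x) atTop (𝓝 (φ x)) := by
    intro x hx
    have h1 : Tendsto (fun N => φ x - 3 * δ N) atTop (𝓝 (φ x)) := by
      simpa using (tendsto_const_nhds (x := φ x)).sub (hδlim.const_mul 3)
    refine tendsto_of_tendsto_of_tendsto_of_le_of_le h1 tendsto_const_nhds ?_ ?_
    · intro N
      have := le_etest (Ω := Ω) (φ := φ) (hδ0 N) x
      rwa [indicator_of_mem hx] at this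
    · intro N
      have := etest_le heig (hδ0 N) x
      rwa [indicator_of_mem hx] at this
  have hwlim : ∀ x ∈ Ω, Tendsto (fun N => ewt Ω φ (δ N) x) atTop (𝓝 (φ x)) := by
    intro x hx
    have hpos := heig.2.2.2.2 x hx
    have h1 : Tendsto (fun N => (φ x - δ N) / δ N) atTop atTop := by
      have e : (fun N => (φ x - δ N) / δ N) = fun N : ℕ => φ x * ((N : ℝ) + 1) - 1 := by
        funext N
        have := hδ0 N
        rw [sub_div, div_self this.ne']
        simp only [hδdef]; field_simp
      rw [e]
      refine tendsto_atTop_add_const_right _ _ (Tendsto.const_mul_atTop hpos ?_)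
      exact tendsto_atTop_add_const_right _ _ tendsto_natCast_atTop_atTop
    have h2 := (tendsto_psi1_atTop.comp h1).const_mul (φ x)
    rw [mul_one] at h2
    refine h2.congr fun N => ?_
    rw [ewt, indicator_of_mem hx]; rfl
  have hbd : ∀ x ∈ Ω, ∀ N, |etest Ω φ (δ N) x| ≤ G ∧ |ewt Ω φ (δ N) x| ≤ G := by
    intro x hx N
    have h1 := etest_le heig (hδ0 N) x
    have h2 := ewt_le heig (δ N) x
    rw [indicator_of_mem hx] at h1 h2
    have h3 := (le_abs_self _).trans (hG x (subset_closure hx))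
    rw [abs_of_nonneg (etest_nonneg (hδ0 N) x), abs_of_nonneg (ewt_nonneg heig _ x)]
    exact ⟨h1.trans h3, h2.trans h3⟩
  have hzx : ∀ t ≥ 0, ContinuousOn (fun x => z x t) (closure Ω) := fun t ht =>
    hzc.comp (f := fun x : E => (x, t)) (by fun_prop) fun x hx => ⟨hx, ht⟩
  have hFx : ∀ t ≥ 0, ContinuousOn (fun x => F x t) (closure Ω) := fun t ht =>
    hF.comp (f := fun x : E => (x, t)) (by fun_prop) fun x hx => ⟨hx, ht⟩
  have hec : ∀ N, Continuous (etest Ω φ (δ N)) := fun N => (etest_contDiff heig hΩ (hδ0 N)).continuous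
  have hwc : ∀ N, Continuous (ewt Ω φ (δ N)) := fun N => ewt_continuous heig _
  have limz : ∀ τ ∈ Icc s t, Tendsto (fun N => ∫ x in Ω, etest Ω φ (δ N) x * z x τ) atTop
      (𝓝 (∫ x in Ω, φ x * z x τ)) := by
    intro τ hτ
    refine tendsto_integral_of_dominated_convergence (fun _ => G * Z) (fun N => ?_)
      (integrable_const _) (fun N => ?_) ?_
    · exact (integrableOn_of_closure hb
        ((hec N).continuousOn.mul (hzx τ (hsub hτ)))).aestronglyMeasurable
    · filter_upwards [ae_restrict_mem hΩ.measurableSet] with x hx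
      rw [norm_mul]
      exact mul_le_mul (hbd x hx N).1 (hZ (x, τ) ⟨subset_closure hx, hτ⟩) (norm_nonneg _)
        ((abs_nonneg _).trans (hbd x hx N).1)
    · filter_upwards [ae_restrict_mem hΩ.measurableSet] with x hx
      exact (hφlim x hx).mul_const _
  set g : ℕ → E → ℝ → ℝ := fun N x τ =>
    lam * (etest Ω φ (δ N) x - ewt Ω φ (δ N) x) * z x τ + etest Ω φ (δ N) x * F x τ with hg
  have hgb : ∀ N, ∀ x ∈ Ω, ∀ τ ∈ Icc s t, |g N x τ| ≤ |lam| * (G + G) * Z + G * B := by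
    intro N x hx τ hτ
    obtain ⟨h1, h2⟩ := hbd x hx N
    have hG0 : 0 ≤ G := (abs_nonneg _).trans h1
    have h3 : |z x τ| ≤ Z := hZ (x, τ) ⟨subset_closure hx, hτ⟩
    have h4 : |F x τ| ≤ B := hB (x, τ) ⟨subset_closure hx, hτ⟩
    refine (abs_add_le _ _).trans (add_le_add ?_ ?_)
    · rw [abs_mul, abs_mul]
      refine mul_le_mul (mul_le_mul_of_nonneg_left ?_ (abs_nonneg _)) h3 (abs_nonneg _) (by positivity)
      exact (abs_sub _ _).trans (add_le_add h1 h2)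
    · rw [abs_mul]
      exact mul_le_mul h1 h4 (abs_nonneg _) hG0
  have hgc : ∀ N, ContinuousOn (fun p : Q => g N p.1 p.2) (closure Ω ×ˢ Ici 0) := by
    intro N
    have h1 : Continuous (fun p : Q => etest Ω φ (δ N) p.1) := (hec N).comp continuous_fst
    have h2 : Continuous (fun p : Q => ewt Ω φ (δ N) p.1) := (hwc N).comp continuous_fst
    exact ((continuous_const.mul (h1.sub h2)).continuousOn.mul hzc).add (h1.continuousOn.mul hF)
  have hgx : ∀ N, ∀ τ ∈ Icc s t, ContinuousOn (fun x => g N x τ) (closure Ω) := fun N τ hτ =>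
    (hgc N).comp (f := fun x : E => (x, τ)) (by fun_prop) fun x hx => ⟨hx, hsub hτ⟩
  have limF : ∀ τ ∈ Icc s t, Tendsto (fun N => ∫ x in Ω, g N x τ) atTop
      (𝓝 (∫ x in Ω, φ x * F x τ)) := by
    intro τ hτ
    refine tendsto_integral_of_dominated_convergence (fun _ => |lam| * (G + G) * Z + G * B)
      (fun N => ?_) (integrable_const _) (fun N => ?_) ?_
    · exact (integrableOn_of_closure hb (hgx N τ hτ)).aestronglyMeasurable
    · filter_upwards [ae_restrict_mem hΩ.measurableSet] with x hx
      exact hgb N x hx τ hτ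
    · filter_upwards [ae_restrict_mem hΩ.measurableSet] with x hx
      have := ((((hφlim x hx).sub (hwlim x hx)).const_mul lam).mul_const (z x τ)).add
        ((hφlim x hx).mul_const (F x τ))
      simpa using this
  have hflip : ∀ N, ContinuousOn (fun t => ∫ x in Ω, g N x t) (Ici 0) := fun N =>
    continuousOn_setIntegral hb hΩ.measurableSet (f := fun t x => g N x t)
      ((hgc N).comp (f := fun p : ℝ × E => (p.2, p.1)) (by fun_prop) fun p hp => ⟨hp.2, hp.1⟩)
  have hu : uIoc s t ⊆ Icc s t := by rw [uIoc_of_le hst]; exact Ioc_subset_Icc_self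
  have limint : Tendsto (fun N => ∫ τ in s..t, ∫ x in Ω, g N x τ) atTop
      (𝓝 (∫ τ in s..t, ∫ x in Ω, φ x * F x τ)) := by
    refine intervalIntegral.tendsto_integral_filter_of_dominated_convergence
      (fun _ => (|lam| * (G + G) * Z + G * B) * volume.real Ω) (of_forall fun N => ?_)
      (of_forall fun N => of_forall fun τ hτ => ?_)
      intervalIntegrable_const (of_forall fun τ hτ => limF τ (hu hτ))
    · exact ((hflip N).mono (hu.trans hsub)).aestronglyMeasurable measurableSet_uIoc
    · exact norm_setIntegral_le_of_norm_le_const hfin fun x hx => hgb N x hx τ (hu hτ)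
  exact le_of_tendsto_of_tendsto' limint
    ((limz t (right_mem_Icc.2 hst)).sub (limz s (left_mem_Icc.2 hst))) fun N =>
      kaplan_etest hΩ hb heig hzc hz0 hz2 hzt hztc hF hpde hs hst (hδ0 N)

end kaplan

/-- The nonlocal factor in the reaction term. -/
def nonloc (Ω : Set E) (p : ℝ) (u : E → ℝ → ℝ) (t : ℝ) : ℝ := ∫ y in Ω, u y t ^ p

lemma nonloc_continuousOn (hΩ : IsOpen Ω) (hb : Bdd Ω) (hp : 0 < p) {J : Set ℝ}
    (hc : ContinuousOn ♯u (closure Ω ×ˢ J)) :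
    ContinuousOn (nonloc Ω p u) J := by
  refine continuousOn_setIntegral hb hΩ.measurableSet (f := fun t y => u y t ^ p) ?_
  refine ContinuousOn.rpow_const ?_ fun _ _ => Or.inr hp.le
  exact hc.comp (f := fun z : ℝ × E => (z.2, z.1)) (by fun_prop) fun z hz => ⟨hz.2, hz.1⟩

lemma IsSol.hasDerivAt (hu : IsSol r p q l Ω a b k u0 T u) (hx : x ∈ Ω) (ht : t ∈ Ioo 0 T) :
    HasDerivAt (u x) (lap (fun y => u y t) x + reac a b r q (nonloc Ω p u) u x t) t := by
  refine (hu.1.1.2.2 x hx t ht).hasDerivAt.congr_deriv ?_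
  have h1 := hu.1.2.2.1 x hx t ht
  have h2 := hu.2.2.2.1 x hx t ht
  unfold reac nonloc
  linarith

lemma IsSol.heatSol (hΩ : IsOpen Ω) (hu : IsSol r p q l Ω a b k u0 T u) :
    HeatSol Ω 0 T u (reac a b r q (nonloc Ω p u) u) := by
  have hc := hu.1.1.1.mono (prod_mono (subset_closure (s := Ω)) Ioo_subset_Ico_self)
  constructor
  · refine SlabSuper.heatSuper hc fun t ht => ⟨T, ht.2, fun x hx τ hτ => ?_⟩
    have hτ' : τ ∈ Ioo 0 T := ⟨ht.1.trans hτ.1, hτ.2⟩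
    refine ⟨(hu.1.1.2.1 τ hτ').contDiffAt (hΩ.mem_nhds hx), hu.1.1.2.2 x hx τ hτ', ?_⟩
    rw [(hu.hasDerivAt hx hτ').deriv]
  · refine SlabSuper.heatSuper hc.neg fun t ht => ⟨T, ht.2, fun x hx τ hτ => ?_⟩
    have hτ' : τ ∈ Ioo 0 T := ⟨ht.1.trans hτ.1, hτ.2⟩
    have h2 := (hu.1.1.2.1 τ hτ').contDiffAt (hΩ.mem_nhds hx)
    refine ⟨h2.neg, (hu.1.1.2.2 x hx τ hτ').neg, ?_⟩
    have h3 : HasDerivAt (fun t => - u x t) _ τ := (hu.hasDerivAt hx hτ').neg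
    rw [lap_neg h2, h3.deriv]
    linarith

lemma IsSol.locInterior (hdata : GoodData Ω a b k) (hr : 0 < r) (hp : 0 < p) (hq : 0 < q)
    (hu : IsSol r p q l Ω a b k u0 T u) : LocInterior Ω 0 T u (reac a b r q (nonloc Ω p u) u) := by
  obtain ⟨hΩ, hb, -, hha, hhb, -, -, -⟩ := hdata
  exact HeatSol.locInterior_reac hΩ hha hhb hr hq hΩ subset_rfl le_rfl
    ((nonloc_continuousOn hΩ hb hp hu.1.1.1).mono Ioo_subset_Ico_self)
    (hu.1.1.1.mono (prod_mono subset_closure Ioo_subset_Ico_self))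
    (fun x hx t ht => hu.1.2.1 x (subset_closure hx) t ⟨ht.1.le, ht.2⟩) (hu.heatSol hΩ)

/-- The consequences of being a global solution used in the blow-up argument. -/
structure GlobalSol (r p q : ℝ) (Ω : Set E) (a b : E → ℝ → ℝ) (u : E → ℝ → ℝ) :
    Prop where
  cont : ContinuousOn ♯u (closure Ω ×ˢ Ici 0)
  nonneg : ∀ x ∈ closure Ω, ∀ t ≥ 0, 0 ≤ u x t
  c2 : ∀ t > 0, ContDiffOn ℝ 2 (fun x => u x t) Ω
  deriv : ∀ x ∈ Ω, ∀ t > 0,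
    HasDerivAt (u x) (lap (fun y => u y t) x + reac a b r q (nonloc Ω p u) u x t) t
  contd : ContinuousOn (fun z : Q => lap (fun y => u y z.2) z.1 +
    reac a b r q (nonloc Ω p u) u z.1 z.2) (Ω ×ˢ Ioi 0)

lemma GlobalSol.of_isSol (hdata : GoodData Ω a b k)
    (hr : 0 < r) (hp : 0 < p) (hq : 0 < q) (hu : ∀ T : ℝ, 0 < T → IsSol r p q l Ω a b k u0 T u) :
    GlobalSol r p q Ω a b u := by
  have hΩ := hdata.1
  have hcc : ContinuousOn ♯u (closure Ω ×ˢ Ici 0) := by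
    rintro ⟨x, t⟩ ⟨hx, ht⟩
    simp only [mem_Ici] at ht
    refine ((hu (t + 1) (by linarith)).1.1.1 (x, t) ⟨hx, ht, by simp⟩).mono_of_mem_nhdsWithin ?_
    have : {z : Q | z.2 < t + 1} ∈ 𝓝 (x, t) :=
      (isOpen_lt continuous_snd continuous_const).mem_nhds (by simp)
    filter_upwards [self_mem_nhdsWithin, nhdsWithin_le_nhds this] with z hz hz2
    exact ⟨hz.1, hz.2, hz2⟩
  refine ⟨hcc, fun x hx t ht => (hu (t + 1) (by linarith)).1.2.1 x hx t ⟨ht, by linarith⟩,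
    fun t ht => (hu (t + 1) (by linarith)).1.1.2.1 t ⟨ht, by linarith⟩,
    fun x hx t ht => (hu (t + 1) (by linarith)).hasDerivAt hx ⟨ht, by linarith⟩, ?_⟩
  refine ContinuousOn.add ?_ ?_
  · rintro ⟨x, t⟩ ⟨hx, ht⟩
    simp only [mem_Ioi] at ht
    refine (((hu (t + 1) (by linarith)).locInterior hdata hr hp hq).continuousOn_lap (x, t)
      ⟨hx, ht, by simp⟩).mono_of_mem_nhdsWithin ?_
    have : {z : Q | z.2 < t + 1} ∈ 𝓝 (x, t) :=
      (isOpen_lt continuous_snd continuous_const).mem_nhds (by simp)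
    filter_upwards [self_mem_nhdsWithin, nhdsWithin_le_nhds this] with z hz hz2
    exact ⟨hz.1, hz.2, hz2⟩
  · exact reac_continuousOn hdata.2.2.2.1 hdata.2.2.2.2.1 hr hq subset_closure Ioi_subset_Ici_self
      ((nonloc_continuousOn hΩ hdata.2.1 hp hcc).mono Ioi_subset_Ici_self)
      (hcc.mono (prod_mono subset_closure Ioi_subset_Ici_self))

/-- Smooth approximation of `min u (e^{-λt} φ)`. -/
def smin (lam δ : ℝ) (φ : E → ℝ) (u : E → ℝ → ℝ) (x : E) (t : ℝ) : ℝ :=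
  exp (-lam * t) * φ x - δ * psi ((exp (-lam * t) * φ x - u x t) / δ)

lemma le_smin (hδ : 0 < δ) (x : E) (t : ℝ) :
    min (u x t) (exp (-lam * t) * φ x) ≤ smin lam δ φ u x t := by
  have h := mul_le_mul_of_nonneg_left (psi_le ((exp (-lam * t) * φ x - u x t) / δ)) hδ.le
  rw [mul_max_of_nonneg _ _ hδ.le, mul_div_cancel₀ _ hδ.ne', mul_zero] at h
  unfold smin
  rcases le_total (u x t) (exp (-lam * t) * φ x) with h1 | h1
  · rw [min_eq_left h1]; rw [max_eq_left (by linarith)] at h; linarith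
  · rw [min_eq_right h1]; rw [max_eq_right (by linarith)] at h; linarith

lemma smin_le (hδ : 0 < δ) (x : E) (t : ℝ) :
    smin lam δ φ u x t ≤ min (u x t) (exp (-lam * t) * φ x) + 2 * δ := by
  have h := mul_le_mul_of_nonneg_left (le_psi ((exp (-lam * t) * φ x - u x t) / δ)) hδ.le
  rw [mul_sub, mul_max_of_nonneg _ _ hδ.le, mul_div_cancel₀ _ hδ.ne', mul_zero] at h
  unfold smin
  rcases le_total (u x t) (exp (-lam * t) * φ x) with h1 | h1
  · rw [min_eq_left h1]; rw [max_eq_left (by linarith)] at h; linarith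
  · rw [min_eq_right h1]; rw [max_eq_right (by linarith)] at h; linarith

section lower

variable {ε : ℝ → ℝ}

lemma GlobalSol.integral_min_le (hu : GlobalSol r p q Ω a b u) (hΩ : IsOpen Ω)
    (hb : Bdd Ω) (heig : IsDirichletEigen Ω lam φ) (hq : 1 < q)
    (hab : ∀ x ∈ closure Ω, ∀ t ≥ 0, 0 ≤ a x t ∧ 0 ≤ b x t)
    (hε : Continuous ε) (hε0 : ∀ t, 0 ≤ ε t)
    (hbε : ∀ x ∈ Ω, ∀ t > 0, b x t ≤ ε t * exp (lam * (q - 1) * t))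
    {G : ℝ} (hG0 : 0 < G) (hG : ∀ x ∈ closure Ω, φ x ≤ G) (ht : 0 ≤ t) (hδ : 0 < δ) :
    ∫ x in Ω, φ x * min (u x 0) (φ x) ≤ exp (lam * t + G ^ (q - 1) * ∫ τ in (0:ℝ)..t, ε τ) *
    ((∫ x in Ω, φ x * min (u x t) (exp (-lam * t) * φ x)) + 2 * δ * ∫ x in Ω, φ x) := by
  set C' := G ^ (q - 1) with hC'
  have hC'0 : 0 ≤ C' := by positivity
  set G₁ : ℝ → ℝ := fun t => exp (lam * t + C' * ∫ τ in (0:ℝ)..t, ε τ) with hE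
  have hEd : ∀ t, HasDerivAt G₁ (G₁ t * (lam + C' * ε t)) t := by
    intro t
    have h1 : HasDerivAt (fun t : ℝ => ∫ τ in (0:ℝ)..t, ε τ) (ε t) t :=
      intervalIntegral.integral_hasDerivAt_right (hε.intervalIntegrable _ _)
        (hε.stronglyMeasurableAtFilter _ _) hε.continuousAt
    refine ((((hasDerivAt_id t).const_mul lam).add (h1.const_mul C')).exp).congr_deriv ?_
    simp [hE]
  have hEc : Continuous G₁ := continuous_iff_continuousAt.2 fun t => (hEd t).continuousAt
  have hE0 : ∀ t, 0 < G₁ t := fun t => exp_pos _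
  set g : E → ℝ → ℝ := fun x t => exp (-lam * t) * φ x with hg
  have hgt : ∀ x t, HasDerivAt (g x) (-lam * g x t) t := by
    intro x t
    refine ((((hasDerivAt_id t).const_mul (-lam)).exp).mul_const (φ x)).congr_deriv ?_
    simp only [hg, id]; ring
  set ut : E → ℝ → ℝ := fun x t => lap (fun y => u y t) x + reac a b r q (nonloc Ω p u) u x t
    with hut
  set ζ := smin lam δ φ u with hζ
  set P : E → ℝ → ℝ := fun x t => psi1 ((g x t - u x t) / δ) with hP
  set ζt : E → ℝ → ℝ := fun x t => -lam * g x t - P x t * (-lam * g x t - ut x t) with hζt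
  have hφ' : ContinuousOn (fun z : Q => φ z.1) (closure Ω ×ˢ Ici 0) :=
    heig.1.comp continuousOn_fst fun z hz => hz.1
  have hgc : ContinuousOn ♯g (closure Ω ×ˢ Ici 0) :=
    (Continuous.continuousOn (by fun_prop)).mul hφ'
  have hwc : ContinuousOn (fun z : Q => (g z.1 z.2 - u z.1 z.2) / δ) (closure Ω ×ˢ Ici 0) :=
    (hgc.sub hu.cont).div_const δ
  have hζc : ContinuousOn ♯ζ (closure Ω ×ˢ Ici 0) :=
    hgc.sub (continuousOn_const.mul (continuous_psi.comp_continuousOn hwc))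
  have hζd : ∀ x ∈ Ω, ∀ t > 0, HasDerivAt (ζ x) (ζt x t) t := by
    intro x hx t ht
    have h1 : HasDerivAt (fun t => (g x t - u x t) / δ) ((-lam * g x t - ut x t) / δ) t :=
      ((hgt x t).sub (hu.deriv x hx t ht)).div_const δ
    have h2 : HasDerivAt (fun t => psi ((g x t - u x t) / δ))
        (psi1 ((g x t - u x t) / δ) * ((-lam * g x t - ut x t) / δ)) t :=
      HasDerivAt.comp t (h₂ := psi) (hasDerivAt_psi ((g x t - u x t) / δ)) h1
    refine ((hgt x t).sub (h2.const_mul δ)).congr_deriv ?_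
    simp only [hζt, hP]
    field_simp
  have hbase : Ω ×ˢ Ioi 0 ⊆ closure Ω ×ˢ Ici (0:ℝ) := prod_mono subset_closure Ioi_subset_Ici_self
  have hζtc : ContinuousOn ♯ζt (Ω ×ˢ Ioi 0) := by
    have h1 := (hgc.mono hbase).const_smul (-lam)
    have h2 := continuous_psi1.comp_continuousOn (hwc.mono hbase)
    exact h1.sub (h2.mul (h1.sub hu.contd))
  have hφ2 : ∀ x ∈ Ω, ContDiffAt ℝ 2 φ x := fun x hx => heig.2.1.contDiffAt (hΩ.mem_nhds hx)
  have hζ2 : ∀ t > 0, ContDiffOn ℝ 2 (fun x => ζ x t) Ω := by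
    intro t ht
    have h1 : ContDiffOn ℝ 2 (fun x => g x t) Ω := contDiffOn_const.mul heig.2.1
    exact h1.sub (contDiffOn_const.mul (contDiff_psi.comp_contDiffOn
      ((h1.sub (hu.c2 t ht)).div_const δ)))
  have hζ0 : ∀ x ∈ closure Ω, ∀ t ≥ 0, 0 ≤ ζ x t := by
    intro x hx t ht
    refine le_trans (le_min (hu.nonneg x hx t ht) (mul_nonneg (exp_pos _).le ?_)) (le_smin hδ x t)
    rcases em (x ∈ Ω) with h | h
    · exact (heig.2.2.2.2 x h).le
    · rw [heig.2.2.2.1 x ⟨hx, by rwa [hΩ.interior_eq]⟩]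
  have hpde : ∀ x ∈ Ω, ∀ t > 0, lap (fun y => ζ y t) x ≤ C' * ε t * ζ x t + ζt x t := by
    intro x hx t ht
    have hg2 : ContDiffAt ℝ 2 (fun y => g y t) x := contDiffAt_const.mul (hφ2 x hx)
    have hu2 : ContDiffAt ℝ 2 (fun y => u y t) x := (hu.c2 t ht).contDiffAt (hΩ.mem_nhds hx)
    have hw2 : ContDiffAt ℝ 2 (fun y => g y t - u y t) x := hg2.sub hu2
    have hd : ∀ s : ℝ, HasDerivAt (fun s => s / δ) (1 / δ) s := fun s => (hasDerivAt_id s).div_const δ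
    have hl1 : lap (fun y => δ * psi ((g y t - u y t) / δ)) x = psi1 ((g x t - u x t) / δ) *
        lap (fun y => g y t - u y t) x +
          psi2 ((g x t - u x t) / δ) * (1 / δ) * gradSq (fun y => g y t - u y t) x := by
      refine lap_comp (H := fun s => δ * psi (s / δ)) (H' := fun s => psi1 (s / δ)) hw2
        (of_forall fun s => ?_) ((hasDerivAt_psi1 _).comp _ (hd _))
      refine (((hasDerivAt_psi _).comp s (hd s)).const_mul δ).congr_deriv ?_
      field_simp
    have hl2 : lap (fun y => ζ y t) x = lap (fun y => g y t) x -
        lap (fun y => δ * psi ((g y t - u y t) / δ)) x :=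
      lap_sub hg2 (contDiffAt_const.mul (contDiff_psi.contDiffAt.comp x (hw2.div_const δ)))
    have hlg : lap (fun y => g y t) x = -lam * g x t := by
      simp only [hg]
      rw [lap_const_mul _ (hφ2 x hx)]
      have := heig.2.2.1 x hx
      rw [show lap φ x = - lam * φ x by linarith]; ring
    rw [hl2, hl1, lap_sub hg2 hu2, hlg]
    have h3 : 0 ≤ psi2 ((g x t - u x t) / δ) * (1 / δ) * gradSq (fun y => g y t - u y t) x :=
      mul_nonneg (mul_nonneg (psi2_nonneg _) (by positivity)) (gradSq_nonneg _ _)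
    have hu0 := hu.nonneg x (subset_closure hx) t ht.le
    obtain ⟨ha0, hb0⟩ := hab x (subset_closure hx) t ht.le
    have hreac : - (b x t * u x t ^ q) ≤ reac a b r q (nonloc Ω p u) u x t := by
      unfold reac
      have : 0 ≤ nonloc Ω p u t := setIntegral_nonneg hΩ.measurableSet fun y hy =>
        rpow_nonneg (hu.nonneg y (subset_closure hy) t ht.le) _
      have : 0 ≤ a x t * u x t ^ r * nonloc Ω p u t :=
        mul_nonneg (mul_nonneg ha0 (rpow_nonneg hu0 _)) this
      linarith
    have hP0 : 0 ≤ P x t := psi1_nonneg _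
    have hmain : P x t * (b x t * u x t ^ q) ≤ C' * ε t * ζ x t := by
      rcases le_or_gt (g x t) (u x t) with h | h
      · have : P x t = 0 := psi1_of_nonpos (div_nonpos_of_nonpos_of_nonneg (by linarith) hδ.le)
        rw [this, zero_mul]
        exact mul_nonneg (mul_nonneg hC'0 (hε0 t)) (hζ0 x (subset_closure hx) t ht.le)
      · have h1 : u x t ≤ ζ x t := by
          have := le_smin (lam := lam) (φ := φ) (u := u) hδ x t
          rwa [min_eq_left h.le] at this
        have hg1 : g x t ≤ exp (-lam * t) * G :=
          mul_le_mul_of_nonneg_left (hG x (subset_closure hx)) (exp_pos _).le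
        have h2 : u x t ^ (q - 1) ≤ exp (-lam * (q - 1) * t) * C' := by
          refine (rpow_le_rpow hu0 (h.le.trans hg1) (by linarith)).trans (le_of_eq ?_)
          rw [mul_rpow (exp_pos _).le hG0.le, ← exp_mul]
          congr 2; ring
        have h3 : u x t ^ q = u x t * u x t ^ (q - 1) := by
          rw [← rpow_one_add' hu0 (by linarith)]; congr 1; ring
        have h4 : b x t * u x t ^ q ≤ C' * ε t * u x t := by
          rw [h3]
          calc b x t * (u x t * u x t ^ (q - 1))
              ≤ (ε t * exp (lam * (q - 1) * t)) * (u x t * (exp (-lam * (q - 1) * t) * C')) := by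
                refine mul_le_mul (hbε x hx t ht) (mul_le_mul_of_nonneg_left h2 hu0)
                  (mul_nonneg hu0 (rpow_nonneg hu0 _)) (mul_nonneg (hε0 t) (exp_pos _).le)
            _ = (exp (lam * (q - 1) * t) * exp (-lam * (q - 1) * t)) * (C' * ε t * u x t) := by ring
            _ = C' * ε t * u x t := by
                rw [← exp_add, show lam * (q - 1) * t + -lam * (q - 1) * t = 0 by ring, exp_zero,
                  one_mul]
        calc P x t * (b x t * u x t ^ q) ≤ 1 * (b x t * u x t ^ q) :=
              mul_le_mul_of_nonneg_right (psi1_le_one _) (mul_nonneg hb0 (rpow_nonneg hu0 _))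
          _ ≤ C' * ε t * u x t := by rw [one_mul]; exact h4
          _ ≤ _ := mul_le_mul_of_nonneg_left h1 (mul_nonneg hC'0 (hε0 t))
    have hPr := mul_le_mul_of_nonneg_left hreac hP0
    simp only [hζt, hut, hP] at *
    nlinarith
  have key := kaplan (z := fun x t => G₁ t * ζ x t)
    (zt := fun x t => G₁ t * (lam + C' * ε t) * ζ x t + G₁ t * ζt x t) (F := fun _ _ => 0) hΩ hb heig
    ((hEc.comp continuous_snd).continuousOn.mul hζc)
    (fun x hx t ht => mul_nonneg (hE0 t).le (hζ0 x hx t ht))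
    (fun t ht => contDiffOn_const.mul (hζ2 t ht))
    (fun x hx t ht => (hEd t).mul (hζd x hx t ht))
    ((Continuous.continuousOn (by fun_prop) |>.mul (hζc.mono hbase)).add
      ((hEc.comp continuous_snd).continuousOn.mul hζtc))
    continuousOn_const
    (fun x hx t ht => by
      rw [lap_const_mul _ ((hζ2 t ht).contDiffAt (hΩ.mem_nhds hx))]
      have := mul_le_mul_of_nonneg_left (hpde x hx t ht) (hE0 t).le
      linarith) le_rfl ht
  have hE00 : G₁ 0 = 1 := by simp [hE]
  simp only [mul_zero, integral_zero, intervalIntegral.integral_zero, hE00, one_mul] at key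
  have hxc : ∀ {f : E → ℝ → ℝ}, ContinuousOn ♯f (closure Ω ×ˢ Ici 0) →
      ∀ t ≥ 0, ContinuousOn (fun x => f x t) (closure Ω) := fun hf t ht =>
    hf.comp (f := fun x : E => (x, t)) (by fun_prop) fun x hx => ⟨hx, ht⟩
  have hφpos : ∀ x ∈ Ω, 0 ≤ φ x := fun x hx => (heig.2.2.2.2 x hx).le
  have hminc : ContinuousOn (fun z : Q => min (u z.1 z.2) (g z.1 z.2)) (closure Ω ×ˢ Ici 0) :=
    hu.cont.inf hgc
  have iφ := integrableOn_of_closure hb heig.1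
  have i1 : IntegrableOn (fun x => φ x * min (u x t) (g x t)) Ω :=
    integrableOn_of_closure hb (heig.1.mul (hxc (f := fun x t => min (u x t) (g x t)) hminc t ht))
  calc ∫ x in Ω, φ x * min (u x 0) (φ x) ≤ ∫ x in Ω, φ x * ζ x 0 := by
        refine setIntegral_mono_on ?_ ?_ hΩ.measurableSet fun x hx => ?_
        · refine integrableOn_of_closure hb (heig.1.mul ?_)
          simpa [hg] using hxc (f := fun x t => min (u x t) (g x t)) hminc 0 le_rfl
        · exact integrableOn_of_closure hb (heig.1.mul (hxc hζc 0 le_rfl))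
        · refine mul_le_mul_of_nonneg_left ?_ (hφpos x hx)
          have := le_smin (lam := lam) (φ := φ) (u := u) hδ x 0
          simpa using this
    _ ≤ ∫ x in Ω, φ x * (G₁ t * ζ x t) := by linarith
    _ ≤ ∫ x in Ω, G₁ t * (φ x * min (u x t) (g x t) + 2 * δ * φ x) := by
        refine setIntegral_mono_on ?_ ?_ hΩ.measurableSet fun x hx => ?_
        · exact integrableOn_of_closure hb
            (heig.1.mul (continuousOn_const.mul (hxc hζc t ht)))
        · exact (i1.add (iφ.const_mul _)).const_mul _
        · have := smin_le (lam := lam) (φ := φ) (u := u) hδ x t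
          have h2 := mul_le_mul_of_nonneg_left this (mul_nonneg (hE0 t).le (hφpos x hx))
          simp only [hg, hζ] at *
          linarith
    _ = _ := by rw [integral_const_mul, integral_add i1 (iφ.const_mul _), integral_const_mul]

lemma GlobalSol.exists_lower_bound (hu : GlobalSol r p q Ω a b u) (hΩ : IsOpen Ω)
    (hb : Bdd Ω) (heig : IsDirichletEigen Ω lam φ) (hq : 1 < q)
    (hab : ∀ x ∈ closure Ω, ∀ t ≥ 0, 0 ≤ a x t ∧ 0 ≤ b x t)
    (hε : Continuous ε) (hε0 : ∀ t, 0 ≤ ε t) (hεi : IntegrableOn ε (Ioi 0))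
    (hbε : ∀ x ∈ Ω, ∀ t > 0, b x t ≤ ε t * exp (lam * (q - 1) * t))
    (hx : ∃ x ∈ Ω, u x 0 ≠ 0) : ∃ c > 0, ∀ t ≥ 0,
    c * exp (-lam * t) ≤ ∫ x in Ω, φ x * min (u x t) (exp (-lam * t) * φ x) := by
  obtain ⟨G₀, hG₀⟩ := hb.isCompact_closure.exists_bound_of_continuousOn heig.1
  set G := |G₀| + 1 with hGdef
  have hG0 : 0 < G := by positivity
  have hG : ∀ x ∈ closure Ω, φ x ≤ G := fun x hx =>
    ((le_abs_self _).trans (hG₀ x hx)).trans (by linarith [le_abs_self G₀])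
  have hφpos : ∀ x ∈ Ω, 0 < φ x := heig.2.2.2.2
  have hu0c : ContinuousOn (fun x => u x 0) (closure Ω) :=
    hu.cont.comp (f := fun x : E => (x, (0:ℝ))) (by fun_prop) fun x hx => ⟨hx, le_refl (0:ℝ)⟩
  have hI0c : ContinuousOn (fun x => φ x * min (u x 0) (φ x)) (closure Ω) :=
    heig.1.mul (hu0c.inf heig.1)
  set I₀ := ∫ x in Ω, φ x * min (u x 0) (φ x) with hI₀
  have hI₀pos : 0 < I₀ := by
    obtain ⟨x, hxΩ, hux⟩ := hx
    have hnn : ∀ y ∈ Ω, 0 ≤ φ y * min (u y 0) (φ y) := fun y hy =>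
      mul_nonneg (hφpos y hy).le (le_min (hu.nonneg y (subset_closure hy) 0 le_rfl) (hφpos y hy).le)
    rw [hI₀, setIntegral_pos_iff_support_of_nonneg_ae
      ((ae_restrict_mem hΩ.measurableSet).mono fun y hy => hnn y hy)
      (integrableOn_of_closure hb hI0c)]
    have hopen : IsOpen (Ω ∩ (fun y => φ y * min (u y 0) (φ y)) ⁻¹' Ioi 0) :=
      (hI0c.mono subset_closure).isOpen_inter_preimage hΩ isOpen_Ioi
    refine (hopen.measure_pos volume ⟨x, hxΩ, ?_⟩).trans_le (measure_mono ?_)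
    · have h1 : 0 < u x 0 := lt_of_le_of_ne (hu.nonneg x (subset_closure hxΩ) 0 le_rfl) (Ne.symm hux)
      exact mul_pos (hφpos x hxΩ) (lt_min h1 (hφpos x hxΩ))
    · rintro y ⟨hy1, hy2⟩
      exact ⟨ne_of_gt hy2, hy1⟩
  set Eε := ∫ τ in Ioi (0:ℝ), ε τ with hEε
  set C' := G ^ (q - 1) with hC'
  have hC'0 : 0 ≤ C' := by positivity
  refine ⟨I₀ * exp (-(C' * Eε)), by positivity, fun t ht => ?_⟩
  set Φ := ∫ x in Ω, φ x with hΦ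
  have hΦ0 : 0 ≤ Φ := setIntegral_nonneg hΩ.measurableSet fun x hx => (hφpos x hx).le
  set J := ∫ x in Ω, φ x * min (u x t) (exp (-lam * t) * φ x) with hJ
  have hJ0 : 0 ≤ J := setIntegral_nonneg hΩ.measurableSet fun x hx =>
    mul_nonneg (hφpos x hx).le (le_min (hu.nonneg x (subset_closure hx) t ht)
      (mul_nonneg (exp_pos _).le (hφpos x hx).le))
  set Et := exp (lam * t + C' * ∫ τ in (0:ℝ)..t, ε τ) with hEt
  have h1 : I₀ ≤ Et * J := by
    refine le_of_forall_pos_le_add fun η hη => ?_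
    have h := hu.integral_min_le hΩ hb heig hq hab hε hε0 hbε hG0 hG ht
      (δ := η / (2 * Et * (Φ + 1))) (by positivity)
    refine h.trans ?_
    have hEt0 : 0 < Et := exp_pos _
    have : Et * (2 * (η / (2 * Et * (Φ + 1))) * Φ) ≤ η := by
      have e : Et * (2 * (η / (2 * Et * (Φ + 1))) * Φ) = η * (Φ / (Φ + 1)) := by field_simp
      rw [e]
      exact mul_le_of_le_one_right hη.le (by rw [div_le_one (by positivity)]; linarith)
    rw [mul_add]
    linarith
  have h2 : (∫ τ in (0:ℝ)..t, ε τ) ≤ Eε := by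
    rw [intervalIntegral.integral_of_le ht]
    exact setIntegral_mono_set hεi (of_forall fun τ => hε0 τ) Ioc_subset_Ioi_self.eventuallyLE
  have h3 : Et ≤ exp (lam * t) * exp (C' * Eε) := by
    rw [← exp_add]
    exact exp_le_exp.2 (by linarith [mul_le_mul_of_nonneg_left h2 hC'0])
  have h4 : I₀ ≤ exp (lam * t) * exp (C' * Eε) * J := h1.trans (mul_le_mul_of_nonneg_right h3 hJ0)
  have h5 := mul_le_mul_of_nonneg_right h4 (by positivity : 0 ≤ exp (-(C' * Eε)) * exp (-lam * t))
  have h6 : exp (lam * t) * exp (C' * Eε) * J * (exp (-(C' * Eε)) * exp (-lam * t)) = J := by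
    have : exp (lam * t) * exp (-lam * t) = 1 := by rw [← exp_add]; simp
    have h7 : exp (C' * Eε) * exp (-(C' * Eε)) = 1 := by rw [← exp_add]; simp
    calc _ = (exp (lam * t) * exp (-lam * t)) * (exp (C' * Eε) * exp (-(C' * Eε))) * J := by ring
      _ = J := by rw [this, h7]; ring
  rw [h6] at h5
  linarith

end lower

lemma integrableOn_Ioi_of_superlinear {α m : ℝ → ℝ} {κ : ℝ} (hα : Continuous α)
    (hα0 : ∀ t, 0 ≤ α t) (hm : Continuous m) (hκ : 1 < κ) (hms : 0 < m s)
    (h : ∀ t, s ≤ t → ∫ τ in s..t, α τ * m τ ^ κ ≤ m t - m s) (hm0 : ∀ t, 0 ≤ m t) :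
    IntegrableOn α (Ioi s) := by
  set f : ℝ → ℝ := fun τ => α τ * m τ ^ κ with hf
  have hfc : Continuous f := hα.mul (hm.rpow_const fun _ => Or.inr (by linarith))
  set N : ℝ → ℝ := fun t => m s + ∫ τ in s..t, f τ with hN
  have hNd : ∀ t, HasDerivAt N (f t) t := fun t =>
    (intervalIntegral.integral_hasDerivAt_right (hfc.intervalIntegrable _ _)
      (hfc.stronglyMeasurableAtFilter _ _) hfc.continuousAt).const_add (m s)
  have hAd : ∀ t, HasDerivAt (fun t => ∫ τ in s..t, α τ) (α t) t := fun t =>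
    intervalIntegral.integral_hasDerivAt_right (hα.intervalIntegrable _ _)
      (hα.stronglyMeasurableAtFilter _ _) hα.continuousAt
  have hf0 : ∀ t, 0 ≤ f t := fun t => mul_nonneg (hα0 t) (rpow_nonneg (hm0 t) _)
  have hNpos : ∀ t, s ≤ t → 0 < N t := fun t ht => by
    have := intervalIntegral.integral_nonneg (μ := volume) (f := f) ht fun τ _ => hf0 τ
    simp only [hN]; linarith
  have hNm : ∀ t, s ≤ t → N t ≤ m t := fun t ht => by have := h t ht; simp only [hN]; linarith
  have hHd : ∀ t, s ≤ t → HasDerivAt (fun t => (∫ τ in s..t, α τ) + N t ^ (1 - κ) / (κ - 1))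
      (α t + (f t * (1 - κ) * N t ^ (1 - κ - 1)) / (κ - 1)) t := fun t ht =>
    (hAd t).add (((hNd t).rpow_const (Or.inl (hNpos t ht).ne')).div_const _)
  have hanti : AntitoneOn (fun t => (∫ τ in s..t, α τ) + N t ^ (1 - κ) / (κ - 1)) (Ici s) := by
    refine antitoneOn_of_deriv_nonpos (convex_Ici s)
      (fun t ht => (hHd t ht).continuousAt.continuousWithinAt) ?_ ?_
    · intro t ht
      rw [interior_Ici] at ht
      exact (hHd t (le_of_lt ht)).differentiableAt.differentiableWithinAt
    · intro t ht
      rw [interior_Ici] at ht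
      have hst : s ≤ t := le_of_lt ht
      rw [(hHd t hst).deriv]
      have e : α t + (f t * (1 - κ) * N t ^ (1 - κ - 1)) / (κ - 1) = α t - f t * N t ^ (-κ) := by
        rw [show 1 - κ - 1 = -κ by ring]
        have : κ - 1 ≠ 0 := by linarith
        field_simp
        ring
      rw [e, rpow_neg (hNpos t hst).le, sub_nonpos, ← div_eq_mul_inv,
        le_div_iff₀ (rpow_pos_of_pos (hNpos t hst) _)]
      exact mul_le_mul_of_nonneg_left (rpow_le_rpow (hNpos t hst).le (hNm t hst) (by linarith)) (hα0 t)
  refine integrableOn_Ioi_of_intervalIntegral_norm_bounded (l := atTop) (b := fun i : ℝ => i)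
    (m s ^ (1 - κ) / (κ - 1)) s (fun i => (hα.integrableOn_Icc).mono_set Ioc_subset_Icc_self)
    tendsto_id ?_
  filter_upwards [eventually_ge_atTop s] with t ht
  have h1 := hanti self_mem_Ici ht ht
  simp only [intervalIntegral.integral_same, hN, add_zero, zero_add] at h1
  have h2 : 0 ≤ N t ^ (1 - κ) / (κ - 1) := div_nonneg (rpow_nonneg (hNpos t ht).le _) (by linarith)
  simp only [Real.norm_eq_abs, abs_of_nonneg (hα0 _)]
  simp only [hN] at h2
  linarith

section jensen

variable {κ : ℝ}

lemma IsDirichletEigen.integral_pos (hΩ : IsOpen Ω) (hb : Bdd Ω) (hne : Ω.Nonempty)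
    (heig : IsDirichletEigen Ω lam φ) : 0 < ∫ x in Ω, φ x := by
  rw [setIntegral_pos_iff_support_of_nonneg_ae
    ((ae_restrict_mem hΩ.measurableSet).mono fun y hy => (heig.2.2.2.2 y hy).le)
    (integrableOn_of_closure hb heig.1)]
  exact (hΩ.measure_pos volume hne).trans_le
    (measure_mono fun y hy => ⟨(heig.2.2.2.2 y hy).ne', hy⟩)

lemma IsDirichletEigen.jensen (hΩ : IsOpen Ω) (hb : Bdd Ω) (hne : Ω.Nonempty)
    (heig : IsDirichletEigen Ω lam φ) (hf : ContinuousOn f (closure Ω)) (hf0 : ∀ x ∈ Ω, 0 ≤ f x)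
    (hκ : 1 ≤ κ) :
    (∫ x in Ω, φ x) * ((∫ x in Ω, φ x * f x) / ∫ x in Ω, φ x) ^ κ ≤ ∫ x in Ω, φ x * f x ^ κ := by
  have hΦ := heig.integral_pos hΩ hb hne
  set Φ := ∫ x in Ω, φ x with hΦdef
  set A := (∫ x in Ω, φ x * f x) / Φ with hA
  have hφ0 : ∀ x ∈ Ω, 0 ≤ φ x := fun x hx => (heig.2.2.2.2 x hx).le
  have hA0 : 0 ≤ A := div_nonneg
    (setIntegral_nonneg hΩ.measurableSet fun x hx => mul_nonneg (hφ0 x hx) (hf0 x hx)) hΦ.le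
  rcases hA0.eq_or_lt with h | h
  · rw [← h, zero_rpow (by linarith), mul_zero]
    exact setIntegral_nonneg hΩ.measurableSet fun x hx =>
      mul_nonneg (hφ0 x hx) (rpow_nonneg (hf0 x hx) _)
  · have i1 := integrableOn_of_closure hb heig.1
    have i2 : IntegrableOn (fun x => φ x * f x) Ω := integrableOn_of_closure hb (heig.1.mul hf)
    have i3 := integrableOn_of_closure hb
      (heig.1.mul (hf.rpow_const fun _ _ => Or.inr (by linarith : 0 ≤ κ)))
    have e : Φ * A ^ κ = ∫ x in Ω, (A ^ κ * (1 - κ) * φ x + A ^ κ * κ / A * (φ x * f x)) := by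
      rw [integral_add (i1.const_mul _) (i2.const_mul _), integral_const_mul, integral_const_mul]
      have : ∫ x in Ω, φ x * f x = A * Φ := by rw [hA]; field_simp
      rw [this, ← hΦdef]
      field_simp
      ring
    rw [e]
    refine setIntegral_mono_on ((i1.const_mul _).add (i2.const_mul _)) i3 hΩ.measurableSet
      fun x hx => ?_
    have h1 := one_add_mul_self_le_rpow_one_add (s := f x / A - 1)
      (by have := div_nonneg (hf0 x hx) h.le; linarith) hκ
    rw [show 1 + (f x / A - 1) = f x / A by ring, div_rpow (hf0 x hx) h.le,
      le_div_iff₀ (rpow_pos_of_pos h _)] at h1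
    have h2 := mul_le_mul_of_nonneg_left h1 (hφ0 x hx)
    refine le_trans (le_of_eq ?_) h2
    field_simp
    ring

end jensen

lemma infOmega_le (h0 : ∀ x ∈ Ω, 0 ≤ a x t) (hx : x ∈ Ω) : infOmega Ω a t ≤ a x t :=
  csInf_le ⟨0, by rintro _ ⟨y, hy, rfl⟩; exact h0 y hy⟩ ⟨x, hx, rfl⟩

lemma infOmega_nonneg (h0 : ∀ x ∈ Ω, 0 ≤ a x t) : 0 ≤ infOmega Ω a t :=
  Real.sInf_nonneg (by rintro _ ⟨y, hy, rfl⟩; exact h0 y hy)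

lemma le_supOmega (hb : Bdd Ω) (hhb : LocHolder Ω b) (ht : 0 ≤ t) (hx : x ∈ Ω) :
    b x t ≤ supOmega Ω b t := by
  have hc : ContinuousOn (fun x => b x t) (closure Ω) :=
    hhb.continuousOn.comp (f := fun x : E => (x, t)) (by fun_prop) fun x hx => ⟨hx, ht⟩
  exact le_csSup ((hb.isCompact_closure.bddAbove_image hc).mono (image_mono subset_closure))
    ⟨x, hx, rfl⟩

lemma infOmega_continuousOn (hne : Ω.Nonempty)
    (hha : LocHolder Ω a) (h0 : ∀ x ∈ Ω, ∀ t ≥ 0, 0 ≤ a x t) :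
    ContinuousOn (infOmega Ω a) (Ici 0) := by
  obtain ⟨θ, hθ, -, h⟩ := hha.nonneg_const
  intro t ht
  simp only [mem_Ici] at ht
  obtain ⟨C, hC0, hC⟩ := h (t + 1) (by linarith)
  have key : ∀ s ∈ Icc (0:ℝ) (t + 1), ∀ s' ∈ Icc (0:ℝ) (t + 1),
      infOmega Ω a s ≤ infOmega Ω a s' + C * |s - s'| ^ θ := by
    intro s hs s' hs'
    rw [← sub_le_iff_le_add]
    refine le_csInf (hne.image _) ?_
    rintro _ ⟨x, hx, rfl⟩
    have h1 := hC x (subset_closure hx) x (subset_closure hx) s hs s' hs'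
    rw [dist_self, zero_add] at h1
    have := infOmega_le (fun y hy => h0 y hy s hs.1) hx
    have := (abs_le.1 h1).2
    simp only
    linarith
  have hlim : Tendsto (fun s => C * |s - t| ^ θ) (𝓝[Ici 0] t) (𝓝 0) := by
    have : Continuous fun s : ℝ => C * |s - t| ^ θ :=
      continuous_const.mul ((continuous_id.sub continuous_const).abs.rpow_const fun _ => Or.inr hθ.le)
    have h2 := (this.tendsto t).mono_left (nhdsWithin_le_nhds (s := Ici 0))
    simpa [zero_rpow hθ.ne'] using h2
  rw [ContinuousWithinAt, tendsto_iff_dist_tendsto_zero]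
  refine squeeze_zero' (of_forall fun s => dist_nonneg) ?_ hlim
  have : ∀ᶠ s in 𝓝[Ici 0] t, s < t + 1 := nhdsWithin_le_nhds (Iio_mem_nhds (by linarith))
  filter_upwards [self_mem_nhdsWithin, this] with s hs hs2
  rw [Real.dist_eq, abs_le]
  have h1 := key s ⟨hs, hs2.le⟩ t ⟨ht, by linarith⟩
  have h2 := key t ⟨ht, by linarith⟩ s ⟨hs, hs2.le⟩
  rw [abs_sub_comm t s] at h2
  constructor <;> linarith

lemma GlobalSol.continuousOn_slice (hu : GlobalSol r p q Ω a b u) (ht : 0 ≤ t) :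
    ContinuousOn (fun x => u x t) (closure Ω) :=
  hu.cont.comp (f := fun x : E => (x, t)) (by fun_prop) fun x hx => ⟨hx, ht⟩

lemma GlobalSol.integrableOn_moment (hu : GlobalSol r p q Ω a b u) (hb : Bdd Ω)
    (heig : IsDirichletEigen Ω lam φ) (hs : 0 ≤ s) (ht : 0 ≤ t) :
    IntegrableOn (fun x => φ x * u x t ^ s) Ω :=
  integrableOn_of_closure hb
    (heig.1.mul ((hu.continuousOn_slice ht).rpow_const fun _ _ => Or.inr hs))

lemma GlobalSol.exists_moment_lower (hu : GlobalSol r p q Ω a b u) (hΩ : IsOpen Ω)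
    (hb : Bdd Ω) (hne : Ω.Nonempty) (heig : IsDirichletEigen Ω lam φ)
    (hc : 0 < c) (hlow : ∀ t ≥ 0,
    c * exp (-lam * t) ≤ ∫ x in Ω, φ x * min (u x t) (exp (-lam * t) * φ x)) (hs : 0 < s) :
    ∃ c' > 0, ∀ t ≥ 0, c' * exp (-lam * s * t) ≤ ∫ x in Ω, φ x * u x t ^ s := by
  have hΦ := heig.integral_pos hΩ hb hne
  have hφ0 : ∀ x ∈ Ω, 0 ≤ φ x := fun x hx => (heig.2.2.2.2 x hx).le
  have imin : ∀ t ≥ 0, IntegrableOn (fun x => φ x * min (u x t) (exp (-lam * t) * φ x)) Ω :=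
    fun t ht => integrableOn_of_closure hb
      (heig.1.mul ((hu.continuousOn_slice ht).inf (continuousOn_const.mul heig.1)))
  rcases le_total 1 s with h1 | h1
  · refine ⟨(∫ x in Ω, φ x) * (c / ∫ x in Ω, φ x) ^ s, by positivity, fun t ht => ?_⟩
    refine le_trans ?_ (heig.jensen hΩ hb hne (hu.continuousOn_slice ht)
      (fun x hx => hu.nonneg x (subset_closure hx) t ht) h1)
    rw [mul_assoc]
    refine mul_le_mul_of_nonneg_left ?_ hΦ.le
    rw [show -lam * s * t = (-lam * t) * s by ring, exp_mul, ← mul_rpow (by positivity) (exp_pos _).le]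
    refine rpow_le_rpow (by positivity) ?_ hs.le
    rw [div_mul_eq_mul_div]
    refine div_le_div_of_nonneg_right ((hlow t ht).trans ?_) hΦ.le
    refine setIntegral_mono_on (imin t ht) (integrableOn_of_closure hb
      (heig.1.mul (hu.continuousOn_slice ht))) hΩ.measurableSet fun x hx => ?_
    exact mul_le_mul_of_nonneg_left (min_le_left _ _) (hφ0 x hx)
  · obtain ⟨G₀, hG₀⟩ := hb.isCompact_closure.exists_bound_of_continuousOn heig.1
    set G := |G₀| + 1 with hGdef
    have hG0 : 0 < G := by positivity
    have hG : ∀ x ∈ closure Ω, φ x ≤ G := fun x hx =>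
      ((le_abs_self _).trans (hG₀ x hx)).trans (by linarith [le_abs_self G₀])
    refine ⟨G ^ (s - 1) * c, by positivity, fun t ht => ?_⟩
    have e : G ^ (s - 1) * c * exp (-lam * s * t) =
        (exp (-lam * t) * G) ^ (s - 1) * (c * exp (-lam * t)) := by
      rw [mul_rpow (exp_pos _).le hG0.le, ← exp_mul]
      calc _ = G ^ (s - 1) * c * exp (-lam * t * (s - 1) + -lam * t) := by congr 2; ring
        _ = _ := by rw [exp_add]; ring
    rw [e]
    refine (mul_le_mul_of_nonneg_left (hlow t ht) (by positivity)).trans ?_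
    rw [← integral_const_mul]
    refine setIntegral_mono_on ((imin t ht).const_mul _) (hu.integrableOn_moment hb heig hs.le ht)
      hΩ.measurableSet fun x hx => ?_
    set v := min (u x t) (exp (-lam * t) * φ x) with hv
    have hu0 := hu.nonneg x (subset_closure hx) t ht
    have hv0 : 0 ≤ v := le_min hu0 (mul_nonneg (exp_pos _).le (hφ0 x hx))
    have hvG : v ≤ exp (-lam * t) * G := (min_le_right _ _).trans
      (mul_le_mul_of_nonneg_left (hG x (subset_closure hx)) (exp_pos _).le)
    have hmain : (exp (-lam * t) * G) ^ (s - 1) * v ≤ u x t ^ s := by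
      rcases hv0.eq_or_lt with h | h
      · rw [← h, mul_zero]; exact rpow_nonneg hu0 _
      · calc (exp (-lam * t) * G) ^ (s - 1) * v ≤ v ^ (s - 1) * v :=
              mul_le_mul_of_nonneg_right (rpow_le_rpow_of_nonpos h hvG (by linarith)) hv0
          _ = v ^ s := by rw [← rpow_add_one h.ne']; congr 1; ring
          _ ≤ _ := rpow_le_rpow hv0 (min_le_left _ _) hs.le
    have := mul_le_mul_of_nonneg_left hmain (hφ0 x hx)
    linarith

lemma GlobalSol.exists_moment_mul_lower (hu : GlobalSol r p q Ω a b u) (hΩ : IsOpen Ω)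
    (hb : Bdd Ω) (hne : Ω.Nonempty) (heig : IsDirichletEigen Ω lam φ)
    (hc : 0 < c) (hlow : ∀ t ≥ 0,
    c * exp (-lam * t) ≤ ∫ x in Ω, φ x * min (u x t) (exp (-lam * t) * φ x))
    (hq : 1 < q) (hs : q ≤ s) : ∃ c' > 0, ∀ t ≥ 0,
    c' * exp (-lam * (s - q) * t) * ∫ x in Ω, φ x * u x t ^ q ≤ ∫ x in Ω, φ x * u x t ^ s := by
  have hΦ := heig.integral_pos hΩ hb hne
  set Φ := ∫ x in Ω, φ x with hΦdef
  obtain ⟨c₁, hc₁, h₁⟩ := hu.exists_moment_lower hΩ hb hne heig hc hlow (s := q) (by linarith)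
  refine ⟨(c₁ / Φ) ^ (s / q - 1), by positivity, fun t ht => ?_⟩
  have hq0 : 0 < q := by linarith
  have hu0 : ∀ x ∈ Ω, 0 ≤ u x t := fun x hx => hu.nonneg x (subset_closure hx) t ht
  have hj := heig.jensen hΩ hb hne (f := fun x => u x t ^ q)
    ((hu.continuousOn_slice ht).rpow_const fun _ _ => Or.inr hq0.le)
    (fun x hx => rpow_nonneg (hu0 x hx) _) (κ := s / q) (by rwa [le_div_iff₀ hq0, one_mul])
  have e1 : ∫ x in Ω, φ x * (u x t ^ q) ^ (s / q) = ∫ x in Ω, φ x * u x t ^ s := by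
    refine setIntegral_congr_fun hΩ.measurableSet fun x hx => ?_
    rw [← rpow_mul (hu0 x hx), mul_div_cancel₀ _ hq0.ne']
  rw [e1] at hj
  refine le_trans ?_ hj
  set X := ∫ x in Ω, φ x * u x t ^ q with hX
  have hX0 : 0 < X := lt_of_lt_of_le (by positivity) (h₁ t ht)
  have e2 : Φ * (X / Φ) ^ (s / q) = (X / Φ) ^ (s / q - 1) * X := by
    rw [rpow_sub_one (by positivity)]
    field_simp
  rw [← hΦdef, e2]
  refine mul_le_mul_of_nonneg_right ?_ hX0.le
  have e3 : exp (-lam * (s - q) * t) = exp (-lam * q * t) ^ (s / q - 1) := by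
    rw [← exp_mul]
    congr 1
    field_simp
  rw [e3, ← mul_rpow (by positivity) (exp_pos _).le, div_mul_eq_mul_div]
  refine rpow_le_rpow (by positivity) (div_le_div_of_nonneg_right (h₁ t ht) hΦ.le) ?_
  rw [sub_nonneg, le_div_iff₀ hq0, one_mul]
  exact hs

lemma GlobalSol.not_exists (hu : GlobalSol r p q Ω a b u) (hΩ : IsOpen Ω)
    (hb : Bdd Ω) (hne : Ω.Nonempty) (heig : IsDirichletEigen Ω lam φ)
    (hr : 0 < r) (hp : 0 < p) (hq : 1 < q) (hrpq : q ≤ max r p)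
    (hha : LocHolder Ω a) (hhb : LocHolder Ω b)
    (hab : ∀ x ∈ closure Ω, ∀ t ≥ 0, 0 ≤ a x t ∧ 0 ≤ b x t)
    (hc : 0 < c) (hlow : ∀ t ≥ 0,
    c * exp (-lam * t) ≤ ∫ x in Ω, φ x * min (u x t) (exp (-lam * t) * φ x))
    {γ : ℝ → ℝ} (hγ : Tendsto γ atTop atTop) (hγab : ∀ t ≥ 0,
    infOmega Ω a t = γ t * exp (lam * (r + p - q) * t) * supOmega Ω b t)
    (hdiv : ¬ IntegrableOn (fun t => infOmega Ω a t * exp (-lam * (r + p - 1) * t)) (Ioi (0:ℝ))) :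
    False := by
  have hΦ := heig.integral_pos hΩ hb hne
  set Φ := ∫ x in Ω, φ x with hΦdef
  have hφ0 : ∀ x ∈ Ω, 0 ≤ φ x := fun x hx => (heig.2.2.2.2 x hx).le
  obtain ⟨G₀, hG₀⟩ := hb.isCompact_closure.exists_bound_of_continuousOn heig.1
  set G := |G₀| + 1 with hGdef
  have hG0 : 0 < G := by positivity
  have hG : ∀ x ∈ closure Ω, φ x ≤ G := fun x hx =>
    ((le_abs_self _).trans (hG₀ x hx)).trans (by linarith [le_abs_self G₀])
  set L : ℝ → ℝ → ℝ := fun s t => ∫ x in Ω, φ x * u x t ^ s with hL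
  have hu0 : ∀ t ≥ 0, ∀ x ∈ Ω, 0 ≤ u x t := fun t ht x hx =>
    hu.nonneg x (subset_closure hx) t ht
  have hL0 : ∀ s t : ℝ, 0 ≤ t → 0 ≤ L s t := fun s t ht =>
    setIntegral_nonneg hΩ.measurableSet fun x hx =>
      mul_nonneg (hφ0 x hx) (rpow_nonneg (hu0 t ht x hx) _)
  obtain ⟨κ, σ, hκq, hσ, hκσ, hLL⟩ : ∃ κ σ : ℝ, q ≤ κ ∧ 0 < σ ∧ κ + σ = r + p ∧
      ∀ t, L r t * L p t = L κ t * L σ t := by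
    rcases le_total r p with h | h
    · exact ⟨p, r, by rwa [max_eq_right h] at hrpq, hr, add_comm _ _, fun t => mul_comm _ _⟩
    · exact ⟨r, p, by rwa [max_eq_left h] at hrpq, hp, rfl, fun t => rfl⟩
  obtain ⟨c₁, hc₁, h₁⟩ := hu.exists_moment_lower hΩ hb hne heig hc hlow hσ
  obtain ⟨c₂, hc₂, h₂⟩ := hu.exists_moment_mul_lower hΩ hb hne heig hc hlow hq hκq
  set U : ℝ → ℝ := fun t => ∫ x in Ω, φ x * u x t with hU
  have hU0 : ∀ t, 0 ≤ t → 0 < U t := fun t ht => by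
    refine lt_of_lt_of_le (by positivity) ((hlow t ht).trans (setIntegral_mono_on
      (integrableOn_of_closure hb (heig.1.mul ((hu.continuousOn_slice ht).inf
      (continuousOn_const.mul heig.1)))) (integrableOn_of_closure hb
      (heig.1.mul (hu.continuousOn_slice ht))) hΩ.measurableSet fun x hx =>
        mul_le_mul_of_nonneg_left (min_le_left _ _) (hφ0 x hx)))
  set c₃ := c₁ * (Φ * (1 / Φ) ^ κ) / (2 * G) with hc₃
  have hc₃0 : 0 < c₃ := by positivity
  set α : ℝ → ℝ := fun t => infOmega Ω a t * exp (-lam * (r + p - 1) * t) with hα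
  have ha0 : ∀ t, 0 ≤ t → 0 ≤ infOmega Ω a t := fun t ht =>
    infOmega_nonneg fun x hx => (hab x (subset_closure hx) t ht).1
  have hα0 : ∀ t, 0 ≤ t → 0 ≤ α t := fun t ht => mul_nonneg (ha0 t ht) (exp_pos _).le
  have hαc : ContinuousOn α (Ici 0) :=
    (infOmega_continuousOn hne hha fun x hx t ht => (hab x (subset_closure hx) t ht).1).mul
      (Continuous.continuousOn (by fun_prop))
  set F : E → ℝ → ℝ := fun x t => exp (lam * t) * reac a b r q (nonloc Ω p u) u x t with hF
  have hnl := nonloc_continuousOn hΩ hb hp hu.cont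
  have hFc : ContinuousOn ♯F (closure Ω ×ˢ Ici 0) :=
    (Continuous.continuousOn (by fun_prop)).mul
      (reac_continuousOn hha hhb hr (by linarith) subset_rfl subset_rfl hnl hu.cont)
  set m : ℝ → ℝ := fun t => exp (lam * t) * U t with hm
  have hFlow : ∀ t, 0 ≤ t → 2 * G / (c₁ * c₂) ≤ γ t →
      c₃ * α t * m t ^ κ ≤ ∫ x in Ω, φ x * F x t := by
    intro t ht hγt
    set I := nonloc Ω p u t with hI
    have hI1 : L p t / G ≤ I := by
      rw [div_le_iff₀ hG0, hI, nonloc, ← integral_mul_const]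
      refine setIntegral_mono_on (hu.integrableOn_moment hb heig hp.le ht)
        ((integrableOn_of_closure hb ((hu.continuousOn_slice ht).rpow_const
          fun _ _ => Or.inr hp.le)).mul_const _) hΩ.measurableSet fun x hx => ?_
      rw [mul_comm]
      exact mul_le_mul_of_nonneg_left (hG x (subset_closure hx)) (rpow_nonneg (hu0 t ht x hx) _)
    have hI0 : 0 ≤ I := le_trans (div_nonneg (hL0 p t ht) hG0.le) hI1
    set ai := infOmega Ω a t with hai
    set bs := supOmega Ω b t with hbs
    have hai0 : 0 ≤ ai := ha0 t ht
    have hbs0 : 0 ≤ bs := by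
      obtain ⟨x, hx⟩ := hne
      exact (hab x (subset_closure hx) t ht).2.trans (le_supOmega hb hhb ht hx)
    have ir := hu.integrableOn_moment hb heig hr.le ht
    have iq := hu.integrableOn_moment hb heig (by linarith : 0 ≤ q) ht
    have h3 : exp (lam * t) * (ai * I * L r t - bs * L q t) ≤ ∫ x in Ω, φ x * F x t := by
      rw [hL]
      simp only
      rw [← integral_const_mul, ← integral_const_mul, ← integral_sub (ir.const_mul _) (iq.const_mul _),
        ← integral_const_mul]
      refine setIntegral_mono_on (((ir.const_mul _).sub (iq.const_mul _)).const_mul _)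
        (integrableOn_of_closure hb (heig.1.mul (hFc.comp (f := fun x : E => (x, t))
          (by fun_prop) fun x hx => ⟨hx, ht⟩))) hΩ.measurableSet fun x hx => ?_
      have e : φ x * F x t = exp (lam * t) * (a x t * I * (φ x * u x t ^ r) -
          b x t * (φ x * u x t ^ q)) := by simp only [hF, reac, ← hI]; ring
      rw [e]
      refine mul_le_mul_of_nonneg_left (sub_le_sub ?_ ?_) (exp_pos _).le
      · exact mul_le_mul_of_nonneg_right (mul_le_mul_of_nonneg_right (infOmega_le
          (fun y hy => (hab y (subset_closure hy) t ht).1) hx) hI0)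
          (mul_nonneg (hφ0 x hx) (rpow_nonneg (hu0 t ht x hx) _))
      · exact mul_le_mul_of_nonneg_right (le_supOmega hb hhb ht hx)
          (mul_nonneg (hφ0 x hx) (rpow_nonneg (hu0 t ht x hx) _))
    have h4 : ai / G * (L κ t * L σ t) ≤ ai * I * L r t := by
      rw [← hLL t]
      calc ai / G * (L r t * L p t) = ai * (L p t / G) * L r t := by ring
        _ ≤ _ := mul_le_mul_of_nonneg_right (mul_le_mul_of_nonneg_left hI1 hai0) (hL0 r t ht)
    have h5 : bs * L q t ≤ ai / (2 * G) * (L κ t * L σ t) := by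
      have h6 : (c₂ * exp (-lam * (κ - q) * t) * L q t) * (c₁ * exp (-lam * σ * t)) ≤ L κ t * L σ t :=
        mul_le_mul (h₂ t ht) (h₁ t ht) (by positivity) (hL0 κ t ht)
      refine le_trans ?_ (mul_le_mul_of_nonneg_left h6 (by positivity))
      rw [hai, hγab t ht]
      have e : γ t * exp (lam * (r + p - q) * t) * bs / (2 * G) *
          (c₂ * exp (-lam * (κ - q) * t) * L q t * (c₁ * exp (-lam * σ * t))) =
          (exp (lam * (r + p - q) * t) * exp (-lam * (κ - q) * t) * exp (-lam * σ * t)) *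
          (γ t * (c₁ * c₂) / (2 * G)) * (bs * L q t) := by ring
      rw [e, ← exp_add, ← exp_add, ← hκσ, show lam * (κ + σ - q) * t + -lam * (κ - q) * t +
        -lam * σ * t = 0 by ring, exp_zero, one_mul]
      refine le_mul_of_one_le_left (mul_nonneg hbs0 (hL0 q t ht)) ?_
      rw [div_le_iff₀ (by positivity)] at hγt
      rw [le_div_iff₀ (by positivity)]
      linarith
    have h7 : c₁ * exp (-lam * σ * t) * (Φ * (1 / Φ) ^ κ * U t ^ κ) ≤ L κ t * L σ t := by
      rw [mul_comm (L κ t)]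
      refine mul_le_mul (h₁ t ht) ?_ (mul_nonneg (by positivity) (rpow_nonneg (hU0 t ht).le _)) (hL0 σ t ht)
      refine le_trans (le_of_eq ?_) (heig.jensen hΩ hb hne (hu.continuousOn_slice ht) (hu0 t ht)
        (κ := κ) (by linarith))
      rw [mul_assoc, ← mul_rpow (by positivity) (hU0 t ht).le, ← hΦdef, hU]
      congr 2
      ring
    refine le_trans ?_ h3
    have h8 : ai / (2 * G) * (c₁ * exp (-lam * σ * t) * (Φ * (1 / Φ) ^ κ * U t ^ κ)) ≤
        ai * I * L r t - bs * L q t := by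
      have := mul_le_mul_of_nonneg_left h7 (by positivity : 0 ≤ ai / (2 * G))
      have e : ai / G * (L κ t * L σ t) = 2 * (ai / (2 * G) * (L κ t * L σ t)) := by field_simp
      linarith
    refine le_trans (le_of_eq ?_) (mul_le_mul_of_nonneg_left h8 (exp_pos (lam * t)).le)
    simp only [hm, hα, hc₃]
    rw [mul_rpow (exp_pos _).le (hU0 t ht).le, ← exp_mul]
    have e : exp (-lam * (r + p - 1) * t) * exp (lam * t * κ) = exp (lam * t) * exp (-lam * σ * t) := by
      rw [← exp_add, ← exp_add, ← hκσ]
      congr 1; ring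
    calc _ = c₁ * (Φ * (1 / Φ) ^ κ) / (2 * G) * ai * U t ^ κ *
          (exp (-lam * (r + p - 1) * t) * exp (lam * t * κ)) := by ring
      _ = _ := by rw [e]; ring
  obtain ⟨s, hs0, hs⟩ : ∃ s : ℝ, 0 ≤ s ∧ ∀ t, s ≤ t → 2 * G / (c₁ * c₂) ≤ γ t := by
    obtain ⟨s, hs⟩ := eventually_atTop.1 (hγ.eventually_ge_atTop (2 * G / (c₁ * c₂)))
    exact ⟨max s 0, le_max_right _ _, fun t ht => hs t ((le_max_left _ _).trans ht)⟩
  have hUc : ContinuousOn U (Ici 0) := by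
    refine continuousOn_setIntegral hb hΩ.measurableSet (f := fun t x => φ x * u x t) ?_
    exact (heig.1.comp continuousOn_snd fun z hz => hz.2).mul
      (hu.cont.comp (f := fun z : ℝ × E => (z.2, z.1)) (by fun_prop) fun z hz => ⟨hz.2, hz.1⟩)
  have hmc : ContinuousOn m (Ici 0) := (Continuous.continuousOn (by fun_prop)).mul hUc
  have hmax : Continuous fun t : ℝ => max t 0 := by fun_prop
  have hmax0 : ∀ t : ℝ, max t 0 ∈ Ici (0:ℝ) := fun t => le_max_right t 0
  have hgoal : IntegrableOn (fun t => c₃ * α (max t 0)) (Ioi s) := by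
    refine integrableOn_Ioi_of_superlinear (m := fun t => m (max t 0)) (κ := κ) (continuous_const.mul
      (hαc.comp_continuous hmax fun t => hmax0 t)) (fun t => mul_nonneg hc₃0.le
        (hα0 _ (le_max_right _ _))) (hmc.comp_continuous hmax fun t => hmax0 t)
      (by linarith) (mul_pos (exp_pos _) (hU0 _ (le_max_right _ _))) (fun t ht => ?_)
      (fun t => (mul_pos (exp_pos _) (hU0 _ (le_max_right _ _))).le)
    have hbase : Ω ×ˢ Ioi 0 ⊆ closure Ω ×ˢ Ici (0:ℝ) := prod_mono subset_closure Ioi_subset_Ici_self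
    have hzc : ContinuousOn (fun z : Q => exp (lam * z.2) * u z.1 z.2) (closure Ω ×ˢ Ici 0) :=
      (Continuous.continuousOn (by fun_prop)).mul hu.cont
    have key := kaplan (z := fun x t => exp (lam * t) * u x t)
      (zt := fun x t => lam * (exp (lam * t) * u x t) + exp (lam * t) *
        (lap (fun y => u y t) x + reac a b r q (nonloc Ω p u) u x t)) (F := F) hΩ hb heig
      hzc (fun x hx t ht => mul_nonneg (exp_pos _).le (hu.nonneg x hx t ht))
      (fun t ht => contDiffOn_const.mul (hu.c2 t ht))
      (fun x hx t ht => by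
        refine ((((hasDerivAt_id t).const_mul lam).exp).mul (hu.deriv x hx t ht)).congr_deriv ?_
        simp only [id]; ring)
      ((continuousOn_const.mul (hzc.mono hbase)).add
        ((Continuous.continuousOn (by fun_prop)).mul hu.contd))
      hFc
      (fun x hx t ht => by
        rw [lap_const_mul _ ((hu.c2 t ht).contDiffAt (hΩ.mem_nhds hx))]
        simp only [hF]
        linarith) hs0 ht
    have e : ∀ t, ∫ x in Ω, φ x * (exp (lam * t) * u x t) = m t := by
      intro t
      simp only [hm, hU]
      rw [← integral_const_mul]
      congr 1; ext x; ring
    rw [e, e] at key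
    rw [max_eq_left (hs0.trans ht), max_eq_left hs0]
    refine le_trans ?_ key
    have hsub : Icc s t ⊆ Ici 0 := fun τ hτ => hs0.trans hτ.1
    refine intervalIntegral.integral_mono_on ht ?_ ?_ fun τ hτ => ?_
    · refine Continuous.intervalIntegrable ?_ _ _
      exact (continuous_const.mul (hαc.comp_continuous hmax fun t => hmax0 t)).mul
        ((hmc.comp_continuous hmax fun t => hmax0 t).rpow_const
          fun _ => Or.inr (by linarith))
    · refine ContinuousOn.intervalIntegrable ?_
      rw [uIcc_of_le ht]
      refine ContinuousOn.mono ?_ hsub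
      refine continuousOn_setIntegral hb hΩ.measurableSet (f := fun t x => φ x * F x t) ?_
      exact (heig.1.comp continuousOn_snd fun z hz => hz.2).mul
        (hFc.comp (f := fun z : ℝ × E => (z.2, z.1)) (by fun_prop) fun z hz => ⟨hz.2, hz.1⟩)
    · rw [max_eq_left (hs0.trans hτ.1)]
      exact hFlow τ (hs0.trans hτ.1) (hs τ hτ.1)
  refine hdiv ?_
  have h9 : IntegrableOn α (Ioi s) := by
    refine IntegrableOn.congr_fun (hgoal.const_mul c₃⁻¹) (fun t ht => ?_) measurableSet_Ioi
    rw [max_eq_left (hs0.trans (le_of_lt ht)), inv_mul_cancel_left₀ hc₃0.ne']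
  rw [← Ioc_union_Ioi_eq_Ioi hs0]
  refine IntegrableOn.union ?_ h9
  exact ((hαc.mono Icc_subset_Ici_self).integrableOn_Icc).mono_set Ioc_subset_Icc_self

lemma no_global_solution (hr : 0 < r) (hp : 0 < p) (hq : 1 < q) (hrpq : q ≤ max r p)
    (hdata : GoodData Ω a b k) (heig : IsDirichletEigen Ω lam φ)
    {ε : ℝ → ℝ} (hεcont : ContinuousOn ε (Ici 0)) (hεnonneg : ∀ t ≥ 0, 0 ≤ ε t)
    (hεint : IntegrableOn ε (Ioi (0:ℝ)))
    (hb : ∀ x ∈ Ω, ∀ t > 0, b x t ≤ ε t * Real.exp (lam * (q - 1) * t))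
    {γ : ℝ → ℝ} (hγ : Tendsto γ atTop atTop) (hab : ∀ t ≥ 0,
    infOmega Ω a t = γ t * Real.exp (lam * (r + p - q) * t) * supOmega Ω b t) (hdiv : ¬ IntegrableOn
    (fun t => infOmega Ω a t * Real.exp (-lam * (r + p - 1) * t)) (Ioi (0:ℝ)))
    (hx : ∃ x ∈ Ω, u0 x ≠ 0) (hu : ∀ T : ℝ, 0 < T → IsSol r p q l Ω a b k u0 T u) : False := by
  have hgs := GlobalSol.of_isSol hdata hr hp (by linarith) hu
  obtain ⟨hΩ, hbd, hne, hha, hhb, hab0, -, -⟩ := hdata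
  have hεc : Continuous fun t : ℝ => ε (max t 0) :=
    hεcont.comp_continuous (by fun_prop) fun t => le_max_right t 0
  obtain ⟨c, hc, hlow⟩ := hgs.exists_lower_bound (ε := fun t => ε (max t 0)) hΩ hbd heig hq hab0 hεc
    (fun t => hεnonneg _ (le_max_right t 0))
    (hεint.congr_fun (fun t (ht : 0 < t) => by rw [max_eq_left ht.le]) measurableSet_Ioi)
    (fun x hx t ht => by rw [max_eq_left ht.le]; exact hb x hx t ht) (by
      obtain ⟨x, hx, h⟩ := hx
      refine ⟨x, hx, ?_⟩
      rwa [le_antisymm ((hu 1 one_pos).1.2.2.2.2 x hx) ((hu 1 one_pos).2.2.2.2.2 x hx)])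
  exact hgs.not_exists hΩ hbd hne heig hr hp hq hrpq hha hhb hab0 hc hlow hγ hab hdiv

/-- The measure of the part of `Ω` where the eigenfunction is small tends to zero. -/
lemma IsDirichletEigen.exists_volume_sublevel_le (hφ : IsDirichletEigen Ω lam φ) (hΩ : IsOpen Ω) (hb : Bdd Ω)
    (hε : 0 < ε) : ∃ δ > 0, volume.real {x | x ∈ Ω ∧ Ω.indicator φ x < δ} ≤ ε := by
  have hfin : volume Ω ≠ ⊤ := hb.measure_lt_top.ne
  have hm : ∀ δ : ℝ, MeasurableSet {x | x ∈ Ω ∧ Ω.indicator φ x < δ} := fun δ =>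
    hΩ.measurableSet.inter
      ((isOpen_lt (hφ.continuous_indicator) continuous_const).measurableSet)
  have ht := tendsto_measure_iInter_atTop (μ := (volume : Measure E))
    (s := fun N : ℕ => {x | x ∈ Ω ∧ Ω.indicator φ x < 1 / ((N : ℝ) + 1)})
    (fun N => (hm _).nullMeasurableSet)
    (fun N N' h x hx => ⟨hx.1, hx.2.trans_le (one_div_le_one_div_of_le (by positivity) (by
      have : (N : ℝ) ≤ N' := by exact_mod_cast h
      linarith))⟩)
    ⟨0, measure_ne_top_of_subset (fun x hx => hx.1) hfin⟩
  have he : (⋂ N : ℕ, {x | x ∈ Ω ∧ Ω.indicator φ x < 1 / ((N : ℝ) + 1)}) = ∅ := by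
    refine eq_empty_of_forall_notMem fun x hx => ?_
    simp only [mem_iInter, Set.mem_setOf_eq] at hx
    have hx0 := (hx 0).1
    have hpos : 0 < Ω.indicator φ x := by rw [indicator_of_mem hx0]; exact hφ.2.2.2.2 x hx0
    obtain ⟨N, hN⟩ := exists_nat_one_div_lt hpos
    exact absurd (hx N).2 (not_lt.2 hN.le)
  rw [he, measure_empty] at ht
  obtain ⟨N, hN⟩ := (ht.eventually_lt_const (ENNReal.ofReal_pos.2 hε)).exists
  refine ⟨1 / ((N : ℝ) + 1), by positivity, ?_⟩
  exact ENNReal.toReal_le_of_le_ofReal hε.le hN.le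

/-- A nonnegative caloric function on `Ω` that dominates `1` initially away from the boundary and
is small near the boundary at later times. -/
lemma IsDirichletEigen.exists_caloric (hφ : IsDirichletEigen Ω lam φ) (hΩ : IsOpen Ω) (hb : Bdd Ω) {σ : ℝ}
    (hε : 0 < ε) (hτ : 0 < τ) : ∃ C : ℝ, 0 ≤ C ∧ ∀ β > 0, ∃ H : E → ℝ → ℝ,
    Continuous ♯H ∧ (∀ x s, 0 ≤ H x s) ∧
    (∀ x, β ≤ Ω.indicator φ x → 1 ≤ H x 0) ∧ (∀ x, ∀ s ∈ Icc τ σ, H x s ≤ ε + C * Ω.indicator φ x) ∧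
    ∀ x ∈ Ω, ∀ s > 0, ContDiffAt ℝ 2 (fun y => H y s) x ∧
    HasDerivAt (H x) (lap (fun y => H y s) x) s := by
  set ψ := Ω.indicator φ with hψ
  have hψc : Continuous ψ := hφ.continuous_indicator
  have hψ0 : ∀ x, 0 ≤ ψ x := hφ.indicator_nonneg
  set P : ℝ := (4 * π * τ) ^ (-(n : ℝ) / 2) with hP
  have hPpos : 0 < P := rpow_pos_of_pos (by positivity) _
  obtain ⟨δ, hδ, hvol⟩ := hφ.exists_volume_sublevel_le hΩ hb (ε := ε / P) (by positivity)
  refine ⟨exp (|lam| * |σ|) * (2 / δ), by positivity, fun β hβ => ?_⟩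
  set F : E → ℝ := fun x => min 1 (ψ x / β) * min 1 (max 0 (2 - ψ x * (2 / δ))) with hF
  have hFc : Continuous F := by rw [hF]; fun_prop
  have hF0 : ∀ x, 0 ≤ F x := fun x => mul_nonneg
    (le_min zero_le_one (div_nonneg (hψ0 x) hβ.le)) (le_min zero_le_one (le_max_left _ _))
  have hF1 : ∀ x, F x ≤ 1 := fun x => mul_le_one₀ (min_le_left _ _)
    (le_min zero_le_one (le_max_left _ _)) (min_le_left _ _)
  have hFabs : ∀ x, |F x| ≤ 1 := fun x => by rw [abs_of_nonneg (hF0 x)]; exact hF1 x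
  have hFz : ∀ x, ¬ (x ∈ Ω ∧ ψ x < δ) → F x = 0 := by
    intro x hx
    by_cases h : x ∈ Ω
    · have : δ ≤ ψ x := not_lt.1 fun h' => hx ⟨h, h'⟩
      have h2 : 2 ≤ ψ x * (2 / δ) := by
        calc (2 : ℝ) = δ * (2 / δ) := by field_simp
          _ ≤ _ := by gcongr
      simp [hF, max_eq_left (sub_nonpos.2 h2)]
    · have : ψ x = 0 := indicator_of_notMem h φ
      simp [hF, this]
  have hFs : HasCompactSupport F := HasCompactSupport.of_support_subset_isCompact
    hb.isCompact_closure fun x hx => by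
      by_contra h
      exact hx (hFz x fun h' => h (subset_closure h'.1))
  have hFint : ∫ y, F y ≤ ε / P := by
    have hms : MeasurableSet {x | x ∈ Ω ∧ ψ x < δ} :=
      hΩ.measurableSet.inter (isOpen_lt hψc continuous_const).measurableSet
    have hfin : volume {x | x ∈ Ω ∧ ψ x < δ} ≠ ⊤ :=
      measure_ne_top_of_subset (fun x hx => hx.1) hb.measure_lt_top.ne
    refine le_trans ?_ hvol
    calc ∫ y, F y ≤ ∫ y, ({x | x ∈ Ω ∧ ψ x < δ}.indicator fun _ => (1 : ℝ)) y := by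
          refine integral_mono (hFc.integrable_of_hasCompactSupport hFs)
            ((integrable_indicator_iff hms).2 (integrableOn_const hfin)) fun x => ?_
          by_cases h : x ∈ {x | x ∈ Ω ∧ ψ x < δ}
          · rw [indicator_of_mem h]; exact hF1 x
          · rw [indicator_of_notMem h]; exact (hFz x h).le
      _ = _ := by rw [integral_indicator_const _ hms]; simp [hψ]
  refine ⟨fun x s => heat F s x + exp (-lam * s) * (2 / δ) * ψ x, ?_, ?_, ?_, ?_, ?_⟩
  · exact (heat_continuous hFc hFabs).add (by fun_prop)
  · exact fun x s => add_nonneg (le_heat hFc hFabs hF0 s x)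
      (mul_nonneg (by positivity) (hψ0 x))
  · intro x hx
    simp only [heat_zero, mul_zero, exp_zero, one_mul]
    rcases le_total (ψ x) (δ / 2) with h | h
    · have e1 : F x = 1 := by
        have h1 : 1 ≤ ψ x / β := (one_le_div hβ).2 hx
        have h2 : 1 ≤ 2 - ψ x * (2 / δ) := by
          have : ψ x * (2 / δ) ≤ δ / 2 * (2 / δ) := by gcongr
          have e : δ / 2 * (2 / δ) = 1 := by field_simp
          linarith
        simp [hF, min_eq_left h1, min_eq_left (h2.trans (le_max_right 0 _))]
      have : 0 ≤ 2 / δ * ψ x := mul_nonneg (by positivity) (hψ0 x)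
      linarith
    · have : 1 ≤ 2 / δ * ψ x := by
        calc (1 : ℝ) = 2 / δ * (δ / 2) := by field_simp
          _ ≤ _ := by gcongr
      linarith [hF0 x]
  · intro x s hs
    have hs0 : 0 < s := hτ.trans_le hs.1
    have h1 : heat F s x ≤ ε := by
      calc heat F s x ≤ (4 * π * s) ^ (-(n : ℝ) / 2) * ∫ y, F y := heat_le_integral hFc hFs hF0 hs0 x
        _ ≤ P * (ε / P) := by
          refine mul_le_mul ?_ hFint (integral_nonneg hF0) hPpos.le
          refine rpow_le_rpow_of_nonpos (by positivity) (by gcongr; exact hs.1) ?_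
          have : (0 : ℝ) ≤ n := n.cast_nonneg
          linarith
        _ = ε := by field_simp
    have h2 : exp (-lam * s) ≤ exp (|lam| * |σ|) := by
      refine exp_le_exp.2 ((le_abs_self _).trans ?_)
      rw [abs_mul, abs_neg]
      gcongr
      exact hs.2
    have : exp (-lam * s) * (2 / δ) * ψ x ≤ exp (|lam| * |σ|) * (2 / δ) * ψ x := by
      have := hψ0 x
      gcongr
    exact add_le_add h1 this
  · intro x hx s hs
    have hev : ψ =ᶠ[𝓝 x] φ := hφ.eventually_eq hΩ hx
    have hφ2 : ContDiffAt ℝ 2 φ x := hφ.2.1.contDiffAt (hΩ.mem_nhds hx)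
    have hψ2 : ContDiffAt ℝ 2 ψ x := hφ2.congr_of_eventuallyEq hev
    have hlap : lap ψ x = - (lam * ψ x) := by
      rw [lap_congr hev, hev.self_of_nhds]
      linarith [hφ.2.2.1 x hx]
    have hh2 : ContDiffAt ℝ 2 (fun y => heat F s y) x := (heat_contDiff hFc hFs hs).contDiffAt
    refine ⟨hh2.add (contDiffAt_const.mul hψ2), ?_⟩
    have e : lap (fun y => heat F s y + exp (-lam * s) * (2 / δ) * ψ y) x
        = lap (fun y => heat F s y) x + exp (-lam * s) * (-lam * 1) * (2 / δ) * ψ x := by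
      rw [lap_add hh2 (contDiffAt_const.mul hψ2), lap_const_mul _ hψ2, hlap]
      ring
    rw [e]
    have hexp : HasDerivAt (fun t => exp (-lam * t)) (exp (-lam * s) * (-lam * 1)) s :=
      ((hasDerivAt_id s).const_mul (-lam)).exp
    exact (heat_hasDerivAt hFc hFs hs x).add ((hexp.mul_const (2 / δ)).mul_const (ψ x))

/-- Supersolution of `z_t = Δz + A` built from a paraboloid and a caloric function `H`. -/
def barrier (x₀ : E) (c C A P : ℝ) (H : E → ℝ → ℝ) (t₀ : ℝ) (x : E) (t : ℝ) : ℝ :=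
  c + C * ‖x - x₀‖ ^ 2 + (A + C * (2 * n)) * (t - t₀) + P * H x (t - t₀)

lemma le_barrier {D : Set E} (hD : IsOpen D) (hb : Bdd D)
    {z H : E → ℝ → ℝ} {t₀ A P : ℝ} (hs : t₀ ≤ s)
    (hc : ContinuousOn ♯z (closure D ×ˢ Icc s s'))
    (hz : ∀ x ∈ D, ∀ t ∈ Ioo s s', ContDiffAt ℝ 2 (fun y => z y t) x ∧
    ∃ f ≤ A, HasDerivAt (z x) (lap (fun y => z y t) x + f) t)
    (hH : Continuous ♯H)
    (hHc : ∀ x ∈ D, ∀ t > 0, ContDiffAt ℝ 2 (fun y => H y t) x ∧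
    HasDerivAt (H x) (lap (fun y => H y t) x) t)
    (h0 : ∀ x ∈ closure D, z x s ≤ barrier x₀ c C A P H t₀ x s)
    (hbd : ∀ x ∈ frontier D, ∀ t ∈ Icc s s', z x t ≤ barrier x₀ c C A P H t₀ x t) :
    ∀ x ∈ closure D, ∀ t ∈ Icc s s', z x t ≤ barrier x₀ c C A P H t₀ x t := by
  have key := heat_comparison hD hb (s := s) (s' := s')
    (e := fun x t => z x t - barrier x₀ c C A P H t₀ x t) ?_ ?_ ?_ ?_ ?_ ?_
  · exact fun x hx t ht => sub_nonpos.1 (key x hx t ht)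
  · refine hc.sub (Continuous.continuousOn ?_)
    have : Continuous fun p : Q => H p.1 (p.2 - t₀) :=
      hH.comp (continuous_fst.prodMk (continuous_snd.sub continuous_const))
    unfold barrier
    fun_prop
  all_goals try
    intro x hx t ht
    have htp : 0 < t - t₀ := by linarith [ht.1]
    obtain ⟨z2, f, hf, zd⟩ := hz x hx t ht
    obtain ⟨H2, Hd⟩ := hHc x hx _ htp
    have hq : ContDiffAt ℝ 2 (fun y : E => ‖y - x₀‖ ^ 2) x := (contDiff_sqDist x₀).contDiffAt
    have h1 : ContDiffAt ℝ 2 (fun y : E => c + C * ‖y - x₀‖ ^ 2) x :=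
      contDiffAt_const.add (contDiffAt_const.mul hq)
    have h2 : ContDiffAt ℝ 2 (fun y : E => c + C * ‖y - x₀‖ ^ 2 + (A + C * (2 * n)) * (t - t₀)) x :=
      h1.add contDiffAt_const
    have h3 : ContDiffAt ℝ 2 (fun y => P * H y (t - t₀)) x := contDiffAt_const.mul H2
    have hB2 : ContDiffAt ℝ 2 (fun y => barrier x₀ c C A P H t₀ y t) x := h2.add h3
    have Hd' : HasDerivAt (fun τ => H x (τ - t₀)) (lap (fun y => H y (t - t₀)) x) t := by
      simpa using HasDerivAt.comp_sub_const t t₀ Hd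
    have hBd : HasDerivAt (barrier x₀ c C A P H t₀ x)
        ((A + C * (2 * n)) * 1 + P * lap (fun y => H y (t - t₀)) x) t :=
      ((((hasDerivAt_id t).sub_const t₀).const_mul (A + C * (2 * n))).const_add
        (c + C * ‖x - x₀‖ ^ 2)).add (Hd'.const_mul P)
    have hBl : lap (fun y => barrier x₀ c C A P H t₀ y t) x
        = C * (2 * n) + P * lap (fun y => H y (t - t₀)) x := by
      unfold barrier
      rw [lap_add h2 h3, lap_add h1 contDiffAt_const, lap_add contDiffAt_const
        (contDiffAt_const.mul hq), lap_const_mul _ hq, lap_const_mul _ H2, lap_sqDist, lap_const,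
        lap_const]
      ring
  · exact z2.sub hB2
  · exact (zd.sub hBd).differentiableAt
  · have hd : HasDerivAt (fun t => z x t - barrier x₀ c C A P H t₀ x t) _ t := zd.sub hBd
    rw [hd.deriv, lap_sub z2 hB2, hBl]
    linarith
  · exact fun x hx => sub_nonpos.2 (h0 x hx)
  · exact fun x hx t ht => sub_nonpos.2 (hbd x hx t ht)

section

lemma IsSolOn.continuousOn (hu : IsSolOn r p q l Ω a b k u0 T u) :
    ContinuousOn ♯u (closure Ω ×ˢ Ico 0 T) := by
  intro z hz
  obtain ⟨T', h1, h2⟩ := exists_between hz.2.2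
  refine ((hu T' (hz.2.1.trans_lt h1) h2).1.1.1 z ⟨hz.1, hz.2.1, h1⟩).mono_of_mem_nhdsWithin ?_
  filter_upwards [self_mem_nhdsWithin,
    mem_nhdsWithin_of_mem_nhds (continuous_snd.continuousAt.preimage_mem_nhds (Iio_mem_nhds h1))]
    with w hw hw' using ⟨hw.1, hw.2.1, hw'⟩

lemma IsSolOn.nonneg (hu : IsSolOn r p q l Ω a b k u0 T u) (hx : x ∈ closure Ω) (ht : t ∈ Ico 0 T) : 0 ≤ u x t := by
  obtain ⟨T', h1, h2⟩ := exists_between ht.2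
  exact (hu T' (ht.1.trans_lt h1) h2).1.2.1 x hx t ⟨ht.1, h1⟩

lemma IsSolOn.pde (hu : IsSolOn r p q l Ω a b k u0 T u) (hΩ : IsOpen Ω) (hx : x ∈ Ω)
    (ht : t ∈ Ioo 0 T) : ContDiffAt ℝ 2 (fun y => u y t) x ∧
    HasDerivAt (u x) (lap (fun y => u y t) x + reac a b r q (nonloc Ω p u) u x t) t := by
  obtain ⟨T', h1, h2⟩ := exists_between ht.2
  have h := hu T' (ht.1.trans h1) h2
  exact ⟨(h.1.1.2.1 t ⟨ht.1, h1⟩).contDiffAt (hΩ.mem_nhds hx), h.hasDerivAt hx ⟨ht.1, h1⟩⟩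

lemma IsSolOn.boundary (hu : IsSolOn r p q l Ω a b k u0 T u) (hx : x ∈ frontier Ω)
    (ht : t ∈ Ioo 0 T) : u x t = ∫ y in Ω, k x y t * u y t ^ l := by
  obtain ⟨T', h1, h2⟩ := exists_between ht.2
  have h := hu T' (ht.1.trans h1) h2
  exact le_antisymm (h.1.2.2.2.1 x hx t ⟨ht.1, h1⟩) (h.2.2.2.2.1 x hx t ⟨ht.1, h1⟩)

lemma nonloc_bounds (hΩ : IsOpen Ω) (hb : Bdd Ω) (hp : 0 < p) (h : ∀ x ∈ Ω, 0 ≤ u x t ∧ u x t ≤ M) :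
    0 ≤ nonloc Ω p u t ∧ nonloc Ω p u t ≤ M ^ p * volume.real Ω := by
  refine ⟨setIntegral_nonneg hΩ.measurableSet fun x hx => rpow_nonneg (h x hx).1 _, ?_⟩
  refine (le_abs_self _).trans (norm_setIntegral_le_of_norm_le_const (f := fun y => u y t ^ p)
    hb.measure_lt_top fun x hx => ?_)
  rw [norm_of_nonneg (rpow_nonneg (h x hx).1 _)]
  exact rpow_le_rpow (h x hx).1 (h x hx).2 hp.le

/-- A solution that does not blow up at `T` is bounded on `[0, T)`. -/
lemma IsSolOn.exists_bound (hr : 0 < r) (hp : 0 < p) (hl : 0 < l)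
    (hdata : GoodData Ω a b k) (heig : IsDirichletEigen Ω lam φ) (hT : 0 < T)
    (hu : IsSolOn r p q l Ω a b k u0 T u) (hnb : ¬ BlowsUpAt Ω u T) :
    ∃ m : ℝ, 0 ≤ m ∧ ∀ x ∈ closure Ω, ∀ t ∈ Ico 0 T, u x t ≤ m := by
  obtain ⟨hΩ, hb, -, ha, hbb, hab, hk, hk0⟩ := hdata
  have hcc := hb.isCompact_closure
  have hfr : frontier Ω ⊆ closure Ω := frontier_subset_closure
  obtain ⟨K, hK⟩ := ((hcc.of_isClosed_subset isClosed_frontier hfr).prod hcc |>.prod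
    (isCompact_Icc (a := (0 : ℝ)) (b := T))).exists_bound_of_continuousOn
    (hk.mono (prod_mono_right Icc_subset_Ici_self))
  obtain ⟨A, hA⟩ := (hcc.prod (isCompact_Icc (a := (0 : ℝ)) (b := T))).exists_bound_of_continuousOn
    (ha.continuousOn.mono (prod_mono_right Icc_subset_Ici_self))
  replace hK : ∀ x ∈ frontier Ω, ∀ y ∈ closure Ω, ∀ t ∈ Icc 0 T, k x y t ≤ |K| := fun x hx y hy t ht =>
    (le_abs_self _).trans ((hK ((x, y), t) ⟨⟨hx, hy⟩, ht⟩).trans (le_abs_self K))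
  replace hA : ∀ x ∈ closure Ω, ∀ t ∈ Icc 0 T, a x t ≤ |A| := fun x hx t ht =>
    (le_abs_self _).trans ((hA (x, t) ⟨hx, ht⟩).trans (le_abs_self A))
  obtain ⟨M, hM0, hM⟩ : ∃ M : ℝ, 0 ≤ M ∧ ∃ᶠ t in 𝓝[<] T, ∀ x ∈ Ω, u x t ≤ M := by
    unfold BlowsUpAt at hnb
    push Not at hnb
    obtain ⟨M, hM⟩ := hnb
    exact ⟨max M 0, le_max_right _ _, hM.mono fun t h x hx => (h x hx).trans (le_max_left _ _)⟩
  set V := volume.real Ω with hV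
  have hV0 : 0 ≤ V := measureReal_nonneg
  set G := |K| * (M + 1) ^ l * V + 1 with hG
  set M₁ := max M G + 1 with hM₁
  set M₂ := M₁ + 1 with hM₂
  have hMG : M ≤ max M G := le_max_left _ _
  have hM₂p : 0 < M₂ := by linarith
  set R := |A| * M₂ ^ r * (M₂ ^ p * V) with hR
  have hR0 : 0 ≤ R := by positivity
  obtain ⟨δ, hδ, hvol⟩ := heig.exists_volume_sublevel_le hΩ hb (ε := 1 / (|K| * M₂ ^ l + 1))
    (by positivity)
  obtain ⟨d, hd, hdΩ⟩ := (heig.isCompact_superlevel hb hδ).exists_cthickening_subset_open hΩ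
    fun x hx => IsDirichletEigen.mem_of_pos x (hδ.trans_le hx)
  set C := M₂ / d ^ 2 with hC
  have hC0 : 0 ≤ C := by positivity
  set τ := 1 / (R + C * (2 * n) + 1) with hτ
  have hτ0 : 0 < τ := by positivity
  have hτ1 : ∀ h, 0 ≤ h → h ≤ τ → (R + C * (2 * n)) * h ≤ 1 := fun h _ hh => by
    have : (R + C * (2 * n) + 1) * h ≤ (R + C * (2 * n) + 1) * τ := by gcongr
    have e : (R + C * (2 * n) + 1) * τ = 1 := by rw [hτ]; field_simp
    nlinarith
  obtain ⟨s₀, hs₀M, hs₀⟩ := (hM.and_eventually (Ioo_mem_nhdsLT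
    (max_lt (sub_lt_self T hτ0) hT))).exists
  have hs₀0 : 0 < s₀ := (le_max_right _ _).trans_lt hs₀.1
  have hs₀τ : T - τ < s₀ := (le_max_left _ _).trans_lt hs₀.1
  have hc := hu.continuousOn
  have hs₀c : ∀ x ∈ closure Ω, u x s₀ ≤ M := by
    have hcs : ContinuousOn (fun x => u x s₀) (closure Ω) := hc.comp
      (continuous_id.prodMk continuous_const).continuousOn fun x hx => ⟨hx, hs₀0.le, hs₀.2⟩
    exact fun x hx => closure_minimal (t := {y | y ∈ closure Ω ∧ u y s₀ ≤ M})
      (fun y hy => ⟨subset_closure hy, hs₀M y hy⟩)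
      (hcs.preimage_isClosed_of_isClosed isClosed_closure isClosed_Iic) hx |>.2
  have hH : Continuous (fun p : Q => (fun (_ : E) (_ : ℝ) => (0 : ℝ)) p.1 p.2) := continuous_const
  have hHc : ∀ D : Set E, ∀ x ∈ D, ∀ t > (0 : ℝ), ContDiffAt ℝ 2 (fun y : E => (0 : ℝ)) x ∧
      HasDerivAt (fun _ : ℝ => (0 : ℝ)) (lap (fun y : E => (0 : ℝ)) x) t := fun D x _ t _ =>
    ⟨contDiffAt_const, by rw [lap_const]; exact hasDerivAt_const t 0⟩
  have step : ∀ s ∈ Ico s₀ T, (∀ t ∈ Icc s₀ s, ∀ x ∈ closure Ω, u x t ≤ M₂) →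
      ∀ t ∈ Icc s₀ s, ∀ x ∈ closure Ω, u x t ≤ M₁ := by
    intro s hs hbdd
    have hsub : ∀ t ∈ Icc s₀ s, t ∈ Ioo 0 T := fun t ht => ⟨hs₀0.trans_le ht.1, ht.2.trans_lt hs.2⟩
    have hpde : ∀ x ∈ Ω, ∀ t ∈ Ioo s₀ s, ContDiffAt ℝ 2 (fun y => u y t) x ∧
        ∃ f ≤ R, HasDerivAt (u x) (lap (fun y => u y t) x + f) t := by
      intro x hx t ht
      have ht' := hsub t ⟨ht.1.le, ht.2.le⟩
      have hx' := subset_closure hx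
      have h0 := hu.nonneg hx' ⟨ht'.1.le, ht'.2⟩
      refine ⟨(hu.pde hΩ hx ht').1, _, ?_, (hu.pde hΩ hx ht').2⟩
      have hI := nonloc_bounds (p := p) hΩ hb hp (t := t) (u := u) (M := M₂) fun y hy =>
        ⟨hu.nonneg (subset_closure hy) ⟨ht'.1.le, ht'.2⟩,
          hbdd t ⟨ht.1.le, ht.2.le⟩ y (subset_closure hy)⟩
      have hb0 : 0 ≤ b x t * u x t ^ q := mul_nonneg (hab x hx' t ht'.1.le).2 (rpow_nonneg h0 _)
      have h1 : a x t * u x t ^ r * nonloc Ω p u t ≤ R := by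
        have := (hab x hx' t ht'.1.le).1
        have := hA x hx' t ⟨ht'.1.le, ht'.2.le⟩
        have := rpow_le_rpow h0 (hbdd t ⟨ht.1.le, ht.2.le⟩ x hx') hr.le
        exact mul_le_mul (by gcongr) hI.2 hI.1 (by positivity)
      unfold reac
      linarith
    have hcs : ∀ D ⊆ closure Ω, ContinuousOn ♯u (D ×ˢ Icc s₀ s) :=
      fun D hD => hc.mono (prod_mono hD fun t ht => ⟨(hsub t ht).1.le, (hsub t ht).2⟩)
    have hint : ∀ x, δ ≤ Ω.indicator φ x → ∀ t ∈ Icc s₀ s, u x t ≤ M + 1 := by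
      intro x hx t ht
      have hball : closedBall x d ⊆ Ω := (closedBall_subset_cthickening (by exact hx) d).trans hdΩ
      have hcb : closure (ball x d) ⊆ Ω := Metric.closure_ball_subset_closedBall.trans hball
      have := le_barrier isOpen_ball Metric.isBounded_ball (z := u) (c := M) (C := C)
        (A := R) (P := 0) (x₀ := x) le_rfl (hcs _ (hcb.trans subset_closure))
        (fun y hy => hpde y (hcb (subset_closure hy))) hH (hHc _)
        (fun y hy => by
          have := hs₀c y (subset_closure (hcb hy))
          simp only [barrier, sub_self, mul_zero, add_zero]
          nlinarith [sq_nonneg ‖y - x‖])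
        (fun y hy t ht => by
          have h1 : ‖y - x‖ = d := by simpa [dist_eq_norm] using Metric.frontier_ball_subset_sphere hy
          have h2 := hbdd t ht y (subset_closure (hcb (frontier_subset_closure hy)))
          have h3 : C * d ^ 2 = M₂ := by rw [hC]; field_simp
          have h4 : 0 ≤ (R + C * (2 * n)) * (t - s₀) := mul_nonneg (by positivity) (by linarith [ht.1])
          simp only [barrier, h1, h3]
          linarith)
        x (subset_closure (mem_ball_self hd)) t ht
      refine this.trans ?_
      have := hτ1 (t - s₀) (by linarith [ht.1]) (by linarith [ht.2, hs.2])
      simp [barrier]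
      linarith
    have hbdy : ∀ x ∈ frontier Ω, ∀ t ∈ Icc s₀ s, u x t ≤ G := by
      intro x hx t ht
      have ht' := hsub t ht
      set S : Set E := {x | x ∈ Ω ∧ Ω.indicator φ x < δ} with hE
      have hEm : MeasurableSet S := hΩ.measurableSet.inter
        (isOpen_lt heig.continuous_indicator continuous_const).measurableSet
      have hΩf : volume Ω ≠ ⊤ := hb.measure_lt_top.ne
      rw [hu.boundary hx ht']
      calc ∫ y in Ω, k x y t * u y t ^ l
          ≤ ∫ y in Ω, (|K| * (M + 1) ^ l + S.indicator (fun _ => |K| * M₂ ^ l) y) := by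
            refine integral_mono_of_nonneg ?_ (Integrable.add (integrableOn_const hΩf)
              ((integrableOn_const hΩf).indicator hEm)) ?_
            · filter_upwards [ae_restrict_mem hΩ.measurableSet] with y hy
              exact mul_nonneg (hk0 x hx y (subset_closure hy) t ht'.1.le)
                (rpow_nonneg (hu.nonneg (subset_closure hy) ⟨ht'.1.le, ht'.2⟩) _)
            · filter_upwards [ae_restrict_mem hΩ.measurableSet] with y hy
              have hy0 := hu.nonneg (subset_closure hy) (t := t) ⟨ht'.1.le, ht'.2⟩
              have hk1 := hK x hx y (subset_closure hy) t ⟨ht'.1.le, ht'.2.le⟩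
              have hp1 : (0 : ℝ) ≤ |K| * (M + 1) ^ l := by positivity
              by_cases h : y ∈ S
              · rw [indicator_of_mem h]
                have h1 := rpow_le_rpow hy0 (hbdd t ht y (subset_closure hy)) hl.le
                have : k x y t * u y t ^ l ≤ |K| * M₂ ^ l := by gcongr
                linarith
              · rw [indicator_of_notMem h, add_zero]
                have h1 := rpow_le_rpow hy0 (hint y (not_lt.1 fun h' => h ⟨hy, h'⟩) t ht) hl.le
                gcongr
        _ = |K| * (M + 1) ^ l * V + |K| * M₂ ^ l * volume.real S := by
            have i1 : Integrable (fun _ : E => |K| * (M + 1) ^ l) (volume.restrict Ω) :=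
              integrableOn_const hΩf
            have i2 : Integrable (S.indicator fun _ => |K| * M₂ ^ l) (volume.restrict Ω) :=
              (integrableOn_const hΩf).indicator hEm
            rw [integral_add i1 i2, setIntegral_const, setIntegral_indicator hEm, setIntegral_const,
              inter_eq_self_of_subset_right fun x hx => hx.1, smul_eq_mul, smul_eq_mul]
            ring
        _ ≤ G := by
            have h1 : |K| * M₂ ^ l * volume.real S ≤ |K| * M₂ ^ l * (1 / (|K| * M₂ ^ l + 1)) := by
              gcongr
            have h2 : |K| * M₂ ^ l * (1 / (|K| * M₂ ^ l + 1)) ≤ 1 := by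
              rw [mul_one_div, div_le_one (by positivity)]; linarith
            linarith
    intro t ht x hx
    have := le_barrier hΩ hb (z := u) (c := max M G) (C := 0)
        (A := R) (P := 0) (x₀ := 0) le_rfl (hcs _ subset_rfl) hpde hH (hHc _)
        (fun y hy => by
          have := hs₀c y hy
          simp only [barrier, sub_self, mul_zero, add_zero, zero_mul]
          linarith)
        (fun y hy t ht => by
          have h2 := hbdy y hy t ht
          have h3 : G ≤ max M G := le_max_right _ _
          have h4 : 0 ≤ R * (t - s₀) := mul_nonneg hR0 (by linarith [ht.1])
          simp only [barrier, mul_zero, add_zero, zero_mul]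
          linarith)
        x hx t ht
    refine this.trans ?_
    have h1 := hτ1 (t - s₀) (by linarith [ht.1]) (by linarith [ht.2, hs.2])
    have h2 : 0 ≤ C * (2 * n) * (t - s₀) := mul_nonneg (by positivity) (by linarith [ht.1])
    simp only [barrier, mul_zero, add_zero, zero_mul]
    linarith
  have main : ∀ t ∈ Ico s₀ T, ∀ x ∈ closure Ω, u x t ≤ M₂ := by
    by_contra hcon
    push Not at hcon
    obtain ⟨t₁, ht₁, x₁, hx₁, h₁⟩ := hcon
    have hcK : ContinuousOn ♯u (closure Ω ×ˢ Icc s₀ t₁) :=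
      hc.mono (prod_mono_right fun t ht => ⟨hs₀0.le.trans ht.1, ht.2.trans_lt ht₁.2⟩)
    have hKc := (hcc.prod (isCompact_Icc (a := s₀) (b := t₁)))
    have hB : IsCompact (Prod.snd '' ((closure Ω ×ˢ Icc s₀ t₁) ∩
        ♯u ⁻¹' Ici M₂)) :=
      (hKc.of_isClosed_subset (hcK.preimage_isClosed_of_isClosed hKc.isClosed isClosed_Ici)
        inter_subset_left).image continuous_snd
    obtain ⟨t₂, ⟨⟨x₂, _⟩, ⟨⟨hx₂, ht₂⟩, hu₂⟩, rfl⟩, hmin⟩ := hB.exists_isLeast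
      ⟨t₁, (x₁, t₁), ⟨⟨hx₁, ht₁.1, le_rfl⟩, h₁.le⟩, rfl⟩
    rename_i t₂
    simp only at hx₂ ht₂ hmin
    have hu₂' : M₂ ≤ u x₂ t₂ := hu₂
    have hlt : ∀ t ∈ Ico s₀ t₂, ∀ x ∈ closure Ω, u x t ≤ M₂ := fun t ht x hx => by
      by_contra h
      exact absurd (hmin ⟨(x, t), ⟨⟨hx, ht.1, ht.2.le.trans ht₂.2⟩, (not_le.1 h).le⟩, rfl⟩)
        (not_le.2 ht.2)
    rcases ht₂.1.eq_or_lt with h | h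
    · have := hs₀c x₂ hx₂
      rw [h] at this
      linarith
    · have hle : ∀ t ∈ Icc s₀ t₂, ∀ x ∈ closure Ω, u x t ≤ M₂ := by
        intro t ht x hx
        have hcx : ContinuousOn (u x) (Icc s₀ t₁) := hcK.comp
          (continuous_const.prodMk continuous_id).continuousOn fun t ht => ⟨hx, ht⟩
        have hcl : IsClosed (Icc s₀ t₂ ∩ u x ⁻¹' Iic M₂) :=
          (hcx.mono (Icc_subset_Icc_right ht₂.2)).preimage_isClosed_of_isClosed isClosed_Icc
            isClosed_Iic
        have hsub : Ico s₀ t₂ ⊆ Icc s₀ t₂ ∩ u x ⁻¹' Iic M₂ := fun t ht =>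
          ⟨Ico_subset_Icc_self ht, hlt t ht x hx⟩
        have := closure_minimal hsub hcl
        rw [closure_Ico h.ne] at this
        exact (this ht).2
      have := step t₂ ⟨ht₂.1, ht₂.2.trans_lt ht₁.2⟩ hle t₂ ⟨ht₂.1, le_rfl⟩ x₂ hx₂
      linarith
  obtain ⟨m, hm⟩ := (hcc.prod (isCompact_Icc (a := (0 : ℝ)) (b := s₀))).exists_bound_of_continuousOn
    (hc.mono (prod_mono_right fun t ht => ⟨ht.1, ht.2.trans_lt hs₀.2⟩))
  refine ⟨max m M₂, hM₂p.le.trans (le_max_right _ _), fun x hx t ht => ?_⟩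
  rcases le_total t s₀ with h | h
  · exact ((le_abs_self _).trans (hm (x, t) ⟨hx, ht.1, h⟩)).trans (le_max_left _ _)
  · exact (main t ⟨h, ht.2⟩ x hx).trans (le_max_right _ _)

end

lemma exists_nonneg_extension {X : Type*} [NormedAddCommGroup X] [ProperSpace X] {K : Set X}
    (hK : IsCompact K) {f : X → ℝ} (hf : ContinuousOn f K) (h0 : ∀ x ∈ K, 0 ≤ f x) :
    ∃ F : X → ℝ, Continuous F ∧ HasCompactSupport F ∧ (∀ x, 0 ≤ F x) ∧ EqOn F f K := by
  obtain ⟨g, hg⟩ := ContinuousMap.exists_restrict_eq hK.isClosed ⟨K.restrict f, hf.restrict⟩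
  obtain ⟨R, hR⟩ := hK.isBounded.exists_norm_le
  have hmul : ∀ x : X, 0 ≤ min 1 (max 0 (1 + R - ‖x‖)) := fun x => le_min zero_le_one (le_max_left _ _)
  refine ⟨fun x => max 0 (g x) * min 1 (max 0 (1 + R - ‖x‖)), by fun_prop, ?_,
    fun x => mul_nonneg (le_max_left _ _) (hmul x), fun x hx => ?_⟩
  · refine HasCompactSupport.of_support_subset_isCompact (isCompact_closedBall (0 : X) (1 + R))
      fun x hx => ?_
    by_contra h
    refine hx ?_
    have : 1 + R - ‖x‖ ≤ 0 := by simpa using (not_le.1 (by simpa using h)).le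
    simp [max_eq_left this]
  · have e : g x = f x := DFunLike.congr_fun hg ⟨x, hx⟩
    have h1 : 1 ≤ 1 + R - ‖x‖ := by linarith [hR x hx]
    simp [e, max_eq_right (h0 x hx), min_eq_left (h1.trans (le_max_right _ _))]

lemma integrableOn_of_abs_le (hΩ : IsOpen Ω) (hb : Bdd Ω)
    (hF : ContinuousOn F Ω) (hC : ∀ y ∈ Ω, |F y| ≤ C) : IntegrableOn F Ω :=
  (integrableOn_const (C := C) hb.measure_lt_top.ne).mono' (hF.aestronglyMeasurable hΩ.measurableSet)
    (by filter_upwards [ae_restrict_mem hΩ.measurableSet] with y hy using hC y hy)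

lemma abs_setIntegral_sub_le (hb : Bdd Ω) {F' : E → ℝ} (hF : IntegrableOn F Ω)
    (hF' : IntegrableOn F' Ω) (h : ∀ y ∈ Ω, |F y - F' y| ≤ c) :
    |(∫ y in Ω, F y) - ∫ y in Ω, F' y| ≤ c * volume.real Ω := by
  rw [← integral_sub hF hF']
  exact norm_setIntegral_le_of_norm_le_const (f := fun y => F y - F' y) hb.measure_lt_top h

variable (n) in
/-- Data for continuing a bounded solution `u` of problem (P) past the time `T`: the coefficients
have been extended to all of space, `m` bounds `u`, and `θ` is a lower bound for the existence time. -/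
structure Setup where
  (Ω : Set E) (φ : E → ℝ) (lam r p q l T m θ A K : ℝ)
  (a b u : E → ℝ → ℝ) (κ : E → E → ℝ → ℝ)
  hΩ : IsOpen Ω
  hbd : Bdd Ω
  heig : IsDirichletEigen Ω lam φ
  hr : 0 < r
  hp : 0 < p
  hl : 0 < l
  hq : 1 < q
  ha : Continuous ♯a
  hb : Continuous ♯b
  hκ : UniformContinuous fun z : (E × E) × ℝ => κ z.1.1 z.1.2 z.2
  hκs : ∃ R, ∀ x, R < ‖x‖ → ∀ y t, κ x y t = 0
  ha0 : ∀ x t, 0 ≤ a x t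
  hb0 : ∀ x t, 0 ≤ b x t ∧ b x t ≤ K
  hκ0 : ∀ x y t, 0 ≤ κ x y t ∧ κ x y t ≤ K
  hm : 0 ≤ m
  hA0 : 0 ≤ A
  hA : ∀ x t s I, 0 ≤ s → s ≤ m + 2 → 0 ≤ I → I ≤ (m + 2) ^ p * volume.real Ω →
    |a x t * s ^ r * I - b x t * s ^ q| ≤ A
  hθ : 0 < θ
  hθT : θ < T
  hθA : A * (2 * θ) ≤ 1
  hu : ContinuousOn ♯u (closure Ω ×ˢ Ico 0 T)
  hum : ∀ x ∈ closure Ω, ∀ t ∈ Ico 0 T, 0 ≤ u x t ∧ u x t ≤ m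
  hpde : ∀ x ∈ Ω, ∀ t ∈ Ioo 0 T, ContDiffAt ℝ 2 (fun y => u y t) x ∧
    HasDerivAt (u x) (lap (fun y => u y t) x + reac a b r q (nonloc Ω p u) u x t) t
  hub : ∀ x ∈ frontier Ω, ∀ t ∈ Ioo 0 T, u x t = ∫ y in Ω, κ x y t * u y t ^ l

namespace Setup

variable (P : Setup n)

/-- The eigenfunction, extended by zero. -/
def ψ : E → ℝ := P.Ω.indicator P.φ

/-- The truncated nonlocal boundary operator. -/
def bnd (S : E → ℝ) (t : ℝ) (x : E) : ℝ := min (∫ y in P.Ω, P.κ x y t * S y ^ P.l) (P.m + 1)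

/-- The nonlocal reaction term. -/
def src (S : E → ℝ) (t : ℝ) (x : E) : ℝ :=
  P.a x t * S x ^ P.r * (∫ y in P.Ω, S y ^ P.p) - P.b x t * S x ^ P.q

/-- Admissible spatial profiles. -/
def Adm (S : E → ℝ) : Prop := ContinuousOn S P.Ω ∧ ∀ y ∈ P.Ω, 0 ≤ S y ∧ S y ≤ P.m + 2

lemma ψ_continuous : Continuous P.ψ := P.heig.continuous_indicator

lemma mem_of_ψ_pos (hx : 0 < P.ψ x) : x ∈ P.Ω := IsDirichletEigen.mem_of_pos x hx

variable {P} {S S' : EuclideanSpace ℝ (Fin n) → ℝ}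

lemma K_nonneg (P : Setup n) : 0 ≤ P.K := (P.hb0 0 0).1.trans (P.hb0 0 0).2

lemma Adm.pow_le (hS : P.Adm S) (hρ : 0 < ρ) (hy : y ∈ P.Ω) :
    0 ≤ S y ^ ρ ∧ S y ^ ρ ≤ (P.m + 2) ^ ρ :=
  ⟨rpow_nonneg (hS.2 y hy).1 _, rpow_le_rpow (hS.2 y hy).1 (hS.2 y hy).2 hρ.le⟩

lemma Adm.integrableOn_kernel (hS : P.Adm S) (x : E) (t : ℝ) :
    IntegrableOn (fun y => P.κ x y t * S y ^ P.l) P.Ω := by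
  refine integrableOn_of_abs_le (C := P.K * (P.m + 2) ^ P.l) P.hΩ P.hbd
    (ContinuousOn.mul ?_ (hS.1.rpow_const fun _ _ => Or.inr P.hl.le)) fun y hy => ?_
  · exact (P.hκ.continuous.comp (by fun_prop : Continuous fun y : E => ((x, y), t))).continuousOn
  · have h := hS.pow_le P.hl hy
    rw [abs_of_nonneg (mul_nonneg (P.hκ0 x y t).1 h.1)]
    exact mul_le_mul (P.hκ0 x y t).2 h.2 h.1 P.K_nonneg

lemma Adm.integral_pow_le (hS : P.Adm S) :
    0 ≤ ∫ y in P.Ω, S y ^ P.p ∧ ∫ y in P.Ω, S y ^ P.p ≤ (P.m + 2) ^ P.p * volume.real P.Ω :=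
  nonloc_bounds (u := fun y _ => S y) (t := 0) P.hΩ P.hbd P.hp hS.2

lemma Adm.abs_src_le (hS : P.Adm S) (t : ℝ) (hx : x ∈ P.Ω) : |P.src S t x| ≤ P.A :=
  P.hA x t _ _ (hS.2 x hx).1 (hS.2 x hx).2 hS.integral_pow_le.1 hS.integral_pow_le.2

lemma bnd_sub_le {x' : E} {t' : ℝ}
    (h : |(∫ y in P.Ω, P.κ x y t * S y ^ P.l) - ∫ y in P.Ω, P.κ x' y t' * S' y ^ P.l| ≤ c) :
    |P.bnd S t x - P.bnd S' t' x'| ≤ c :=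
  (abs_inf_sub_inf_le_abs _ _ _).trans h

lemma bnd_nonneg (hS : P.Adm S) (t : ℝ) (x : E) : 0 ≤ P.bnd S t x := by
  refine le_min (setIntegral_nonneg P.hΩ.measurableSet fun y hy => ?_) (by linarith [P.hm])
  exact mul_nonneg (P.hκ0 x y t).1 (hS.pow_le P.hl hy).1

lemma bnd_le (t : ℝ) (x : E) : P.bnd S t x ≤ P.m + 1 := min_le_right _ _

lemma exists_bnd_modulus (P : Setup n) (hε : 0 < ε) : ∃ δ > 0, ∀ S, P.Adm S →
    ∀ (t t' : ℝ) (x x' : E), dist x x' < δ → |t - t'| < δ → |P.bnd S t x - P.bnd S t' x'| ≤ ε := by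
  have hc : 0 < (P.m + 2) ^ P.l * volume.real P.Ω + 1 := by
    have := P.hm
    positivity
  obtain ⟨δ, hδ, h⟩ := Metric.uniformContinuous_iff.1 P.hκ
    (ε / ((P.m + 2) ^ P.l * volume.real P.Ω + 1)) (by positivity)
  refine ⟨δ, hδ, fun S hS t t' x x' hx ht => bnd_sub_le ?_⟩
  have := abs_setIntegral_sub_le P.hbd (hS.integrableOn_kernel x t) (hS.integrableOn_kernel x' t')
    (c := ε / ((P.m + 2) ^ P.l * volume.real P.Ω + 1) * (P.m + 2) ^ P.l) fun y hy => by
      rw [← sub_mul, abs_mul, abs_of_nonneg (hS.pow_le P.hl hy).1]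
      have h1 := h (a := ((x, y), t)) (b := ((x', y), t')) (by
        simp only [Prod.dist_eq, dist_self, Real.dist_eq]
        exact max_lt (max_lt hx hδ) ht)
      exact mul_le_mul h1.le (hS.pow_le P.hl hy).2 (hS.pow_le P.hl hy).1 (by positivity)
  refine this.trans ?_
  rw [mul_assoc, div_mul_eq_mul_div, div_le_iff₀ hc]
  exact mul_le_mul_of_nonneg_left (by linarith) hε.le

lemma bnd_continuous (hS : P.Adm S) (t : ℝ) : Continuous (P.bnd S t) := by
  refine Metric.continuous_iff.2 fun x ε hε => ?_
  obtain ⟨δ, hδ, h⟩ := P.exists_bnd_modulus (half_pos hε)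
  exact ⟨δ, hδ, fun y hy => (h S hS t t y x hy (by simpa using hδ)).trans_lt (half_lt_self hε)⟩

lemma bnd_hasCompactSupport (S : E → ℝ) (t : ℝ) : HasCompactSupport (P.bnd S t) := by
  obtain ⟨R, hR⟩ := P.hκs
  refine HasCompactSupport.of_support_subset_isCompact (isCompact_closedBall (0 : E) R)
    fun x hx => ?_
  by_contra h
  refine hx ?_
  have : ∀ y, P.κ x y t = 0 := fun y => hR x (not_le.1 (by simpa using h)) y t
  simp [bnd, this, min_eq_left (show 0 ≤ P.m + 1 by linarith [P.hm])]

lemma adm_u (P : Setup n) (ht : t ∈ Ico 0 P.T) : P.Adm (fun x => P.u x t) :=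
  ⟨P.hu.comp (continuous_id.prodMk continuous_const).continuousOn fun _ hx => ⟨subset_closure hx, ht⟩,
    fun y hy => ⟨(P.hum y (subset_closure hy) t ht).1,
      (P.hum y (subset_closure hy) t ht).2.trans (by linarith)⟩⟩

lemma bnd_u (P : Setup n) (hx : x ∈ frontier P.Ω) (ht : t ∈ Ioo 0 P.T) :
    P.bnd (fun y => P.u y t) t x = P.u x t := by
  rw [bnd, ← P.hub x hx t ht]
  exact min_eq_left (by linarith [(P.hum x (frontier_subset_closure hx) t ⟨ht.1.le, ht.2⟩).2])

end Setup

/-- Heat flow started at `S`, with the source `f` transported by the flow. -/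
def duhamel (S f : E → ℝ) (x : E) (τ : ℝ) : ℝ := heat S τ x + τ * heat f τ x

lemma duhamel_zero (S f : E → ℝ) (x : E) : duhamel S f x 0 = S x := by simp [duhamel, heat_zero]

lemma duhamel_pde {S : E → ℝ} (hS : Continuous S) (hSc : HasCompactSupport S)
    (hf : Continuous f) (hfc : HasCompactSupport f) (hτ : 0 < τ) (x : E) :
    ContDiffAt ℝ 2 (fun y => duhamel S f y τ) x ∧
    HasDerivAt (duhamel S f x) (lap (fun y => duhamel S f y τ) x + heat f τ x) τ := by
  have h1 := (heat_contDiff hS hSc hτ).contDiffAt (x := x)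
  have h2 := (heat_contDiff hf hfc hτ).contDiffAt (x := x)
  refine ⟨h1.add (contDiffAt_const.mul h2), ?_⟩
  have e : lap (fun y => duhamel S f y τ) x =
      lap (fun y => heat S τ y) x + τ * lap (fun y => heat f τ y) x := by
    unfold duhamel
    rw [lap_add h1 (contDiffAt_const.mul h2), lap_const_mul τ h2]
  exact ((heat_hasDerivAt hS hSc hτ x).add ((hasDerivAt_id τ).mul
    (heat_hasDerivAt hf hfc hτ x))).congr_deriv (by rw [e]; simp; ring)

lemma duhamel_continuous {S : E → ℝ} {A : ℝ} (hS : Continuous S)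
    (hM : ∀ x, |S x| ≤ M) (hf : Continuous f) (hA : ∀ x, |f x| ≤ A) :
    Continuous fun z : Q => duhamel S f z.1 z.2 :=
  (heat_continuous hS hM).add (continuous_snd.mul (heat_continuous hf hA))

namespace Setup

variable (P : Setup n)

/-- Cutoff supported in `{β ≤ ψ}`. -/
def cut (β : ℝ) (x : E) : ℝ := min 1 (max 0 (P.ψ x / β - 1))

/-- Compactly supported profiles with values in `[0, c]`. -/
def Prof (c : ℝ) (S : E → ℝ) : Prop := Continuous S ∧ HasCompactSupport S ∧ ∀ x, 0 ≤ S x ∧ S x ≤ c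

/-- Parameters and iterates of one time discretization. -/
structure Approx (ε : ℝ) where
  (T0 h β : ℝ) (L : ℕ) (S f G : ℕ → E → ℝ) (η : E → ℝ)
  hT0 : T0 ∈ Ioo (P.T - ε) P.T
  hT0θ : P.T - P.θ ≤ T0
  hh : 0 < h
  hhε : h ≤ ε
  hL : L * h = 2 * P.θ
  hβ : 0 < β
  hβε : β ≤ ε
  hη : ∀ x, 0 ≤ η x ∧ η x ≤ 1
  hη1 : ∀ x, 2 * β ≤ P.ψ x → η x = 1
  hS : ∀ k ≤ L, Prof (P.m + 2) (S k)
  hf : ∀ k ≤ L, Continuous (f k) ∧ HasCompactSupport (f k) ∧ ∀ x, |f k x| ≤ P.A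
  hfS : ∀ k, ∀ x, 2 * β ≤ P.ψ x → f k x = P.src (S k) (T0 + k * h) x
  hv : ∀ k < L, ∀ x, ∀ τ ∈ Icc 0 h, duhamel (S k) (f k) x τ ∈ Icc 0 (P.m + 2)
  hS0 : ∀ x, S 0 x = η x * P.u x T0 + (1 - η x) * G 0 x
  hSk : ∀ k x, S (k + 1) x = η x * duhamel (S k) (f k) x h + (1 - η x) * G (k + 1) x
  hG0 : G 0 = P.bnd (fun y => P.u y T0) T0
  hGk : ∀ k, G (k + 1) = P.bnd (S k) (T0 + k * h)
  hlat : ∀ k < L, ∀ x, P.ψ x = β / 2 → ∀ τ ∈ Icc 0 h, |duhamel (S k) (f k) x τ - G k x| ≤ ε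
  hlatu : ∀ x ∈ P.Ω, P.ψ x ≤ β → ∀ t ∈ Icc (P.T - P.θ) T0,
    |P.u x t - P.bnd (fun y => P.u y t) t x| ≤ ε

variable {P}

lemma cut_continuous : Continuous (P.cut β) := by
  have := P.ψ_continuous
  unfold cut
  fun_prop

lemma cut_mem (x : E) : 0 ≤ P.cut β x ∧ P.cut β x ≤ 1 :=
  ⟨le_min zero_le_one (le_max_left _ _), min_le_left _ _⟩

lemma cut_eq_one (hβ : 0 < β) (hx : 2 * β ≤ P.ψ x) : P.cut β x = 1 :=
  min_eq_left (le_max_of_le_right (by rw [le_sub_iff_add_le, le_div_iff₀ hβ]; linarith))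

lemma cut_eq_zero (hβ : 0 < β) (hx : P.ψ x ≤ β) : P.cut β x = 0 := by
  rw [cut, max_eq_left (by rw [sub_nonpos, div_le_one hβ]; exact hx), min_eq_right zero_le_one]

lemma cut_tsupport (hβ : 0 < β) : tsupport (P.cut β) ⊆ {x | β ≤ P.ψ x} :=
  closure_minimal (fun x hx => by
    by_contra h
    exact hx (cut_eq_zero hβ (not_le.1 h).le)) (isClosed_le continuous_const P.ψ_continuous)

lemma cut_hasCompactSupport (hβ : 0 < β) : HasCompactSupport (P.cut β) :=
  (P.heig.isCompact_superlevel P.hbd hβ).of_isClosed_subset (isClosed_tsupport _) (cut_tsupport hβ)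

lemma mem_of_cut_ne (hβ : 0 < β) (hx : P.cut β x ≠ 0) : x ∈ P.Ω :=
  P.mem_of_ψ_pos (hβ.trans (lt_of_not_ge fun h => hx (cut_eq_zero hβ h)))

variable {S : EuclideanSpace ℝ (Fin n) → ℝ}

lemma Prof.adm (hS : Prof (P.m + 2) S) : P.Adm S := ⟨hS.1.continuousOn, fun y _ => hS.2.2 y⟩

lemma Prof.abs_le (hS : Prof c S) (x : E) : |S x| ≤ c := by
  rw [abs_of_nonneg (hS.2.2 x).1]; exact (hS.2.2 x).2

lemma cut_src (hβ : 0 < β) (hS : Prof (P.m + 2) S) (t : ℝ) :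
    Continuous (fun x => P.cut β x * P.src S t x) ∧
    HasCompactSupport (fun x => P.cut β x * P.src S t x) ∧ ∀ x, |P.cut β x * P.src S t x| ≤ P.A := by
  refine ⟨?_, (cut_hasCompactSupport hβ).mul_right, fun x => ?_⟩
  · have h1 : Continuous fun x => P.a x t := P.ha.comp (continuous_id.prodMk continuous_const)
    have h2 : Continuous fun x => P.b x t := P.hb.comp (continuous_id.prodMk continuous_const)
    exact cut_continuous.mul (((h1.mul (hS.1.rpow_const fun _ => Or.inr P.hr.le)).mul
      continuous_const).sub (h2.mul (hS.1.rpow_const fun _ => Or.inr (by linarith [P.hq]))))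
  · by_cases h : P.cut β x = 0
    · simpa [h] using P.hA0
    · rw [abs_mul, abs_of_nonneg (cut_mem x).1]
      exact (mul_le_of_le_one_left (abs_nonneg _) (cut_mem x).2).trans
        (hS.adm.abs_src_le t (mem_of_cut_ne hβ h))

lemma duhamel_cut_src (hβ : 0 < β) (hS : Prof c S) (hc : c ≤ P.m + 2)
    (hh : h * (P.K * (P.m + 2) ^ (P.q - 1)) ≤ 1) (t : ℝ) (hτ : τ ∈ Icc 0 h) (x : E) :
    duhamel S (fun x => P.cut β x * P.src S t x) x τ ∈ Icc 0 (c + P.A * h) := by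
  have hS' : Prof (P.m + 2) S := ⟨hS.1, hS.2.1, fun x => ⟨(hS.2.2 x).1, (hS.2.2 x).2.trans hc⟩⟩
  obtain ⟨fc, -, fb⟩ := cut_src (P := P) hβ hS' t
  have hb' : ∀ y, |τ * (P.cut β y * P.src S t y)| ≤ P.A * h := fun y => by
    rw [abs_mul, abs_of_nonneg hτ.1, mul_comm]
    exact mul_le_mul (fb y) hτ.2 hτ.1 P.hA0
  have e : duhamel S (fun x => P.cut β x * P.src S t x) x τ =
      heat (fun y => S y + τ * (P.cut β y * P.src S t y)) τ x := by
    rw [heat_add (F' := fun y => τ * (P.cut β y * P.src S t y)) hS.1 (continuous_const.mul fc)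
      hS.abs_le hb', heat_const_mul]; rfl
  have hsum : ∀ y, |S y + τ * (P.cut β y * P.src S t y)| ≤ c + P.A * h := fun y =>
    (abs_add_le _ _).trans (add_le_add (hS.abs_le y) (hb' y))
  have hcont : Continuous fun y => S y + τ * (P.cut β y * P.src S t y) :=
    hS.1.add (continuous_const.mul fc)
  rw [e]
  refine ⟨le_heat hcont hsum (fun y => ?_) τ x, (le_abs_self _).trans (abs_heat_le hcont hsum τ x)⟩
  have hy := hS'.2.2 y
  have h1 : S y ^ P.q ≤ S y * (P.m + 2) ^ (P.q - 1) := by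
    rcases hy.1.eq_or_lt with h0 | h0
    · rw [← h0, zero_rpow (by linarith [P.hq]), zero_mul]
    · have e := rpow_add h0 1 (P.q - 1)
      rw [add_sub_cancel, rpow_one] at e
      rw [e]
      exact mul_le_mul_of_nonneg_left (rpow_le_rpow hy.1 hy.2 (by linarith [P.hq])) hy.1
  have h2 : - (P.K * (P.m + 2) ^ (P.q - 1) * S y) ≤ P.src S t y := by
    have i1 : 0 ≤ P.a y t * S y ^ P.r * ∫ y in P.Ω, S y ^ P.p :=
      mul_nonneg (mul_nonneg (P.ha0 y t) (rpow_nonneg hy.1 _)) hS'.adm.integral_pow_le.1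
    have i2 : P.b y t * S y ^ P.q ≤ P.K * (S y * (P.m + 2) ^ (P.q - 1)) :=
      mul_le_mul (P.hb0 y t).2 h1 (rpow_nonneg hy.1 _) P.K_nonneg
    unfold src
    linarith
  have hk : 0 ≤ P.K * (P.m + 2) ^ (P.q - 1) :=
    mul_nonneg P.K_nonneg (rpow_nonneg (by linarith [P.hm]) _)
  have h3 : - (P.K * (P.m + 2) ^ (P.q - 1) * S y) ≤ P.cut β y * P.src S t y := by
    have hc := cut_mem (P := P) (β := β) y
    nlinarith [mul_nonneg hk hy.1, mul_le_mul_of_nonneg_left h2 hc.1]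
  have h4 : τ * (P.K * (P.m + 2) ^ (P.q - 1)) ≤ 1 := (mul_le_mul_of_nonneg_right hτ.2 hk).trans hh
  nlinarith [mul_le_mul_of_nonneg_left h3 hτ.1, mul_le_mul_of_nonneg_right h4 hy.1]

lemma Prof.blend (hβ : 0 < β) (hc : P.m + 1 ≤ c) {z G : E → ℝ} (hz : ContinuousOn z P.Ω)
    (hz0 : ∀ x ∈ P.Ω, z x ∈ Icc 0 c) (hG : Prof (P.m + 1) G) :
    Prof c fun x => P.cut β x * z x + (1 - P.cut β x) * G x := by
  refine ⟨?_, ?_, fun x => ?_⟩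
  · exact (continuous_mul_of_tsupport P.hΩ cut_continuous (fun x hx =>
      P.mem_of_ψ_pos (hβ.trans_le (cut_tsupport hβ hx))) hz).add
        ((continuous_const.sub cut_continuous).mul hG.1)
  · exact (cut_hasCompactSupport hβ).mul_right.add hG.2.1.mul_left
  · have h1 := cut_mem (P := P) (β := β) x
    have h2 := hG.2.2 x
    by_cases h : P.cut β x = 0
    · simpa [h] using ⟨h2.1, h2.2.trans hc⟩
    · have h3 := hz0 x (mem_of_cut_ne hβ h)
      constructor
      · exact add_nonneg (mul_nonneg h1.1 h3.1) (mul_nonneg (by linarith) h2.1)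
      · nlinarith [mul_le_mul_of_nonneg_left h3.2 h1.1,
          mul_le_mul_of_nonneg_left (h2.2.trans hc) (sub_nonneg.2 h1.2)]

lemma Adm.prof_bnd (hS : P.Adm S) (t : ℝ) : Prof (P.m + 1) (P.bnd S t) :=
  ⟨bnd_continuous hS t, bnd_hasCompactSupport S t, fun x => ⟨bnd_nonneg hS t x, bnd_le t x⟩⟩

lemma bnd_u_continuousOn (P : Setup n) : ContinuousOn
    (fun z : Q => P.bnd (fun y => P.u y z.2) z.2 z.1) (univ ×ˢ Ico 0 P.T) := by
  refine ContinuousOn.inf (continuousOn_setIntegral P.hbd P.hΩ.measurableSet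
    (f := fun (z : Q) y => P.κ z.1 y z.2 * P.u y z.2 ^ P.l)
    (ContinuousOn.mul ?_ (ContinuousOn.rpow_const ?_ fun _ _ => Or.inr P.hl.le))) continuousOn_const
  · exact (P.hκ.continuous.comp (by fun_prop :
      Continuous fun y : Q × E => ((y.1.1, y.2), y.1.2))).continuousOn
  · exact P.hu.comp (f := fun y : Q × E => (y.2, y.1.2)) (by fun_prop)
      fun y hy => ⟨hy.2, hy.1.2⟩

lemma exists_lateral (P : Setup n) {T0 : ℝ} (hε : 0 < ε) (hT0 : T0 < P.T) :
    ∃ β > 0, β ≤ ε ∧ ∀ x ∈ P.Ω, P.ψ x ≤ β → ∀ t ∈ Icc (P.T - P.θ) T0,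
    |P.u x t - P.bnd (fun y => P.u y t) t x| ≤ ε := by
  have hI : Icc (P.T - P.θ) T0 ⊆ Ioo 0 P.T := fun t ht =>
    ⟨by linarith [ht.1, P.hθT], ht.2.trans_lt hT0⟩
  have hK : IsCompact (closure P.Ω ×ˢ Icc (P.T - P.θ) T0) :=
    P.hbd.isCompact_closure.prod isCompact_Icc
  have hc : ContinuousOn (fun z : Q => |P.u z.1 z.2 - P.bnd (fun y => P.u y z.2) z.2 z.1|)
      (closure P.Ω ×ˢ Icc (P.T - P.θ) T0) :=
    ((P.hu.mono (prod_mono_right (hI.trans Ioo_subset_Ico_self))).sub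
      (P.bnd_u_continuousOn.mono (prod_mono (subset_univ _) (hI.trans Ioo_subset_Ico_self)))).abs
  obtain ⟨β, hβ, h⟩ : ∃ β > 0, ∀ z ∈ (closure P.Ω ×ˢ Icc (P.T - P.θ) T0) ∩
      (fun z : Q => |P.u z.1 z.2 - P.bnd (fun y => P.u y z.2) z.2 z.1|) ⁻¹' Ici ε,
      β ≤ P.ψ z.1 := by
    have hcomp := hK.of_isClosed_subset (hc.preimage_isClosed_of_isClosed hK.isClosed
      (isClosed_Ici (a := ε))) inter_subset_left
    refine hcomp.exists_forall_le' (f := fun z => P.ψ z.1) (a := 0)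
      (P.ψ_continuous.comp continuous_fst).continuousOn fun z hz => ?_
    by_cases hx : z.1 ∈ P.Ω
    · rw [ψ, indicator_of_mem hx]; exact P.heig.2.2.2.2 _ hx
    · have hfr : z.1 ∈ frontier P.Ω := ⟨hz.1.1, by rwa [P.hΩ.interior_eq]⟩
      have := hz.2
      simp only [mem_preimage, P.bnd_u hfr (hI hz.1.2), sub_self, abs_zero, mem_Ici] at this
      linarith
  refine ⟨min (β / 2) ε, by positivity, min_le_right _ _, fun x hx hψ t ht => ?_⟩
  by_contra hlt
  have := h (x, t) ⟨⟨subset_closure hx, ht⟩, (not_le.1 hlt).le⟩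
  have := hψ.trans (min_le_left _ _)
  dsimp at *
  linarith

variable {P : Setup n}

variable (P) in
/-- Iterates of the time discretization with step `h`, started from `u (·, T0)`. -/
def iter (β h T0 : ℝ) : ℕ → E → ℝ
  | 0 => fun x => P.cut β x * P.u x T0 + (1 - P.cut β x) * P.bnd (fun y => P.u y T0) T0 x
  | k + 1 => fun x => P.cut β x * duhamel (iter β h T0 k)
      (fun y => P.cut β y * P.src (iter β h T0 k) (T0 + k * h) y) x h +
      (1 - P.cut β x) * P.bnd (iter β h T0 k) (T0 + k * h) x

lemma prof_iter {T0 : ℝ} {L : ℕ} (hβ : 0 < β) (hT0 : T0 ∈ Ico 0 P.T) (hh : 0 < h)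
    (hL : L * h = 2 * P.θ) (hK : h * (P.K * (P.m + 2) ^ (P.q - 1)) ≤ 1) :
    ∀ k ≤ L, Prof (P.m + 1 + P.A * (k * h)) (P.iter β h T0 k) ∧
    P.m + 1 + P.A * (k * h) ≤ P.m + 2 := by
  have hle : ∀ k ≤ L, P.m + 1 + P.A * (k * h) ≤ P.m + 2 := fun k hk => by
    have h1 : (k : ℝ) * h ≤ 2 * P.θ := hL ▸ mul_le_mul_of_nonneg_right (by exact_mod_cast hk) hh.le
    linarith [mul_le_mul_of_nonneg_left h1 P.hA0, P.hθA]
  intro k hk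
  refine ⟨?_, hle k hk⟩
  induction k with
  | zero =>
    have ha := P.adm_u hT0
    refine Prof.blend hβ (by simp) ha.1 (fun x hx => ?_) (ha.prof_bnd T0)
    have := P.hum x (subset_closure hx) T0 hT0
    exact ⟨this.1, by simpa using by linarith⟩
  | succ k ih =>
    have hS := ih (Nat.le_of_succ_le hk)
    have hle' := hle k (Nat.le_of_succ_le hk)
    have hS' : Prof (P.m + 2) (P.iter β h T0 k) :=
      ⟨hS.1, hS.2.1, fun x => ⟨(hS.2.2 x).1, (hS.2.2 x).2.trans hle'⟩⟩
    obtain ⟨fc, -, fb⟩ := cut_src (P := P) hβ hS' (T0 + k * h)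
    refine Prof.blend hβ ?_ ?_ (fun x _ => ?_) (hS'.adm.prof_bnd _)
    · have := P.hA0
      have : 0 ≤ P.A * (((k + 1 : ℕ) : ℝ) * h) := by positivity
      linarith
    · exact ((duhamel_continuous hS.1 hS.abs_le fc fb).comp
        (continuous_id.prodMk continuous_const)).continuousOn
    · have := duhamel_cut_src (P := P) hβ hS hle' hK (T0 + k * h) ⟨hh.le, le_rfl⟩ x
      exact ⟨this.1, this.2.trans (by push_cast; linarith)⟩

lemma abs_heat_sub_le_of_local {g : ℝ}
    (hF : 0 < τ → Continuous F ∧ ∀ y, |F y| ≤ c) (hρ : 0 < ρ) (hδ : 0 < δ)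
    (hM : 0 < τ → ∀ y, |F y - g| ≤ M) (hloc : ∀ y, dist y x < ρ → |F y - g| ≤ δ)
    (hh : M * h ^ 2 ≤ δ * ρ ^ 4) (hτ : τ ∈ Icc 0 h) : |heat F τ x - g| ≤ max 1 (gaussC n) * δ := by
  rcases hτ.1.eq_or_lt with h0 | h0
  · rw [← h0, heat_zero]
    exact (hloc x (by simpa using hρ)).trans (le_mul_of_one_le_left hδ.le (le_max_left _ _))
  refine (abs_heat_sub_le (hF h0).1 (hF h0).2 h0 x g (δ := δ) fun y => ?_).trans
    (by gcongr; exact le_max_right _ _)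
  by_cases hy : dist y x < ρ
  · refine (hloc y hy).trans (le_mul_of_one_le_right hδ.le (one_le_pow₀ ?_))
    have : 0 ≤ ‖x - y‖ ^ 2 / τ := by positivity
    linarith
  · have hxy : ρ ≤ ‖x - y‖ := by rw [← dist_eq_norm, dist_comm]; exact not_lt.1 hy
    have h2 : ρ ^ 2 / h ≤ 1 + ‖x - y‖ ^ 2 / τ := by
      have : ρ ^ 2 / h ≤ ‖x - y‖ ^ 2 / τ := by gcongr; exact hτ.2
      linarith
    have hh0 : 0 < h := h0.trans_le hτ.2
    calc |F y - g| ≤ M := hM h0 y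
      _ ≤ δ * (ρ ^ 2 / h) ^ 2 := by
        rw [div_pow, ← pow_mul, mul_div_assoc', le_div_iff₀ (by positivity)]; exact hh
      _ ≤ _ := by gcongr

lemma exists_approx (P : Setup n) (hε : 0 < ε) : Nonempty (P.Approx ε) := by
  obtain ⟨T0, hT0, hT0θ⟩ : ∃ T0 ∈ Ioo (P.T - ε) P.T, P.T - P.θ ≤ T0 := by
    have := P.hθ
    refine ⟨P.T - min P.θ (ε / 2), ⟨?_, ?_⟩, ?_⟩
    · linarith [min_le_right P.θ (ε / 2)]
    · linarith [lt_min this (half_pos hε)]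
    · linarith [min_le_left P.θ (ε / 2)]
  have hT0' : T0 ∈ Ico 0 P.T := ⟨by linarith [P.hθT], hT0.2⟩
  obtain ⟨β, hβ, hβε, hlat⟩ := P.exists_lateral hε hT0.2
  set δ := ε / (4 * max 1 (gaussC n)) with hδ
  have hg : 0 < max 1 (gaussC n) := lt_max_of_lt_left one_pos
  have hδ0 : 0 < δ := by positivity
  obtain ⟨ρ₁, hρ₁, hmod⟩ := P.exists_bnd_modulus hδ0
  have hψu : UniformContinuous P.ψ := by
    refine HasCompactSupport.uniformContinuous_of_continuous ?_ P.ψ_continuous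
    exact HasCompactSupport.of_support_subset_isCompact P.hbd.isCompact_closure
      (support_indicator_subset.trans subset_closure)
  obtain ⟨ρ₂, hρ₂, hψ⟩ := Metric.uniformContinuous_iff.1 hψu (β / 2) (by positivity)
  set ρ := min ρ₁ ρ₂ with hρ
  have hρ0 : 0 < ρ := lt_min hρ₁ hρ₂
  have ev : ∀ᶠ h : ℝ in 𝓝 0, h < ε ∧ h * (P.K * (P.m + 2) ^ (P.q - 1)) < 1 ∧
      (P.m + 2) * h ^ 2 < δ * ρ ^ 4 ∧ P.A * h < ε / 2 := by
    refine (eventually_lt_nhds hε).and (Eventually.and ?_ (Eventually.and ?_ ?_))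
    · exact (continuous_id.mul continuous_const).continuousAt.eventually_lt continuousAt_const (by simp)
    · exact (continuous_const.mul (continuous_id.pow 2)).continuousAt.eventually_lt continuousAt_const
        (by simp; positivity)
    · exact (continuous_const.mul continuous_id).continuousAt.eventually_lt continuousAt_const
        (by simpa using hε)
  have ht : Tendsto (fun L : ℕ => 2 * P.θ / (L : ℝ)) atTop (𝓝 0) :=
    tendsto_const_nhds.div_atTop tendsto_natCast_atTop_atTop
  obtain ⟨L, ⟨hhε, hK, hhρ, hhA⟩, hL1⟩ := ((ht.eventually ev).and (eventually_ge_atTop 1)).exists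
  set h := 2 * P.θ / (L : ℝ) with hh
  have hL0 : (0 : ℝ) < L := by exact_mod_cast hL1
  have hh0 : 0 < h := by have := P.hθ; positivity
  have hL : L * h = 2 * P.θ := by rw [hh]; field_simp
  have hiter := prof_iter hβ hT0' hh0 hL hK.le
  have hS : ∀ k ≤ L, Prof (P.m + 2) (P.iter β h T0 k) := fun k hk =>
    ⟨(hiter k hk).1.1, (hiter k hk).1.2.1, fun x => ⟨((hiter k hk).1.2.2 x).1,
      ((hiter k hk).1.2.2 x).2.trans (hiter k hk).2⟩⟩
  let G : ℕ → E → ℝ := fun k => match k with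
    | 0 => P.bnd (fun y => P.u y T0) T0
    | k + 1 => P.bnd (P.iter β h T0 k) (T0 + k * h)
  have hGS : ∀ k x, P.ψ x ≤ β → P.iter β h T0 k x = G k x := by
    rintro (_ | k) x hx <;> simp [iter, G, cut_eq_zero hβ hx]
  have hG : ∀ k ≤ L, Prof (P.m + 1) (G k) ∧ ∀ x x', dist x x' < ρ₁ → |G k x - G k x'| ≤ δ := by
    rintro (_ | k) hk
    · exact ⟨(P.adm_u hT0').prof_bnd T0, fun x x' hx =>
        hmod _ (P.adm_u hT0') _ _ x x' hx (by simpa using hρ₁)⟩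
    · have := (hS k (Nat.le_of_succ_le hk)).adm
      exact ⟨this.prof_bnd _, fun x x' hx => hmod _ this _ _ x x' hx (by simpa using hρ₁)⟩
  refine ⟨⟨T0, h, β, L, P.iter β h T0, fun k y => P.cut β y * P.src (P.iter β h T0 k) (T0 + k * h) y,
    G, P.cut β, hT0, hT0θ, hh0, hhε.le, hL, hβ, hβε, cut_mem, fun x hx => cut_eq_one hβ hx, hS,
    fun k hk => cut_src hβ (hS k hk) _, fun k x hx => by rw [cut_eq_one hβ hx, one_mul],
    fun k hk x τ hτ => ?_, fun _ => rfl, fun _ _ => rfl, rfl, fun _ => rfl, fun k hk x hx τ hτ => ?_,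
    hlat⟩⟩
  · have h1 := duhamel_cut_src hβ (hiter k hk.le).1 (hiter k hk.le).2 hK.le (T0 + k * h) hτ x
    have h2 := (hiter (k + 1) hk).2
    push_cast at h2
    exact ⟨h1.1, h1.2.trans (by linarith)⟩
  · obtain ⟨fc, -, fb⟩ := cut_src (P := P) hβ (hS k hk.le) (T0 + k * h)
    have h2 : |τ * heat (fun y => P.cut β y * P.src (P.iter β h T0 k) (T0 + k * h) y) τ x| ≤
        P.A * h := by
      rw [abs_mul, abs_of_nonneg hτ.1, mul_comm]
      exact mul_le_mul (abs_heat_le fc fb τ x) hτ.2 hτ.1 P.hA0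
    have h1 := abs_heat_sub_le_of_local (fun _ => ⟨(hS k hk.le).1, (hS k hk.le).abs_le⟩) hρ0 hδ0
      (M := P.m + 2) (g := G k x) (x := x) (fun _ y => ?_) (fun y hy => ?_) hhρ.le hτ
    · have h3 : max 1 (gaussC n) * δ = ε / 4 := by rw [hδ]; field_simp
      rw [duhamel, add_sub_right_comm]
      exact (abs_add_le _ _).trans (by linarith)
    · have h1 := (hS k hk.le).2.2 y
      have h2 := (hG k hk.le).1.2.2 x
      exact abs_le.2 ⟨by linarith [P.hm], by linarith⟩
    · have h1 := hψ (hy.trans_le (min_le_right _ _))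
      rw [Real.dist_eq, hx] at h1
      rw [hGS k y (by linarith [(abs_lt.1 h1).2])]
      exact (hG k hk.le).2 y x (hy.trans_le (min_le_left _ _))

end Setup

namespace Setup.Approx

variable {P : Setup n} (a : P.Approx ε)

/-- Nodes of the time grid. -/
def node (k : ℕ) : ℝ := a.T0 + k * a.h

/-- The approximate solution on the `k`-th time slab. -/
def v (k : ℕ) : E → ℝ → ℝ := duhamel (a.S k) (a.f k)

/-- Continuous interpolation of the approximate solution, meaningful where `2 * β ≤ ψ`. -/
def z (x : E) (t : ℝ) : ℝ := P.u x (min t a.T0) +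
  ∑ k ∈ Finset.range a.L, (a.v k x (max 0 (min a.h (t - a.node k))) - a.S k x)

/-- Index of the time slab containing `t`. -/
def ix (t : ℝ) : ℕ := ⌊(t - a.T0) / a.h⌋₊

/-- Source term of the approximate equation. -/
def fx (x : E) (t : ℝ) : ℝ :=
  if t < a.T0 then P.src (fun y => P.u y t) t x else heat (a.f (a.ix t)) (t - a.node (a.ix t)) x

/-- `Y` is the profile of the approximate solution at a time `σ` close to `t`. -/
def Frozen (t : ℝ) (Y : E → ℝ) (σ : ℝ) : Prop :=
  P.Adm Y ∧ |σ - t| ≤ 2 * ε ∧ ∀ x, 2 * a.β ≤ P.ψ x → Y x = a.z x σ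

lemma node_succ (k : ℕ) : a.node (k + 1) = a.node k + a.h := by unfold node; push_cast; ring

lemma node_zero : a.node 0 = a.T0 := by simp [node]

lemma node_mono : Monotone a.node :=
  monotone_nat_of_le_succ fun k => by rw [node_succ]; linarith [a.hh]

lemma T0_pos : 0 < a.T0 := by linarith [a.hT0θ, P.hθT]

lemma eps_pos (a : P.Approx ε) : 0 < ε := a.hh.trans_le a.hhε

lemma ix_spec (ht : t ∈ Ico a.T0 (a.T0 + 2 * P.θ)) :
    a.ix t < a.L ∧ t ∈ Ico (a.node (a.ix t)) (a.node (a.ix t) + a.h) := by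
  have h0 : 0 ≤ (t - a.T0) / a.h := div_nonneg (by linarith [ht.1]) a.hh.le
  have h1 := (le_div_iff₀ a.hh).1 (Nat.floor_le h0)
  have h2 := (div_lt_iff₀ a.hh).1 (Nat.lt_floor_add_one ((t - a.T0) / a.h))
  refine ⟨(Nat.floor_lt h0).2 ((div_lt_iff₀ a.hh).2 (by rw [a.hL]; linarith [ht.2])), ?_, ?_⟩
  · unfold node ix; linarith
  · unfold node ix; linarith

lemma ix_eq {j : ℕ} (ht : t ∈ Ico (a.node j) (a.node j + a.h)) : a.ix t = j := by
  have h1 := ht.1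
  have h2 := ht.2
  unfold node at h1 h2
  have hj : (0 : ℝ) ≤ j * a.h := by have := a.hh; positivity
  rw [ix, Nat.floor_eq_iff (div_nonneg (by linarith) a.hh.le), le_div_iff₀ a.hh, div_lt_iff₀ a.hh]
  constructor <;> linarith

lemma v_zero (k : ℕ) (x : E) : a.v k x 0 = a.S k x := duhamel_zero _ _ x

lemma z_eq_u (ht : t ≤ a.T0) (x : E) : a.z x t = P.u x t := by
  rw [z, min_eq_left ht, Finset.sum_eq_zero, add_zero]
  intro k _
  have : t - a.node k ≤ 0 := by linarith [a.node_zero ▸ a.node_mono (Nat.zero_le k)]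
  rw [max_eq_left ((min_le_right _ _).trans this), v_zero, sub_self]

lemma S_zero (hx : 2 * a.β ≤ P.ψ x) : a.S 0 x = P.u x a.T0 := by rw [a.hS0, a.hη1 x hx]; ring

lemma S_succ (hx : 2 * a.β ≤ P.ψ x) (k : ℕ) : a.S (k + 1) x = a.v k x a.h := by
  rw [a.hSk, a.hη1 x hx, v]; ring

lemma z_eq_v {j : ℕ} (hj : j < a.L) (ht : t ∈ Icc (a.node j) (a.node j + a.h)) (hx : 2 * a.β ≤ P.ψ x) : a.z x t = a.v j x (t - a.node j) := by
  have key : ∀ J, j < J → ∑ k ∈ Finset.range J,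
      (a.v k x (max 0 (min a.h (t - a.node k))) - a.S k x) = a.v j x (t - a.node j) - a.S 0 x := by
    intro J hJ
    induction J, hJ using Nat.le_induction with
    | base =>
      rw [Finset.sum_range_succ, min_eq_right (by linarith [ht.2]), max_eq_right (by linarith [ht.1]),
        Finset.sum_congr rfl (g := fun k => a.S (k + 1) x - a.S k x), Finset.sum_range_sub
        (fun k => a.S k x)]
      · ring
      · intro k hk
        have := a.node_mono (Nat.succ_le_of_lt (Finset.mem_range.1 hk))
        rw [Nat.succ_eq_add_one, node_succ] at this
        rw [min_eq_left (by linarith [ht.1]), max_eq_right a.hh.le, a.S_succ hx]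
    | succ J hJ ih =>
      rw [Finset.sum_range_succ, ih]
      have := a.node_mono hJ
      rw [Nat.succ_eq_add_one, node_succ] at this
      rw [max_eq_left ((min_le_right _ _).trans (by linarith [ht.2])), v_zero, sub_self, add_zero]
  have h0 := a.node_mono (Nat.zero_le j)
  rw [node_zero] at h0
  rw [z, key _ hj, min_eq_right (h0.trans ht.1), a.S_zero hx]
  ring

lemma z_node {k : ℕ} (hk : k < a.L) (hx : 2 * a.β ≤ P.ψ x) : a.z x (a.node k) = a.S k x := by
  rw [a.z_eq_v hk ⟨le_rfl, by linarith [a.hh]⟩ hx, sub_self, v_zero]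

lemma z_mem (ht : t ∈ Ico 0 (a.T0 + 2 * P.θ)) (hx : 2 * a.β ≤ P.ψ x) :
    a.z x t ∈ Icc 0 (P.m + 2) := by
  have hxΩ := P.mem_of_ψ_pos (by linarith [a.hβ] : 0 < P.ψ x)
  rcases le_total t a.T0 with h | h
  · have := P.hum x (subset_closure hxΩ) t ⟨ht.1, h.trans_lt a.hT0.2⟩
    rw [a.z_eq_u h]
    exact ⟨this.1, by linarith [this.2]⟩
  · obtain ⟨h1, h2, h3⟩ := a.ix_spec ⟨h, ht.2⟩
    rw [a.z_eq_v h1 ⟨h2, h3.le⟩ hx]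
    exact a.hv _ h1 x _ ⟨by linarith, by linarith⟩

lemma v_continuous {k : ℕ} (hk : k ≤ a.L) : Continuous fun p : Q => a.v k p.1 p.2 :=
  duhamel_continuous (a.hS k hk).1 (a.hS k hk).abs_le (a.hf k hk).1 (a.hf k hk).2.2

lemma v_pde {k : ℕ} (hk : k ≤ a.L) (ht : a.node k < t) (x : E) :
    ContDiffAt ℝ 2 (fun y => a.v k y (t - a.node k)) x ∧
    HasDerivAt (fun s => a.v k x (s - a.node k)) (lap (fun y => a.v k y (t - a.node k)) x +
    heat (a.f k) (t - a.node k) x) t := by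
  have h := duhamel_pde (a.hS k hk).1 (a.hS k hk).2.1 (a.hf k hk).1 (a.hf k hk).2.1
    (sub_pos.2 ht) x
  exact ⟨h.1, (h.2.comp t ((hasDerivAt_id t).sub_const _)).congr_deriv (mul_one _)⟩

lemma z_continuousOn : ContinuousOn ♯a.z (P.Ω ×ˢ Ioo 0 (a.T0 + 2 * P.θ)) := by
  refine ContinuousOn.add ?_ (Continuous.continuousOn (continuous_finsetSum _ fun k hk => ?_))
  · refine P.hu.comp (f := fun p : Q => (p.1, min p.2 a.T0)) (by fun_prop) fun p hp =>
      ⟨subset_closure hp.1, le_min hp.2.1.le a.T0_pos.le, (min_le_right _ _).trans_lt a.hT0.2⟩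
  · have hk' := (Finset.mem_range.1 hk).le
    exact ((a.v_continuous hk').comp (by fun_prop : Continuous fun p : Q =>
      (p.1, max 0 (min a.h (p.2 - a.node k))))).sub ((a.hS k hk').1.comp continuous_fst)

lemma z_pde (ht : t ∈ Ioo 0 (a.T0 + 2 * P.θ)) : ∃ t' > t, ∀ x, 2 * a.β < P.ψ x →
    ∀ τ ∈ Ioo t t', ContDiffAt ℝ 2 (fun y => a.z y τ) x ∧
    HasDerivAt (a.z x) (lap (fun y => a.z y τ) x + a.fx x τ) τ := by
  rcases lt_or_ge t a.T0 with h | h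
  · refine ⟨a.T0, h, fun x hx τ hτ => ?_⟩
    have hxΩ := P.mem_of_ψ_pos (by linarith [a.hβ] : 0 < P.ψ x)
    have e : (fun y => a.z y τ) = fun y => P.u y τ := funext (a.z_eq_u hτ.2.le)
    have h1 := P.hpde x hxΩ τ ⟨ht.1.trans hτ.1, hτ.2.trans a.hT0.2⟩
    rw [e, fx, if_pos hτ.2]
    exact ⟨h1.1, h1.2.congr_of_eventuallyEq ((eventually_lt_nhds hτ.2).mono fun s hs =>
      a.z_eq_u hs.le x)⟩
  · obtain ⟨h1, h2⟩ := a.ix_spec ⟨h, ht.2⟩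
    set j := a.ix t with hj
    refine ⟨a.node j + a.h, h2.2, fun x hx τ hτ => ?_⟩
    have e : (fun y => a.z y τ) =ᶠ[𝓝 x] fun y => a.v j y (τ - a.node j) :=
      (P.ψ_continuous.continuousAt.eventually (lt_mem_nhds hx)).mono fun y hy =>
        a.z_eq_v h1 ⟨h2.1.trans hτ.1.le, hτ.2.le⟩ (le_of_lt hy)
    have h3 := a.v_pde h1.le (h2.1.trans_lt hτ.1) x
    rw [lap_congr e, fx, if_neg (not_lt.2 (h.trans hτ.1.le)), a.ix_eq ⟨h2.1.trans hτ.1.le, hτ.2⟩]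
    refine ⟨h3.1.congr_of_eventuallyEq e, h3.2.congr_of_eventuallyEq ?_⟩
    exact (Ioo_mem_nhds (h2.1.trans_lt hτ.1) hτ.2 : Ioo (a.node j) (a.node j + a.h) ∈ 𝓝 τ) |>
      fun h => Filter.mem_of_superset h fun s hs => a.z_eq_v h1 ⟨hs.1.le, hs.2.le⟩ hx.le

lemma heatSol : HeatSol {x | 2 * a.β < P.ψ x} 0 (a.T0 + 2 * P.θ) a.z a.fx := by
  have hc : ContinuousOn ♯a.z
      ({x | 2 * a.β < P.ψ x} ×ˢ Ioo 0 (a.T0 + 2 * P.θ)) :=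
    a.z_continuousOn.mono (prod_mono_left fun x (hx : 2 * a.β < P.ψ x) =>
      P.mem_of_ψ_pos (by linarith [a.hβ]))
  constructor
  · refine SlabSuper.heatSuper hc fun t ht => ?_
    obtain ⟨t', h, h'⟩ := a.z_pde ht
    refine ⟨t', h, fun x hx τ hτ => ?_⟩
    obtain ⟨h1, h2⟩ := h' x hx τ hτ
    exact ⟨h1, h2.differentiableAt, h2.deriv.ge⟩
  · refine SlabSuper.heatSuper hc.neg fun t ht => ?_
    obtain ⟨t', h, h'⟩ := a.z_pde ht
    refine ⟨t', h, fun x hx τ hτ => ?_⟩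
    obtain ⟨h1, h2⟩ := h' x hx τ hτ
    have h3 : HasDerivAt (fun s => - a.z x s) _ τ := h2.neg
    refine ⟨h1.neg, h3.differentiableAt, ?_⟩
    rw [lap_neg h1, h3.deriv]
    linarith

lemma abs_F_le (ht : t ∈ Ico 0 (a.T0 + 2 * P.θ)) (hx : x ∈ P.Ω) : |a.fx x t| ≤ P.A := by
  unfold fx
  split_ifs with h
  · exact (P.adm_u ⟨ht.1, h.trans a.hT0.2⟩).abs_src_le t hx
  · have := a.hf _ (a.ix_spec ⟨not_lt.1 h, ht.2⟩).1.le
    exact abs_heat_le this.1 this.2.2 _ x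

lemma frozen_u (ht : t ∈ Icc 0 a.T0) : a.Frozen t (fun y => P.u y t) t :=
  ⟨P.adm_u ⟨ht.1, ht.2.trans_lt a.hT0.2⟩, by simpa using a.eps_pos.le,
    fun x _ => (a.z_eq_u ht.2 x).symm⟩

lemma frozen_S {k : ℕ} (hk : k < a.L) (ht : |a.node k - t| ≤ 2 * ε) :
    a.Frozen t (a.S k) (a.node k) :=
  ⟨(a.hS k hk.le).adm, ht, fun _ hx => (a.z_node hk hx).symm⟩

lemma frozen_G {k : ℕ} (hk : k < a.L) (ht : t ∈ Icc (a.node k) (a.node k + a.h)) :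
    ∃ Y σ, a.Frozen t Y σ ∧ a.G k = P.bnd Y σ := by
  have h1 := a.hhε
  have h2 := a.hh
  rcases k with _ | k
  · refine ⟨_, a.T0, ⟨(a.frozen_u ⟨a.T0_pos.le, le_rfl⟩).1, ?_, fun x _ => (a.z_eq_u le_rfl x).symm⟩,
      a.hG0⟩
    rw [node_zero] at ht
    exact abs_le.2 ⟨by linarith [ht.2], by linarith [ht.1]⟩
  · rw [node_succ] at ht
    exact ⟨_, _, a.frozen_S (Nat.lt_of_succ_lt hk)
      (abs_le.2 ⟨by linarith [ht.2], by linarith [ht.1]⟩), a.hGk k⟩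

lemma exists_frozen_F (ht : t ∈ Ico 0 (a.T0 + 2 * P.θ)) :
    ∃ Y σ, a.Frozen t Y σ ∧ ∃ f τ, τ ∈ Icc 0 ε ∧ (0 < τ → Continuous f ∧ ∀ y, |f y| ≤ P.A) ∧
    (∀ y, 2 * a.β ≤ P.ψ y → f y = P.src Y σ y) ∧ ∀ x, a.fx x t = heat f τ x := by
  rcases lt_or_ge t a.T0 with h | h
  · refine ⟨_, _, a.frozen_u ⟨ht.1, h.le⟩, P.src (fun y => P.u y t) t, 0, ⟨le_rfl, a.eps_pos.le⟩,
      fun h => absurd h (lt_irrefl _), fun _ _ => rfl, fun x => ?_⟩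
    rw [heat_zero, fx, if_pos h]
  · obtain ⟨h1, h2, h3⟩ := a.ix_spec ⟨h, ht.2⟩
    have h4 := a.hf _ h1.le
    refine ⟨_, _, a.frozen_S h1 (abs_le.2 ⟨?_, ?_⟩), a.f (a.ix t), t - a.node (a.ix t), ⟨?_, ?_⟩,
      fun _ => ⟨h4.1, h4.2.2⟩, fun y hy => a.hfS _ y hy, fun x => by rw [fx, if_neg (not_lt.2 h)]⟩ <;>
    linarith [a.hhε, a.eps_pos]

end Setup.Approx

variable (n) in
lemma HeatSol.exists_modulus (hρ : 0 < ρ) (hM0 : 0 ≤ M) (hA0 : 0 ≤ A₀)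
    (ht : t ∈ Ioo α β) (hδ : 0 < δ) : ∃ r > 0, ∀ (U : Set E) (w f : E → ℝ → ℝ) (x : E),
    IsOpen U → ContinuousOn ♯w (U ×ˢ Ioo α β) → HeatSol U α β w f →
    closedBall x (4 * ρ) ⊆ U →
    (∀ y ∈ closedBall x (4 * ρ), ∀ t ∈ Ioo α β, |f y t| ≤ A₀ ∧ |w y t| ≤ M) →
    ∀ y t', dist y x < r → |t' - t| < r → |w y t' - w x t| ≤ δ := by
  have hm : 0 ≤ modC n ρ M A₀ := by unfold modC; positivity
  have hg := gaussC_pos n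
  set C := 2 * modC n ρ M A₀ + gaussC n * M with hC
  have hC0 : 0 ≤ C := by positivity
  have ev : ∀ᶠ η : ℝ in 𝓝[>] 0, η < 1 ∧ η < (t - α) / 2 ∧ (1 + gaussC n) * C * η < δ / 2 ∧ 0 < η := by
    refine Eventually.and ?_ (Eventually.and ?_ (Eventually.and ?_ self_mem_nhdsWithin))
    · exact nhdsWithin_le_nhds (eventually_lt_nhds one_pos)
    · exact nhdsWithin_le_nhds (eventually_lt_nhds (by linarith [ht.1]))
    · exact nhdsWithin_le_nhds ((continuous_const.mul continuous_id).continuousAt.eventually_lt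
        continuousAt_const (by simpa using hδ))
  obtain ⟨η, hη1, hηα, hηδ, hη⟩ := ev.exists
  have ev : ∀ᶠ r : ℝ in 𝓝[>] 0, r < 1 ∧ r < (t - α) / 2 ∧ r < β - t ∧ r < ρ ∧
      C * ((√η)⁻¹ * r) + (modC n ρ M A₀ * r + gaussC n * (C * ((√η)⁻¹ * √r) + 2 * M / ρ ^ 4 * r ^ 2))
        < δ / 2 ∧ 0 < r := by
    refine Eventually.and ?_ (Eventually.and ?_ (Eventually.and ?_ (Eventually.and ?_
      (Eventually.and ?_ self_mem_nhdsWithin))))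
    · exact nhdsWithin_le_nhds (eventually_lt_nhds one_pos)
    · exact nhdsWithin_le_nhds (eventually_lt_nhds (by linarith [ht.1]))
    · exact nhdsWithin_le_nhds (eventually_lt_nhds (by linarith [ht.2]))
    · exact nhdsWithin_le_nhds (eventually_lt_nhds hρ)
    · exact nhdsWithin_le_nhds (ContinuousAt.eventually_lt (by fun_prop) continuousAt_const
        (by simpa using hδ))
  obtain ⟨r, hr1, hrα, hrβ, hrρ, hrδ, hr⟩ := ev.exists
  refine ⟨r, hr, fun U w f x hUo hc hw hU hb y t' hy ht' => ?_⟩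
  have hA := fun y hy t ht => (hb y hy t ht).1
  have hM := fun y hy t ht => (hb y hy t ht).2
  obtain ⟨i1, i2⟩ := abs_lt.1 ht'
  have h1 : |w y t' - w x t'| ≤ C * (η + (√η)⁻¹ * r) := by
    refine (hw.space_modulus hUo hc hρ hU hA hM (x := y) (y := x) (h := η) (t := t')
      (mem_closedBall.2 (by linarith)) (mem_closedBall_self (by linarith)) hη hη1.le
      (by linarith) (by linarith)).trans ?_
    rw [← dist_eq_norm]
    gcongr
  have h2 : |w x t' - w x t| ≤ modC n ρ M A₀ * r + gaussC n *
      (C * (η + (√η)⁻¹ * √r) + 2 * M / ρ ^ 4 * r ^ 2) := by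
    have key : ∀ s h, 0 < h → h < r → α < s - η → s + h < β → |w x (s + h) - w x s| ≤
        modC n ρ M A₀ * r + gaussC n * (C * (η + (√η)⁻¹ * √r) + 2 * M / ρ ^ 4 * r ^ 2) := by
      intro s h hh hhr h1 h2
      refine (hw.time_modulus hUo hc hρ hU hA hM (mem_closedBall_self hρ.le) hh (by linarith) hη
        hη1.le h1 h2).trans ?_
      gcongr
    rcases lt_trichotomy t t' with h | h | h
    · simpa using key t (t' - t) (by linarith) (by linarith) (by linarith) (by linarith)
    · rw [h, sub_self, abs_zero]; positivity
    · simpa [abs_sub_comm] using key t' (t - t') (by linarith) (by linarith) (by linarith) (by linarith)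
  have h3 := abs_sub_le (w y t') (w x t') (w x t)
  nlinarith

lemma abs_sub_le_of_continuousConv {X : Type*} [TopologicalSpace X] {F : ℕ → X → ℝ} {w : X → ℝ}
    {O : Set X} (h : ∀ x ∈ O, Tendsto (fun q : ℕ × X => F q.1 q.2) (atTop ×ˢ 𝓝 x) (𝓝 (w x)))
    {x : X} (hx : x ∈ O) (hδ : 0 < δ) : ∃ V ∈ 𝓝 x, (∀ y ∈ V ∩ O, |w y - w x| ≤ δ) ∧
    ∀ᶠ N in atTop, ∀ y ∈ V, |F N y - w x| ≤ δ := by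
  have h1 := (h x hx).eventually (closedBall_mem_nhds (w x) hδ)
  obtain ⟨pa, ha, pb, hb, hab⟩ := eventually_prod_iff.1 h1
  refine ⟨{y | pb y}, hb, fun y hy => ?_, ha.mono fun N hN y hy => hab hN hy⟩
  have h2 : Tendsto (fun N => F N y) atTop (𝓝 (w y)) :=
    (h y hy.2).comp (tendsto_id.prodMk (tendsto_const_nhds (x := y)))
  exact le_of_tendsto ((h2.sub_const _).abs) (ha.mono fun N hN => hab hN hy.1)

lemma continuousOn_of_continuousConv {X : Type*} [TopologicalSpace X] {F : ℕ → X → ℝ} {w : X → ℝ}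
    {O : Set X} (h : ∀ x ∈ O, Tendsto (fun q : ℕ × X => F q.1 q.2) (atTop ×ˢ 𝓝 x) (𝓝 (w x))) :
    ContinuousOn w O := by
  refine fun x hx => Metric.tendsto_nhds.2 fun ε hε => ?_
  obtain ⟨V, hV, h1, -⟩ := abs_sub_le_of_continuousConv h hx (half_pos hε)
  filter_upwards [inter_mem (mem_nhdsWithin_of_mem_nhds hV) self_mem_nhdsWithin] with y hy
  exact (h1 y hy).trans_lt (half_lt_self hε)

lemma eventually_of_continuousConv {X : Type*} [TopologicalSpace X] {F : ℕ → X → ℝ} {w : X → ℝ}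
    {O : Set X} (h : ∀ x ∈ O, Tendsto (fun q : ℕ × X => F q.1 q.2) (atTop ×ˢ 𝓝 x) (𝓝 (w x)))
    {K : Set X} (hK : IsCompact K) (hKO : K ⊆ O) (hδ : 0 < δ) :
    ∀ᶠ N in atTop, ∀ y ∈ K, |F N y - w y| ≤ δ := by
  have : ∀ᶠ N in atTop, ∀ y ∈ K, y ∈ O → |F N y - w y| ≤ δ := by
    refine hK.induction_on (p := fun K => ∀ᶠ N in atTop, ∀ y ∈ K, y ∈ O → |F N y - w y| ≤ δ)
      (by simp) (fun s t hst ht => ht.mono fun N hN y hy => hN y (hst hy))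
      (fun s t hs ht => (hs.and ht).mono fun N hN y hy => hy.elim (hN.1 y) (hN.2 y)) fun x hx => ?_
    obtain ⟨V, hV, h1, h2⟩ := abs_sub_le_of_continuousConv h (hKO hx) (half_pos hδ)
    refine ⟨V, mem_nhdsWithin_of_mem_nhds hV, h2.mono fun N hN y hy hyO => ?_⟩
    have := abs_sub_le (F N y) (w x) (w y)
    have := h1 y ⟨hy, hyO⟩
    have := hN y hy
    rw [abs_sub_comm (w x)] at *
    linarith
  exact this.mono fun N hN y hy => hN y hy (hKO hy)

lemma HeatSuper.of_continuousConv {U : ℕ → Set E} {z f : ℕ → E → ℝ → ℝ} {g : E → ℝ → ℝ}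
    (hU : ∀ K ⊆ Ω, IsCompact K → ∀ᶠ N in atTop, K ⊆ U N) (hs : ∀ N, HeatSuper (U N) α β (z N) (f N))
    (hz : ∀ x ∈ Ω ×ˢ Ioo α β, Tendsto (fun q : ℕ × Q => z q.1 q.2.1 q.2.2)
    (atTop ×ˢ 𝓝 x) (𝓝 (w x.1 x.2)))
    (hf : ∀ x ∈ Ω ×ˢ Ioo α β, Tendsto (fun q : ℕ × Q => f q.1 q.2.1 q.2.2)
    (atTop ×ˢ 𝓝 x) (𝓝 (g x.1 x.2))) : HeatSuper Ω α β w g := by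
  intro x d s h A₀ M A F hd hB hαs hh hβ hAc hA₀ hA hM hF hFc hFM hFz
  have hM0 : 0 ≤ M := (abs_nonneg _).trans (hFM x)
  have hA0 : 0 ≤ A₀ := (abs_nonneg _).trans (hA₀ 0)
  set c : ℝ := (2 * n + 4) ^ 2 * h ^ 2 / d ^ 4 with hc
  have hc0 : 0 ≤ c := by positivity
  have hKc : IsCompact (closedBall x d ×ˢ Icc s (s + h)) :=
    (isCompact_closedBall x d).prod isCompact_Icc
  have hKO : closedBall x d ×ˢ Icc s (s + h) ⊆ Ω ×ˢ Ioo α β :=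
    prod_mono hB fun t ht => ⟨hαs.trans_le ht.1, ht.2.trans_lt hβ⟩
  obtain ⟨χ, hχ2, hχc, -, hχ0, hχ1, hχe⟩ := exists_cutoff x hd (lt_add_one d)
  have key : ∀ ε > 0, heat F h x + (∫ τ in s..(s + h), A τ) - (2 * M + A₀ * h) * c ≤
      w x (s + h) + ε * (2 + h + (2 + h) * c) := by
    intro ε hε
    obtain ⟨N, hN1, hN2, hN3⟩ := ((hU _ hB (isCompact_closedBall x d)).and
      ((eventually_of_continuousConv (w := fun p => w p.1 p.2) (F := fun N p => z N p.1 p.2) hz hKc hKO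
        hε).and (eventually_of_continuousConv (w := fun p => g p.1 p.2) (F := fun N p => f N p.1 p.2)
        hf hKc hKO hε))).exists
    have hFχ : ∀ y, |ε * χ y| ≤ ε := fun y => by
      rw [abs_of_nonneg (mul_nonneg hε.le (hχ0 y))]
      exact mul_le_of_le_one_right hε.le (hχ1 y)
    have hFb : ∀ y, |F y + -(ε * χ y)| ≤ M + ε := fun y =>
      (abs_add_le _ _).trans (add_le_add (hFM y) (by rw [abs_neg]; exact hFχ y))
    have hχm : Continuous fun y => -(ε * χ y) := (continuous_const.mul hχ2.continuous).neg
    have h1 := hs N x d s h (A₀ + ε) (M + ε) (fun t => A t - ε) (fun y => F y + -(ε * χ y)) hd hN1 hαs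
      hh hβ (hAc.sub continuous_const) (fun t => (abs_sub _ _).trans
        (add_le_add (hA₀ t) (abs_of_pos hε).le)) (fun y hy t ht => by
          have h1 := hN3 (y, t) ⟨hy, ht⟩
          have h2 := hA y hy t ht
          linarith [(abs_le.1 h1).1]) (fun y hy t ht => by
          have h1 := hN2 (y, t) ⟨hy, ht⟩
          have h2 := abs_sub_abs_le_abs_sub (z N y t) (w y t)
          have h3 := hM y hy t ht
          dsimp at h1
          linarith) (hF.add hχm)
      (hFc.add (hχc.comp_left (g := fun s => -(ε * s)) (by simp))) hFb (fun y hy => by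
          have h1 := hN2 (y, s) ⟨hy, le_rfl, by linarith⟩
          have h2 := hFz y hy
          rw [hχe y hy]
          linarith [(abs_le.1 h1).1])
    have e1 : heat (fun y => F y + -(ε * χ y)) h x = heat F h x + heat (fun y => -(ε * χ y)) h x :=
      heat_add hF hχm hFM (fun y => by rw [abs_neg]; exact hFχ y) h x
    have e2 := le_heat hχm (fun y => by rw [abs_neg]; exact hFχ y)
      (fun y => neg_le_neg (le_of_abs_le (hFχ y))) h x
    have e3 : (∫ τ in s..(s + h), (A τ - ε)) = (∫ τ in s..(s + h), A τ) - ε * h := by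
      rw [intervalIntegral.integral_sub (hAc.intervalIntegrable _ _) (by simp)]
      simp [mul_comm]
    have e4 := hN2 (x, s + h) ⟨mem_closedBall_self hd.le, by linarith, le_rfl⟩
    have e5 : (2 * (M + ε) + (A₀ + ε) * h) * (2 * n + 4) ^ 2 * h ^ 2 / d ^ 4 =
      (2 * M + A₀ * h) * c + ε * ((2 + h) * c) := by rw [hc]; ring
    rw [e1, e3, e5] at h1
    dsimp at e4
    linarith [(abs_le.1 e4).2]
  have hK : 0 < 2 + h + (2 + h) * c := by positivity
  have e : (2 * M + A₀ * h) * (2 * n + 4) ^ 2 * h ^ 2 / d ^ 4 = (2 * M + A₀ * h) * c := by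
    rw [hc]; ring
  rw [e]
  refine le_of_forall_pos_le_add fun ε hε => ?_
  have := key (ε / (2 + h + (2 + h) * c)) (by positivity)
  rwa [div_mul_cancel₀ _ hK.ne'] at this

lemma exists_subseq_continuousConv {X : Type*} [TopologicalSpace X] [TopologicalSpace.SeparableSpace X]
    [Nonempty X] {F : ℕ → X → ℝ} {O : Set X} (hO : IsOpen O) (hM0 : 0 ≤ M)
    (hM : ∀ x ∈ O, ∀ᶠ N in atTop, F N x ∈ Icc 0 M)
    (heq : ∀ x ∈ O, ∀ δ > 0, ∃ V ∈ 𝓝 x, ∀ᶠ N in atTop, ∀ y ∈ V, |F N y - F N x| ≤ δ) :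
    ∃ φ : ℕ → ℕ, StrictMono φ ∧ ∃ w : X → ℝ, ∀ x ∈ O,
    Tendsto (fun q : ℕ × X => F (φ q.1) q.2) (atTop ×ˢ 𝓝 x) (𝓝 (w x)) := by
  obtain ⟨c, -, φ, hφ, hc⟩ := (isCompact_univ_pi fun _ : ℕ => isCompact_Icc (a := 0) (b := M)).tendsto_subseq
    (x := fun N i => max 0 (min M (F N (TopologicalSpace.denseSeq X i))))
    fun N i _ => ⟨le_max_left _ _, max_le hM0 (min_le_left _ _)⟩
  have hlim : ∀ x ∈ O, ∃ L, Tendsto (fun N => F (φ N) x) atTop (𝓝 L) := by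
    intro x hx
    refine cauchySeq_tendsto_of_complete (Metric.cauchySeq_iff.2 fun ε hε => ?_)
    obtain ⟨V, hV, h1⟩ := heq x hx (ε / 8) (by positivity)
    obtain ⟨_, ⟨i, rfl⟩, hyV, hyO⟩ := (TopologicalSpace.denseRange_denseSeq X).inter_nhds_nonempty
      (inter_mem hV (hO.mem_nhds hx))
    have h2 := Metric.tendsto_nhds.1 ((continuous_apply i).continuousAt.tendsto.comp hc) (ε / 8) (by positivity)
    obtain ⟨N₀, h3⟩ := eventually_atTop.1 (h2.and (hφ.tendsto_atTop.eventually (h1.and (hM _ hyO))))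
    have h4 : ∀ N ≥ N₀, |F (φ N) x - c i| < ε / 2 := fun N hN => by
      obtain ⟨h4, h5, h6⟩ := h3 N hN
      simp only [Function.comp_def, Real.dist_eq, min_eq_right h6.2, max_eq_right h6.1] at h4
      have h5 := h5 _ hyV
      rw [abs_sub_comm] at h5
      have := abs_sub_le (F (φ N) x) (F (φ N) (TopologicalSpace.denseSeq X i)) (c i)
      linarith
    refine ⟨N₀, fun N hN N' hN' => ?_⟩
    have h5 := abs_sub_le (F (φ N) x) (c i) (F (φ N') x)
    have h6 := h4 N' hN'
    rw [abs_sub_comm] at h6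
    rw [Real.dist_eq]
    linarith [h4 N hN]
  choose! w hw using hlim
  refine ⟨φ, hφ, w, fun x hx => Metric.tendsto_nhds.2 fun ε hε => ?_⟩
  obtain ⟨V, hV, h1⟩ := heq x hx (ε / 2) (by positivity)
  refine ((hφ.tendsto_atTop.eventually h1).and
    (Metric.tendsto_nhds.1 (hw x hx) (ε / 2) (by positivity))).prod_mk hV |>.mono fun q hq => ?_
  have h2 := dist_triangle (F (φ q.1) q.2) (F (φ q.1) x) (w x)
  have h3 := hq.1.1 q.2 hq.2
  rw [← Real.dist_eq] at h3
  linarith [hq.1.2]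

namespace Setup

/-- A locally uniform limit of approximate solutions. -/
structure Lim (P : Setup n) where
  (e : ℕ → ℝ) (a : ∀ N, P.Approx (e N)) (w : E → ℝ → ℝ)
  he : Tendsto e atTop (𝓝 0)
  conv : ∀ x ∈ P.Ω ×ˢ Ioo 0 (P.T + P.θ), Tendsto (fun q : ℕ × Q =>
    (a q.1).z q.2.1 q.2.2) (atTop ×ˢ 𝓝 x) (𝓝 (w x.1 x.2))

variable {P : Setup n}

lemma Approx.T_add_le (a : P.Approx ε) : P.T + P.θ ≤ a.T0 + 2 * P.θ := by linarith [a.hT0θ]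

lemma eventually_subset_superlevel {e : ℕ → ℝ} (a : ∀ N, P.Approx (e N))
    (he : Tendsto e atTop (𝓝 0)) {K : Set E} (hK : IsCompact K) (hKΩ : K ⊆ P.Ω) :
    ∀ᶠ N in atTop, K ⊆ {x | 2 * (a N).β < P.ψ x} := by
  obtain ⟨c, hc, h⟩ := hK.exists_forall_le' (f := P.ψ) (a := 0) P.ψ_continuous.continuousOn fun x hx => by
    rw [ψ, indicator_of_mem (hKΩ hx)]; exact P.heig.2.2.2.2 x (hKΩ hx)
  filter_upwards [he.eventually (gt_mem_nhds (half_pos hc))] with N hN x hx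
  have := (a N).hβε
  have := h x hx
  simp only [mem_setOf_eq]
  linarith

lemma exists_lim (P : Setup n) : Nonempty P.Lim := by
  have h0 : ∀ N : ℕ, Nonempty (P.Approx (1 / ((N : ℝ) + 1))) := fun N => P.exists_approx (by positivity)
  have a := fun N => Classical.choice (h0 N)
  have he := tendsto_one_div_add_atTop_nhds_zero_nat (𝕜 := ℝ)
  have hcomp := fun K hK hKΩ => eventually_subset_superlevel a he (K := K) hK hKΩ
  have key := exists_subseq_continuousConv (X := E × ℝ)
    (F := fun N x => (a N).z x.1 x.2) (O := P.Ω ×ˢ Ioo 0 (P.T + P.θ)) (P.hΩ.prod isOpen_Ioo)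
    (M := P.m + 2) (by linarith [P.hm]) (fun x hx => ?_) fun x hx δ hδ => ?_
  · obtain ⟨φ, hφ, w, hw⟩ := key
    exact ⟨⟨_, fun N => a (φ N), fun x t => w (x, t), he.comp hφ.tendsto_atTop, hw⟩⟩
  · filter_upwards [hcomp {x.1} isCompact_singleton (singleton_subset_iff.2 hx.1)] with N hN
    exact (a N).z_mem ⟨hx.2.1.le, hx.2.2.trans_le (a N).T_add_le⟩ (le_of_lt (hN rfl))
  · obtain ⟨ρ, hρ, hB⟩ := Metric.nhds_basis_closedBall.mem_iff.1 (P.hΩ.mem_nhds hx.1)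
    obtain ⟨r, hr, h⟩ := HeatSol.exists_modulus n (ρ := ρ / 4) (M := P.m + 2) (by positivity)
      (by linarith [P.hm]) P.hA0 hx.2 hδ
    rw [mul_div_cancel₀ _ four_ne_zero] at h
    refine ⟨_, ball_mem_nhds x hr, (hcomp _ (isCompact_closedBall _ ρ) hB).mono fun N hN y hy => ?_⟩
    rw [mem_ball, Prod.dist_eq, max_lt_iff, Real.dist_eq] at hy
    have hsub : {x | 2 * (a N).β < P.ψ x} ⊆ P.Ω := fun y (hy : 2 * (a N).β < P.ψ y) =>
      P.mem_of_ψ_pos (by linarith [(a N).hβ])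
    refine h {x | 2 * (a N).β < P.ψ x} (a N).z (a N).fx x.1 (isOpen_lt continuous_const P.ψ_continuous)
      ((a N).z_continuousOn.mono (prod_mono hsub (Ioo_subset_Ioo_right (a N).T_add_le)))
      ((a N).heatSol.mono Subset.rfl le_rfl (a N).T_add_le) hN (fun y hy t ht => ?_) y.1 y.2 hy.1 hy.2
    have ht' : t ∈ Ico 0 ((a N).T0 + 2 * P.θ) := ⟨ht.1.le, ht.2.trans_le (a N).T_add_le⟩
    have h1 := (a N).z_mem ht' (le_of_lt (hN hy))
    exact ⟨(a N).abs_F_le ht' (hB hy), abs_le.2 ⟨by linarith [h1.1, P.hm], h1.2⟩⟩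

namespace Lim

variable (Λ : P.Lim)

lemma eventually_subset {K : Set E} (hK : IsCompact K) (hKΩ : K ⊆ P.Ω) :
    ∀ᶠ N in atTop, K ⊆ {x | 2 * (Λ.a N).β < P.ψ x} :=
  eventually_subset_superlevel Λ.a Λ.he hK hKΩ

lemma tendsto_z (hx : x ∈ P.Ω) (ht : t ∈ Ioo 0 (P.T + P.θ)) :
    Tendsto (fun N => (Λ.a N).z x t) atTop (𝓝 (Λ.w x t)) :=
  (Λ.conv (x, t) ⟨hx, ht⟩).comp (tendsto_id.prodMk (tendsto_const_nhds (x := (x, t))))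

lemma w_mem (hx : x ∈ P.Ω) (ht : t ∈ Ioo 0 (P.T + P.θ)) : Λ.w x t ∈ Icc 0 (P.m + 2) := by
  refine isClosed_Icc.mem_of_tendsto (Λ.tendsto_z hx ht) ?_
  filter_upwards [Λ.eventually_subset isCompact_singleton (singleton_subset_iff.2 hx)] with N hN
  exact (Λ.a N).z_mem ⟨ht.1.le, ht.2.trans_le (Λ.a N).T_add_le⟩ (le_of_lt (hN rfl))

lemma w_continuousOn : ContinuousOn ♯Λ.w (P.Ω ×ˢ Ioo 0 (P.T + P.θ)) :=
  continuousOn_of_continuousConv (F := fun N x => (Λ.a N).z x.1 x.2) Λ.conv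

lemma adm_w (ht : t ∈ Ioo 0 (P.T + P.θ)) : P.Adm fun x => Λ.w x t :=
  ⟨Λ.w_continuousOn.comp (continuous_id.prodMk continuous_const).continuousOn fun _ hx => ⟨hx, ht⟩,
    fun _ hy => Λ.w_mem hy ht⟩

lemma w_eq_u (hx : x ∈ P.Ω) (ht : t ∈ Ioo 0 P.T) : Λ.w x t = P.u x t := by
  refine tendsto_nhds_unique (Λ.tendsto_z hx ⟨ht.1, by linarith [ht.2, P.hθ]⟩) (tendsto_const_nhds.congr' ?_)
  filter_upwards [Λ.he.eventually (gt_mem_nhds (sub_pos.2 ht.2))] with N hN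
  exact ((Λ.a N).z_eq_u (by linarith [(Λ.a N).hT0.1]) x).symm

/-- Filter of frozen profiles of the approximate solutions at times close to `t`. -/
def frz (t : ℝ) : Filter (ℕ × ℝ × (E → ℝ) × ℝ) :=
  comap (fun i => (i.1, i.2.1)) (atTop ×ˢ 𝓝 t) ⊓ 𝓟 {i | (Λ.a i.1).Frozen i.2.1 i.2.2.1 i.2.2.2}

instance (t : ℝ) : (Λ.frz t).IsCountablyGenerated := by unfold frz; infer_instance

lemma eventually_frz {p : ℕ × ℝ × (E → ℝ) × ℝ → Prop} (h : ∀ᶠ i in Λ.frz t, p i) :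
    ∀ᶠ j in atTop ×ˢ 𝓝 t, ∀ Y σ, (Λ.a j.1).Frozen j.2 Y σ → p (j.1, j.2, Y, σ) :=
  (eventually_comap.1 (eventually_inf_principal.1 h)).mono fun _ hj _ _ hY => hj _ rfl hY

variable {Λ}

lemma frozen_frz : ∀ᶠ i in Λ.frz t, (Λ.a i.1).Frozen i.2.1 i.2.2.1 i.2.2.2 :=
  mem_inf_of_right (mem_principal_self _)

lemma tendsto_frz_fst : Tendsto (fun i => (i.1, i.2.1)) (Λ.frz t) (atTop ×ˢ 𝓝 t) :=
  tendsto_comap.mono_left inf_le_left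

lemma tendsto_frz_time : Tendsto (fun i => i.2.2.2) (Λ.frz t) (𝓝 t) := by
  have h1 : Tendsto (fun i => |i.2.2.2 - i.2.1|) (Λ.frz t) (𝓝 0) := by
    refine squeeze_zero' (.of_forall fun _ => abs_nonneg _) (frozen_frz.mono fun i hi => hi.2.1) ?_
    simpa [Function.comp_def] using (Λ.he.const_mul 2).comp (tendsto_fst.comp tendsto_frz_fst)
  have h2 : Tendsto (fun i => i.2.1) (Λ.frz t) (𝓝 t) := tendsto_snd.comp tendsto_frz_fst
  simpa using h2.add ((tendsto_zero_iff_abs_tendsto_zero _).2 h1)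

lemma tendsto_frz (ht : t ∈ Ioo 0 (P.T + P.θ)) (hx : x ∈ P.Ω) :
    Tendsto (fun j : (ℕ × ℝ × (E → ℝ) × ℝ) × E => j.1.2.2.1 j.2) (Λ.frz t ×ˢ 𝓝 x)
    (𝓝 (Λ.w x t)) := by
  have h1 : Tendsto (fun j : (ℕ × ℝ × (E → ℝ) × ℝ) × E => (j.1.1, (j.2, j.1.2.2.2)))
      (Λ.frz t ×ˢ 𝓝 x) (atTop ×ˢ 𝓝 (x, t)) :=
    (tendsto_fst.comp (tendsto_frz_fst.comp tendsto_fst)).prodMk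
      (tendsto_snd.prodMk_nhds (tendsto_frz_time.comp tendsto_fst))
  obtain ⟨ρ, hρ, hB⟩ := Metric.nhds_basis_closedBall.mem_iff.1 (P.hΩ.mem_nhds hx)
  refine ((Λ.conv (x, t) ⟨hx, ht⟩).comp h1).congr' ?_
  have h2 := (tendsto_fst.comp (tendsto_frz_fst (Λ := Λ) (t := t))).eventually
    (Λ.eventually_subset (isCompact_closedBall x ρ) hB)
  filter_upwards [(frozen_frz.and h2).prod_mk (closedBall_mem_nhds x hρ)] with j hj
  exact (hj.1.1.2.2 _ (le_of_lt (hj.1.2 hj.2))).symm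

lemma tendsto_frz_pt (ht : t ∈ Ioo 0 (P.T + P.θ)) (hx : x ∈ P.Ω) :
    Tendsto (fun j => j.2.2.1 x) (Λ.frz t) (𝓝 (Λ.w x t)) :=
  (tendsto_frz ht hx).comp (tendsto_id.prodMk tendsto_const_nhds)

lemma tendsto_frz_integral (ht : t ∈ Ioo 0 (P.T + P.θ)) {κ : E → ℝ} (hκ : Continuous κ)
    (hC : ∀ y, |κ y| ≤ C) (hρ : 0 < ρ) : Tendsto (fun j => ∫ y in P.Ω, κ y * j.2.2.1 y ^ ρ) (Λ.frz t)
    (𝓝 (∫ y in P.Ω, κ y * Λ.w y t ^ ρ)) := by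
  have hb : ∀ᶠ j in Λ.frz t, P.Adm j.2.2.1 := frozen_frz.mono fun j hj => hj.1
  refine tendsto_integral_filter_of_dominated_convergence (fun _ => C * (P.m + 2) ^ ρ)
    (hb.mono fun j hj => ?_) (hb.mono fun j hj => ?_) (integrableOn_const P.hbd.measure_lt_top.ne) ?_
  · exact (hκ.continuousOn.mul (hj.1.rpow_const fun _ _ => Or.inr hρ.le)).aestronglyMeasurable
      P.hΩ.measurableSet
  · filter_upwards [ae_restrict_mem P.hΩ.measurableSet] with y hy
    have h1 := hj.pow_le hρ hy
    rw [norm_mul, Real.norm_eq_abs, Real.norm_eq_abs, abs_of_nonneg h1.1]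
    exact mul_le_mul (hC y) h1.2 h1.1 ((abs_nonneg _).trans (hC y))
  · filter_upwards [ae_restrict_mem P.hΩ.measurableSet] with y hy
    exact ((tendsto_frz_pt ht hy).rpow_const (Or.inr hρ.le)).const_mul _

lemma tendsto_frz_bnd (ht : t ∈ Ioo 0 (P.T + P.θ)) (x : E) :
    Tendsto (fun j : (ℕ × ℝ × (E → ℝ) × ℝ) × E => P.bnd j.1.2.2.1 j.1.2.2.2 j.2)
    (Λ.frz t ×ˢ 𝓝 x) (𝓝 (P.bnd (fun y => Λ.w y t) t x)) := by
  have h1 : Tendsto (fun j => P.bnd j.2.2.1 t x) (Λ.frz t) (𝓝 (P.bnd (fun y => Λ.w y t) t x)) :=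
    (tendsto_frz_integral ht (κ := fun y => P.κ x y t) (C := P.K)
      (P.hκ.continuous.comp (by fun_prop : Continuous fun y : E => ((x, y), t)))
      (fun y => by rw [abs_of_nonneg (P.hκ0 x y t).1]; exact (P.hκ0 x y t).2) P.hl).min tendsto_const_nhds
  refine Metric.tendsto_nhds.2 fun ε hε => ?_
  obtain ⟨δ, hδ, h⟩ := P.exists_bnd_modulus (half_pos hε)
  filter_upwards [((frozen_frz.and (tendsto_frz_time.eventually (ball_mem_nhds t hδ))).and
    (Metric.tendsto_nhds.1 h1 (ε / 2) (by positivity))).prod_mk (ball_mem_nhds x hδ)] with j hj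
  refine (dist_triangle _ (P.bnd j.1.2.2.1 t x) _).trans_lt ?_
  have := h _ hj.1.1.1.1 _ _ _ _ hj.2 hj.1.1.2
  rw [← Real.dist_eq] at this
  linarith [hj.1.2]

lemma tendsto_frz_src (ht : t ∈ Ioo 0 (P.T + P.θ)) (hx : x ∈ P.Ω) :
    Tendsto (fun j : (ℕ × ℝ × (E → ℝ) × ℝ) × E => P.src j.1.2.2.1 j.1.2.2.2 j.2)
    (Λ.frz t ×ˢ 𝓝 x) (𝓝 (P.src (fun y => Λ.w y t) t x)) := by
  have h0 : Tendsto (fun j : (ℕ × ℝ × (E → ℝ) × ℝ) × E => (j.2, j.1.2.2.2)) (Λ.frz t ×ˢ 𝓝 x)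
    (𝓝 (x, t)) := tendsto_snd.prodMk_nhds (tendsto_frz_time.comp tendsto_fst)
  have h1 := tendsto_frz (Λ := Λ) ht hx
  have h2 := (tendsto_frz_integral (Λ := Λ) ht (κ := fun _ => 1) (C := 1) continuous_const (by simp)
    P.hp).comp (tendsto_fst (g := 𝓝 x))
  simp only [one_mul, Function.comp_def] at h2
  exact (((P.ha.continuousAt.tendsto.comp h0).mul (h1.rpow_const (Or.inr P.hr.le))).mul h2).sub
    ((P.hb.continuousAt.tendsto.comp h0).mul (h1.rpow_const (Or.inr (one_pos.trans P.hq).le)))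

lemma tendsto_F (ht : t ∈ Ioo 0 (P.T + P.θ)) (hx : x ∈ P.Ω) :
    Tendsto (fun q : ℕ × Q => (Λ.a q.1).fx q.2.1 q.2.2) (atTop ×ˢ 𝓝 (x, t))
    (𝓝 (P.src (fun y => Λ.w y t) t x)) := by
  set g := P.src (fun y => Λ.w y t) t x with hg
  refine Metric.tendsto_nhds.2 fun ε hε => ?_
  have hG : 0 < max 1 (gaussC n) := lt_max_of_lt_left one_pos
  set δ := ε / (2 * max 1 (gaussC n)) with hδ
  have hδ0 : 0 < δ := by positivity
  obtain ⟨pa, h1, pb, h2, h12⟩ := eventually_prod_iff.1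
    (Metric.tendsto_nhds.1 (tendsto_frz_src (Λ := Λ) ht hx) δ hδ0)
  obtain ⟨ρ, hρ, hB⟩ := Metric.nhds_basis_closedBall.mem_iff.1 (inter_mem (P.hΩ.mem_nhds hx) h2)
  have h3 : ∀ᶠ N in atTop, 2 * P.A * Λ.e N ^ 2 < δ * (ρ / 2) ^ 4 := by
    have : Tendsto (fun N => 2 * P.A * Λ.e N ^ 2) atTop (𝓝 0) := by
      simpa using (Λ.he.pow 2).const_mul (2 * P.A)
    exact this.eventually (gt_mem_nhds (by positivity))
  have h4 : Tendsto (fun q : ℕ × Q => (q.1, q.2.2)) (atTop ×ˢ 𝓝 (x, t)) (atTop ×ˢ 𝓝 t) :=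
    tendsto_id.prodMap (continuous_snd.tendsto (x, t))
  have h5 := (h3.and (Λ.eventually_subset (isCompact_closedBall x ρ) (hB.trans inter_subset_left))).prod_mk
    ((prod_mem_nhds (ball_mem_nhds x (half_pos hρ)) (Ioo_mem_nhds ht.1 ht.2)))
  filter_upwards [h4.eventually (Λ.eventually_frz h1), h5] with q hq hq'
  obtain ⟨⟨hq3, hq4⟩, hq5, hq6⟩ := hq'
  obtain ⟨Y, σ, hY, f, τ, hτ, hf, hfs, hF⟩ := (Λ.a q.1).exists_frozen_F (t := q.2.2)
    ⟨hq6.1.le, hq6.2.trans_le (Λ.a q.1).T_add_le⟩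
  rw [Real.dist_eq, hF]
  have hgA : |g| ≤ P.A := (Λ.adm_w ht).abs_src_le t hx
  refine (abs_heat_sub_le_of_local hf (half_pos hρ) hδ0 (M := 2 * P.A) (fun h0 y => ?_) (fun y hy => ?_)
    hq3.le hτ).trans_lt ?_
  · exact (abs_sub _ _).trans (by linarith [(hf h0).2 y])
  · have hy' : y ∈ closedBall x ρ := by
      rw [mem_closedBall]
      have := dist_triangle y q.2.1 x
      have h6 : dist q.2.1 x < ρ / 2 := hq5
      linarith
    rw [hfs y (le_of_lt (hq4 hy'))]
    exact (h12 (hq Y σ hY) (hB hy').2).le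
  · rw [hδ]; field_simp; linarith

lemma heatSol (Λ : P.Lim) :
    HeatSol P.Ω 0 (P.T + P.θ) Λ.w (fun x t => P.src (fun y => Λ.w y t) t x) := by
  have h := fun N => (Λ.a N).heatSol.mono Subset.rfl le_rfl (Λ.a N).T_add_le
  refine ⟨HeatSuper.of_continuousConv (fun K hK hKc => Λ.eventually_subset hKc hK) (fun N => (h N).1)
    Λ.conv fun x hx => tendsto_F hx.2 hx.1, HeatSuper.of_continuousConv
    (fun K hK hKc => Λ.eventually_subset hKc hK) (fun N => (h N).2)
    (fun x hx => (Λ.conv x hx).neg) fun x hx => (tendsto_F hx.2 hx.1).neg⟩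

end Setup.Lim

namespace Setup

variable {P : Setup n}

lemma Approx.le_barrier (a : P.Approx ε) {g t₀ t₁ : ℝ} {H : E → ℝ → ℝ} (hs : s = 1 ∨ s = -1) (hg : g ∈ Icc 0 (P.m + 1)) (hρ : 0 < ρ) (hεδ : ε ≤ δ) (hC0 : 0 ≤ C)
    (hC : C * ρ ^ 2 = 2 * P.m + 2)
    (hbd : ∀ t ∈ Ico t₀ t₁, ∀ Y σ, a.Frozen t Y σ → ∀ x, dist x x₀ < ρ → |P.bnd Y σ x - g| ≤ δ)
    (hH : Continuous ♯H) (hH0 : ∀ x s, 0 ≤ H x s)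
    (hH1 : ∀ x, a.β / 2 ≤ P.ψ x → 1 ≤ H x 0)
    (hHc : ∀ x ∈ P.Ω, ∀ s > 0, ContDiffAt ℝ 2 (fun y => H y s) x ∧
    HasDerivAt (H x) (lap (fun y => H y s) x) s)
    (hst : (P.T - P.θ ≤ t₀ ∧ t₀ < a.T0 ∧ a.T0 < t₁) ∨ ∃ k < a.L, t₀ = a.node k) (hx : 2 * a.β ≤ P.ψ x) (ht : t ∈ Ico t₀ t₁) (htθ : t < a.T0 + 2 * P.θ) :
    s * a.z x t ≤ barrier x₀ (s * g + 2 * δ) C P.A (2 * P.m + 4) H t₀ x t := by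
  set D : Set E := {x | a.β / 2 < P.ψ x} with hD
  set B := barrier x₀ (s * g + 2 * δ) C P.A (2 * P.m + 4) H t₀ with hBdef
  have hm := P.hm
  have hA0 := P.hA0
  have hβ := a.hβ
  have hε := a.eps_pos
  have hDo : IsOpen D := isOpen_lt continuous_const P.ψ_continuous
  have hcl : ∀ x ∈ closure D, a.β / 2 ≤ P.ψ x := fun x hx =>
    closure_lt_subset_le continuous_const P.ψ_continuous hx
  have hfr : ∀ x ∈ frontier D, P.ψ x = a.β / 2 := fun x hx =>
    (frontier_lt_subset_eq continuous_const P.ψ_continuous hx).symm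
  have hclΩ : closure D ⊆ P.Ω := fun x hx => P.mem_of_ψ_pos (by linarith [hcl x hx])
  have hDb : Bdd D := P.hbd.subset (subset_closure.trans hclΩ)
  have hsy : ∀ y c, |y| ≤ c → s * y ≤ c := fun y c h => by
    rcases hs with rfl | rfl <;> linarith [(abs_le.1 h).1, (abs_le.1 h).2]
  have hsg : -(P.m + 1) ≤ s * g := by rcases hs with rfl | rfl <;> linarith [hg.1, hg.2]
  have hB : ∀ x t y, t₀ ≤ t → 0 ≤ y → y ≤ P.m + 1 → (dist x x₀ < ρ → |y - g| ≤ δ) →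
      s * y + δ ≤ B x t := by
    intro x t y ht h0 h1 h2
    have h3 : 0 ≤ (P.A + C * (2 * n)) * (t - t₀) := mul_nonneg (by positivity) (by linarith)
    have h4 : 0 ≤ (2 * P.m + 4) * H x (t - t₀) := mul_nonneg (by positivity) (hH0 _ _)
    have h5 : 0 ≤ C * ‖x - x₀‖ ^ 2 := by positivity
    rw [hBdef, barrier]
    by_cases hx : dist x x₀ < ρ
    · have := hsy _ _ (h2 hx)
      linarith
    · rw [dist_eq_norm, not_lt] at hx
      have h6 : C * ρ ^ 2 ≤ C * ‖x - x₀‖ ^ 2 := by gcongr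
      have := hsy y (P.m + 1) (by rwa [abs_of_nonneg h0])
      linarith
  have hFr : ∀ {t Y σ}, t ∈ Ico t₀ t₁ → a.Frozen t Y σ → ∀ x, ∀ t' ≥ t,
      s * P.bnd Y σ x + δ ≤ B x t' := fun ht hY x t' ht' =>
    hB x t' _ (ht.1.trans ht') (bnd_nonneg hY.1 _ x) (bnd_le _ x) (hbd _ ht _ _ hY x)
  have hGB : ∀ k < a.L, a.node k ∈ Ico t₀ t₁ → ∀ x, ∀ t ≥ a.node k, s * a.G k x + δ ≤ B x t := by
    intro k hk hkt x
    obtain ⟨Y, σ, hY, e⟩ := a.frozen_G hk ⟨le_rfl, by linarith [a.hh]⟩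
    rw [e]
    exact hFr hkt hY x
  have hslab : ∀ k < a.L, a.node k ∈ Ico t₀ t₁ → (∀ x ∈ closure D, s * a.S k x ≤ B x (a.node k)) →
      ∀ x ∈ closure D, ∀ t ∈ Icc (a.node k) (a.node k + a.h), s * a.v k x (t - a.node k) ≤ B x t := by
    intro k hk hkt h0
    refine _root_.le_barrier hDo hDb hkt.1 ?_ (fun x hx t ht => ?_) hH
      (fun x hx => hHc x (hclΩ (subset_closure hx))) ?_ fun x hx t ht => ?_
    · exact (continuous_const.mul ((a.v_continuous hk.le).comp
        (continuous_fst.prodMk (continuous_snd.sub continuous_const)))).continuousOn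
    · obtain ⟨h1, h2⟩ := a.v_pde hk.le ht.1 x
      refine ⟨contDiffAt_const.mul h1, s * heat (a.f k) (t - a.node k) x,
        hsy _ _ (abs_heat_le (a.hf k hk.le).1 (a.hf k hk.le).2.2 _ x), ?_⟩
      rw [lap_const_mul _ h1, ← mul_add]
      exact h2.const_mul s
    · simpa [a.v_zero] using h0
    · have h1 := hsy _ _ (a.hlat k hk x (hfr x hx) (t - a.node k) ⟨by linarith [ht.1], by linarith [ht.2]⟩)
      have h2 := hGB k hk hkt x t ht.1
      change s * duhamel (a.S k) (a.f k) x (t - a.node k) ≤ B x t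
      linarith
  have hmix : ∀ {x} {y y' M : ℝ}, s * y ≤ M → s * y' + δ ≤ M →
      s * (a.η x * y + (1 - a.η x) * y') ≤ M := fun {x y y' M} h1 h2 => by
    have := mul_le_mul_of_nonneg_left h1 (a.hη x).1
    have := mul_le_mul_of_nonneg_left (by linarith : s * y' ≤ M) (sub_nonneg.2 (a.hη x).2)
    linarith
  have hind : ∀ k₀, t₀ ≤ a.node k₀ → (∀ x ∈ closure D, s * a.S k₀ x ≤ B x (a.node k₀)) → ∀ k ≥ k₀,
      k < a.L → a.node k < t₁ → ∀ x ∈ closure D, s * a.S k x ≤ B x (a.node k) := by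
    intro k₀ hk₀ h0 k hk
    induction k, hk using Nat.le_induction with
    | base => exact fun _ _ => h0
    | succ k hk ih =>
      intro hkL hkt x hx
      have h1 := hk₀.trans (a.node_mono hk)
      have h2 := a.node_succ k
      have h3 := hslab k (Nat.lt_of_succ_lt hkL) ⟨h1, by linarith [a.hh]⟩
        (ih (Nat.lt_of_succ_lt hkL) (by linarith [a.hh])) x hx (a.node (k + 1))
        ⟨by linarith [a.hh], h2.le⟩
      rw [h2, add_sub_cancel_left, ← h2] at h3
      rw [a.hSk]
      exact hmix h3 (hGB _ hkL ⟨by linarith [a.hh], hkt⟩ x _ le_rfl)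
  have hxD : x ∈ closure D := subset_closure (by simp only [hD, mem_setOf_eq]; linarith)
  have hfin : ∀ k₀, t₀ ≤ a.node k₀ → (∀ x ∈ closure D, s * a.S k₀ x ≤ B x (a.node k₀)) →
      a.node k₀ ≤ t → s * a.z x t ≤ B x t := by
    intro k₀ hk₀ h0 hkt
    have hT0 := a.node_mono (Nat.zero_le k₀)
    rw [a.node_zero] at hT0
    obtain ⟨h1, h2, h3⟩ := a.ix_spec ⟨hT0.trans hkt, htθ⟩
    have hk : k₀ ≤ a.ix t := by
      by_contra hk
      have := a.node_mono (Nat.succ_le_of_lt (not_le.1 hk))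
      rw [Nat.succ_eq_add_one, a.node_succ] at this
      linarith
    rw [a.z_eq_v h1 ⟨h2, h3.le⟩ hx]
    exact hslab _ h1 ⟨hk₀.trans (a.node_mono hk), h2.trans_lt ht.2⟩
      (hind k₀ hk₀ h0 _ hk h1 (h2.trans_lt ht.2)) x hxD t ⟨h2, h3.le⟩
  have hinit : ∀ x ∈ closure D, ∀ y ∈ Icc 0 (P.m + 2), s * y ≤ B x t₀ := by
    intro x hx y hy
    have h1 := hsy y (P.m + 2) (by rw [abs_of_nonneg hy.1]; exact hy.2)
    have h2 : (2 * P.m + 4) * 1 ≤ (2 * P.m + 4) * H x 0 :=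
      mul_le_mul_of_nonneg_left (hH1 x (hcl x hx)) (by linarith)
    have h5 : 0 ≤ C * ‖x - x₀‖ ^ 2 := by positivity
    rw [hBdef, barrier, sub_self]
    linarith
  rcases hst with ⟨hθ, h0, h1⟩ | ⟨k₀, hk₀, rfl⟩
  · have hu : ∀ x ∈ closure D, ∀ t ∈ Icc t₀ a.T0, s * P.u x t ≤ B x t := by
      have hp : ∀ t ∈ Icc t₀ a.T0, t ∈ Ioo 0 P.T := fun t ht =>
        ⟨by linarith [ht.1, P.hθT], ht.2.trans_lt a.hT0.2⟩
      refine _root_.le_barrier hDo hDb le_rfl ?_ (fun x hx t ht => ?_) hH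
        (fun x hx => hHc x (hclΩ (subset_closure hx))) (fun x hx => ?_) fun x hx t ht => ?_
      · exact continuousOn_const.mul (P.hu.mono (prod_mono (hclΩ.trans subset_closure) fun t ht =>
          ⟨(hp t ht).1.le, (hp t ht).2⟩))
      · obtain ⟨h1, h2⟩ := P.hpde x (hclΩ (subset_closure hx)) t (hp t ⟨ht.1.le, ht.2.le⟩)
        refine ⟨contDiffAt_const.mul h1, s * P.src (fun y => P.u y t) t x, hsy _ _ ((P.adm_u
          (Ioo_subset_Ico_self (hp t ⟨ht.1.le, ht.2.le⟩))).abs_src_le t (hclΩ (subset_closure hx))), ?_⟩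
        rw [lap_const_mul _ h1, ← mul_add]
        exact h2.const_mul s
      · have := P.hum x (subset_closure (hclΩ hx)) t₀ (Ioo_subset_Ico_self (hp t₀ ⟨le_rfl, h0.le⟩))
        exact hinit x hx _ ⟨this.1, by linarith [this.2]⟩
      · have h1 := hsy _ _ (a.hlatu x (hclΩ (frontier_subset_closure hx)) (by rw [hfr x hx]; linarith) t
          ⟨hθ.trans ht.1, ht.2⟩)
        have h2 := hFr ⟨ht.1, by linarith [ht.2]⟩ (a.frozen_u ⟨(hp t ht).1.le, ht.2⟩) x t le_rfl
        linarith
    rcases le_total t a.T0 with h | h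
    · rw [a.z_eq_u h]
      exact hu x hxD t ⟨ht.1, h⟩
    · refine hfin 0 (by rw [a.node_zero]; exact h0.le) (fun x hx => ?_) (by rwa [a.node_zero])
      have h2 := hFr ⟨h0.le, h1⟩ (a.frozen_u ⟨a.T0_pos.le, le_rfl⟩) x _ le_rfl
      rw [a.hS0, a.node_zero]
      rw [← a.hG0] at h2
      exact hmix (hu x hx _ ⟨h0.le, le_rfl⟩) h2
  · exact hfin k₀ le_rfl (fun x hx => hinit x hx _ ((a.hS k₀ hk₀.le).2.2 x)) ht.1

variable {P : Setup n}

lemma Lim.eventually_le (Λ : P.Lim) (hx₀ : x₀ ∈ frontier P.Ω) (ht : t ∈ Ico P.T (P.T + P.θ)) (hs : s = 1 ∨ s = -1) (hδ : 0 < δ) :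
    ∀ᶠ p in 𝓝 (x₀, t), p.1 ∈ P.Ω → s * Λ.w p.1 p.2 ≤ s * P.bnd (fun y => Λ.w y t) t x₀ + 6 * δ := by
  have hT : 0 < P.T := by linarith [P.hθT, P.hθ]
  have ht' : t ∈ Ioo 0 (P.T + P.θ) := ⟨hT.trans_le ht.1, ht.2⟩
  have hm := P.hm
  have hA := P.hA0
  set g := P.bnd (fun y => Λ.w y t) t x₀ with hg
  obtain ⟨pa, h1, pb, h2, h12⟩ := eventually_prod_iff.1
    (Metric.tendsto_nhds.1 (tendsto_frz_bnd (Λ := Λ) ht' x₀) δ hδ)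
  obtain ⟨qa, h3, qb, h4, h34⟩ := eventually_prod_iff.1 (Λ.eventually_frz h1)
  obtain ⟨ρ₁, hρ₁, hB₁⟩ := Metric.mem_nhds_iff.1 h2
  obtain ⟨ρ₂, hρ₂, hB₂⟩ := Metric.mem_nhds_iff.1 h4
  set C := (2 * P.m + 2) / ρ₁ ^ 2 with hC
  have hC0 : 0 ≤ C := by positivity
  have ev : ∀ᶠ τ : ℝ in 𝓝[>] 0, (τ < ρ₂ / 2 ∧ τ < P.θ) ∧ (τ < P.T + P.θ - t ∧ (P.T < t → τ < t - P.T)) ∧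
      (P.A + C * (2 * n)) * (2 * τ) < δ ∧ 0 < τ := by
    have hlt : ∀ c : ℝ, 0 < c → ∀ᶠ τ : ℝ in 𝓝[>] 0, τ < c := fun c hc =>
      nhdsWithin_le_nhds (eventually_lt_nhds hc)
    refine ((hlt _ (by positivity)).and (hlt _ P.hθ)).and (((hlt _ (by linarith [ht.2])).and ?_).and
      (Eventually.and ?_ self_mem_nhdsWithin))
    · by_cases h : P.T < t
      · exact (hlt _ (sub_pos.2 h)).mono fun _ h _ => h
      · exact .of_forall fun _ h' => absurd h' h
    · exact nhdsWithin_le_nhds (ContinuousAt.eventually_lt (by fun_prop) continuousAt_const (by simpa))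
  obtain ⟨τ, ⟨hτρ, hτθ⟩, ⟨hτt, hτT⟩, hτδ, hτ⟩ := ev.exists
  obtain ⟨C', hC', hcal⟩ := P.heig.exists_caloric P.hΩ P.hbd (ε := δ / (2 * P.m + 4)) (τ := τ / 2)
    (σ := 2 * τ) (by positivity) (by positivity)
  have hψ0 : P.ψ x₀ = 0 := indicator_of_notMem (fun h => (P.hΩ.frontier_eq ▸ hx₀).2 h) _
  have hψ := P.ψ_continuous
  have ev1 : ∀ᶠ x in 𝓝 x₀, C * ‖x - x₀‖ ^ 2 < δ ∧ (2 * P.m + 4) * (C' * P.ψ x) < δ :=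
    (ContinuousAt.eventually_lt (by fun_prop) continuousAt_const (by simpa)).and
      (ContinuousAt.eventually_lt (by fun_prop) continuousAt_const (by simpa [hψ0]))
  filter_upwards [ev1.prod_nhds (ball_mem_nhds t (half_pos hτ))] with p hp hpΩ
  obtain ⟨⟨hp1, hp2⟩, hp3⟩ := hp
  obtain ⟨hp4, hp5⟩ := abs_lt.1 (Real.dist_eq p.2 t ▸ mem_ball.1 hp3)
  refine le_of_tendsto ((Λ.tendsto_z hpΩ ⟨by linarith [P.hθT, ht.1], by linarith⟩).const_mul s) ?_
  filter_upwards [h3, Λ.he.eventually (gt_mem_nhds (half_pos hτ)), Λ.he.eventually (gt_mem_nhds hδ),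
    Λ.eventually_subset isCompact_singleton (singleton_subset_iff.2 hpΩ)] with N hN hNτ hNδ hNp
  have hst : ∃ t₀ ∈ Icc (t - τ - Λ.e N) (t - τ), (P.T - P.θ ≤ t₀ ∧ t₀ < (Λ.a N).T0 ∧
      (Λ.a N).T0 < t + τ) ∨ ∃ k < (Λ.a N).L, t₀ = (Λ.a N).node k := by
    have hT0 := (Λ.a N).hT0
    have := (Λ.a N).eps_pos
    rcases ht.1.eq_or_lt with h | h
    · exact ⟨t - τ, ⟨by linarith, le_rfl⟩, Or.inl ⟨by linarith, by linarith [hT0.1], by linarith [hT0.2]⟩⟩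
    · obtain ⟨i1, i2, i3⟩ := (Λ.a N).ix_spec (t := t - τ) ⟨by linarith [hτT h, hT0.2],
        by linarith [(Λ.a N).T_add_le]⟩
      exact ⟨_, ⟨by linarith [(Λ.a N).hhε], i2⟩, Or.inr ⟨_, i1, rfl⟩⟩
  obtain ⟨t₀, ⟨ht1, ht2⟩, hst⟩ := hst
  obtain ⟨H, hHc, hH0, hH1, hHle, hHpde⟩ := hcal ((Λ.a N).β / 2) (half_pos (Λ.a N).hβ)
  refine ((Λ.a N).le_barrier hs (g := g) (x₀ := x₀) ⟨bnd_nonneg (Λ.adm_w ht') _ _, bnd_le _ _⟩ hρ₁ hNδ.le hC0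
    (by rw [hC]; field_simp) (fun t' ht' Y σ hY x hx => ?_) hHc hH0 hH1 hHpde hst (le_of_lt (hNp rfl))
    ⟨by linarith, by linarith⟩ (by linarith [(Λ.a N).T_add_le])).trans ?_
  · refine (h12 (h34 hN (hB₂ ?_) Y σ hY) (hB₁ hx)).le
    rw [mem_ball, Real.dist_eq]
    exact abs_lt.2 ⟨by linarith [ht'.1], by linarith [ht'.2]⟩
  · have h5 := hHle p.1 (p.2 - t₀) ⟨by linarith, by linarith⟩
    have h6 := mul_le_mul_of_nonneg_left h5 (by linarith : 0 ≤ 2 * P.m + 4)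
    have h7 : (P.A + C * (2 * n)) * (p.2 - t₀) ≤ (P.A + C * (2 * n)) * (2 * τ) :=
      mul_le_mul_of_nonneg_left (by linarith) (by positivity)
    rw [mul_add, mul_div_cancel₀ _ (by positivity)] at h6
    change _ ≤ δ + (2 * P.m + 4) * (C' * P.ψ p.1) at h6
    rw [barrier]
    linarith

lemma Lim.tendsto_boundary (Λ : P.Lim) (hx₀ : x₀ ∈ frontier P.Ω) (ht : t ∈ Ioo 0 (P.T + P.θ)) : Tendsto ♯Λ.w
    (𝓝[P.Ω ×ˢ Ioo 0 (P.T + P.θ)] (x₀, t)) (𝓝 (P.bnd (fun y => Λ.w y t) t x₀)) := by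
  rcases lt_or_ge t P.T with h | h
  · have e : P.bnd (fun y => Λ.w y t) t x₀ = P.u x₀ t := by
      rw [← P.bnd_u hx₀ ⟨ht.1, h⟩, bnd, bnd, setIntegral_congr_fun P.hΩ.measurableSet fun y hy => by
        rw [Λ.w_eq_u hy ⟨ht.1, h⟩]]
    have hsub : P.Ω ×ˢ Ioo 0 P.T ⊆ closure P.Ω ×ˢ Ico 0 P.T := prod_mono subset_closure Ioo_subset_Ico_self
    have h1 : Tendsto _ _ (𝓝 (P.u x₀ t)) := (P.hu (x₀, t) ⟨frontier_subset_closure hx₀, ht.1.le, h⟩).mono hsub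
    rw [e]
    have h2 : 𝓝[P.Ω ×ˢ Ioo 0 (P.T + P.θ)] (x₀, t) ≤ 𝓝[P.Ω ×ˢ Ioo 0 P.T] (x₀, t) := by
      refine nhdsWithin_le_of_mem ?_
      filter_upwards [self_mem_nhdsWithin, mem_nhdsWithin_of_mem_nhds
        (continuous_snd.continuousAt.eventually (gt_mem_nhds h))] with p hp hp'
      exact ⟨hp.1, hp.2.1, hp'⟩
    refine Tendsto.mono_left (h1.congr' ?_) h2
    filter_upwards [self_mem_nhdsWithin] with p hp
    exact (Λ.w_eq_u hp.1 hp.2).symm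
  · refine Metric.tendsto_nhds.2 fun ε hε => ?_
    have h1 := Λ.eventually_le hx₀ ⟨h, ht.2⟩ (Or.inl rfl) (δ := ε / 12) (by positivity)
    have h2 := Λ.eventually_le hx₀ ⟨h, ht.2⟩ (Or.inr rfl) (δ := ε / 12) (by positivity)
    filter_upwards [self_mem_nhdsWithin, mem_nhdsWithin_of_mem_nhds (h1.and h2)] with p hp hp'
    have h3 := hp'.1 hp.1
    have h4 := hp'.2 hp.1
    rw [Real.dist_eq]
    exact abs_lt.2 ⟨by linarith, by linarith⟩

end Setup

lemma HeatSuper.congr {z f z' f' : E → ℝ → ℝ}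
    (h : HeatSuper U α β z f) (hz : ∀ x ∈ U, ∀ t ∈ Ioo α β, z' x t = z x t)
    (hf : ∀ x ∈ U, ∀ t ∈ Ioo α β, f' x t = f x t) : HeatSuper U α β z' f' := by
  intro x d s h' A₀ M A F hd hb hs h0 h1 hA hA₀ hAf hM hF hFc hFM hFz
  have hI : Icc s (s + h') ⊆ Ioo α β := Icc_subset_Ioo hs h1
  have hs' : s ∈ Ioo α β := hI ⟨le_rfl, by linarith⟩
  rw [hz x (hb (mem_closedBall_self hd.le)) _ (hI ⟨by linarith, le_rfl⟩)]
  exact h x d s h' A₀ M A F hd hb hs h0 h1 hA hA₀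
    (fun y hy t ht => (hAf y hy t ht).trans_eq (hf y (hb hy) t (hI ht)))
    (fun y hy t ht => by rw [← hz y (hb hy) t (hI ht)]; exact hM y hy t ht) hF hFc hFM
    (fun y hy => (hFz y hy).trans_eq (hz y (hb hy) s hs'))

lemma HeatSol.congr {z f z' f' : E → ℝ → ℝ}
    (h : HeatSol U α β z f) (hz : ∀ x ∈ U, ∀ t ∈ Ioo α β, z' x t = z x t)
    (hf : ∀ x ∈ U, ∀ t ∈ Ioo α β, f' x t = f x t) : HeatSol U α β z' f' :=
  ⟨h.1.congr hz hf, h.2.congr (fun x hx t ht => congrArg Neg.neg (hz x hx t ht))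
    fun x hx t ht => congrArg Neg.neg (hf x hx t ht)⟩

namespace Setup

variable {P : Setup n}

/-- The limit of the approximations extends continuously to the lateral boundary. -/
lemma Lim.exists_extendFrom (Λ : P.Lim) : ∃ w : E → ℝ → ℝ,
    ContinuousOn ♯w (closure P.Ω ×ˢ Ioo 0 (P.T + P.θ)) ∧
    (∀ x ∈ P.Ω, ∀ t ∈ Ioo 0 (P.T + P.θ), w x t = Λ.w x t) ∧
    ∀ x ∈ frontier P.Ω, ∀ t ∈ Ioo 0 (P.T + P.θ), w x t = P.bnd (fun y => Λ.w y t) t x := by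
  have hcl : closure P.Ω ×ˢ Ioo 0 (P.T + P.θ) ⊆ closure (P.Ω ×ˢ Ioo 0 (P.T + P.θ)) := by
    rw [closure_prod_eq]; exact prod_mono_right subset_closure
  refine ⟨fun x t => extendFrom (P.Ω ×ˢ Ioo 0 (P.T + P.θ)) (fun z => Λ.w z.1 z.2) (x, t),
    continuousOn_extendFrom hcl ?_, fun x hx t ht => extendFrom_extends Λ.w_continuousOn _ ⟨hx, ht⟩,
    fun x hx t ht => extendFrom_eq (hcl ⟨frontier_subset_closure hx, ht⟩) (Λ.tendsto_boundary hx ht)⟩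
  rintro ⟨x, t⟩ ⟨hx, ht⟩
  by_cases hxΩ : x ∈ P.Ω
  · exact ⟨_, Λ.w_continuousOn (x, t) ⟨hxΩ, ht⟩⟩
  · exact ⟨_, Λ.tendsto_boundary (by rw [P.hΩ.frontier_eq]; exact ⟨hx, hxΩ⟩) ht⟩

lemma exists_extension (P : Setup n) : ∃ T1 > P.T, T1 ≤ P.T + P.θ ∧ ∃ v : E → ℝ → ℝ,
    ContinuousOn ♯v (closure P.Ω ×ˢ Ico 0 T1) ∧
    (∀ x ∈ closure P.Ω, ∀ t ∈ Ico 0 P.T, v x t = P.u x t) ∧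
    (∀ x ∈ closure P.Ω, ∀ t ∈ Ico 0 T1, 0 ≤ v x t) ∧
    (∀ x ∈ frontier P.Ω, ∀ t ∈ Ioo 0 T1, v x t = ∫ y in P.Ω, P.κ x y t * v y t ^ P.l) ∧
    HeatSol P.Ω 0 T1 v (reac P.a P.b P.r P.q (nonloc P.Ω P.p v) v) := by
  obtain ⟨Λ⟩ := P.exists_lim
  obtain ⟨w, hwc, hwΩ, hwb⟩ := Λ.exists_extendFrom
  have hT : 0 < P.T := P.hθ.trans P.hθT
  have hθ := P.hθ
  have hfr : frontier P.Ω ⊆ closure P.Ω := frontier_subset_closure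
  have hmem : ∀ x ∈ closure P.Ω, x ∉ P.Ω → x ∈ frontier P.Ω := fun x hx h => by
    rw [P.hΩ.frontier_eq]; exact ⟨hx, h⟩
  have hwu : ∀ x ∈ closure P.Ω, ∀ t ∈ Ioo 0 P.T, w x t = P.u x t := fun x hx t ht => by
    have ht' : t ∈ Ioo 0 (P.T + P.θ) := ⟨ht.1, by linarith [ht.2]⟩
    by_cases hxΩ : x ∈ P.Ω
    · rw [hwΩ x hxΩ t ht', Λ.w_eq_u hxΩ ht]
    · rw [hwb x (hmem x hx hxΩ) t ht', ← P.bnd_u (hmem x hx hxΩ) ht]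
      refine congrArg (min · _) (setIntegral_congr_fun P.hΩ.measurableSet fun y hy => ?_)
      simp only [Λ.w_eq_u hy ht]
  have hTI : P.T ∈ Ioo 0 (P.T + P.θ) := ⟨hT, by linarith⟩
  have hwT : ∀ x ∈ closure P.Ω, w x P.T ≤ P.m := fun x hx => by
    have h1 : Tendsto (fun t => w x t) (𝓝[Ioo 0 P.T] P.T) (𝓝 (w x P.T)) :=
      (hwc.comp (f := fun t : ℝ => (x, t)) (s := Ioo 0 (P.T + P.θ)) (by fun_prop)
        (fun t ht => ⟨hx, ht⟩) P.T hTI).mono (Ioo_subset_Ioo_right (by linarith))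
    have : (𝓝[Ioo 0 P.T] P.T).NeBot := by
      rw [← mem_closure_iff_nhdsWithin_neBot, closure_Ioo hT.ne]; exact right_mem_Icc.2 hT.le
    refine le_of_tendsto h1 ?_
    filter_upwards [self_mem_nhdsWithin] with t ht
    rw [hwu x hx t ht]
    exact (P.hum x hx t ⟨ht.1.le, ht.2⟩).2
  have hev : ∀ᶠ t in 𝓝 P.T, ∀ x ∈ frontier P.Ω, t ∈ Ioo 0 (P.T + P.θ) → w x t < P.m + 1 := by
    have key := IsCompact.eventually_forall_of_forall_eventually (x₀ := P.T)
      (P := fun t x => x ∈ closure P.Ω → t ∈ Ioo 0 (P.T + P.θ) → w x t < P.m + 1)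
      (P.hbd.isCompact_closure.of_isClosed_subset isClosed_frontier hfr) (fun x hx => ?_)
    · filter_upwards [key] with t ht x hx using ht x hx (hfr hx)
    · have h := (hwc (x, P.T) ⟨hfr hx, hTI⟩).eventually_lt_const
        (u := P.m + 1) (by linarith [hwT x (hfr hx)])
      rw [eventually_nhdsWithin_iff] at h
      have h2 : Tendsto (fun z : ℝ × E => (z.2, z.1)) (𝓝 (P.T, x)) (𝓝 (x, P.T)) :=
        continuous_swap.tendsto (P.T, x)
      filter_upwards [h2.eventually h] with z hz h1 h2 using hz ⟨h1, h2⟩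
  obtain ⟨δ, hδ, hδ'⟩ := Metric.eventually_nhds_iff.1 hev
  set T1 := P.T + min δ P.θ with hT1
  have hT1' : T1 ≤ P.T + P.θ := by rw [hT1]; gcongr; exact min_le_right _ _
  have hTT1 : P.T < T1 := by rw [hT1]; linarith [lt_min hδ P.hθ]
  set v : E → ℝ → ℝ := fun x t => if t < P.T then P.u x t else w x t with hv
  have hvw : ∀ x ∈ closure P.Ω, ∀ t ∈ Ioo 0 T1, v x t = w x t := fun x hx t ht => by
    by_cases h : t < P.T
    · simp only [hv, if_pos h]; exact (hwu x hx t ⟨ht.1, h⟩).symm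
    · simp only [hv, if_neg h]
  have hvΛ : ∀ x ∈ P.Ω, ∀ t ∈ Ioo 0 T1, v x t = Λ.w x t := fun x hx t ht =>
    (hvw x (subset_closure hx) t ht).trans (hwΩ x hx t ⟨ht.1, ht.2.trans_le hT1'⟩)
  have hvu : ∀ x ∈ closure P.Ω, ∀ t ∈ Ico 0 P.T, v x t = P.u x t := fun x hx t ht => by
    simp only [hv, if_pos ht.2]
  refine ⟨T1, hTT1, hT1', v, ?_, hvu, ?_, ?_, ?_⟩
  · rintro ⟨x, t⟩ ⟨hx, ht⟩
    by_cases h : t < P.T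
    · have h1 := P.hu (x, t) ⟨hx, ht.1, h⟩
      have h2 : ♯v =ᶠ[𝓝[closure P.Ω ×ˢ Ico 0 P.T] (x, t)]
          fun z => P.u z.1 z.2 := by
        filter_upwards [self_mem_nhdsWithin] with z hz using hvu z.1 hz.1 z.2 hz.2
      refine (h1.congr_of_eventuallyEq h2 (hvu x hx t ⟨ht.1, h⟩)).mono_of_mem_nhdsWithin ?_
      filter_upwards [self_mem_nhdsWithin, mem_nhdsWithin_of_mem_nhds
        (continuous_snd.continuousAt.preimage_mem_nhds (Iio_mem_nhds h))] with z hz hz'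
        using ⟨hz.1, hz.2.1, hz'⟩
    · have ht0 : 0 < t := hT.trans_le (not_lt.1 h)
      have h1 := (hwc (x, t) ⟨hx, ht0, ht.2.trans_le hT1'⟩).mono
        (prod_mono_right (Ioo_subset_Ioo_right hT1'))
      have h2 : ♯v =ᶠ[𝓝[closure P.Ω ×ˢ Ioo 0 T1] (x, t)]
          fun z => w z.1 z.2 := by
        filter_upwards [self_mem_nhdsWithin] with z hz using hvw z.1 hz.1 z.2 hz.2
      refine (h1.congr_of_eventuallyEq h2 (hvw x hx t ⟨ht0, ht.2⟩)).mono_of_mem_nhdsWithin ?_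
      filter_upwards [self_mem_nhdsWithin, mem_nhdsWithin_of_mem_nhds
        (continuous_snd.continuousAt.preimage_mem_nhds (Ioi_mem_nhds ht0))] with z hz hz'
        using ⟨hz.1, hz', hz.2.2⟩
  · intro x hx t ht
    by_cases h : t < P.T
    · rw [hvu x hx t ⟨ht.1, h⟩]; exact (P.hum x hx t ⟨ht.1, h⟩).1
    · have ht0 : t ∈ Ioo 0 T1 := ⟨hT.trans_le (not_lt.1 h), ht.2⟩
      have ht1 : t ∈ Ioo 0 (P.T + P.θ) := ⟨ht0.1, ht.2.trans_le hT1'⟩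
      rw [hvw x hx t ht0]
      by_cases hxΩ : x ∈ P.Ω
      · rw [hwΩ x hxΩ t ht1]; exact (Λ.w_mem hxΩ ht1).1
      · rw [hwb x (hmem x hx hxΩ) t ht1]; exact bnd_nonneg (Λ.adm_w ht1) t x
  · intro x hx t ht
    have e : ∀ y ∈ P.Ω, v y t = Λ.w y t := fun y hy => hvΛ y hy t ht
    rw [setIntegral_congr_fun P.hΩ.measurableSet fun y hy => by rw [e y hy]]
    have ht1 : t ∈ Ioo 0 (P.T + P.θ) := ⟨ht.1, ht.2.trans_le hT1'⟩
    by_cases h : t < P.T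
    · rw [hvu x (hfr hx) t ⟨ht.1.le, h⟩, P.hub x hx t ⟨ht.1, h⟩]
      exact setIntegral_congr_fun P.hΩ.measurableSet fun y hy => by rw [Λ.w_eq_u hy ⟨ht.1, h⟩]
    · have h1 : w x t < P.m + 1 := hδ' (by
        rw [Real.dist_eq, abs_of_nonneg (by linarith [not_lt.1 h])]
        linarith [ht.2, min_le_left δ P.θ]) x hx ht1
      rw [hvw x (hfr hx) t ht]
      have h2 := hwb x hx t ht1
      rw [h2] at h1 ⊢
      exact min_eq_left ((min_lt_iff.1 h1).resolve_right (lt_irrefl _)).le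
  · refine (Λ.heatSol.mono Subset.rfl le_rfl hT1').congr hvΛ fun x hx t ht => ?_
    have e : ∀ y ∈ P.Ω, v y t = Λ.w y t := fun y hy => hvΛ y hy t ht
    unfold reac nonloc src
    rw [e x hx, setIntegral_congr_fun P.hΩ.measurableSet fun y hy => by rw [e y hy]]

end Setup

section

lemma LocHolder.exists_extension (hb : Bdd Ω) (ha : LocHolder Ω a)
    (h0 : ∀ x ∈ closure Ω, ∀ t ≥ 0, 0 ≤ a x t) (T : ℝ) : ∃ (a' : E → ℝ → ℝ) (K : ℝ),
    (Continuous ♯a') ∧ (∀ x t, 0 ≤ a' x t ∧ a' x t ≤ K) ∧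
    ∀ x ∈ closure Ω, ∀ t ∈ Icc 0 T, a' x t = a x t := by
  obtain ⟨F, hF, hFc, hF0, hFe⟩ := exists_nonneg_extension
    (hb.isCompact_closure.prod (isCompact_Icc (a := (0 : ℝ)) (b := T)))
    (ha.continuousOn.mono (prod_mono_right Icc_subset_Ici_self)) fun z hz => h0 z.1 hz.1 z.2 hz.2.1
  obtain ⟨K, hK⟩ := hF.bounded_above_of_compact_support hFc
  exact ⟨fun x t => F (x, t), K, hF, fun x t => ⟨hF0 _, (le_abs_self _).trans (hK _)⟩,
    fun x hx t ht => hFe ⟨hx, ht⟩⟩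

/-- A solution on `[0, T)` which does not blow up at `T` can be continued past `T`. -/
lemma IsSolOn.exists_continuation (hr : 0 < r) (hp : 0 < p) (hl : 0 < l) (hq : 1 < q)
    (hdata : GoodData Ω a b k) (heig : IsDirichletEigen Ω lam φ) (hT : 0 < T)
    (hu : IsSolOn r p q l Ω a b k u0 T u) (hnb : ¬ BlowsUpAt Ω u T) :
    ∃ (v : E → ℝ → ℝ) (T' : ℝ), T < T' ∧ IsSolOn r p q l Ω a b k u0 T' v ∧
    ∀ x ∈ closure Ω, ∀ t ∈ Ico 0 T, v x t = u x t := by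
  obtain ⟨m, hm, hum⟩ := hu.exists_bound hr hp hl hdata heig hT hnb
  obtain ⟨hΩ, hb, -, ha, hbb, hab, hk, hk0⟩ := hdata
  have hcc := hb.isCompact_closure
  have hfr : frontier Ω ⊆ closure Ω := frontier_subset_closure
  obtain ⟨a', Ka, ha', ha0, hae⟩ := ha.exists_extension hb (fun x hx t ht => (hab x hx t ht).1) (T + 1)
  obtain ⟨b', Kb, hb', hb0, hbe⟩ := hbb.exists_extension hb (fun x hx t ht => (hab x hx t ht).2) (T + 1)
  obtain ⟨κ, hκ, hκc, hκ0, hκe⟩ := exists_nonneg_extension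
    ((hcc.of_isClosed_subset isClosed_frontier hfr).prod hcc |>.prod
    (isCompact_Icc (a := (0 : ℝ)) (b := T + 1)))
    (hk.mono (prod_mono_right Icc_subset_Ici_self)) fun z hz => hk0 _ hz.1.1 _ hz.1.2 _ hz.2.1
  obtain ⟨Kk, hKk⟩ := hκ.bounded_above_of_compact_support hκc
  obtain ⟨R, hR⟩ := hκc.isCompact.isBounded.exists_norm_le
  have hKa : 0 ≤ Ka := (ha0 0 0).1.trans (ha0 0 0).2
  have hKb : 0 ≤ Kb := (hb0 0 0).1.trans (hb0 0 0).2
  set A := Ka * (m + 2) ^ r * ((m + 2) ^ p * volume.real Ω) + Kb * (m + 2) ^ q with hAdef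
  have hA0 : 0 ≤ A := by positivity
  set θ := min (min 1 (T / 2)) (1 / (2 * (A + 1))) with hθdef
  have hθ : 0 < θ := by positivity
  have hθ1 : θ ≤ 1 := (min_le_left _ _).trans (min_le_left _ _)
  let P : Setup n :=
    { Ω := Ω, φ := φ, lam := lam, r := r, p := p, q := q, l := l, T := T, m := m, θ := θ, A := A
      K := max Kb Kk, a := a', b := b', u := u, κ := fun x y t => κ ((x, y), t)
      hΩ := hΩ, hbd := hb, heig := heig, hr := hr, hp := hp, hl := hl, hq := hq, ha := ha', hb := hb'
      hκ := hκc.uniformContinuous_of_continuous hκ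
      hκs := ⟨R, fun x hx y t => by
        by_contra h
        have h1 := hR _ (subset_tsupport _ h)
        have h2 : ‖x‖ ≤ ‖((x, y), t)‖ := (norm_fst_le (x, y)).trans (norm_fst_le ((x, y), t))
        linarith⟩
      ha0 := fun x t => (ha0 x t).1
      hb0 := fun x t => ⟨(hb0 x t).1, (hb0 x t).2.trans (le_max_left _ _)⟩
      hκ0 := fun x y t => ⟨hκ0 _, (le_abs_self _).trans ((hKk _).trans (le_max_right _ _))⟩
      hm := hm, hA0 := hA0
      hA := fun x t s I hs hs' hI hI' => by
        have h1 : s ^ r ≤ (m + 2) ^ r := rpow_le_rpow hs hs' hr.le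
        have h2 : s ^ q ≤ (m + 2) ^ q := rpow_le_rpow hs hs' (by linarith)
        have h3 : 0 ≤ s ^ r := rpow_nonneg hs _
        have h4 : 0 ≤ s ^ q := rpow_nonneg hs _
        have h5 := ha0 x t
        have h6 := hb0 x t
        have h7 : a' x t * s ^ r * I ≤ Ka * (m + 2) ^ r * ((m + 2) ^ p * volume.real Ω) := by
          gcongr; exact h5.2
        have h8 : b' x t * s ^ q ≤ Kb * (m + 2) ^ q := mul_le_mul h6.2 h2 h4 hKb
        have h9 : 0 ≤ a' x t * s ^ r * I := mul_nonneg (mul_nonneg h5.1 h3) hI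
        have h10 : 0 ≤ b' x t * s ^ q := mul_nonneg h6.1 h4
        rw [abs_le]
        constructor <;> linarith
      hθ := hθ
      hθT := ((min_le_left _ _).trans (min_le_right _ _)).trans_lt (by linarith)
      hθA := by
        have h1 : θ * (2 * (A + 1)) ≤ 1 := by
          rw [← le_div_iff₀ (by positivity)]; exact min_le_right _ _
        nlinarith
      hu := hu.continuousOn
      hum := fun x hx t ht => ⟨hu.nonneg hx ht, hum x hx t ht⟩
      hpde := fun x hx t ht => by
        have h := hu.pde hΩ hx ht
        have ht' : t ∈ Icc 0 (T + 1) := ⟨ht.1.le, by linarith [ht.2]⟩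
        unfold reac at h ⊢
        rwa [hae x (subset_closure hx) t ht', hbe x (subset_closure hx) t ht']
      hub := fun x hx t ht => by
        rw [hu.boundary hx ht]
        refine setIntegral_congr_fun hΩ.measurableSet fun y hy => ?_
        have := hκe (x := ((x, y), t)) ⟨⟨hx, subset_closure hy⟩, ht.1.le, by linarith [ht.2]⟩
        simp only [this] }
  obtain ⟨T1, hT1, hT1', v, hvc, hvu, hv0, hvb, hvh⟩ := P.exists_extension
  change T < T1 at hT1
  change T1 ≤ T + θ at hT1'
  have hJ : ∀ t ∈ Ioo 0 T1, t ∈ Icc 0 (T + 1) := fun t ht => ⟨ht.1.le, by linarith [ht.2]⟩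
  have hh : HeatSol Ω 0 T1 v (reac a b r q (nonloc Ω p v) v) := by
    refine HeatSol.congr hvh (fun _ _ _ _ => rfl) fun x hx t ht => ?_
    change reac a b r q (nonloc Ω p v) v x t = reac a' b' r q (nonloc Ω p v) v x t
    unfold reac
    rw [hae x (subset_closure hx) t (hJ t ht), hbe x (subset_closure hx) t (hJ t ht)]
  have hI : ContinuousOn (nonloc Ω p v) (Ioo 0 T1) :=
    (nonloc_continuousOn hΩ hb hp hvc).mono Ioo_subset_Ico_self
  have hvc' : ContinuousOn ♯v (Ω ×ˢ Ioo 0 T1) :=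
    hvc.mono (prod_mono subset_closure Ioo_subset_Ico_self)
  have hq0 : 0 < q := by linarith
  have hL := hh.locInterior_reac hΩ ha hbb hr hq0 hΩ Subset.rfl le_rfl hI hvc'
    fun x hx t ht => hv0 x (subset_closure hx) t ⟨ht.1.le, ht.2⟩
  have hf := reac_continuousOn ha hbb hr hq0 subset_closure
    (fun t (ht : t ∈ Ioo 0 T1) => ht.1.le) hI hvc'
  have hd : ∀ x ∈ Ω, ∀ t ∈ Ioo 0 T1, HasDerivAt (v x) (lap (fun y => v y t) x
      + a x t * v x t ^ r * (∫ y in Ω, v y t ^ p) - b x t * v x t ^ q) t := fun x hx t ht =>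
    (hL.hasDerivAt hvc' hf hx ht).congr_deriv (by unfold reac nonloc; ring)
  have hbdry : ∀ x ∈ frontier Ω, ∀ t ∈ Ioo 0 T1, v x t = ∫ y in Ω, k x y t * v y t ^ l :=
    fun x hx t ht => by
      rw [hvb x hx t ht]
      refine setIntegral_congr_fun hΩ.measurableSet fun y hy => ?_
      have : κ ((x, y), t) = k x y t := hκe (x := ((x, y), t)) ⟨⟨hx, subset_closure hy⟩, hJ t ht⟩
      change κ ((x, y), t) * v y t ^ l = _
      rw [this]
  have hinit : ∀ x ∈ Ω, v x 0 = u0 x := fun x hx => by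
    have h := hu (T / 2) (by linarith) (by linarith)
    rw [hvu x (subset_closure hx) 0 ⟨le_rfl, hT⟩]
    exact le_antisymm (h.1.2.2.2.2 x hx) (h.2.2.2.2.2 x hx)
  refine ⟨v, T1, hT1, fun T' _ hT' => ?_, hvu⟩
  have hI' : Ioo 0 T' ⊆ Ioo 0 T1 := Ioo_subset_Ioo_right hT'.le
  have hreg : RegQ Ω T' v := ⟨hvc.mono (prod_mono_right (Ico_subset_Ico_right hT'.le)),
    fun t ht => hL.contDiffOn (hI' ht), fun x hx t ht => (hd x hx t (hI' ht)).differentiableAt⟩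
  have hnn : ∀ x ∈ closure Ω, ∀ t ∈ Ico 0 T', 0 ≤ v x t := fun x hx t ht =>
    hv0 x hx t ⟨ht.1, ht.2.trans hT'⟩
  exact ⟨⟨hreg, hnn, fun x hx t ht => (hd x hx t (hI' ht)).deriv.le,
    fun x hx t ht => (hbdry x hx t (hI' ht)).le, fun x hx => (hinit x hx).le⟩,
    ⟨hreg, hnn, fun x hx t ht => (hd x hx t (hI' ht)).deriv.ge,
    fun x hx t ht => (hbdry x hx t (hI' ht)).ge, fun x hx => (hinit x hx).ge⟩⟩

end

/-- **Blow-up of all nontrivial solutions when `max(r,p) ≥ q > 1`.** Suppose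
`max(r,p) ≥ q > 1`, `b(x,t) ≤ ε(t) exp[λ₁(q−1)t]` with `ε` continuous, nonnegative and
integrable on `[0,∞)`, `a̲(t) = γ(t) exp[λ₁(r+p−q)t] b̄(t)` with `γ(t) → ∞`, and
`∫₀^∞ a̲(t) exp[−λ₁(r+p−1)t] dt = ∞`. Then every nontrivial solution of problem (P)
blows up in finite time. -/
theorem blowup_all_max_rp_ge_q_gt_one {n : ℕ} (r p q l : ℝ)
    (hr : 0 < r) (hp : 0 < p) (hl : 0 < l) (hq : 1 < q) (hrpq : q ≤ max r p)
    (Ω : Set (EuclideanSpace ℝ (Fin n)))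
    (a b : EuclideanSpace ℝ (Fin n) → ℝ → ℝ)
    (k : EuclideanSpace ℝ (Fin n) → EuclideanSpace ℝ (Fin n) → ℝ → ℝ)
    (hdata : GoodData Ω a b k)
    (lam : ℝ) (φ : EuclideanSpace ℝ (Fin n) → ℝ) (heig : IsFirstEigen Ω lam φ)
    (ε : ℝ → ℝ) (hεcont : ContinuousOn ε (Ici 0)) (hεnonneg : ∀ t : ℝ, 0 ≤ t → 0 ≤ ε t)
    (hεint : IntegrableOn ε (Ioi (0:ℝ)))
    (hb : ∀ x ∈ Ω, ∀ t : ℝ, 0 < t → b x t ≤ ε t * Real.exp (lam * (q - 1) * t))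
    (γ : ℝ → ℝ) (hγ : Tendsto γ atTop atTop)
    (hab : ∀ t : ℝ, 0 ≤ t →
      infOmega Ω a t = γ t * Real.exp (lam * (r + p - q) * t) * supOmega Ω b t)
    (hdiv : ¬ IntegrableOn
      (fun t => infOmega Ω a t * Real.exp (-lam * (r + p - 1) * t)) (Ioi (0:ℝ))) :
    ∀ u0 : EuclideanSpace ℝ (Fin n) → ℝ, GoodInit Ω k l u0 →
      (∃ x ∈ Ω, u0 x ≠ 0) → AllSolutionsBlowUp r p q l Ω a b k u0 := by
  refine fun u0 hu0 ⟨x, hx, hne⟩ => ⟨fun u hu => ?_, fun u Tstar hT hu hnc => ?_⟩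
  · exact no_global_solution hr hp hq hrpq hdata heig.1 hεcont hεnonneg hεint hb hγ hab hdiv ⟨x, hx, hne⟩
      hu
  · by_contra h
    exact hnc (hu.exists_continuation hr hp hl hq hdata heig.1 hT h)
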